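/- Let 𝔗 be a TCI in V. Then 𝔗 is consistent if and only if every condition of the collapse forcing Col(ω, λ) forces (over V) that there exists M with M ⊨* 𝔗, where λ ≥ |H(|trcl(𝔗)|⁺)|. Hence consistency of a TCI is uniformly first-order expressible in V. -/

import Mathlib

/-!
Common formalization layer for "Small extensions of set-theoretic universes".

We work with `ZFSet`, Mathlib's type of ZFC sets.  A "universe" `V` is a
`ZFSet` which is a (countable) transitive model of ZFC, where satisfaction
of ZFC is spelled out via an explicit first-order syntax `Fm` for languages
whose symbols are named by ZFC sets, together with a Tarskian satisfaction
predicate `Sat`.  TCIs (theories with constraints in interpretation), their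
models, the forcings `ℙ(𝔗)`, derivative forcings, generic filters, the
evaluation map `Eval^V`, local method definitions and the reducibility
relation `≤^M` are all defined below, following the paper.
-/

noncomputable section

namespace SmallExt

open Classical

attribute [local instance] Classical.propDecidable

instance : Nonempty ZFSet := ⟨∅⟩

/-! ### basic coding machinery -/

/-- Kuratowski ordered pair. -/
def opair (a b : ZFSet) : ZFSet := ZFSet.pair a b

/-- First projection of a Kuratowski pair. -/
def zfst (x : ZFSet) : ZFSet := ZFSet.sUnion (ZFSet.sInter x)

/-- Second projection of a Kuratowski pair. -/
def zsnd (x : ZFSet) : ZFSet :=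
  ZFSet.sUnion
    (ZFSet.sep (fun y => ZFSet.sUnion x ≠ ZFSet.sInter x → y ∉ ZFSet.sInter x) (ZFSet.sUnion x))

/-- The `n`-th von Neumann natural, as a ZFC set. -/
def natZ : ℕ → ZFSet
  | 0 => ∅
  | n + 1 => insert (natZ n) (natZ n)

/-- Internal coding of a finite list as an iterated pair (`[a] ↦ a`), so that
`ztuple` of a list of length `n` is a member of the `n`-th cartesian power. -/
def ztuple : List ZFSet → ZFSet
  | [] => ∅
  | [a] => a
  | a :: b :: l => opair a (ztuple (b :: l))

/-- Internal coding of a finite list as an iterated pair, with end marker `∅`. -/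
def zlist : List ZFSet → ZFSet
  | [] => ∅
  | a :: l => opair a (zlist l)

/-- `n`-th cartesian power of a ZFC set (with `z^1 = z`, as in the paper). -/
def ZPow (z : ZFSet) : ℕ → ZFSet
  | 0 => {∅}
  | 1 => z
  | n + 2 => ZFSet.prod z (ZPow z (n + 1))

/-- Decode an internal `n`-tuple into a list. -/
def decodeTuple : ℕ → ZFSet → List ZFSet
  | 0, _ => []
  | 1, t => [t]
  | n + 2, t => zfst t :: decodeTuple (n + 1) (zsnd t)

/-- Image of a ZFC set under an arbitrary (classically definable) function. -/
def zimage (f : ZFSet → ZFSet) (x : ZFSet) : ZFSet :=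
  @ZFSet.image f (Classical.allZFSetDefinable _) x

/-- The set of finite subsets of a ZFC set. -/
def finSubsets (A : ZFSet) : ZFSet :=
  ZFSet.sep (fun p => p.toSet.Finite) (ZFSet.powerset A)

/-- Application of a set-coded function (a set of ordered pairs) to an argument. -/
def iapp (I s : ZFSet) : ZFSet := Classical.epsilon fun v => opair s v ∈ I

/-- `f` is a set-coded function with domain `d`. -/
def IsZFunc (f d : ZFSet) : Prop :=
  (∀ q ∈ f, ∃ s v, q = opair s v ∧ s ∈ d) ∧ ∀ s ∈ d, ∃! v, opair s v ∈ f

/-- `j` is (the code of) an injective function from `a` into `b`. -/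
def ZInjFun (j a b : ZFSet) : Prop :=
  IsZFunc j a ∧ (∀ s ∈ a, iapp j s ∈ b) ∧
    ∀ s ∈ a, ∀ s' ∈ a, iapp j s = iapp j s' → s = s'

/-- Von Neumann ordinals: transitive sets of transitive sets. -/
def IsOrd (x : ZFSet) : Prop := x.IsTransitive ∧ ∀ y ∈ x, ZFSet.IsTransitive y

/-- `t` is the transitive closure of `a`. -/
def IsTrclOf (a t : ZFSet) : Prop :=
  a ⊆ t ∧ t.IsTransitive ∧ ∀ u, a ⊆ u → u.IsTransitive → t ⊆ u

/-! ### first-order syntax over set-named signatures -/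

/-- Terms: de Bruijn variables, set parameters, and applications of
function symbols (named by ZFC sets; constants are `0`-ary functions). -/
inductive Tm : Type 1
  | var : ℕ → Tm
  | param : ZFSet.{0} → Tm
  | func : ZFSet.{0} → (n : ℕ) → (Fin n → Tm) → Tm

/-- First-order formulas over set-named signatures (with equality). -/
inductive Fm : Type 1
  | rel : ZFSet.{0} → (n : ℕ) → (Fin n → Tm) → Fm
  | eq : Tm → Tm → Fm
  | not : Fm → Fm
  | imp : Fm → Fm → Fm
  | all : Fm → Fm
  | ex : Fm → Fm

/-- Derived conjunction. -/
def Fm.and (f g : Fm) : Fm := Fm.not (Fm.imp f (Fm.not g))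

/-- Derived disjunction. -/
def Fm.or (f g : Fm) : Fm := Fm.imp (Fm.not f) g

/-- Derived biconditional. -/
def Fm.iff (f g : Fm) : Fm := Fm.and (Fm.imp f g) (Fm.imp g f)

/-- Evaluation of terms. -/
def Tm.eval (fI : ZFSet → List ZFSet → ZFSet) (v : ℕ → ZFSet) : Tm → ZFSet
  | Tm.var n => v n
  | Tm.param a => a
  | Tm.func s n a => fI s (List.ofFn fun i => Tm.eval fI v (a i))

/-- Prepend a value to a valuation (for quantifiers). -/
def vcons (z : ZFSet) (v : ℕ → ZFSet) : ℕ → ZFSet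
  | 0 => z
  | n + 1 => v n

/-- Tarskian satisfaction, parametrized by a class domain `domP`, an
interpretation `rI` of the relation symbols and `fI` of the function symbols. -/
def Sat (domP : ZFSet → Prop) (rI : ZFSet → List ZFSet → Prop)
    (fI : ZFSet → List ZFSet → ZFSet) : Fm → (ℕ → ZFSet) → Prop
  | Fm.rel s n a, v => rI s (List.ofFn fun i => Tm.eval fI v (a i))
  | Fm.eq t u, v => Tm.eval fI v t = Tm.eval fI v u
  | Fm.not f, v => ¬ Sat domP rI fI f v
  | Fm.imp f g, v => Sat domP rI fI f v → Sat domP rI fI g v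
  | Fm.all f, v => ∀ z, domP z → Sat domP rI fI f (vcons z v)
  | Fm.ex f, v => ∃ z, domP z ∧ Sat domP rI fI f (vcons z v)

/-- Free variables of a term. -/
def Tm.free : Tm → Set ℕ
  | Tm.var n => {n}
  | Tm.param _ => ∅
  | Tm.func _ _ a => {m | ∃ i, m ∈ Tm.free (a i)}

/-- Free variables of a formula (de Bruijn). -/
def Fm.free : Fm → Set ℕ
  | Fm.rel _ _ a => {m | ∃ i, m ∈ Tm.free (a i)}
  | Fm.eq t u => Tm.free t ∪ Tm.free u
  | Fm.not f => Fm.free f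
  | Fm.imp f g => Fm.free f ∪ Fm.free g
  | Fm.all f => {m | m + 1 ∈ Fm.free f}
  | Fm.ex f => {m | m + 1 ∈ Fm.free f}

/-- Set parameters occurring in a term. -/
def Tm.paramSet : Tm → Set ZFSet
  | Tm.var _ => ∅
  | Tm.param a => {a}
  | Tm.func _ _ a => {b | ∃ i, b ∈ Tm.paramSet (a i)}

/-- Set parameters occurring in a formula. -/
def Fm.paramSet : Fm → Set ZFSet
  | Fm.rel _ _ a => {b | ∃ i, b ∈ Tm.paramSet (a i)}
  | Fm.eq t u => Tm.paramSet t ∪ Tm.paramSet u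
  | Fm.not f => Fm.paramSet f
  | Fm.imp f g => Fm.paramSet f ∪ Fm.paramSet g
  | Fm.all f => Fm.paramSet f
  | Fm.ex f => Fm.paramSet f

/-- Quantifier-free formulas. -/
def IsQF : Fm → Prop
  | Fm.rel _ _ _ => True
  | Fm.eq _ _ => True
  | Fm.not f => IsQF f
  | Fm.imp f g => IsQF f ∧ IsQF g
  | Fm.all _ => False
  | Fm.ex _ => False

mutual
  /-- `Π_n` formulas (prenex, with possibly empty quantifier blocks). -/
  inductive IsPi : ℕ → Fm → Prop where
    | qf {f} : IsQF f → IsPi 0 f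
    | ofSigma {n f} : IsSigma n f → IsPi (n + 1) f
    | all {n f} : IsPi (n + 1) f → IsPi (n + 1) (Fm.all f)

  /-- `Σ_n` formulas (prenex, with possibly empty quantifier blocks). -/
  inductive IsSigma : ℕ → Fm → Prop where
    | qf {f} : IsQF f → IsSigma 0 f
    | ofPi {n f} : IsPi n f → IsSigma (n + 1) f
    | ex {n f} : IsSigma (n + 1) f → IsSigma (n + 1) (Fm.ex f)
end

/-! ### the language of set theory and ZFC -/

/-- The name of the membership relation symbol. -/
def memSym : ZFSet := natZ 0

/-- The standard interpretation of `∈`. -/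
def memRel : ZFSet → List ZFSet → Prop :=
  fun s args => s = memSym ∧ ∃ a b, args = [a, b] ∧ a ∈ b

/-- Satisfaction in the ∈-structure with domain `M` (a ZFC set). -/
def SatV (M : ZFSet) (f : Fm) (v : ℕ → ZFSet) : Prop :=
  Sat (· ∈ M) memRel (fun _ _ => ∅) f v

/-- Satisfaction in the ambient (class-sized) ∈-structure. -/
def SatU (f : Fm) (v : ℕ → ZFSet) : Prop :=
  Sat (fun _ => True) memRel (fun _ _ => ∅) f v

/-- Atomic membership formula between de Bruijn variables. -/
def mem2 (i j : ℕ) : Fm := Fm.rel memSym 2 ![Tm.var i, Tm.var j]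

/-- Equality between de Bruijn variables. -/
def eq2 (i j : ℕ) : Fm := Fm.eq (Tm.var i) (Tm.var j)

/-- Terms that are plain variables or parameters. -/
def Tm.noFunc : Tm → Prop
  | Tm.var _ => True
  | Tm.param _ => True
  | Tm.func _ _ _ => False

/-- Formulas of the language of set theory (only `∈`, binary, no function
symbols; parameters allowed). -/
def Fm.memOnly : Fm → Prop
  | Fm.rel s n a => s = memSym ∧ n = 2 ∧ ∀ i, Tm.noFunc (a i)
  | Fm.eq t u => Tm.noFunc t ∧ Tm.noFunc u
  | Fm.not f => Fm.memOnly f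
  | Fm.imp f g => Fm.memOnly f ∧ Fm.memOnly g
  | Fm.all f => Fm.memOnly f
  | Fm.ex f => Fm.memOnly f

/-- Iterated universal closure. -/
def allClose : ℕ → Fm → Fm
  | 0, f => f
  | k + 1, f => allClose k (Fm.all f)

/-- Extensionality. -/
def extAx : Fm :=
  Fm.all (Fm.all (Fm.imp (Fm.all (Fm.iff (mem2 0 2) (mem2 0 1))) (eq2 1 0)))

/-- Pairing. -/
def pairAx : Fm := Fm.all (Fm.all (Fm.ex (Fm.and (mem2 2 0) (mem2 1 0))))

/-- Union. -/
def unionAx : Fm :=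
  Fm.all (Fm.ex (Fm.all (Fm.all (Fm.imp (Fm.and (mem2 1 0) (mem2 0 3)) (mem2 1 2)))))

/-- Power set. -/
def powAx : Fm :=
  Fm.all (Fm.ex (Fm.all (Fm.imp (Fm.all (Fm.imp (mem2 0 1) (mem2 0 3))) (mem2 0 1))))

/-- Infinity. -/
def infAx : Fm :=
  Fm.ex (Fm.and
    (Fm.ex (Fm.and (mem2 0 1) (Fm.all (Fm.not (mem2 0 1)))))
    (Fm.all (Fm.imp (mem2 0 1)
      (Fm.ex (Fm.and (mem2 0 2) (Fm.and (mem2 1 0)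
        (Fm.all (Fm.iff (mem2 0 1) (Fm.or (mem2 0 2) (eq2 0 2))))))))))

/-- Foundation. -/
def fundAx : Fm :=
  Fm.all (Fm.imp (Fm.ex (mem2 0 1))
    (Fm.ex (Fm.and (mem2 0 1) (Fm.all (Fm.imp (mem2 0 1) (Fm.not (mem2 0 2)))))))

/-- Choice (for families of nonempty pairwise disjoint sets). -/
def choiceAx : Fm :=
  Fm.all (Fm.imp
    (Fm.and
      (Fm.all (Fm.imp (mem2 0 1) (Fm.ex (mem2 0 1))))
      (Fm.all (Fm.all (Fm.imp
        (Fm.and (mem2 1 2) (Fm.and (mem2 0 2) (Fm.ex (Fm.and (mem2 0 2) (mem2 0 1)))))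
        (eq2 1 0)))))
    (Fm.ex (Fm.all (Fm.imp (mem2 0 2)
      (Fm.ex (Fm.and (mem2 0 1) (Fm.and (mem2 0 2)
        (Fm.all (Fm.imp (Fm.and (mem2 0 2) (mem2 0 3)) (eq2 0 1))))))))))

/-- Body of a separation instance: `∀x ∃s ∀z (z ∈ s ↔ z ∈ x ∧ φ)`,
where in `φ` the variable `0` is `z`, `2` is `x`, and `≥ 3` are parameters. -/
def sepBody (φ : Fm) : Fm :=
  Fm.all (Fm.ex (Fm.all (Fm.iff (mem2 0 1) (Fm.and (mem2 0 2) φ))))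

/-- Body of a collection instance: `∀a ∃b ∀x∈a (∃y φ → ∃y∈b φ)`,
where in `φ` the variable `0` is `y`, `1` is `x`, `3` is `a`, and `≥ 4` are parameters. -/
def repBody (φ : Fm) : Fm :=
  Fm.all (Fm.ex (Fm.all (Fm.imp (mem2 0 2)
    (Fm.imp (Fm.ex φ) (Fm.ex (Fm.and (mem2 0 2) φ))))))

/-- The ZFC axioms, as a set of sentences of the language of set theory. -/
def ZFCax : Set Fm :=
  {extAx, pairAx, unionAx, powAx, infAx, fundAx, choiceAx} ∪
    {f | ∃ k φ, Fm.memOnly φ ∧ Fm.paramSet φ = ∅ ∧ 1 ∉ Fm.free φ ∧ f = allClose k (sepBody φ)} ∪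
    {f | ∃ k φ, Fm.memOnly φ ∧ Fm.paramSet φ = ∅ ∧ 2 ∉ Fm.free φ ∧ f = allClose k (repBody φ)}

/-- `M` is an ∈-model of ZFC. -/
def SatZFC (M : ZFSet) : Prop := ∀ f ∈ ZFCax, SatV M f (fun _ => ∅)

/-- A transitive model of ZFC. -/
def IsTransModel (M : ZFSet) : Prop := M.IsTransitive ∧ SatZFC M

/-- A countable transitive model of ZFC. -/
def IsCTM (M : ZFSet) : Prop := IsTransModel M ∧ M.toSet.Countable

/-- `W` is an outer model of `U`: both are CTMs, `U ⊆ W`, and they have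
the same ordinals. -/
def OuterModel (U W : ZFSet) : Prop :=
  IsCTM U ∧ IsCTM W ∧ U ⊆ W ∧ ∀ y ∈ W, IsOrd y → y ∈ U

/-- `W = U[m]`: `W` is an outer model of `U` and the smallest CTM
containing `U` as a subset and `m` as an element. -/
def Generates (U m W : ZFSet) : Prop :=
  OuterModel U W ∧ m ∈ W ∧ ∀ W', IsCTM W' → U ⊆ W' → m ∈ W' → W ⊆ W'

/-- `W` is a small extension of `U`. -/
def IsSmallExt (U W : ZFSet) : Prop :=
  OuterModel U W ∧ ∃ m ∈ W, ∀ W', IsCTM W' → U ⊆ W' → m ∈ W' → W ⊆ W'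

/-- `k` is a cardinal from the point of view of the model `U`: an ordinal
with no `U`-internal injection into a smaller ordinal. -/
def IsCardinalIn (U k : ZFSet) : Prop :=
  k ∈ U ∧ IsOrd k ∧ ∀ b ∈ k, ¬ ∃ j ∈ U, ZInjFun j k b

end SmallExt
namespace SmallExt

attribute [local instance] Classical.propDecidable

/-! ### Theories with constraints in interpretation (TCIs) -/

/-- Coding of terms as ZFC sets. -/
def TmCode : Tm → ZFSet
  | Tm.var n => opair (natZ 0) (natZ n)
  | Tm.param a => opair (natZ 1) a
  | Tm.func s n a => opair (natZ 2) (opair s (zlist (List.ofFn fun i => TmCode (a i))))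

/-- Coding of formulas as ZFC sets (the code of `¬ f` is `⟨2, code f⟩`). -/
def FmCode : Fm → ZFSet
  | Fm.rel s n a => opair (natZ 0) (opair s (zlist (List.ofFn fun i => TmCode (a i))))
  | Fm.eq t u => opair (natZ 1) (opair (TmCode t) (TmCode u))
  | Fm.not f => opair (natZ 2) (FmCode f)
  | Fm.imp f g => opair (natZ 3) (opair (FmCode f) (FmCode g))
  | Fm.all f => opair (natZ 4) (FmCode f)
  | Fm.ex f => opair (natZ 5) (FmCode f)

/-- The first component of a TCI `⟨T, σ, U̇, ϑ⟩`: its theory. -/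
def tciT (x : ZFSet) : ZFSet := zfst x

/-- The signature `σ` of a TCI. -/
def tciSig (x : ZFSet) : ZFSet := zfst (zsnd x)

/-- The distinguished unary relation symbol `U̇` of a TCI. -/
def tciUdot (x : ZFSet) : ZFSet := zfst (zsnd (zsnd x))

/-- The interpretation constraint map `ϑ` of a TCI. -/
def tciTheta (x : ZFSet) : ZFSet := zsnd (zsnd (zsnd x))

/-- Symbols are coded as `⟨kind, ⟨arity, name⟩⟩` with kind `0` (relation),
`1` (function) or `2` (constant). -/
def symKind (s : ZFSet) : ZFSet := zfst s

/-- The (internal) arity of a symbol. -/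
def symArity (s : ZFSet) : ZFSet := zfst (zsnd s)

/-- A well-formed symbol. -/
def IsSymbol (s : ZFSet) : Prop :=
  ∃ k a nm, s = opair k (opair a nm) ∧ (k = natZ 0 ∨ k = natZ 1 ∨ k = natZ 2) ∧ ∃ n : ℕ, a = natZ n

/-- Decode an internal von Neumann natural. -/
def zToNat (a : ZFSet) : ℕ := if h : ∃ n, natZ n = a then h.choose else 0

/-- The arity of a symbol, as a natural number. -/
def arityOf (s : ZFSet) : ℕ := zToNat (symArity s)

/-- A term uses only symbols of the signature `σ` (with correct kinds and
arities) and no parameters. -/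
def Tm.usesSig (σ : ZFSet) : Tm → Prop
  | Tm.var _ => True
  | Tm.param _ => False
  | Tm.func s n a => s ∈ σ ∧
      ((symKind s = natZ 1 ∧ symArity s = natZ n) ∨ (symKind s = natZ 2 ∧ n = 0)) ∧
      ∀ i, Tm.usesSig σ (a i)

/-- A formula over the signature `σ` (no parameters). -/
def Fm.usesSig (σ : ZFSet) : Fm → Prop
  | Fm.rel s n a => s ∈ σ ∧ symKind s = natZ 0 ∧ symArity s = natZ n ∧ ∀ i, Tm.usesSig σ (a i)
  | Fm.eq t u => Tm.usesSig σ t ∧ Tm.usesSig σ u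
  | Fm.not f => Fm.usesSig σ f
  | Fm.imp f g => Fm.usesSig σ f ∧ Fm.usesSig σ g
  | Fm.all f => Fm.usesSig σ f
  | Fm.ex f => Fm.usesSig σ f

/-- Same as `Fm.usesSig` but allowing set parameters (used for literals
with parameters). -/
def Tm.usesSigP (σ : ZFSet) : Tm → Prop
  | Tm.var _ => True
  | Tm.param _ => True
  | Tm.func s n a => s ∈ σ ∧
      ((symKind s = natZ 1 ∧ symArity s = natZ n) ∨ (symKind s = natZ 2 ∧ n = 0)) ∧
      ∀ i, Tm.usesSigP σ (a i)

/-- A formula over the signature `σ`, allowing set parameters. -/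
def Fm.usesSigP (σ : ZFSet) : Fm → Prop
  | Fm.rel s n a => s ∈ σ ∧ symKind s = natZ 0 ∧ symArity s = natZ n ∧ ∀ i, Tm.usesSigP σ (a i)
  | Fm.eq t u => Tm.usesSigP σ t ∧ Tm.usesSigP σ u
  | Fm.not f => Fm.usesSigP σ f
  | Fm.imp f g => Fm.usesSigP σ f ∧ Fm.usesSigP σ g
  | Fm.all f => Fm.usesSigP σ f
  | Fm.ex f => Fm.usesSigP σ f

/-- Atomic formulas. -/
def Fm.isAtom : Fm → Prop
  | Fm.rel _ _ _ => True
  | Fm.eq _ _ => True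
  | _ => False

/-- `x` is (the code of) a theory with constraints in interpretation:
a tuple `⟨T, σ, U̇, ϑ⟩` where `T` is a set of (codes of) first-order
sentences over `σ`, `U̇` is a unary relation symbol not in `σ`, and `ϑ`
maps each symbol of `σ ∪ {U̇}` to a pair `(y, i)` with `i ∈ {0, 1}` and `y`
included in a finite cartesian power of the first component `z` of `ϑ(U̇)`,
with the disjointness conditions on the powers of `z` from the paper. -/
def IsTCI (x : ZFSet) : Prop :=
  x = opair (tciT x) (opair (tciSig x) (opair (tciUdot x) (tciTheta x))) ∧
  (∀ s ∈ tciSig x, IsSymbol s) ∧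
  IsSymbol (tciUdot x) ∧ symKind (tciUdot x) = natZ 0 ∧ symArity (tciUdot x) = natZ 1 ∧
  tciUdot x ∉ tciSig x ∧
  IsZFunc (tciTheta x) (insert (tciUdot x) (tciSig x)) ∧
  (∀ s ∈ insert (tciUdot x) (tciSig x),
    ∃ y i, iapp (tciTheta x) s = opair y i ∧ (i = natZ 0 ∨ i = natZ 1) ∧
      ∃ n : ℕ, y ⊆ ZPow (zfst (iapp (tciTheta x) (tciUdot x))) n) ∧
  (∀ n : ℕ, 1 < n →
    zfst (iapp (tciTheta x) (tciUdot x)) ∩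
      ZPow (zfst (iapp (tciTheta x) (tciUdot x))) n = ∅) ∧
  (∀ m n : ℕ, 1 < m → m < n →
    ZPow (zfst (iapp (tciTheta x) (tciUdot x))) m ∩
      ZPow (zfst (iapp (tciTheta x) (tciUdot x))) n = ∅) ∧
  (∀ c ∈ tciT x, ∃ f : Fm, FmCode f = c ∧ Fm.free f = ∅ ∧ Fm.usesSig (tciSig x) f)

/-- Satisfaction in a coded structure `M = ⟨U, I⟩`: relation symbols are
interpreted by `I` via internal tuples, function and constant symbols by the
(graph) values recorded in `I`. -/
def SatStr (M : ZFSet) (f : Fm) : Prop :=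
  Sat (· ∈ zfst M) (fun s args => ztuple args ∈ iapp (zsnd M) s)
    (fun s args => if args = [] then iapp (zsnd M) s
      else Classical.epsilon fun b => ztuple (args ++ [b]) ∈ iapp (zsnd M) s)
    f (fun _ => ∅)

/-- The modelling relation `M ⊨* 𝔗` between coded structures and TCIs. -/
def ModelsTCI (M x : ZFSet) : Prop :=
  IsTCI x ∧
  M = opair (zfst M) (zsnd M) ∧
  IsZFunc (zsnd M) (tciSig x) ∧
  -- the constraint on the universe
  (∀ y i, iapp (tciTheta x) (tciUdot x) = opair y i →
    (i = natZ 0 → zfst M ⊆ y) ∧ (i = natZ 1 → zfst M = y)) ∧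
  -- the constraints on the symbols of the signature
  (∀ s ∈ tciSig x, ∀ y i, iapp (tciTheta x) s = opair y i →
    (symKind s = natZ 0 →
      (i = natZ 0 → iapp (zsnd M) s ⊆ y ∩ ZPow (zfst M) (arityOf s)) ∧
      (i = natZ 1 → iapp (zsnd M) s = y ∩ ZPow (zfst M) (arityOf s))) ∧
    (symKind s = natZ 1 →
      (∀ args : List ZFSet, args.length = arityOf s → (∀ a ∈ args, a ∈ zfst M) →
        ∃! b, b ∈ zfst M ∧ ztuple (args ++ [b]) ∈ iapp (zsnd M) s) ∧
      (i = natZ 0 → iapp (zsnd M) s ⊆ y ∩ ZPow (zfst M) (arityOf s + 1)) ∧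
      (i = natZ 1 → iapp (zsnd M) s = y ∩ ZPow (zfst M) (arityOf s + 1))) ∧
    (symKind s = natZ 2 → iapp (zsnd M) s ∈ y ∧ iapp (zsnd M) s ∈ zfst M)) ∧
  -- `M` satisfies the theory
  (∀ c ∈ tciT x, ∀ f : Fm, FmCode f = c → SatStr M f)

/-- A `Π_n` TCI: one whose theory contains only `Π_n` sentences. -/
def IsPiTCI (n : ℕ) (x : ZFSet) : Prop :=
  IsTCI x ∧ ∀ c ∈ tciT x, ∃ f : Fm, FmCode f = c ∧ IsPi n f

/-- A `Σ_n` TCI: one whose theory contains only `Σ_n` sentences. -/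
def IsSigmaTCI (n : ℕ) (x : ZFSet) : Prop :=
  IsTCI x ∧ ∀ c ∈ tciT x, ∃ f : Fm, FmCode f = c ∧ IsSigma n f

/-- A TCI in `V` is consistent iff it has a model in some outer model of `V`. -/
def ConsistentTCI (V x : ZFSet) : Prop :=
  ∃ W M, OuterModel V W ∧ M ∈ W ∧ ModelsTCI M x

/-! ### the language fragment `𝓛_𝔗` and the diagram `Σ(𝔗, M)` -/

/-- The set of codes of atomic sentences (with parameters) associated to a
symbol `s` of a TCI `x`, as in the proof of Proposition 3.22 of the paper. -/
def codesFor (x s : ZFSet) : ZFSet :=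
  if symKind s = natZ 0 then
    zimage (fun t => FmCode (Fm.rel s (arityOf s)
      fun i => Tm.param ((decodeTuple (arityOf s) t).getD i ∅)))
      (zfst (iapp (tciTheta x) s))
  else if symKind s = natZ 1 then
    zimage (fun t => FmCode (Fm.eq
      (Tm.func s (arityOf s) fun i => Tm.param ((decodeTuple (arityOf s + 1) t).getD i ∅))
      (Tm.param ((decodeTuple (arityOf s + 1) t).getD (arityOf s) ∅))))
      (zfst (iapp (tciTheta x) s))
  else
    zimage (fun a => FmCode (Fm.eq (Tm.func s 0 Fin.elim0) (Tm.param a)))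
      (zfst (iapp (tciTheta x) s))

/-- The atomic sentences of `𝓛_𝔗`. -/
def LLbase (x : ZFSet) : ZFSet :=
  ZFSet.sUnion (zimage (fun s => codesFor x s) (insert (tciUdot x) (tciSig x)))

/-- The language fragment `𝓛_𝔗`: atomic sentences with parameters, closed
under negation. -/
def LL (x : ZFSet) : ZFSet :=
  LLbase x ∪ zimage (fun t => opair (natZ 2) t) (LLbase x)

/-- A literal of `𝓛_𝔗` true in the structure `M` (with `U̇` interpreted as
the domain of `M`). -/
def LitTrue (x M : ZFSet) (f : Fm) : Prop :=
  (∃ a, f = Fm.rel (tciUdot x) 1 (fun _ => Tm.param a) ∧ a ∈ zfst M) ∨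
  (∃ a, f = Fm.not (Fm.rel (tciUdot x) 1 (fun _ => Tm.param a)) ∧ a ∉ zfst M) ∨
  (∃ g, (f = g ∨ f = Fm.not g) ∧ Fm.isAtom g ∧ Fm.usesSigP (tciSig x) g ∧
    (∀ a ∈ Fm.paramSet g, a ∈ zfst M) ∧
    (f = g → SatStr M g) ∧ (f = Fm.not g → ¬ SatStr M g))

/-- The `𝔗`-specific atomic diagram `Σ(𝔗, M)` of a model `M` of `𝔗`. -/
def SigmaSet (x M : ZFSet) : ZFSet :=
  ZFSet.sep (fun c => ∃ f : Fm, FmCode f = c ∧ LitTrue x M f) (LL x)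

/-! ### forcing notions and generic filters -/

/-- A forcing notion coded as a pair `⟨P, ≤⟩` of a set of conditions and a
partial order (a set of Kuratowski pairs). -/
def IsForcing (P : ZFSet) : Prop :=
  P = opair (zfst P) (zsnd P) ∧
  (∀ q ∈ zsnd P, ∃ a ∈ zfst P, ∃ b ∈ zfst P, q = opair a b) ∧
  (∀ a ∈ zfst P, opair a a ∈ zsnd P) ∧
  (∀ a b c : ZFSet, opair a b ∈ zsnd P → opair b c ∈ zsnd P → opair a c ∈ zsnd P) ∧
  (∀ a b : ZFSet, opair a b ∈ zsnd P → opair b a ∈ zsnd P → a = b)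

/-- `a ≤ b` in the coded forcing `P` (`a` extends, i.e. is stronger than, `b`). -/
def ple (P a b : ZFSet) : Prop := opair a b ∈ zsnd P

/-- `g` is a filter on the coded forcing `P`. -/
def IsFilterOn (P g : ZFSet) : Prop :=
  g ⊆ zfst P ∧
  (∀ p ∈ g, ∀ q ∈ zfst P, ple P p q → q ∈ g) ∧
  (∀ p ∈ g, ∀ q ∈ g, ∃ r ∈ g, ple P r p ∧ ple P r q)

/-- `D` is a dense subset of the coded forcing `P`. -/
def IsDenseIn (P D : ZFSet) : Prop :=
  D ⊆ zfst P ∧ ∀ p ∈ zfst P, ∃ q ∈ D, ple P q p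

/-- `g` is a `P`-generic filter over `V`: a filter on `P` meeting all dense
subsets of `P` lying in `V`. -/
def GenericFilterOver (V P g : ZFSet) : Prop :=
  IsFilterOn P g ∧ ∀ D ∈ V, IsDenseIn P D → ∃ q ∈ g, q ∈ D

/-- `p` is an atom of the coded forcing `P`: any two extensions of `p`
are compatible. -/
def PAtom (P p : ZFSet) : Prop :=
  p ∈ zfst P ∧ ∀ q₁ ∈ zfst P, ∀ q₂ ∈ zfst P, ple P q₁ p → ple P q₂ p →
    ∃ r ∈ zfst P, ple P r q₁ ∧ ple P r q₂

/-- An atomless forcing notion. -/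
def Atomless (P : ZFSet) : Prop := ∀ p ∈ zfst P, ¬ PAtom P p

/-- `g_p(ℙ) = {q ∈ P : q` is compatible with `p}`. -/
def gpSet (P p : ZFSet) : ZFSet :=
  ZFSet.sep (fun q => ∃ r ∈ zfst P, ple P r q ∧ ple P r p) (zfst P)

/-- The reverse-inclusion order on a set `p` of conditions, as a set of pairs. -/
def supsetOrder (p : ZFSet) : ZFSet :=
  ZFSet.sep (fun q => ∃ a ∈ p, ∃ b ∈ p, q = opair a b ∧ b ⊆ a) (ZFSet.prod p p)

/-! ### the forcings `ℙ(𝔗)` and their derivatives -/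

/-- `P(𝔗)`: finite subsets of `𝓛_𝔗` included in `Σ(𝔗, M)` for some model
`M` of `𝔗` in some outer model of `V`. -/
def PT (V x : ZFSet) : ZFSet :=
  ZFSet.sep
    (fun p => ∃ W M, OuterModel V W ∧ M ∈ W ∧ ModelsTCI M x ∧ p ⊆ SigmaSet x M)
    (finSubsets (LL x))

/-- The forcing notion `ℙ(𝔗) = (P(𝔗), ⊇)`. -/
def Pforcing (V x : ZFSet) : ZFSet := opair (PT V x) (supsetOrder (PT V x))

/-- `q` is an atom of a `⊇`-ordered set `P` of conditions. -/
def SupAtomIn (P q : ZFSet) : Prop :=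
  q ∈ P ∧ ∀ q₁ ∈ P, ∀ q₂ ∈ P, q ⊆ q₁ → q ⊆ q₂ → ∃ r ∈ P, q₁ ⊆ r ∧ q₂ ⊆ r

/-- The derivative forcings `P(𝔗)^{(α)}`: conditions certified by the diagram
of a model of `𝔗` avoiding all atoms of all earlier stages (stage `0` is
`P(𝔗)` itself). -/
def PTa (V x : ZFSet) : Ordinal.{1} → ZFSet :=
  WellFounded.fix wellFounded_lt fun α rec =>
    ZFSet.sep
      (fun p => ∃ W M, OuterModel V W ∧ M ∈ W ∧ ModelsTCI M x ∧ p ⊆ SigmaSet x M ∧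
        ∀ β, ∀ h : β < α, ∀ q, SupAtomIn (rec β h) q → ¬ q ⊆ SigmaSet x M)
      (finSubsets (LL x))

/-- The ordinal `|[𝓛_𝔗]^{<ω}|⁺`, bounding the derivative process. -/
def cardBound (x : ZFSet) : Ordinal.{1} :=
  (Order.succ (Cardinal.mk (finSubsets (LL x)).toSet)).ord

/-- The fixed point `P(𝔗)^⊤` of the derivative process. -/
def PTtopSet (V x : ZFSet) : ZFSet :=
  PTa V x (sInf {α : Ordinal.{1} | PTa V x α = PTa V x (Order.succ α)})

/-- The forcing notion `ℙ(𝔗)^⊤`. -/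
def PtopForcing (V x : ZFSet) : ZFSet :=
  opair (PTtopSet V x) (supsetOrder (PTtopSet V x))

/-- `M` is an almost finitely determined model of `𝔗`: `p ⊆ Σ(𝔗, M)` for
some atom `p` of some derivative forcing `ℙ(𝔗)^{(α)}`, `α < |[𝓛_𝔗]^{<ω}|⁺`. -/
def AlmostFinDet (V x M : ZFSet) : Prop :=
  ModelsTCI M x ∧ ∃ α : Ordinal.{1}, α < cardBound x ∧
    ∃ p, SupAtomIn (PTa V x α) p ∧ p ⊆ SigmaSet x M

/-- All models of `𝔗` in outer models of `V` are almost finitely determined. -/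
def AllAFD (V x : ZFSet) : Prop :=
  ∀ W M, OuterModel V W → M ∈ W → ModelsTCI M x → AlmostFinDet V x M

/-! ### the TCI `𝔗(ℙ)` of a forcing notion -/

/-- The symbol `≤̇` (binary relation). -/
def leSym : ZFSet := opair (natZ 0) (opair (natZ 2) (natZ 0))

/-- The symbol `Ġ` (unary relation) for the generic filter. -/
def gSym : ZFSet := opair (natZ 0) (opair (natZ 1) (natZ 1))

/-- The symbol `Ḋ` (unary relation) associated to the dense set `D`. -/
def dSym (D : ZFSet) : ZFSet := opair (natZ 0) (opair (natZ 1) (opair (natZ 2) D))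

/-- The distinguished symbol `U̇` used for `𝔗(ℙ)` and `𝔗_s`. -/
def udSym : ZFSet := opair (natZ 0) (opair (natZ 1) (natZ 3))

/-- The set of dense subsets of a coded forcing notion `P`. -/
def denseSets (P : ZFSet) : ZFSet :=
  ZFSet.sep (fun D => ∀ p ∈ zfst P, ∃ q ∈ D, ple P q p) (ZFSet.powerset (zfst P))

/-- `Ġ(i)` as a formula. -/
def relG (i : ℕ) : Fm := Fm.rel gSym 1 (fun _ => Tm.var i)

/-- `i ≤̇ j` as a formula. -/
def relLe (i j : ℕ) : Fm := Fm.rel leSym 2 ![Tm.var i, Tm.var j]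

/-- The sentences of `𝔗(ℙ)`: `Ġ` is a filter meeting each dense set. -/
def TofPTheory (P : ZFSet) : ZFSet :=
  insert (FmCode (Fm.all (Fm.all (Fm.ex (Fm.imp (Fm.and (relG 2) (relG 1))
      (Fm.and (relG 0) (Fm.and (relLe 0 2) (relLe 0 1))))))))
    (insert (FmCode (Fm.all (Fm.all (Fm.imp (Fm.and (relLe 1 0) (relG 1)) (relG 0)))))
      (zimage (fun D => FmCode (Fm.ex (Fm.and (relG 0) (Fm.rel (dSym D) 1 (fun _ => Tm.var 0)))))
        (denseSets P)))

/-- The constraint map of `𝔗(ℙ)`. -/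
def TofPTheta (P : ZFSet) : ZFSet :=
  insert (opair udSym (opair (zfst P) (natZ 1)))
    (insert (opair leSym (opair (zsnd P) (natZ 1)))
      (insert (opair gSym (opair (zfst P) (natZ 0)))
        (zimage (fun D => opair (dSym D) (opair D (natZ 1))) (denseSets P))))

/-- The `Π₂` TCI `𝔗(ℙ)` whose models (in outer models of `V`) are exactly
the `ℙ`-generic filters over `V`. -/
def TofP (P : ZFSet) : ZFSet :=
  opair (TofPTheory P)
    (opair (insert leSym (insert gSym (zimage dSym (denseSets P))))
      (opair udSym (TofPTheta P)))

/-! ### evaluations, local method definitions and `≤^M` -/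

/-- `Eval^V(𝔗) = {V[M] : M ⊨* 𝔗` in some outer model of `V}`. -/
def EvalT (V x : ZFSet) : Set ZFSet :=
  {W' | ∃ W M, OuterModel V W ∧ M ∈ W ∧ ModelsTCI M x ∧ Generates V M W'}

/-- A valuation loading one set at variable `0`. -/
def vone (a : ZFSet) : ℕ → ZFSet := fun n => if n = 0 then a else ∅

/-- A valuation loading two sets at variables `0`, `1`. -/
def vtwo (a b : ZFSet) : ℕ → ZFSet := fun n => if n = 0 then a else if n = 1 then b else ∅

/-- A valuation loading three sets at variables `0`, `1`, `2`. -/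
def vthree (a b c : ZFSet) : ℕ → ZFSet :=
  fun n => if n = 0 then a else if n = 1 then b else if n = 2 then c else ∅

/-- The class function `F` (restricted to the class `X`) is definable in `V`
with parameters in `V`. -/
def DefFunIn (V : ZFSet) (X : ZFSet → Prop) (F : ZFSet → ZFSet) : Prop :=
  ∃ φ : Fm, Fm.memOnly φ ∧ (∀ a ∈ Fm.paramSet φ, a ∈ V) ∧
    ∀ x, x ∈ V → X x → ∀ y, y ∈ V → (SatV V φ (vtwo x y) ↔ y = F x)

/-- A local method definition over `V`: a nonempty class of TCIs in `V`,
definable in `V` with parameters in `V`. -/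
def LocalMethodDef (V : ZFSet) (X : ZFSet → Prop) : Prop :=
  (∃ t, X t) ∧ (∀ t, X t → t ∈ V ∧ IsTCI t) ∧
  ∃ φ : Fm, Fm.memOnly φ ∧ (∀ a ∈ Fm.paramSet φ, a ∈ V) ∧
    ∀ t, t ∈ V → (X t ↔ SatV V φ (vone t))

/-- The reducibility relation `X ≤^M Y` between local method definitions:
some `V`-definable `F : X → Y` satisfies
`∅ ≠ Eval^V(F(𝔗)) ⊆ Eval^V(𝔗)` for all consistent `𝔗 ∈ X`. -/
def LeqM (V : ZFSet) (X Y : ZFSet → Prop) : Prop :=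
  ∃ F : ZFSet → ZFSet, DefFunIn V X F ∧
    (∀ x, x ∈ V → X x → F x ∈ V ∧ Y (F x)) ∧
    ∀ x, x ∈ V → X x → ConsistentTCI V x →
      (EvalT V (F x)).Nonempty ∧ EvalT V (F x) ⊆ EvalT V x

/-- `X ≡^M Y`. -/
def EquivM (V : ZFSet) (X Y : ZFSet → Prop) : Prop := LeqM V X Y ∧ LeqM V Y X

/-- The local method definition `Π^M_n` of all `Π_n` TCIs. -/
def PiM (n : ℕ) : ZFSet → Prop := IsPiTCI n

/-- The local method definition `Σ^M_n` of all `Σ_n` TCIs. -/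
def SigmaM (n : ℕ) : ZFSet → Prop := IsSigmaTCI n

/-- The local method definition `Fg = {𝔗(ℙ) : ℙ` a forcing notion in `V}`. -/
def FgClass (V : ZFSet) : ZFSet → Prop :=
  fun t => ∃ P, P ∈ V ∧ IsForcing P ∧ t = TofP P

/-! ### H(κ), collapse forcing, and structure-genericity -/

/-- `H` is (the code of) `H(|trcl(t)|⁺)` as computed inside `V`:
the set of all `y ∈ V` whose transitive closure admits, in `V`,
an injection into the transitive closure of `t`. -/
def IsHIn (V t H : ZFSet) : Prop :=
  H ∈ V ∧ ∀ y, (y ∈ H ↔ (y ∈ V ∧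
    ∀ ty tt, IsTrclOf {y} ty → IsTrclOf t tt → ∃ j ∈ V, ZInjFun j ty tt))

/-- The conditions of the collapse `Col(ω, λ)`: finite partial functions
from `ω` to `λ`. -/
def ColSet (lam : ZFSet) : ZFSet :=
  ZFSet.sep
    (fun f => (∀ q ∈ f, ∃ a b, q = opair a b) ∧
      (∀ a b b' : ZFSet, opair a b ∈ f → opair a b' ∈ f → b = b') ∧ f.toSet.Finite)
    (ZFSet.powerset (ZFSet.prod ZFSet.omega lam))

/-- The collapse forcing `Col(ω, λ)`, ordered by reverse inclusion. -/
def ColForcing (lam : ZFSet) : ZFSet := opair (ColSet lam) (supsetOrder (ColSet lam))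

/-- `g` is a `P`-generic filter over the ∈-structure with domain `H`:
a filter on `P` meeting every dense subset of `P` definable over `(H; ∈)`
with parameters in `H`. -/
def GenericOverStruct (H P g : ZFSet) : Prop :=
  IsFilterOn P g ∧
  ∀ φ : Fm, Fm.memOnly φ → (∀ a ∈ Fm.paramSet φ, a ∈ H) →
    ((∀ p ∈ zfst P, ∃ q ∈ zfst P, SatV H φ (vone q) ∧ ple P q p) →
      ∃ q ∈ g, SatV H φ (vone q))

/-- The `Π₀` TCI `𝔗_s` whose models in any outer model are the subsets of `s`. -/
def Tsub (s : ZFSet) : ZFSet :=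
  opair ∅ (opair ∅ (opair udSym ({opair udSym (opair s (natZ 0))} : ZFSet)))

end SmallExt

namespace SmallExt

/-- `g_p` for a `⊇`-ordered set of conditions `P`:
the conditions compatible with `p`. -/
def gpSup (P p : ZFSet) : ZFSet :=
  ZFSet.sep (fun q => ∃ r ∈ P, q ⊆ r ∧ p ⊆ r) P

/-- Outer models among arbitrary (not necessarily countable) transitive
models of ZFC. -/
def OuterModelT (U W : ZFSet) : Prop :=
  IsTransModel U ∧ IsTransModel W ∧ U ⊆ W ∧ ∀ y ∈ W, IsOrd y → y ∈ U

/-- Consistency of a TCI relative to a transitive model `U` of ZFC. -/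
def ConsistentT (U x : ZFSet) : Prop :=
  ∃ W M, OuterModelT U W ∧ M ∈ W ∧ ModelsTCI M x

end SmallExt



noncomputable section
namespace SmallExt
set_option linter.unusedVariables false
attribute [local instance] Classical.propDecidable

/-! ## Part 1: definability framework -/

abbrev Zs := ZFSet.{0}

def fI0 : Zs → List Zs → Zs := fun _ _ => ∅

theorem eval_noFunc_congr {u : Tm} (hu : u.noFunc) {v w : ℕ → Zs}
    (h : ∀ n ∈ u.free, v n = w n) : u.eval fI0 v = u.eval fI0 w := by
  cases u with
  | var n => simpa [Tm.eval] using h n (by simp [Tm.free])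
  | param a => simp [Tm.eval]
  | func s n a => exact absurd hu (by simp [Tm.noFunc])

/-- lift of a term map under a quantifier -/
def bumpT : Tm → Tm
  | Tm.var n => Tm.var (n+1)
  | Tm.param a => Tm.param a
  | Tm.func s n a => Tm.func s n a

def liftT (τ : Tm → Tm) : Tm → Tm
  | Tm.var 0 => Tm.var 0
  | Tm.var (n+1) => bumpT (τ (Tm.var n))
  | Tm.param a => bumpT (τ (Tm.param a))
  | Tm.func s n a => Tm.func s n a

def Fm.tm : (Tm → Tm) → Fm → Fm
  | τ, Fm.rel s n a => Fm.rel s n (fun i => τ (a i))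
  | τ, Fm.eq t u => Fm.eq (τ t) (τ u)
  | τ, Fm.not f => Fm.not (f.tm τ)
  | τ, Fm.imp f g => Fm.imp (f.tm τ) (g.tm τ)
  | τ, Fm.all f => Fm.all (f.tm (liftT τ))
  | τ, Fm.ex f => Fm.ex (f.tm (liftT τ))

theorem bumpT_noFunc {u : Tm} (h : u.noFunc) : (bumpT u).noFunc := by
  cases u <;> simp_all [bumpT, Tm.noFunc]

theorem liftT_noFunc {τ : Tm → Tm} (h : ∀ u : Tm, u.noFunc → (τ u).noFunc) :
    ∀ u : Tm, u.noFunc → (liftT τ u).noFunc := by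
  intro u hu
  cases u with
  | var n => cases n with
    | zero => simp [liftT, Tm.noFunc]
    | succ n => exact bumpT_noFunc (h _ (by simp [Tm.noFunc]))
  | param a => exact bumpT_noFunc (h _ (by simp [Tm.noFunc]))
  | func s n a => exact absurd hu (by simp [Tm.noFunc])

theorem bumpT_eval {u : Tm} (h : u.noFunc) (z : Zs) (v : ℕ → Zs) :
    (bumpT u).eval fI0 (vcons z v) = u.eval fI0 v := by
  cases u <;> simp_all [bumpT, Tm.noFunc, Tm.eval, vcons]

theorem liftT_eval {τ : Tm → Tm} (h : ∀ u : Tm, u.noFunc → (τ u).noFunc) {v w : ℕ → Zs}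
    (he : ∀ u : Tm, u.noFunc → u.eval fI0 v = (τ u).eval fI0 w) (z : Zs) :
    ∀ u : Tm, u.noFunc → u.eval fI0 (vcons z v) = (liftT τ u).eval fI0 (vcons z w) := by
  intro u hu
  cases u with
  | var n => cases n with
    | zero => simp [liftT, Tm.eval, vcons]
    | succ n =>
      rw [liftT, bumpT_eval (h _ (by simp [Tm.noFunc])), ← he _ (by simp [Tm.noFunc])]
      simp [Tm.eval, vcons]
  | param a =>
      rw [liftT, bumpT_eval (h _ (by simp [Tm.noFunc])), ← he _ (by simp [Tm.noFunc])]
      simp [Tm.eval]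
  | func s n a => exact absurd hu (by simp [Tm.noFunc])

theorem tm_memOnly : ∀ {f : Fm} {τ : Tm → Tm}, f.memOnly →
    (∀ u : Tm, u.noFunc → (τ u).noFunc) → (f.tm τ).memOnly := by
  intro f
  induction f with
  | rel s n a => intro τ hf h; exact ⟨hf.1, hf.2.1, fun i => h _ (hf.2.2 i)⟩
  | eq t u => intro τ hf h; exact ⟨h _ hf.1, h _ hf.2⟩
  | not f ih => intro τ hf h; exact ih (τ := τ) hf h
  | imp f g ihf ihg => intro τ hf h; exact ⟨ihf hf.1 h, ihg hf.2 h⟩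
  | all f ih => intro τ hf h; exact ih (τ := liftT τ) hf (liftT_noFunc h)
  | ex f ih => intro τ hf h; exact ih (τ := liftT τ) hf (liftT_noFunc h)

theorem tm_sat {V : Zs} : ∀ {f : Fm} {τ : Tm → Tm} {v w : ℕ → Zs}, f.memOnly →
    (∀ u : Tm, u.noFunc → (τ u).noFunc) →
    (∀ u : Tm, u.noFunc → u.eval fI0 v = (τ u).eval fI0 w) →
    (SatV V f v ↔ SatV V (f.tm τ) w) := by
  intro f
  induction f with
  | rel s n a =>
    intro τ v w hf h he
    have : ∀ i, (a i).eval fI0 v = (τ (a i)).eval fI0 w := fun i => he _ (hf.2.2 i)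
    change memRel s (List.ofFn fun i => (a i).eval fI0 v) ↔
      memRel s (List.ofFn fun i => (τ (a i)).eval fI0 w)
    simp only [this]
  | eq t u =>
    intro τ v w hf h he
    change (t.eval fI0 v = u.eval fI0 v) ↔ ((τ t).eval fI0 w = (τ u).eval fI0 w)
    rw [he _ hf.1, he _ hf.2]
  | not f ih => intro τ v w hf h he; exact not_congr (ih (τ := τ) hf h he)
  | imp f g ihf ihg => intro τ v w hf h he; exact imp_congr (ihf hf.1 h he) (ihg hf.2 h he)
  | all f ih =>
    intro τ v w hf h he
    exact forall_congr' fun z => imp_congr_right fun _ =>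
      ih (τ := liftT τ) hf (liftT_noFunc h) (liftT_eval h he z)
  | ex f ih =>
    intro τ v w hf h he
    exact exists_congr fun z => and_congr_right fun _ =>
      ih (τ := liftT τ) hf (liftT_noFunc h) (liftT_eval h he z)

theorem liftT_param {τ : Tm → Tm} {S : Set Zs}
    (h : ∀ u : Tm, u.noFunc → u.paramSet ⊆ S → (τ u).paramSet ⊆ S) :
    ∀ u : Tm, u.noFunc → u.paramSet ⊆ S → (liftT τ u).paramSet ⊆ S := by
  have hb : ∀ u : Tm, (bumpT u).paramSet = u.paramSet := by
    intro u; cases u <;> simp [bumpT, Tm.paramSet]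
  intro u hu hS
  cases u with
  | var n => cases n with
    | zero => simp [liftT, Tm.paramSet]
    | succ n => rw [liftT, hb]; exact h _ (by simp [Tm.noFunc]) (by simp [Tm.paramSet])
  | param a => rw [liftT, hb]; exact h _ (by simp [Tm.noFunc]) hS
  | func s n a => exact absurd hu (by simp [Tm.noFunc])

/-- control of parameters: those of `f` lie in `S₀`, output in `S` -/
theorem tm_param : ∀ {f : Fm} {τ : Tm → Tm} {S₀ S : Set Zs}, f.memOnly → f.paramSet ⊆ S₀ →
    (∀ u : Tm, u.noFunc → u.paramSet ⊆ S₀ → (τ u).paramSet ⊆ S) → (f.tm τ).paramSet ⊆ S := by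
  have hb : ∀ u : Tm, (bumpT u).paramSet = u.paramSet := by
    intro u; cases u <;> simp [bumpT, Tm.paramSet]
  have hl : ∀ {τ : Tm → Tm} {S₀ S : Set Zs},
      (∀ u : Tm, u.noFunc → u.paramSet ⊆ S₀ → (τ u).paramSet ⊆ S) →
      (∀ u : Tm, u.noFunc → u.paramSet ⊆ S₀ → (liftT τ u).paramSet ⊆ S) := by
    intro τ S₀ S h u hu hS
    cases u with
    | var n => cases n with
      | zero => simp [liftT, Tm.paramSet]
      | succ n => rw [liftT, hb]; exact h _ (by simp [Tm.noFunc]) (by simp [Tm.paramSet])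
    | param a => rw [liftT, hb]; exact h _ (by simp [Tm.noFunc]) hS
    | func s n a => exact absurd hu (by simp [Tm.noFunc])
  intro f
  induction f with
  | rel s n a =>
    intro τ S₀ S hf hp h
    rintro b ⟨i, hi⟩
    exact h (a i) (hf.2.2 i) (fun c hc => hp ⟨i, hc⟩) hi
  | eq t u =>
    intro τ S₀ S hf hp h
    exact Set.union_subset (h _ hf.1 (Set.subset_union_left.trans hp))
      (h _ hf.2 (Set.subset_union_right.trans hp))
  | not f ih => intro τ S₀ S hf hp h; exact ih (τ := τ) hf hp h
  | imp f g ihf ihg =>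
    intro τ S₀ S hf hp h
    exact Set.union_subset (ihf hf.1 (Set.subset_union_left.trans hp) h)
      (ihg hf.2 (Set.subset_union_right.trans hp) h)
  | all f ih => intro τ S₀ S hf hp h; exact ih (τ := liftT τ) hf hp (hl h)
  | ex f ih => intro τ S₀ S hf hp h; exact ih (τ := liftT τ) hf hp (hl h)

theorem tm_free : ∀ {f : Fm} {τ : Tm → Tm} {k : ℕ}, f.memOnly →
    (∀ u : Tm, u.noFunc → k ∉ (τ u).free) → (∀ u : Tm, u.noFunc → (τ u).noFunc) →
    k ∉ (f.tm τ).free := by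
  have hl : ∀ {τ : Tm → Tm} {k : ℕ}, (∀ u : Tm, u.noFunc → k ∉ (τ u).free) →
      (∀ u : Tm, u.noFunc → (τ u).noFunc) →
      (∀ u : Tm, u.noFunc → k + 1 ∉ (liftT τ u).free) := by
    have hb : ∀ (u : Tm) (k : ℕ), u.noFunc → k ∉ u.free → k+1 ∉ (bumpT u).free := by
      intro u k hu; cases u <;> simp_all [bumpT, Tm.free, Tm.noFunc]
    intro τ k h hn u hu
    cases u with
    | var n => cases n with
      | zero => simp [liftT, Tm.free]
      | succ n => exact hb _ _ (hn _ (by simp [Tm.noFunc])) (h _ (by simp [Tm.noFunc]))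
    | param a => exact hb _ _ (hn _ (by simp [Tm.noFunc])) (h _ (by simp [Tm.noFunc]))
    | func s n a => exact absurd hu (by simp [Tm.noFunc])
  intro f
  induction f with
  | rel s n a => rintro τ k hf h hn ⟨i, hi⟩; exact h _ (hf.2.2 i) hi
  | eq t u => rintro τ k hf h hn (hi | hi); exacts [h _ hf.1 hi, h _ hf.2 hi]
  | not f ih => intro τ k hf h hn; exact ih (τ := τ) hf h hn
  | imp f g ihf ihg =>
    rintro τ k hf h hn (hi | hi); exacts [ihf hf.1 h hn hi, ihg hf.2 h hn hi]
  | all f ih => intro τ k hf h hn; exact ih (τ := liftT τ) hf (hl h hn) (liftT_noFunc hn)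
  | ex f ih => intro τ k hf h hn; exact ih (τ := liftT τ) hf (hl h hn) (liftT_noFunc hn)

theorem sat_congr {V : Zs} : ∀ {f : Fm} {v w : ℕ → Zs}, f.memOnly →
    (∀ n ∈ f.free, v n = w n) → (SatV V f v ↔ SatV V f w) := by
  intro f
  induction f with
  | rel s n a =>
    intro v w hf h
    have : ∀ i, (a i).eval fI0 v = (a i).eval fI0 w :=
      fun i => eval_noFunc_congr (hf.2.2 i) fun n hn => h n ⟨i, hn⟩
    change memRel s (List.ofFn fun i => (a i).eval fI0 v) ↔
      memRel s (List.ofFn fun i => (a i).eval fI0 w)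
    simp only [this]
  | eq t u =>
    intro v w hf h
    change (t.eval fI0 v = u.eval fI0 v) ↔ (t.eval fI0 w = u.eval fI0 w)
    rw [eval_noFunc_congr hf.1 fun n hn => h n (Or.inl hn),
      eval_noFunc_congr hf.2 fun n hn => h n (Or.inr hn)]
  | not f ih => intro v w hf h; exact not_congr (ih hf h)
  | imp f g ihf ihg =>
    intro v w hf h
    exact imp_congr (ihf hf.1 fun n hn => h n (Or.inl hn)) (ihg hf.2 fun n hn => h n (Or.inr hn))
  | all f ih =>
    intro v w hf h
    refine forall_congr' fun z => imp_congr_right fun _ => ih hf ?_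
    intro n hn; cases n with
    | zero => rfl
    | succ n => exact h n hn
  | ex f ih =>
    intro v w hf h
    refine exists_congr fun z => and_congr_right fun _ => ih hf ?_
    intro n hn; cases n with
    | zero => rfl
    | succ n => exact h n hn

theorem tm_free_bdd {u : Tm} (h : u.noFunc) : ∃ k, ∀ m ∈ u.free, m < k := by
  cases u with
  | var n => exact ⟨n+1, by simp [Tm.free]⟩
  | param a => exact ⟨0, by simp [Tm.free]⟩
  | func s n a => exact absurd h (by simp [Tm.noFunc])

theorem free_bdd : ∀ {f : Fm}, f.memOnly → ∃ k, ∀ m ∈ f.free, m < k := by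
  intro f
  induction f with
  | rel s n a =>
    intro hf
    choose k hk using fun i => tm_free_bdd (hf.2.2 i)
    refine ⟨∑ i, k i, ?_⟩
    rintro m ⟨i, hi⟩
    exact (hk i m hi).trans_le (Finset.single_le_sum (f := k) (fun _ _ => Nat.zero_le _)
      (Finset.mem_univ i))
  | eq t u =>
    intro hf
    obtain ⟨k, hk⟩ := tm_free_bdd hf.1
    obtain ⟨l, hl⟩ := tm_free_bdd hf.2
    refine ⟨k + l, ?_⟩
    rintro m (h | h)
    · have := hk m h; omega
    · have := hl m h; omega
  | not f ih => intro hf; exact ih hf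
  | imp f g ihf ihg =>
    intro hf
    obtain ⟨k, hk⟩ := ihf hf.1
    obtain ⟨l, hl⟩ := ihg hf.2
    refine ⟨k + l, ?_⟩
    rintro m (h | h)
    · have := hk m h; omega
    · have := hl m h; omega
  | all f ih =>
    intro hf; obtain ⟨k, hk⟩ := ih hf
    exact ⟨k, fun m hm => by have := hk _ hm; omega⟩
  | ex f ih =>
    intro hf; obtain ⟨k, hk⟩ := ih hf
    exact ⟨k, fun m hm => by have := hk _ hm; omega⟩

theorem allClose_sat {V : Zs} : ∀ (k : ℕ) (f : Fm) (u w : ℕ → Zs),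
    SatV V (allClose k f) u → (∀ n, n < k → w n ∈ V) → (∀ n, w (n + k) = u n) → SatV V f w := by
  intro k
  induction k with
  | zero =>
    intro f u w h _ h2
    have : w = u := funext fun n => h2 n
    rw [this]; exact h
  | succ k ih =>
    intro f u w h h1 h2
    have := ih (Fm.all f) u (fun n => w (n+1)) h (fun n hn => h1 _ (by omega))
      (fun n => by rw [← h2 n]; congr 1)
    have h3 := this (w 0) (h1 0 (by omega))
    have h4 : (vcons (w 0) fun n => w (n + 1)) = w := by
      funext n; cases n <;> rfl
    rw [h4] at h3; exact h3

theorem allClose_of {V : Zs} : ∀ (k : ℕ) (f : Fm) (u : ℕ → Zs),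
    (∀ w : ℕ → Zs, (∀ n, n < k → w n ∈ V) → (∀ n, w (n + k) = u n) → SatV V f w) →
    SatV V (allClose k f) u := by
  intro k
  induction k with
  | zero => intro f u h; exact h u (by simp) (by simp)
  | succ k ih =>
    intro f u h
    refine ih (Fm.all f) u fun w h1 h2 z hz => h _ ?_ ?_
    · intro n hn
      cases n with
      | zero => exact hz
      | succ n => exact h1 n (by omega)
    · intro n; exact h2 n

/-! ### Definable predicates -/

class DP (V : Zs) (P : (ℕ → Zs) → Prop) : Prop where
  out : ∃ φ : Fm, φ.memOnly ∧ φ.paramSet ⊆ {a | a ∈ V} ∧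
    ∀ v : ℕ → Zs, (∀ n, v n ∈ V) → (SatV V φ v ↔ P v)

class DT (V : Zs) (f : (ℕ → Zs) → Zs) : Prop where
  mem : ∀ v : ℕ → Zs, (∀ n, v n ∈ V) → f v ∈ V
  gr : DP V (fun v => v 0 = f (fun n => v (n+1)))

class InV (V : Zs) (a : Zs) : Prop where
  out : a ∈ V

theorem DP.congr {V : Zs} {P Q : (ℕ → Zs) → Prop} (hP : DP V P)
    (h : ∀ v, (∀ n, v n ∈ V) → (Q v ↔ P v)) : DP V Q := by
  obtain ⟨φ, h1, h2, h3⟩ := hP.out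
  exact ⟨φ, h1, h2, fun v hv => (h3 v hv).trans (h v hv).symm⟩

/-- general substitution of variables/constants -/
theorem DP.submap {V : Zs} {P : (ℕ → Zs) → Prop} (hP : DP V P) (ρ : ℕ → ℕ ⊕ Zs)
    (hρ : ∀ n a, ρ n = Sum.inr a → a ∈ V) :
    DP V (fun v => P (fun n => Sum.elim v id (ρ n))) := by
  obtain ⟨φ, h1, h2, h3⟩ := hP.out
  let τ : Tm → Tm := fun u => match u with
    | Tm.var n => (match ρ n with | Sum.inl m => Tm.var m | Sum.inr a => Tm.param a)
    | u => u
  have hτ : ∀ u : Tm, u.noFunc → (τ u).noFunc := by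
    intro u hu
    cases u with
    | var n => simp only [τ]; cases ρ n <;> simp [Tm.noFunc]
    | param a => exact hu
    | func s n a => exact hu
  refine ⟨φ.tm τ, tm_memOnly h1 hτ, tm_param h1 h2 ?_, ?_⟩
  · intro u hu hS
    cases u with
    | var n =>
      simp only [τ]; cases h : ρ n with
      | inl m => simp [Tm.paramSet]
      | inr a => simpa [Tm.paramSet] using hρ n a h
    | param a => exact hS
    | func s n a => exact hS
  · intro v hv
    rw [← h3 (fun n => Sum.elim v id (ρ n))]
    · refine (tm_sat h1 hτ ?_).symm
      intro u hu
      cases u with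
      | var n => simp only [τ]; cases h : ρ n <;> simp [Tm.eval, h]
      | param a => simp [τ, Tm.eval]
      | func s n a => exact absurd hu (by simp [Tm.noFunc])
    · intro n; cases h : ρ n with
      | inl m => simpa using hv m
      | inr a => simpa using hρ n a h

theorem DP.reindex {V : Zs} {P : (ℕ → Zs) → Prop} (hP : DP V P) (σ : ℕ → ℕ) :
    DP V (fun v => P (fun n => v (σ n))) := by
  have := hP.submap (fun n => Sum.inl (σ n)) (by simp)
  simpa using this

instance (priority := 2000) DP.not {V : Zs} {P : (ℕ → Zs) → Prop} [hP : DP V P] :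
    DP V (fun v => ¬ P v) := by
  obtain ⟨φ, h1, h2, h3⟩ := hP.out
  exact ⟨φ.not, h1, h2, fun v hv => not_congr (h3 v hv)⟩

instance (priority := 2000) DP.imp {V : Zs} {P Q : (ℕ → Zs) → Prop} [hP : DP V P] [hQ : DP V Q] :
    DP V (fun v => P v → Q v) := by
  obtain ⟨φ, h1, h2, h3⟩ := hP.out
  obtain ⟨ψ, k1, k2, k3⟩ := hQ.out
  exact ⟨φ.imp ψ, ⟨h1, k1⟩, Set.union_subset h2 k2,
    fun v hv => imp_congr (h3 v hv) (k3 v hv)⟩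

instance (priority := 2000) DP.and {V : Zs} {P Q : (ℕ → Zs) → Prop} [hP : DP V P] [hQ : DP V Q] :
    DP V (fun v => P v ∧ Q v) := by
  have : DP V (fun v => ¬ (P v → ¬ Q v)) := inferInstance
  exact this.congr fun v _ => by tauto

instance (priority := 2000) DP.or {V : Zs} {P Q : (ℕ → Zs) → Prop} [hP : DP V P] [hQ : DP V Q] :
    DP V (fun v => P v ∨ Q v) := by
  have : DP V (fun v => (¬ P v → Q v)) := inferInstance
  exact this.congr fun v _ => by tauto

instance (priority := 2000) DP.iff {V : Zs} {P Q : (ℕ → Zs) → Prop} [hP : DP V P] [hQ : DP V Q] :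
    DP V (fun v => P v ↔ Q v) := by
  have : DP V (fun v => (P v → Q v) ∧ (Q v → P v)) := inferInstance
  exact this.congr fun v _ => by tauto

theorem vcons_mem {V z : Zs} {v : ℕ → Zs} (hz : z ∈ V) (hv : ∀ n, v n ∈ V) :
    ∀ n, vcons z v n ∈ V := by
  intro n; cases n with
  | zero => exact hz
  | succ n => exact hv n

instance (priority := 2000) DP.exV {V : Zs} {P : Zs → (ℕ → Zs) → Prop}
    [hP : DP V (fun v => P (v 0) (fun n => v (n+1)))] :
    DP V (fun v => ∃ z, z ∈ V ∧ P z v) := by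
  obtain ⟨φ, h1, h2, h3⟩ := hP.out
  exact ⟨φ.ex, h1, h2, fun v hv => exists_congr fun z => and_congr_right fun hz =>
    h3 (vcons z v) (vcons_mem hz hv)⟩

instance (priority := 2000) DP.allV {V : Zs} {P : Zs → (ℕ → Zs) → Prop}
    [hP : DP V (fun v => P (v 0) (fun n => v (n+1)))] :
    DP V (fun v => ∀ z, z ∈ V → P z v) := by
  obtain ⟨φ, h1, h2, h3⟩ := hP.out
  exact ⟨φ.all, h1, h2, fun v hv => forall_congr' fun z => imp_congr_right fun hz =>
    h3 (vcons z v) (vcons_mem hz hv)⟩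

theorem memRel_two (a b : Zs) : memRel memSym [a, b] ↔ a ∈ b := by
  simp [memRel]

theorem DP.mem_var (V : Zs) (i j : ℕ) : DP V (fun v => v i ∈ v j) :=
  ⟨mem2 i j, ⟨rfl, rfl, by intro i; fin_cases i <;> simp [Tm.noFunc]⟩,
    by rintro a ⟨i, hi⟩; fin_cases i <;> simp [Tm.paramSet] at hi,
    fun v _ => memRel_two _ _⟩

theorem DP.eq_var (V : Zs) (i j : ℕ) : DP V (fun v => v i = v j) :=
  ⟨eq2 i j, ⟨trivial, trivial⟩,
    by rintro a (hi | hi) <;> simp [Tm.paramSet] at hi,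
    fun v _ => Iff.rfl⟩

/-- substitution of a definable term for variable `0` -/
theorem DP.subst {V : Zs} {P : Zs → (ℕ → Zs) → Prop} {f : (ℕ → Zs) → Zs}
    (hP : DP V (fun v => P (v 0) (fun n => v (n+1)))) (hf : DT V f) :
    DP V (fun v => P (f v) v) := by
  have hg := hf.gr
  have : DP V (fun v => ∃ z, z ∈ V ∧ (z = f v ∧ P z v)) := inferInstance
  refine this.congr fun v hv => ⟨fun h => ⟨_, hf.mem v hv, rfl, h⟩, ?_⟩
  rintro ⟨z, _, rfl, h⟩; exact h

theorem DT.reindex {V : Zs} {f : (ℕ → Zs) → Zs} (hf : DT V f) (σ : ℕ → ℕ) :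
    DT V (fun v => f (fun n => v (σ n))) :=
  ⟨fun v hv => hf.mem _ (fun n => hv _),
   (hf.gr.reindex (fun n => match n with | 0 => 0 | n+1 => σ n + 1))⟩

theorem DP.subst1 {V : Zs} {Q : Zs → Prop} {f : (ℕ → Zs) → Zs}
    (hP : DP V (fun v => Q (v 0))) (hf : DT V f) : DP V (fun v => Q (f v)) :=
  DP.subst (P := fun z _ => Q z) hP hf

theorem DP.subst2 {V : Zs} {Q : Zs → Zs → Prop} {f g : (ℕ → Zs) → Zs}
    (hP : DP V (fun v => Q (v 0) (v 1))) (hf : DT V f) (hg : DT V g) :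
    DP V (fun v => Q (f v) (g v)) := by
  refine DP.subst (P := fun z v => Q z (g v)) ?_ hf
  refine DP.subst (P := fun z v => Q (v 0) z) (f := fun v => g (fun n => v (n+1))) ?_
    (hg.reindex _)
  exact hP.reindex (fun n => match n with | 0 => 1 | _ => 0)

theorem DP.subst3 {V : Zs} {Q : Zs → Zs → Zs → Prop} {f g h : (ℕ → Zs) → Zs}
    (hP : DP V (fun v => Q (v 0) (v 1) (v 2))) (hf : DT V f) (hg : DT V g) (hh : DT V h) :
    DP V (fun v => Q (f v) (g v) (h v)) := by
  refine DP.subst (P := fun z v => Q z (g v) (h v)) ?_ hf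
  refine DP.subst (P := fun z v => Q (v 0) z (h (fun n => v (n+1))))
    (f := fun v => g (fun n => v (n+1))) ?_ (hg.reindex _)
  refine DP.subst (P := fun z v => Q (v 1) (v 0) z)
    (f := fun v => h (fun n => v (n+1+1))) ?_ (hh.reindex _)
  exact hP.reindex (fun n => match n with | 0 => 2 | 1 => 1 | _ => 0)

theorem DP.subst4 {V : Zs} {Q : Zs → Zs → Zs → Zs → Prop} {f g h k : (ℕ → Zs) → Zs}
    (hP : DP V (fun v => Q (v 0) (v 1) (v 2) (v 3)))
    (hf : DT V f) (hg : DT V g) (hh : DT V h) (hk : DT V k) :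
    DP V (fun v => Q (f v) (g v) (h v) (k v)) := by
  refine DP.subst (P := fun z v => Q z (g v) (h v) (k v)) ?_ hf
  refine DP.subst (P := fun z v => Q (v 0) z (h (fun n => v (n+1))) (k (fun n => v (n+1))))
    (f := fun v => g (fun n => v (n+1))) ?_ (hg.reindex _)
  refine DP.subst (P := fun z v => Q (v 1) (v 0) z (k (fun n => v (n+1+1))))
    (f := fun v => h (fun n => v (n+1+1))) ?_ (hh.reindex _)
  refine DP.subst (P := fun z v => Q (v 2) (v 1) (v 0) z)
    (f := fun v => k (fun n => v (n+1+1+1))) ?_ (hk.reindex _)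
  exact hP.reindex (fun n => match n with | 0 => 3 | 1 => 2 | 2 => 1 | _ => 0)

/-- fixing all variables but `0` to constants -/
theorem DP.fix {V : Zs} {P : Zs → (ℕ → Zs) → Prop}
    (hP : DP V (fun v => P (v 0) (fun n => v (n+1)))) (v : ℕ → Zs) (hv : ∀ n, v n ∈ V) :
    DP V (fun w => P (w 0) v) :=
  hP.submap (fun n => match n with | 0 => Sum.inl 0 | n+1 => Sum.inr (v n)) (by
    intro n a h
    cases n with
    | zero => simp at h
    | succ n => simp at h; rw [← h]; exact hv n)

theorem DP.fix2 {V : Zs} {P : Zs → Zs → (ℕ → Zs) → Prop}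
    (hP : DP V (fun v => P (v 0) (v 1) (fun n => v (n+2)))) (v : ℕ → Zs) (hv : ∀ n, v n ∈ V) :
    DP V (fun w => P (w 0) (w 1) v) :=
  hP.submap (fun n => match n with | 0 => Sum.inl 0 | 1 => Sum.inl 1 | n+2 => Sum.inr (v n)) (by
    intro n a h
    match n with
    | 0 => simp at h
    | 1 => simp at h
    | n+2 => simp at h; rw [← h]; exact hv n)

instance (priority := 2000) DT.var {V : Zs} (n : ℕ) : DT V (fun v => v n) :=
  ⟨fun v hv => hv n, DP.eq_var V 0 (n+1)⟩

theorem DP.const_eq {V a : Zs} (h : a ∈ V) : DP V (fun v => v 0 = a) :=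
  ⟨Fm.eq (Tm.var 0) (Tm.param a), ⟨trivial, trivial⟩,
    by rintro b (hi | hi) <;> simp [Tm.paramSet] at hi; subst hi; exact h,
    fun v _ => Iff.rfl⟩

instance (priority := 1500) DT.const {V a : Zs} [h : InV V a] : DT V (fun _ => a) :=
  ⟨fun _ _ => h.out, DP.const_eq h.out⟩

instance (priority := 1500) DP.mem {V : Zs} {f g : (ℕ → Zs) → Zs} [hf : DT V f] [hg : DT V g] :
    DP V (fun v => f v ∈ g v) := DP.subst2 (Q := fun a b => a ∈ b) (DP.mem_var V 0 1) hf hg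

instance (priority := 1500) DP.eq {V : Zs} {f g : (ℕ → Zs) → Zs} [hf : DT V f] [hg : DT V g] :
    DP V (fun v => f v = g v) := DP.subst2 (Q := fun a b => a = b) (DP.eq_var V 0 1) hf hg

instance (priority := 2000) DP.constP {V : Zs} (p : Prop) : DP V (fun _ => p) := by
  by_cases h : p
  · have := DP.eq_var V 0 0
    exact this.congr (by simp [h])
  · have := @DP.not V _ (DP.eq_var V 0 0)
    exact this.congr (by simp [h])

end SmallExt

end

noncomputable section
namespace SmallExt
set_option linter.unusedVariables false
attribute [local instance] Classical.propDecidable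

/-! ## Part 2: ZF models, semantically -/

theorem mem_omega {x : Zs} : x ∈ (ZFSet.omega : Zs) ↔ ∃ n, x = natZ n := by
  have h : ∀ n : ℕ, ZFSet.mk (PSet.ofNat n) = natZ n := by
    intro n
    induction n with
    | zero => rfl
    | succ n ih => rw [natZ, ← ih]; rfl
  constructor
  · refine Quotient.inductionOn x ?_
    rintro y ⟨⟨n⟩, hn⟩
    exact ⟨n, by rw [← h]; exact Quotient.sound hn⟩
  · rintro ⟨n, rfl⟩
    induction n with
    | zero => exact ZFSet.omega_zero
    | succ n ih => exact ZFSet.omega_succ ih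

class ZFM (V : Zs) : Prop where
  trans : ∀ x ∈ V, ∀ y ∈ x, y ∈ V
  emp : (∅ : Zs) ∈ V
  pair : ∀ a ∈ V, ∀ b ∈ V, ({a, b} : Zs) ∈ V
  union : ∀ a ∈ V, ZFSet.sUnion a ∈ V
  pow : ∀ a ∈ V, ZFSet.sep (fun x => x ∈ V) (ZFSet.powerset a) ∈ V
  omega : (ZFSet.omega : Zs) ∈ V
  sep : ∀ (a : Zs) (P : Zs → Prop), a ∈ V → DP V (fun v => P (v 0)) → ZFSet.sep P a ∈ V
  coll : ∀ (a : Zs) (R : Zs → Zs → Prop), a ∈ V → DP V (fun v => R (v 0) (v 1)) →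
    (∀ x ∈ a, ∃ y ∈ V, R x y) → ∃ b ∈ V, ∀ x ∈ a, ∃ y ∈ b, R x y

class ZFCM (V : Zs) : Prop extends ZFM V where
  choice : ∀ a ∈ V, (∀ x ∈ a, ∃ y, y ∈ x) →
    (∀ x ∈ a, ∀ y ∈ a, (∃ z, z ∈ x ∧ z ∈ y) → x = y) →
    ∃ c ∈ V, ∀ x ∈ a, ∃ z, z ∈ c ∧ z ∈ x ∧ ∀ w, w ∈ c → w ∈ x → w = z

section sat
variable {V : Zs} {f g : Fm} {v : ℕ → Zs}
theorem SatV_all : SatV V (Fm.all f) v ↔ ∀ z, z ∈ V → SatV V f (vcons z v) := Iff.rfl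
theorem SatV_ex : SatV V (Fm.ex f) v ↔ ∃ z, z ∈ V ∧ SatV V f (vcons z v) := Iff.rfl
theorem SatV_not : SatV V (Fm.not f) v ↔ ¬ SatV V f v := Iff.rfl
theorem SatV_imp : SatV V (Fm.imp f g) v ↔ (SatV V f v → SatV V g v) := Iff.rfl
theorem SatV_and : SatV V (Fm.and f g) v ↔ (SatV V f v ∧ SatV V g v) := by
  rw [Fm.and, SatV_not, SatV_imp, SatV_not]; tauto
theorem SatV_or : SatV V (Fm.or f g) v ↔ (SatV V f v ∨ SatV V g v) := by
  rw [Fm.or, SatV_imp, SatV_not]; tauto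
theorem SatV_iff : SatV V (Fm.iff f g) v ↔ (SatV V f v ↔ SatV V g v) := by
  rw [Fm.iff, SatV_and, SatV_imp, SatV_imp]; tauto
theorem SatV_mem2 {i j : ℕ} : SatV V (mem2 i j) v ↔ v i ∈ v j := memRel_two _ _
theorem SatV_eq2 {i j : ℕ} : SatV V (eq2 i j) v ↔ v i = v j := Iff.rfl
theorem vcons_zero {z : Zs} : vcons z v 0 = z := rfl
theorem vcons_succ {z : Zs} {n : ℕ} : vcons z v (n+1) = v n := rfl
end sat

theorem IsCTM.nonempty {V : Zs} (h : IsCTM V) : ∃ x, x ∈ V := by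
  have := h.1.2 infAx (by simp [ZFCax])
  obtain ⟨z, hz, _⟩ := this
  exact ⟨z, hz⟩

/-- the term map eliminating parameters -/
def elimT (V : Zs) (k : ℕ) (idx : Zs → ℕ) : Tm → Tm
  | Tm.var n => if n + 2 < k then Tm.var n else Tm.var 3
  | Tm.param b => if b ∈ V then Tm.var (k + idx b) else Tm.param b
  | Tm.func s n a => Tm.func s n a

theorem elimT_noFunc {V : Zs} {k : ℕ} {idx : Zs → ℕ} :
    ∀ u : Tm, u.noFunc → (elimT V k idx u).noFunc := by
  intro u hu
  cases u with
  | var n => rw [elimT]; split_ifs <;> trivial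
  | param a => rw [elimT]; split_ifs <;> trivial
  | func s n a => exact hu

theorem elimT_param {V : Zs} {k : ℕ} {idx : Zs → ℕ} :
    ∀ u : Tm, u.noFunc → u.paramSet ⊆ {a | a ∈ V} → (elimT V k idx u).paramSet ⊆ ∅ := by
  intro u hu h
  cases u with
  | var n => rw [elimT]; split_ifs <;> simp [Tm.paramSet]
  | param a =>
    have : a ∈ V := h (by simp [Tm.paramSet])
    simp [elimT, this, Tm.paramSet]
  | func s n a => exact absurd hu (by simp [Tm.noFunc])

/-- elimination of parameters: there is a parameter free formula -/
theorem elim_params {V : Zs} (hc : IsCTM V) {φ : Fm} (h1 : φ.memOnly)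
    (h2 : φ.paramSet ⊆ {a | a ∈ V}) (k : ℕ) (hk : k = 3 ∨ k = 4) :
    ∃ (φ' : Fm) (e : ℕ → Zs), (∀ n, e n ∈ V) ∧ φ'.memOnly ∧ φ'.paramSet = ∅ ∧
      (k - 2) ∉ φ'.free ∧
      ∀ w : ℕ → Zs, (∀ n, w (k + n) = e n) →
        (SatV V φ (fun n => if n + 2 < k then w n else w 3) ↔ SatV V φ' w) := by
  obtain ⟨x0, hx0⟩ := hc.nonempty
  have hcount : (V.toSet).Countable := hc.2
  obtain ⟨e, he⟩ := hcount.exists_eq_range ⟨x0, hx0⟩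
  have heV : ∀ n, e n ∈ V := fun n => by
    have : e n ∈ V.toSet := by rw [he]; exact ⟨n, rfl⟩
    exact this
  have hidx : ∀ b : Zs, ∃ n, b ∈ V → e n = b := by
    intro b
    by_cases hb : b ∈ V
    · have : b ∈ V.toSet := hb
      rw [he] at this
      obtain ⟨n, hn⟩ := this
      exact ⟨n, fun _ => hn⟩
    · exact ⟨0, fun h => absurd h hb⟩
  choose idx hidx using hidx
  refine ⟨φ.tm (elimT V k idx), e, heV, tm_memOnly h1 elimT_noFunc,
    Set.subset_empty_iff.1 (tm_param h1 h2 elimT_param), tm_free h1 ?_ elimT_noFunc, ?_⟩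
  · intro u hu
    cases u with
    | var n => rw [elimT]; split_ifs <;> simp [Tm.free] <;> omega
    | param a => rw [elimT]; split_ifs <;> simp [Tm.free]; omega
    | func s n a => exact absurd hu (by simp [Tm.noFunc])
  · intro w hw
    refine tm_sat h1 elimT_noFunc ?_
    intro u hu
    cases u with
    | var n => rw [elimT]; split_ifs with h <;> simp [Tm.eval, h]
    | param a =>
      rw [elimT]; split_ifs with h
      · simp [Tm.eval, hw, hidx a h]
      · simp [Tm.eval]
    | func s n a => exact absurd hu (by simp [Tm.noFunc])

theorem CTM_sep {V : Zs} (hc : IsCTM V) (a : Zs) (P : Zs → Prop) (ha : a ∈ V)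
    (hP : DP V (fun v => P (v 0))) : ZFSet.sep P a ∈ V := by
  obtain ⟨φ, h1, h2, h3⟩ := hP.out
  obtain ⟨φ', e, he, k1, k2, k3, k4⟩ := elim_params hc h1 h2 3 (Or.inl rfl)
  obtain ⟨k, hk⟩ := free_bdd k1
  have hax := hc.1.2 (allClose k (sepBody φ')) (Or.inl (Or.inr ⟨k, φ', k1, k2, k3, rfl⟩))
  let w0 : ℕ → Zs := fun n => if n < k then e n else ∅
  have := allClose_sat k _ _ w0 hax (fun n hn => by simp [w0, hn, he]) (fun n => by simp [w0])
  obtain ⟨s, hs, h⟩ := this a ha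
  have hs' : ∀ z ∈ V, (z ∈ s ↔ z ∈ a ∧ P z) := by
    intro z hz
    have hh := h z hz
    have hh := SatV_iff.1 hh
    rw [SatV_and, SatV_mem2, SatV_mem2] at hh
    have e1 : SatV V φ' (vcons z (vcons s (vcons a w0))) ↔
        SatV V φ' (vcons z (vcons s (vcons a e))) := by
      refine sat_congr k1 fun n hn => ?_
      have := hk n hn
      match n with
      | 0 => rfl
      | 1 => rfl
      | 2 => rfl
      | n+3 => simp only [vcons, w0]; rw [if_pos (by omega)]
    have e2 := k4 (vcons z (vcons s (vcons a e))) (fun n => by rw [add_comm]; rfl)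
    have e3 := h3 (fun n => if n + 2 < 3 then (vcons z (vcons s (vcons a e))) n
      else (vcons z (vcons s (vcons a e))) 3) (by
        intro n; split_ifs with h
        · exact vcons_mem hz (vcons_mem hs (vcons_mem ha he)) _
        · exact vcons_mem hz (vcons_mem hs (vcons_mem ha he)) _)
    rw [e1, ← e2, e3] at hh
    exact hh
  have : ZFSet.sep P a = s := by
    ext z
    rw [ZFSet.mem_sep]
    constructor
    · intro hz; exact (hs' z (hc.1.1 a ha hz.1)).2 hz
    · intro hz; exact (hs' z (hc.1.1 s hs hz)).1 hz
  rw [this]; exact hs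

theorem CTM_coll {V : Zs} (hc : IsCTM V) (a : Zs) (R : Zs → Zs → Prop) (ha : a ∈ V)
    (hP : DP V (fun v => R (v 0) (v 1))) (hR : ∀ x ∈ a, ∃ y ∈ V, R x y) :
    ∃ b ∈ V, ∀ x ∈ a, ∃ y ∈ b, R x y := by
  have hP' : DP V (fun v => R (v 1) (v 0)) :=
    hP.reindex (fun n => match n with | 0 => 1 | _ => 0)
  obtain ⟨φ, h1, h2, h3⟩ := hP'.out
  obtain ⟨φ', e, he, k1, k2, k3, k4⟩ := elim_params hc h1 h2 4 (Or.inr rfl)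
  obtain ⟨k, hk⟩ := free_bdd k1
  have hax := hc.1.2 (allClose k (repBody φ')) (Or.inr ⟨k, φ', k1, k2, k3, rfl⟩)
  let w0 : ℕ → Zs := fun n => if n < k then e n else ∅
  have := allClose_sat k _ _ w0 hax (fun n hn => by simp [w0, hn, he]) (fun n => by simp [w0])
  obtain ⟨b, hb, h⟩ := this a ha
  have key : ∀ x ∈ V, ∀ y ∈ V, (SatV V φ' (vcons y (vcons x (vcons b (vcons a w0)))) ↔ R x y) := by
    intro x hx y hy
    have e1 : SatV V φ' (vcons y (vcons x (vcons b (vcons a w0)))) ↔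
        SatV V φ' (vcons y (vcons x (vcons b (vcons a e)))) := by
      refine sat_congr k1 fun n hn => ?_
      have := hk n hn
      match n with
      | 0 => rfl
      | 1 => rfl
      | 2 => rfl
      | 3 => rfl
      | n+4 => simp only [vcons, w0]; rw [if_pos (by omega)]
    have e2 := k4 (vcons y (vcons x (vcons b (vcons a e)))) (fun n => by rw [add_comm]; rfl)
    have e3 := h3 (fun n => if n + 2 < 4 then (vcons y (vcons x (vcons b (vcons a e)))) n
      else (vcons y (vcons x (vcons b (vcons a e)))) 3) (by
        intro n; split_ifs with h
        · exact vcons_mem hy (vcons_mem hx (vcons_mem hb (vcons_mem ha he))) _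
        · exact vcons_mem hy (vcons_mem hx (vcons_mem hb (vcons_mem ha he))) _)
    rw [e1, ← e2, e3]
    exact Iff.rfl
  refine ⟨b, hb, fun x hx => ?_⟩
  have hxV := hc.1.1 a ha hx
  obtain ⟨y, hy, hxy⟩ := hR x hx
  have hh := h x hxV (SatV_mem2.2 hx) ⟨y, hy, (key x hxV y hy).2 hxy⟩
  obtain ⟨y', hy', hh⟩ := hh
  have hh := SatV_and.1 hh
  exact ⟨y', SatV_mem2.1 hh.1, (key x hxV y' hy').1 hh.2⟩

theorem InV_of {V a : Zs} (h : a ∈ V) : InV V a := ⟨h⟩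

/-- bounded quantifiers in transitive sets -/
theorem DP_exB {V : Zs} (ht : ∀ x ∈ V, ∀ y ∈ x, y ∈ V) {f : (ℕ → Zs) → Zs}
    {P : Zs → (ℕ → Zs) → Prop} (hf : DT V f)
    (hP : DP V (fun v => P (v 0) (fun n => v (n+1)))) :
    DP V (fun v => ∃ z, z ∈ f v ∧ P z v) := by
  have hf' := hf.reindex (fun n => n+1)
  have : DP V (fun v => ∃ z, z ∈ V ∧ (z ∈ f v ∧ P z v)) := inferInstance
  exact this.congr fun v hv =>
    ⟨fun ⟨z, h1, h2⟩ => ⟨z, ht _ (hf.mem v hv) _ h1, h1, h2⟩, fun ⟨z, h1, h2⟩ => ⟨z, h2⟩⟩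

theorem DP_allB {V : Zs} (ht : ∀ x ∈ V, ∀ y ∈ x, y ∈ V) {f : (ℕ → Zs) → Zs}
    {P : Zs → (ℕ → Zs) → Prop} (hf : DT V f)
    (hP : DP V (fun v => P (v 0) (fun n => v (n+1)))) :
    DP V (fun v => ∀ z, z ∈ f v → P z v) := by
  have hf' := hf.reindex (fun n => n+1)
  have : DP V (fun v => ∀ z, z ∈ V → (z ∈ f v → P z v)) := inferInstance
  exact this.congr fun v hv =>
    ⟨fun h z _ h2 => h z h2, fun h z h2 => h z (ht _ (hf.mem v hv) _ h2) h2⟩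

theorem CTM_trans {V : Zs} (hc : IsCTM V) : ∀ x ∈ V, ∀ y ∈ x, y ∈ V :=
  fun x hx y hy => hc.1.1 x hx hy

theorem CTM_pair {V : Zs} (hc : IsCTM V) (a : Zs) (ha : a ∈ V) (b : Zs) (hb : b ∈ V) :
    ({a, b} : Zs) ∈ V := by
  have := hc.1.2 pairAx (by simp [ZFCax])
  obtain ⟨c, hc', h⟩ := this a ha b hb
  have h := SatV_and.1 h
  rw [SatV_mem2, SatV_mem2] at h
  have h : a ∈ c ∧ b ∈ c := h
  have := InV_of ha
  have := InV_of hb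
  have := CTM_sep hc c (fun z => z = a ∨ z = b) hc' inferInstance
  convert this using 1
  ext z
  rw [ZFSet.mem_sep, ZFSet.mem_pair]
  constructor
  · rintro (rfl | rfl)
    exacts [⟨h.1, Or.inl rfl⟩, ⟨h.2, Or.inr rfl⟩]
  · exact fun h => h.2

theorem CTM_union {V : Zs} (hc : IsCTM V) (a : Zs) (ha : a ∈ V) :
    (ZFSet.sUnion a) ∈ V := by
  have := hc.1.2 unionAx (by simp [ZFCax])
  obtain ⟨c, hc', h⟩ := this a ha
  have := InV_of ha
  have := CTM_sep hc c (fun z => ∃ y, y ∈ a ∧ z ∈ y) hc' (DP_exB (CTM_trans hc) inferInstance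
    inferInstance)
  convert this using 1
  ext z
  rw [ZFSet.mem_sep, ZFSet.mem_sUnion]
  constructor
  · rintro ⟨y, hy, hz⟩
    refine ⟨?_, y, hy, hz⟩
    have hyV := hc.1.1 a ha hy
    have h1 := h z (hc.1.1 y hyV hz) y hyV (SatV_and.2 ⟨SatV_mem2.2 hz, SatV_mem2.2 hy⟩)
    exact SatV_mem2.1 h1
  · exact fun h => h.2

theorem CTM_pow {V : Zs} (hc : IsCTM V) (a : Zs) (ha : a ∈ V) :
    ZFSet.sep (fun x => x ∈ V) (ZFSet.powerset a) ∈ V := by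
  have := hc.1.2 powAx (by simp [ZFCax])
  obtain ⟨c, hc', h⟩ := this a ha
  have := InV_of ha
  have := CTM_sep hc c (fun z => ∀ y, y ∈ z → y ∈ a) hc' (DP_allB (CTM_trans hc)
    inferInstance inferInstance)
  convert this using 1
  ext z
  rw [ZFSet.mem_sep, ZFSet.mem_sep, ZFSet.mem_powerset]
  constructor
  · rintro ⟨hz, hzV⟩
    refine ⟨?_, fun y hy => hz hy⟩
    have h1 := h z hzV (fun y _ hy => SatV_mem2.2 (hz (SatV_mem2.1 hy)))
    exact SatV_mem2.1 h1
  · rintro ⟨hz, h⟩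
    exact ⟨fun y hy => h y hy, hc.1.1 c hc' hz⟩

theorem CTM_omega {V : Zs} (hc : IsCTM V) : (ZFSet.omega : Zs) ∈ V := by
  have ht := CTM_trans hc
  have := hc.1.2 infAx (by simp [ZFCax])
  obtain ⟨I, hI, h⟩ := this
  have h := SatV_and.1 h
  obtain ⟨⟨e, he, h1⟩, h2⟩ := h
  have h1 := SatV_and.1 h1
  have hempI : e ∈ I := SatV_mem2.1 h1.1
  have hemp : e = ∅ := by
    rw [ZFSet.eq_empty]
    intro y hy
    exact h1.2 y (ht e he y hy) (SatV_mem2.2 hy)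
  subst hemp
  have hins : ∀ x ∈ I, insert x x ∈ I := by
    intro x hx
    obtain ⟨y, hy, h3⟩ := h2 x (ht I hI x hx) (SatV_mem2.2 hx)
    have h3 := SatV_and.1 h3
    have h4 := SatV_and.1 h3.2
    have hyI : y ∈ I := SatV_mem2.1 h3.1
    convert hyI using 1
    ext z
    rw [ZFSet.mem_insert_iff]
    constructor
    · intro hz
      have hzV : z ∈ V := by
        rcases hz with rfl | hz
        · exact ht I hI z hx
        · exact ht x (ht I hI x hx) z hz
      have h5 := SatV_iff.1 (h4.2 z hzV)
      rw [SatV_or, SatV_mem2, SatV_mem2, SatV_eq2] at h5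
      exact h5.2 hz.symm
    · intro hz
      have h5 := SatV_iff.1 (h4.2 z (ht y hy z hz))
      rw [SatV_or, SatV_mem2, SatV_mem2, SatV_eq2] at h5
      exact (h5.1 hz).symm
  have hsub : ∀ n, natZ n ∈ I := by
    intro n
    induction n with
    | zero => exact hempI
    | succ n ih => exact hins _ ih
  -- insert z z in V
  have hsucV : ∀ z ∈ V, insert z z ∈ V := by
    intro z hz
    have e1 : (insert z z : Zs) = ZFSet.sUnion {z, {z, z}} := by
      ext w; simp [ZFSet.mem_insert_iff, or_comm]
    rw [e1]
    exact CTM_union hc _ (CTM_pair hc _ hz _ (CTM_pair hc _ hz _ hz))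
  -- inductive sets
  let ind : Zs → Prop := fun X => (∃ z, z ∈ X ∧ ∀ w, w ∈ z → False) ∧
    ∀ z, z ∈ X → ∃ y, y ∈ X ∧ ((∀ w, w ∈ y → (w ∈ z ∨ w = z)) ∧ (∀ w, w ∈ z → w ∈ y) ∧ z ∈ y)
  have hind : ∀ X, ind X ↔ (∅ ∈ X ∧ ∀ z ∈ X, insert z z ∈ X) := by
    intro X
    have hs : ∀ z y : Zs, ((∀ w, w ∈ y → (w ∈ z ∨ w = z)) ∧ (∀ w, w ∈ z → w ∈ y) ∧ z ∈ y) ↔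
        y = insert z z := by
      intro z y
      constructor
      · rintro ⟨a, b, c⟩
        ext w; rw [ZFSet.mem_insert_iff]
        constructor
        · intro h; exact (a w h).symm
        · rintro (rfl | h)
          exacts [c, b w h]
      · rintro rfl
        refine ⟨fun w h => ((ZFSet.mem_insert_iff).1 h).symm,
          fun w h => ZFSet.mem_insert_iff.2 (Or.inr h), ZFSet.mem_insert_iff.2 (Or.inl rfl)⟩
    constructor
    · rintro ⟨⟨z, hz, hz'⟩, h⟩
      have : z = ∅ := by rw [ZFSet.eq_empty]; exact hz'
      refine ⟨this ▸ hz, fun z hz => ?_⟩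
      obtain ⟨y, hy, h⟩ := h z hz
      rw [hs] at h; exact h ▸ hy
    · rintro ⟨h1, h2⟩
      refine ⟨⟨∅, h1, fun w hw => ZFSet.notMem_empty _ hw⟩, fun z hz => ⟨_, h2 z hz, (hs _ _).2 rfl⟩⟩
  have hDPind : DP V (fun v => ind (v 0)) := by
    refine @DP.and V _ _ ?_ ?_
    · refine DP_exB ht inferInstance (DP_allB ht inferInstance inferInstance)
    · refine DP_allB ht inferInstance (DP_exB ht inferInstance ?_)
      refine @DP.and V _ _ ?_ (@DP.and V _ _ ?_ inferInstance)
      · exact DP_allB ht inferInstance inferInstance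
      · exact DP_allB ht inferInstance inferInstance
  have hJ : ZFSet.sep (fun x => ∀ X, X ∈ V → (ind X → x ∈ X)) I ∈ V := by
    refine CTM_sep hc _ _ hI ?_
    have : DP V (fun v => ind (v 0)) := hDPind
    exact inferInstance
  convert hJ using 1
  set J := ZFSet.sep (fun x => ∀ X, X ∈ V → (ind X → x ∈ X)) I with hJdef
  ext x
  constructor
  · intro hx
    obtain ⟨n, rfl⟩ := mem_omega.1 hx
    rw [ZFSet.mem_sep]
    refine ⟨hsub n, fun X _ hX => ?_⟩
    rw [hind] at hX
    induction n with
    | zero => exact hX.1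
    | succ n ih => exact hX.2 _ (ih (mem_omega.2 ⟨n, rfl⟩))
  · have hJind : ∅ ∈ J ∧ ∀ z ∈ J, insert z z ∈ J := by
      refine ⟨?_, ?_⟩
      · rw [hJdef, ZFSet.mem_sep]
        exact ⟨hempI, fun X _ hX => ((hind X).1 hX).1⟩
      · intro z hz
        rw [hJdef, ZFSet.mem_sep] at hz ⊢
        exact ⟨hins z hz.1, fun X hX hX' => ((hind X).1 hX').2 z (hz.2 X hX hX')⟩
    have hpred : ∀ x ∈ J, x = ∅ ∨ ∃ y ∈ J, x = insert y y := by
      intro x hx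
      by_contra hcon
      push Not at hcon
      have : InV V x := InV_of (ht J hJ x hx)
      have hX : ZFSet.sep (fun z => ¬ z = x) J ∈ V := CTM_sep hc _ _ hJ inferInstance
      have hXind : ind (ZFSet.sep (fun z => ¬ z = x) J) := by
        rw [hind]
        refine ⟨?_, ?_⟩
        · rw [ZFSet.mem_sep]; exact ⟨hJind.1, fun h => hcon.1 h.symm⟩
        · intro z hz
          rw [ZFSet.mem_sep] at hz ⊢
          exact ⟨hJind.2 z hz.1, fun h => hcon.2 z hz.1 h.symm⟩
      have hx' := hx
      rw [hJdef, ZFSet.mem_sep] at hx'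
      have := hx'.2 _ hX hXind
      rw [ZFSet.mem_sep] at this
      exact this.2 rfl
    refine ZFSet.inductionOn x ?_
    intro x ih hx
    rcases hpred x hx with rfl | ⟨y, hy, rfl⟩
    · exact ZFSet.omega_zero
    · exact ZFSet.omega_succ (ih y (ZFSet.mem_insert_iff.2 (Or.inl rfl)) hy)

theorem CTM_ZFM {V : Zs} (hc : IsCTM V) : ZFM V where
  trans := CTM_trans hc
  emp := by
    obtain ⟨x, hx⟩ := hc.nonempty
    exact CTM_trans hc _ (CTM_omega hc) _ ZFSet.omega_zero
  pair := CTM_pair hc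
  union := CTM_union hc
  pow := CTM_pow hc
  omega := CTM_omega hc
  sep := CTM_sep hc
  coll := CTM_coll hc

theorem CTM_ZFCM {V : Zs} (hc : IsCTM V) : ZFCM V where
  toZFM := CTM_ZFM hc
  choice := by
    intro a ha h1 h2
    have ht := CTM_trans hc
    have := hc.1.2 choiceAx (by simp [ZFCax])
    have := SatV_imp.1 (this a ha)
    have h3 := this (by
      refine SatV_and.2 ⟨?_, ?_⟩
      · intro x hx hxa
        have hxa : x ∈ a := SatV_mem2.1 hxa
        obtain ⟨y, hy⟩ := h1 x hxa
        exact ⟨y, ht x hx y hy, SatV_mem2.2 hy⟩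
      · intro x hx y hy h
        have h := SatV_and.1 h
        have h' := SatV_and.1 h.2
        obtain ⟨z, hz, hz'⟩ := h'.2
        have hz' := SatV_and.1 hz'
        exact h2 x (SatV_mem2.1 h.1) y (SatV_mem2.1 h'.1)
          ⟨z, SatV_mem2.1 hz'.1, SatV_mem2.1 hz'.2⟩)
    obtain ⟨c, hcV, hcc⟩ := h3
    refine ⟨c, hcV, fun x hx => ?_⟩
    obtain ⟨z, hz, h⟩ := hcc x (ht a ha x hx) (SatV_mem2.2 hx)
    have h := SatV_and.1 h
    have h' := SatV_and.1 h.2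
    exact ⟨z, SatV_mem2.1 h'.1, SatV_mem2.1 h.1, fun w hw hw' =>
      h'.2 w (ht c hcV w hw) (SatV_and.2 ⟨SatV_mem2.2 hw', SatV_mem2.2 hw⟩)⟩

end SmallExt

end

noncomputable section
namespace SmallExt
set_option linter.unusedVariables false
attribute [local instance] Classical.propDecidable

instance (priority := 1800) DP.exB {V : Zs} [hV : ZFM V] {f : (ℕ → Zs) → Zs}
    {P : Zs → (ℕ → Zs) → Prop} [hf : DT V f]
    [hP : DP V (fun v => P (v 0) (fun n => v (n+1)))] :
    DP V (fun v => ∃ z, z ∈ f v ∧ P z v) := DP_exB hV.trans hf hP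

instance (priority := 1800) DP.allB {V : Zs} [hV : ZFM V] {f : (ℕ → Zs) → Zs}
    {P : Zs → (ℕ → Zs) → Prop} [hf : DT V f]
    [hP : DP V (fun v => P (v 0) (fun n => v (n+1)))] :
    DP V (fun v => ∀ z, z ∈ f v → P z v) := DP_allB hV.trans hf hP

theorem DT.ofMem {V : Zs} [hV : ZFM V] {f : (ℕ → Zs) → Zs}
    (hm : ∀ v : ℕ → Zs, (∀ n, v n ∈ V) → f v ∈ V)
    (hd : DP V (fun v => v 0 ∈ f (fun n => v (n+1)))) : DT V f := by
  refine ⟨hm, ?_⟩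
  have hd' : DP V (fun v => v 0 ∈ f (fun n => v (n+1+1))) :=
    hd.reindex (fun n => match n with | 0 => 0 | n+1 => n+1+1)
  have : DP V (fun v => ∀ w, w ∈ V → (w ∈ v 0 ↔ w ∈ f (fun n => v (n+1)))) := inferInstance
  refine this.congr fun v hv => ⟨fun h w _ => by rw [h], fun h => ?_⟩
  ext w
  refine ⟨fun hw => (h w (hV.trans _ (hv 0) _ hw)).1 hw,
    fun hw => (h w (hV.trans _ (hm _ (fun n => hv (n+1))) _ hw)).2 hw⟩

theorem DT.subst1 {V : Zs} {F : Zs → Zs} {f : (ℕ → Zs) → Zs}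
    (hF : DT V (fun v => F (v 0))) (hf : DT V f) : DT V (fun v => F (f v)) := by
  refine ⟨fun v hv => hF.mem (fun _ => f v) (fun _ => hf.mem v hv), ?_⟩
  exact DP.subst2 (Q := fun z a => z = F a) (f := fun v => v 0) hF.gr inferInstance
    (hf.reindex (fun n => n+1))

theorem DT.subst2 {V : Zs} {F : Zs → Zs → Zs} {f g : (ℕ → Zs) → Zs}
    (hF : DT V (fun v => F (v 0) (v 1))) (hf : DT V f) (hg : DT V g) :
    DT V (fun v => F (f v) (g v)) := by
  refine ⟨fun v hv => hF.mem (fun n => match n with | 0 => f v | _ => g v) (fun n => ?_), ?_⟩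
  · match n with
    | 0 => exact hf.mem v hv
    | n+1 => exact hg.mem v hv
  exact DP.subst3 (Q := fun z a b => z = F a b) (f := fun v => v 0) hF.gr inferInstance
    (hf.reindex (fun n => n+1)) (hg.reindex (fun n => n+1))

theorem DT.congr {V : Zs} {f g : (ℕ → Zs) → Zs} (hf : DT V f)
    (h : ∀ v, (∀ n, v n ∈ V) → g v = f v) : DT V g :=
  ⟨fun v hv => by rw [h v hv]; exact hf.mem v hv,
   hf.gr.congr fun v hv => by rw [h _ fun n => hv (n+1)]⟩

section
variable {V : Zs} [hV : ZFM V]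

theorem ZFM.tr {x y : Zs} (hx : x ∈ V) (hy : y ∈ x) : y ∈ V := hV.trans x hx y hy

theorem ZFM.sing {a : Zs} (ha : a ∈ V) : ({a} : Zs) ∈ V := by
  have h := hV.pair a ha a ha
  have e : ({a} : Zs) = {a, a} := by ext; simp
  rw [e]; exact h

theorem ZFM.un {a b : Zs} (ha : a ∈ V) (hb : b ∈ V) : a ∪ b ∈ V := by
  have h := hV.union _ (hV.pair a ha b hb)
  rwa [ZFSet.sUnion_pair] at h

theorem ZFM.ins {a b : Zs} (ha : a ∈ V) (hb : b ∈ V) : insert a b ∈ V := by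
  have h := ZFM.un (ZFM.sing ha) hb
  convert h using 1
  ext; simp

theorem ZFM.opair {a b : Zs} (ha : a ∈ V) (hb : b ∈ V) : opair a b ∈ V :=
  hV.pair _ (ZFM.sing ha) _ (hV.pair _ ha _ hb)

theorem mem_opair_def (a b : Zs) : opair a b = {{a}, {a, b}} := rfl

theorem opair_inj {a b c d : Zs} : opair a b = opair c d ↔ a = c ∧ b = d := ZFSet.pair_inj

instance : InV V ∅ := ⟨hV.emp⟩
instance : InV V ZFSet.omega := ⟨hV.omega⟩
theorem ZFM.natZ (n : ℕ) : natZ n ∈ V := ZFM.tr hV.omega (mem_omega.2 ⟨n, rfl⟩)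
instance (n : ℕ) : InV V (natZ n) := ⟨ZFM.natZ n⟩

instance (priority := 1400) DP.sub {f g : (ℕ → Zs) → Zs} [hf : DT V f] [hg : DT V g] :
    DP V (fun v => f v ⊆ g v) := by
  refine DP.subst2 (Q := fun a b => a ⊆ b) ?_ hf hg
  have : DP V (fun v => ∀ z, z ∈ v 0 → z ∈ v 1) := inferInstance
  exact this.congr fun v _ => ⟨fun h z hz => h hz, fun h z hz => h z hz⟩

instance (priority := 1400) DT.ins {f g : (ℕ → Zs) → Zs} [hf : DT V f] [hg : DT V g] :
    DT V (fun v => insert (f v) (g v)) := by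
  refine DT.subst2 (F := fun a b => insert a b) (DT.ofMem ?_ ?_) hf hg
  · intro v hv; exact ZFM.ins (hv 0) (hv 1)
  · have : DP V (fun v => v 0 = v 1 ∨ v 0 ∈ v 2) := inferInstance
    exact this.congr fun v _ => ZFSet.mem_insert_iff

instance (priority := 1400) DT.sing {f : (ℕ → Zs) → Zs} [hf : DT V f] :
    DT V (fun v => ({f v} : Zs)) := by
  refine DT.subst1 (F := fun a => {a}) (DT.ofMem ?_ ?_) hf
  · intro v hv; exact ZFM.sing (hv 0)
  · have : DP V (fun v => v 0 = v 1) := inferInstance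
    exact this.congr fun v _ => ZFSet.mem_singleton

instance (priority := 1400) DT.opair {f g : (ℕ → Zs) → Zs} [hf : DT V f] [hg : DT V g] :
    DT V (fun v => opair (f v) (g v)) := by
  have : DT V (fun v => ({{f v}, {f v, g v}} : Zs)) := inferInstance
  exact this

instance (priority := 1400) DT.sU {f : (ℕ → Zs) → Zs} [hf : DT V f] :
    DT V (fun v => ZFSet.sUnion (f v)) := by
  refine DT.subst1 (F := fun a => ZFSet.sUnion a) (DT.ofMem ?_ ?_) hf
  · intro v hv; exact hV.union _ (hv 0)
  · have : DP V (fun v => ∃ y, y ∈ v 1 ∧ v 0 ∈ y) := inferInstance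
    exact this.congr fun v _ => ZFSet.mem_sUnion

instance (priority := 1400) DT.un {f g : (ℕ → Zs) → Zs} [hf : DT V f] [hg : DT V g] :
    DT V (fun v => f v ∪ g v) := by
  refine DT.subst2 (F := fun a b => a ∪ b) (DT.ofMem ?_ ?_) hf hg
  · intro v hv; exact ZFM.un (hv 0) (hv 1)
  · have : DP V (fun v => v 0 ∈ v 1 ∨ v 0 ∈ v 2) := inferInstance
    exact this.congr fun v _ => ZFSet.mem_union

/-- separation with a definable formula and parameters from a valuation -/
instance (priority := 1400) DT.sep {P : Zs → (ℕ → Zs) → Prop} {f : (ℕ → Zs) → Zs}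
    [hf : DT V f] [hP : DP V (fun v => P (v 0) (fun n => v (n+1)))] :
    DT V (fun v => ZFSet.sep (fun z => P z v) (f v)) := by
  have hf' := hf.reindex (fun n => n+1)
  refine DT.ofMem ?_ ?_
  · intro v hv; exact hV.sep _ _ (hf.mem v hv) (hP.fix v hv)
  · have : DP V (fun v => v 0 ∈ f (fun n => v (n+1)) ∧ P (v 0) (fun n => v (n+1))) :=
      inferInstance
    exact this.congr fun v _ => ZFSet.mem_sep

def powV (V a : Zs) : Zs := ZFSet.sep (fun x => x ∈ V) (ZFSet.powerset a)

theorem mem_powV {V a x : Zs} : x ∈ powV V a ↔ x ⊆ a ∧ x ∈ V := by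
  rw [powV, ZFSet.mem_sep, ZFSet.mem_powerset]

theorem powV_mem {a : Zs} (ha : a ∈ V) : powV V a ∈ V := hV.pow a ha

instance (priority := 1400) DT.powV {f : (ℕ → Zs) → Zs} [hf : DT V f] :
    DT V (fun v => powV V (f v)) := by
  refine DT.subst1 (F := fun a => SmallExt.powV V a) (DT.ofMem ?_ ?_) hf
  · intro v hv; exact powV_mem (hv 0)
  · have : DP V (fun v => v 0 ⊆ v 1) := inferInstance
    exact this.congr fun v hv => by rw [mem_powV]; simp [hv 0]

theorem ZFM.prod {a b : Zs} (ha : a ∈ V) (hb : b ∈ V) : ZFSet.prod a b ∈ V := by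
  have hab := ZFM.un ha hb
  have h := powV_mem (powV_mem hab)
  have i1 := InV_of ha
  have i2 := InV_of hb
  have h2 := hV.sep _ (fun z => ∃ x, x ∈ a ∧ ∃ y, y ∈ b ∧ z = SmallExt.opair x y) h inferInstance
  convert h2 using 1
  ext z
  rw [ZFSet.mem_sep, ZFSet.mem_prod]
  constructor
  · rintro ⟨x, hx, y, hy, rfl⟩
    have hxV := ZFM.tr ha hx
    have hyV := ZFM.tr hb hy
    refine ⟨?_, x, hx, y, hy, rfl⟩
    rw [mem_powV]
    refine ⟨?_, ZFM.opair hxV hyV⟩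
    intro w hw
    rw [mem_powV]
    refine ⟨?_, ZFM.tr (ZFM.opair hxV hyV) hw⟩
    intro u hu
    have hw : w ∈ ({{x}, {x, y}} : Zs) := hw
    rw [ZFSet.mem_pair] at hw
    rw [ZFSet.mem_union]
    rcases hw with rfl | rfl
    · rw [ZFSet.mem_singleton] at hu; subst hu; exact Or.inl hx
    · rw [ZFSet.mem_pair] at hu
      rcases hu with rfl | rfl
      exacts [Or.inl hx, Or.inr hy]
  · rintro ⟨_, x, hx, y, hy, h⟩
    exact ⟨x, hx, y, hy, h⟩

instance (priority := 1400) DT.prod {f g : (ℕ → Zs) → Zs} [hf : DT V f] [hg : DT V g] :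
    DT V (fun v => ZFSet.prod (f v) (g v)) := by
  refine DT.subst2 (F := fun a b => ZFSet.prod a b) (DT.ofMem ?_ ?_) hf hg
  · intro v hv; exact ZFM.prod (hv 0) (hv 1)
  · have : DP V (fun v => ∃ x, x ∈ v 1 ∧ ∃ y, y ∈ v 2 ∧ v 0 = SmallExt.opair x y) := inferInstance
    exact this.congr fun v _ => ZFSet.mem_prod

theorem sInter_eq (x : Zs) : ZFSet.sInter x =
    ZFSet.sep (fun y => ∀ z, z ∈ x → y ∈ z) (ZFSet.sUnion x) := by
  ext y
  rw [ZFSet.mem_sep, ZFSet.mem_sUnion]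
  by_cases h : x.Nonempty
  · rw [ZFSet.mem_sInter h]
    obtain ⟨z, hz⟩ := h
    exact ⟨fun h => ⟨⟨z, hz, h z hz⟩, h⟩, fun h => h.2⟩
  · have : x = ∅ := by
      rw [ZFSet.eq_empty]; intro y hy; exact h ⟨y, hy⟩
    subst this
    simp

instance (priority := 1400) DT.sI {f : (ℕ → Zs) → Zs} [hf : DT V f] :
    DT V (fun v => ZFSet.sInter (f v)) := by
  refine DT.subst1 (F := fun a => ZFSet.sInter a) ?_ hf
  have : DT V (fun v => ZFSet.sep (fun y => ∀ z, z ∈ v 0 → y ∈ z) (ZFSet.sUnion (v 0))) :=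
    inferInstance
  exact this.congr fun v _ => sInter_eq _

instance (priority := 1400) DT.zfst {f : (ℕ → Zs) → Zs} [hf : DT V f] :
    DT V (fun v => zfst (f v)) := by unfold SmallExt.zfst; infer_instance

instance (priority := 1400) DT.zsnd {f : (ℕ → Zs) → Zs} [hf : DT V f] :
    DT V (fun v => zsnd (f v)) := by
  refine DT.subst1 (F := fun a => SmallExt.zsnd a) ?_ hf
  unfold SmallExt.zsnd
  have : DT V (fun v => ZFSet.sUnion (ZFSet.sep (fun y => ¬ ZFSet.sUnion (v 0) = ZFSet.sInter (v 0) →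
    ¬ y ∈ ZFSet.sInter (v 0)) (ZFSet.sUnion (v 0)))) := inferInstance
  exact this

end

theorem zfst_opair (a b : Zs) : zfst (opair a b) = a := by
  have : ZFSet.sInter (opair a b) = {a} := by
    ext y
    rw [ZFSet.mem_sInter ⟨{a}, by simp [mem_opair_def]⟩]
    simp only [mem_opair_def, ZFSet.mem_pair, ZFSet.mem_singleton]
    constructor
    · intro h; simpa using h {a} (Or.inl rfl)
    · rintro rfl z (rfl | rfl) <;> simp
  rw [zfst, this]; simp

theorem zsnd_opair (a b : Zs) : zsnd (opair a b) = b := by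
  have h1 : ZFSet.sInter (opair a b) = {a} := by
    ext y
    rw [ZFSet.mem_sInter ⟨{a}, by simp [mem_opair_def]⟩]
    simp only [mem_opair_def, ZFSet.mem_pair, ZFSet.mem_singleton]
    constructor
    · intro h; simpa using h {a} (Or.inl rfl)
    · rintro rfl z (rfl | rfl) <;> simp
  have h2 : ZFSet.sUnion (opair a b) = {a, b} := by
    ext y
    simp [mem_opair_def]
  rw [zsnd, h1, h2]
  by_cases hab : a = b
  · subst hab
    have : ({a, a} : Zs) = {a} := by ext; simp
    ext y
    simp [this]
  · have hne : ({a, b} : Zs) ≠ {a} := by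
      intro h
      have : b ∈ ({a} : Zs) := by rw [← h]; simp
      rw [ZFSet.mem_singleton] at this
      exact hab this.symm
    ext y
    simp only [ZFSet.mem_sUnion, ZFSet.mem_sep]
    constructor
    · rintro ⟨z, ⟨h1, h2⟩, h3⟩
      have := h2 hne
      rw [ZFSet.mem_singleton] at this
      rw [ZFSet.mem_pair] at h1
      rcases h1 with rfl | rfl
      · exact absurd rfl this
      · exact h3
    · intro hy
      refine ⟨b, ⟨by simp, fun _ h => ?_⟩, hy⟩
      rw [ZFSet.mem_singleton] at h; exact hab h.symm

theorem natZ_inj {m n : ℕ} (h : natZ m = natZ n) : m = n := by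
  have hlt : ∀ m n : ℕ, m < n → natZ m ∈ natZ n := by
    intro m n h
    induction n with
    | zero => omega
    | succ n ih =>
      rw [natZ, ZFSet.mem_insert_iff]
      rcases Nat.lt_succ_iff_lt_or_eq.1 h with h | rfl
      · exact Or.inr (ih h)
      · exact Or.inl rfl
  rcases lt_trichotomy m n with h1 | h1 | h1
  · have := hlt _ _ h1; rw [h] at this; exact absurd this (ZFSet.mem_irrefl _)
  · exact h1
  · have := hlt _ _ h1; rw [h] at this; exact absurd this (ZFSet.mem_irrefl _)

theorem mem_natZ {x : Zs} {n : ℕ} : x ∈ natZ n ↔ ∃ m < n, x = natZ m := by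
  induction n with
  | zero => simp [natZ]
  | succ n ih =>
    rw [natZ, ZFSet.mem_insert_iff, ih]
    constructor
    · rintro (rfl | ⟨m, h, rfl⟩)
      exacts [⟨n, by omega, rfl⟩, ⟨m, by omega, rfl⟩]
    · rintro ⟨m, h, rfl⟩
      rcases Nat.lt_succ_iff_lt_or_eq.1 h with h | rfl
      exacts [Or.inr ⟨m, h, rfl⟩, Or.inl rfl]

section
variable {V : Zs} [hV : ZFM V]

theorem opair_mem_left {a b : Zs} (h : opair a b ∈ V) : a ∈ V :=
  ZFM.tr (ZFM.tr h (y := {a}) (by simp [mem_opair_def])) (by simp)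

theorem opair_mem_right {a b : Zs} (h : opair a b ∈ V) : b ∈ V :=
  ZFM.tr (ZFM.tr h (y := {a, b}) (by simp [mem_opair_def])) (by simp)

theorem opair_mem_iff {a b : Zs} : opair a b ∈ V ↔ a ∈ V ∧ b ∈ V :=
  ⟨fun h => ⟨opair_mem_left h, opair_mem_right h⟩, fun h => ZFM.opair h.1 h.2⟩

/-- replacement: image under definable function -/
theorem ZFM.repl {a : Zs} (ha : a ∈ V) {F : Zs → Zs} [hF : DT V (fun v => F (v 0))] :
    ∃ b ∈ V, ∀ y, y ∈ b ↔ ∃ x ∈ a, y = F x := by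
  have hFV : ∀ x ∈ V, F x ∈ V := fun x hx => hF.mem (fun _ => x) (fun _ => hx)
  have hd : DP V (fun v => v 1 = F (v 0)) := DP.eq (f := fun v => v 1) (g := fun v => F (v 0))
  obtain ⟨b, hb, h⟩ := hV.coll a (fun x y => y = F x) ha hd
    (fun x hx => ⟨_, hFV x (ZFM.tr ha hx), rfl⟩)
  have i := InV_of ha
  have hd' : DP V (fun v => ∃ x, x ∈ a ∧ v 0 = F x) := by
    have : DP V (fun v => v 1 = F (v 0)) := hd
    exact inferInstance
  refine ⟨_, hV.sep b (fun y => ∃ x, x ∈ a ∧ y = F x) hb hd', fun y => ?_⟩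
  rw [ZFSet.mem_sep]
  constructor
  · exact fun h => h.2
  · rintro ⟨x, hx, rfl⟩
    obtain ⟨y, hy, rfl⟩ := h x hx
    exact ⟨hy, x, hx, rfl⟩

/-- finite induction: finite subsets are in V -/
theorem ZFM.finite_mem {s : Set Zs} (hs : s.Finite) (h : ∀ x ∈ s, x ∈ V) :
    ∃ a ∈ V, ∀ x, x ∈ a ↔ x ∈ s := by
  induction s, hs using Set.Finite.induction_on with
  | empty => exact ⟨∅, hV.emp, by simp⟩
  | insert _ _ ih =>
    rename_i x s _ _
    obtain ⟨a, ha, h'⟩ := ih (fun y hy => h y (Set.mem_insert_of_mem _ hy))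
    refine ⟨insert x a, ZFM.ins (h x (Set.mem_insert _ _)) ha, fun y => ?_⟩
    rw [ZFSet.mem_insert_iff, h', Set.mem_insert_iff]

end

/-! ### back to CTMs -/

theorem ZFCM.isCTM {V : Zs} [hV : ZFCM V] (hc : V.toSet.Countable) : IsCTM V := by
  have hm : ZFM V := inferInstance
  refine ⟨⟨fun x hx y hy => ZFM.tr hx hy, ?_⟩, hc⟩
  have hφ : ∀ φ : Fm, φ.memOnly → φ.paramSet = ∅ → DP V (fun v => SatV V φ v) :=
    fun φ h1 h2 => ⟨φ, h1, by rw [h2]; exact Set.empty_subset _, fun _ _ => Iff.rfl⟩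
  rintro f ((hf | ⟨k, φ, h1, h2, h3, rfl⟩) | ⟨k, φ, h1, h2, h3, rfl⟩)
  · simp only [Set.mem_insert_iff, Set.mem_singleton_iff] at hf
    rcases hf with rfl | rfl | rfl | rfl | rfl | rfl | rfl
    · intro x hx y hy h
      refine SatV_eq2.2 ?_
      change x = y
      ext z
      constructor
      · intro hz
        have h5 := SatV_iff.1 (h z (ZFM.tr hx hz))
        rw [SatV_mem2, SatV_mem2] at h5
        exact h5.1 hz
      · intro hz
        have h5 := SatV_iff.1 (h z (ZFM.tr hy hz))
        rw [SatV_mem2, SatV_mem2] at h5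
        exact h5.2 hz
    · intro x hx y hy
      refine ⟨{x, y}, hm.pair x hx y hy, SatV_and.2 ⟨SatV_mem2.2 ?_, SatV_mem2.2 ?_⟩⟩
      · change x ∈ ({x, y} : Zs); simp
      · change y ∈ ({x, y} : Zs); simp
    · intro x hx
      refine ⟨_, hm.union x hx, ?_⟩
      intro z hz y hy h
      have h := SatV_and.1 h
      rw [SatV_mem2, SatV_mem2] at h
      refine SatV_mem2.2 ?_
      change z ∈ ZFSet.sUnion x
      rw [ZFSet.mem_sUnion]
      exact ⟨y, h.2, h.1⟩
    · intro x hx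
      refine ⟨_, hm.pow x hx, ?_⟩
      intro z hz h
      refine SatV_mem2.2 ?_
      change z ∈ powV V x
      rw [mem_powV]
      exact ⟨fun w hw => SatV_mem2.1 (h w (ZFM.tr hz hw) (SatV_mem2.2 hw)), hz⟩
    · refine ⟨_, hm.omega, SatV_and.2 ⟨⟨∅, hm.emp, SatV_and.2 ⟨SatV_mem2.2 ZFSet.omega_zero, ?_⟩⟩, ?_⟩⟩
      · intro z hz h
        exact ZFSet.notMem_empty z (SatV_mem2.1 h)
      · intro x hx h
        refine ⟨insert x x, ZFM.ins hx hx, SatV_and.2 ⟨SatV_mem2.2 (ZFSet.omega_succ (SatV_mem2.1 h)),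
          SatV_and.2 ⟨SatV_mem2.2 ?_, ?_⟩⟩⟩
        · change x ∈ (insert x x : Zs); simp
        · intro z hz
          refine SatV_iff.2 ?_; rw [SatV_or, SatV_mem2, SatV_mem2, SatV_eq2]
          change z ∈ (insert x x : Zs) ↔ z ∈ x ∨ z = x
          rw [ZFSet.mem_insert_iff, or_comm]
    · intro x hx h
      obtain ⟨y, hy, h⟩ := h
      have hyx : y ∈ x := SatV_mem2.1 h
      obtain ⟨m, hm1, hm2⟩ := ZFSet.regularity x (by rintro rfl; exact ZFSet.notMem_empty _ hyx)
      refine ⟨m, ZFM.tr hx hm1, SatV_and.2 ⟨SatV_mem2.2 hm1, ?_⟩⟩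
      intro z hz h1 h2
      have h1 : z ∈ m := SatV_mem2.1 h1
      have h2 : z ∈ x := SatV_mem2.1 h2
      have : z ∈ x ∩ m := ZFSet.mem_inter.2 ⟨h2, h1⟩
      rw [hm2] at this
      exact ZFSet.notMem_empty _ this
    · intro a ha h
      have h := SatV_and.1 h
      obtain ⟨c, hc, h'⟩ := hV.choice a ha (fun x hx => by
        obtain ⟨y, hy, h1⟩ := h.1 x (ZFM.tr ha hx) (SatV_mem2.2 hx)
        exact ⟨y, SatV_mem2.1 h1⟩) (fun x hx y hy hz => by
          obtain ⟨z, hz, hz'⟩ := hz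
          exact h.2 x (ZFM.tr ha hx) y (ZFM.tr ha hy) (SatV_and.2 ⟨SatV_mem2.2 hx, SatV_and.2
            ⟨SatV_mem2.2 hy, z, ZFM.tr (ZFM.tr ha hx) hz, SatV_and.2 ⟨SatV_mem2.2 hz,
              SatV_mem2.2 hz'⟩⟩⟩))
      refine ⟨c, hc, fun x hx hxa => ?_⟩
      obtain ⟨z, h1, h2, h3⟩ := h' x (SatV_mem2.1 hxa)
      refine ⟨z, ZFM.tr hx h2, SatV_and.2 ⟨SatV_mem2.2 h2, SatV_and.2 ⟨SatV_mem2.2 h1, ?_⟩⟩⟩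
      intro w hw h
      have h := SatV_and.1 h
      exact h3 w (SatV_mem2.1 h.2) (SatV_mem2.1 h.1)
  · refine allClose_of k _ _ fun w hw1 hw2 => ?_
    have hw : ∀ n, w n ∈ V := by
      intro n
      by_cases h : n < k
      · exact hw1 n h
      · have := hw2 (n - k)
        rw [Nat.sub_add_cancel (by omega)] at this
        rw [this]; exact hm.emp
    intro a ha
    have hd := hφ φ h1 h2
    have hd1 : DP V (fun v => SatV V φ (vcons (v 0) (vcons ∅ (vcons a w)))) := by
      have hd2 : DP V (fun v => SatV V φ (vcons (v 0) (fun n => v (n+1)))) := by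
        refine hd.congr fun v hv => ?_
        have : vcons (v 0) (fun n => v (n+1)) = v := by funext n; cases n <;> rfl
        rw [this]
      exact DP.fix (P := fun z v => SatV V φ (vcons z v)) hd2 (vcons ∅ (vcons a w))
        (vcons_mem hm.emp (vcons_mem ha hw))
    have hs := hm.sep a (fun z => SatV V φ (vcons z (vcons ∅ (vcons a w)))) ha hd1
    refine ⟨_, hs, fun z hz => ?_⟩
    refine SatV_iff.2 ?_; rw [SatV_and, SatV_mem2, SatV_mem2]
    have : ∀ s, (SatV V φ (vcons z (vcons s (vcons a w))) ↔
        SatV V φ (vcons z (vcons ∅ (vcons a w)))) := by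
      intro s
      refine sat_congr h1 fun n hn => ?_
      match n with
      | 0 => rfl
      | 1 => exact absurd hn h3
      | n+2 => rfl
    rw [this]
    rw [show (2:ℕ) = 1 + 1 from rfl, show (1:ℕ) = 0 + 1 from rfl]
    simp only [vcons_zero, vcons_succ, ZFSet.mem_sep]
  · refine allClose_of k _ _ fun w hw1 hw2 => ?_
    have hw : ∀ n, w n ∈ V := by
      intro n
      by_cases h : n < k
      · exact hw1 n h
      · have := hw2 (n - k)
        rw [Nat.sub_add_cancel (by omega)] at this
        rw [this]; exact hm.emp
    intro a ha
    have hd := hφ φ h1 h2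
    let R0 : Zs → Zs → Prop := fun x y => SatV V φ (vcons y (vcons x (vcons ∅ (vcons a w))))
    have hd1 : DP V (fun v => R0 (v 0) (v 1)) := by
      have hd2 : DP V (fun v => SatV V φ (vcons (v 1) (vcons (v 0) (fun n => v (n+2))))) := by
        have := hd.reindex (fun n => match n with | 0 => 1 | 1 => 0 | n+2 => n+2)
        refine this.congr fun v hv => ?_
        have : vcons (v 1) (vcons (v 0) (fun n => v (n+2))) = (fun n => v (match n with
          | 0 => 1 | 1 => 0 | n+2 => n+2)) := by
          funext n; match n with
          | 0 => rfl
          | 1 => rfl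
          | n+2 => rfl
        rw [this]
      exact DP.fix2 (P := fun x y v => SatV V φ (vcons y (vcons x v))) hd2 (vcons ∅ (vcons a w))
        (vcons_mem hm.emp (vcons_mem ha hw))
    have hd3 : DP V (fun v => R0 (v 1) (v 0)) :=
      hd1.reindex (fun n => match n with | 0 => 1 | _ => 0)
    have i1 : DP V (fun v => ∃ y, y ∈ V ∧ R0 (v 0) y) := inferInstance
    have i2 : DP V (fun v => (∃ y, y ∈ V ∧ R0 (v 0) y) → R0 (v 0) (v 1)) := by
      have : DP V (fun v => ∃ y, y ∈ V ∧ R0 (v 0) y) := i1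
      exact DP.imp
    obtain ⟨b, hb, h⟩ := hm.coll a (fun x y => (∃ y, y ∈ V ∧ R0 x y) → R0 x y) ha i2 (by
      intro x hx
      by_cases h : ∃ y, y ∈ V ∧ R0 x y
      · obtain ⟨y, hy, h⟩ := h; exact ⟨y, hy, fun _ => h⟩
      · exact ⟨∅, hm.emp, fun h' => absurd h' h⟩)
    refine ⟨b, hb, fun x hx hxa hex => ?_⟩
    have hxa : x ∈ a := SatV_mem2.1 hxa
    obtain ⟨y, hy, hxy⟩ := hex
    have : ∀ s y, (SatV V φ (vcons y (vcons x (vcons s (vcons a w)))) ↔ R0 x y) := by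
      intro s y
      refine sat_congr h1 fun n hn => ?_
      match n with
      | 0 => rfl
      | 1 => rfl
      | 2 => exact absurd hn h3
      | n+3 => rfl
    obtain ⟨y', hy', h'⟩ := h x hxa
    have h4 := h' ⟨y, hy, (this b y).1 hxy⟩
    exact ⟨y', ZFM.tr hb hy', SatV_and.2 ⟨SatV_mem2.2 hy', (this b y').2 h4⟩⟩

end SmallExt

end

noncomputable section
namespace SmallExt
set_option linter.unusedVariables false
attribute [local instance] Classical.propDecidable

/-! ## Part 4: tools inside a transitive model of ZF -/

section tools
variable {V : Zs} [hV : ZFM V]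

def GoodRk (V E f : Zs) : Prop :=
  ∀ x, x ∈ V → ∀ a, a ∈ V → (opair x a ∈ f → ∀ y, y ∈ V → (opair x y ∈ E →
    ∃ b, b ∈ a ∧ opair y b ∈ f))

theorem mem_sU2_left {x y E : Zs} (h : opair x y ∈ E) : x ∈ ZFSet.sUnion (ZFSet.sUnion E) := by
  rw [ZFSet.mem_sUnion]
  refine ⟨{x}, ?_, by simp⟩
  rw [ZFSet.mem_sUnion]
  exact ⟨_, h, by simp [mem_opair_def]⟩

theorem mem_sU2_right {x y E : Zs} (h : opair x y ∈ E) : y ∈ ZFSet.sUnion (ZFSet.sUnion E) := by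
  rw [ZFSet.mem_sUnion]
  refine ⟨{x, y}, ?_, by simp⟩
  rw [ZFSet.mem_sUnion]
  exact ⟨_, h, by simp [mem_opair_def]⟩

theorem illf {E : Zs} (hE : E ∈ V) (s : ℕ → Zs) (hs : ∀ n, opair (s n) (s (n+1)) ∈ E) :
    ∃ B ∈ V, s 0 ∈ B ∧ ∀ x ∈ B, ∃ y ∈ B, opair x y ∈ E := by
  have iE := InV_of hE
  have dG : DP V (fun v => GoodRk V E (v 0)) := by unfold GoodRk; infer_instance
  have dG1 : DP V (fun v => GoodRk V E (v 1)) := dG.reindex (fun n => n + 1)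
  have dB : DP V (fun v => ¬ ∃ f, f ∈ V ∧ (GoodRk V E f ∧ ∃ a, a ∈ V ∧ opair (v 0) a ∈ f)) :=
    inferInstance
  have hD : ZFSet.sUnion (ZFSet.sUnion E) ∈ V := hV.union _ (hV.union _ hE)
  have hB := hV.sep _ (fun x => ¬ ∃ f, f ∈ V ∧ (GoodRk V E f ∧ ∃ a, a ∈ V ∧ opair x a ∈ f)) hD dB
  refine ⟨_, hB, ?_, ?_⟩
  · rw [ZFSet.mem_sep]
    refine ⟨mem_sU2_left (hs 0), ?_⟩
    rintro ⟨f, hf, hg, a, ha, hfa⟩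
    have key : ∀ a : Zs, ∀ n, opair (s n) a ∉ f := by
      intro a
      induction a using ZFSet.inductionOn with
      | _ a ih =>
        intro n hn
        have hn' := ZFM.tr hf hn
        obtain ⟨b, hb, h⟩ := hg _ (opair_mem_left hn') _ (opair_mem_right hn') hn (s (n+1))
          (ZFM.tr hD (mem_sU2_right (hs n))) (hs n)
        exact ih b hb _ h
    exact key a 0 hfa
  · intro x hx
    rw [ZFSet.mem_sep] at hx
    obtain ⟨hxD, hx⟩ := hx
    by_contra hcon
    apply hx
    have hxV := ZFM.tr hD hxD
    have ix := InV_of hxV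
    have hsucc : ∀ y, opair x y ∈ E → ∃ f, f ∈ V ∧ (GoodRk V E f ∧ ∃ a, a ∈ V ∧ opair y a ∈ f) := by
      intro y hy
      by_contra h
      exact hcon ⟨y, ZFSet.mem_sep.2 ⟨mem_sU2_right hy, h⟩, hy⟩
    have dR : DP V (fun v => opair x (v 0) ∈ E →
        (GoodRk V E (v 1) ∧ ∃ a, a ∈ V ∧ opair (v 0) a ∈ v 1)) := inferInstance
    obtain ⟨F, hF, hFF⟩ := hV.coll _ (fun y f => opair x y ∈ E →
        (GoodRk V E f ∧ ∃ a, a ∈ V ∧ opair y a ∈ f)) hD dR (by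
      intro y _
      by_cases h : opair x y ∈ E
      · obtain ⟨f, h1, h2⟩ := hsucc y h
        exact ⟨f, h1, fun _ => h2⟩
      · exact ⟨∅, hV.emp, fun h' => absurd h' h⟩)
    have hF1 := hV.sep F (fun f => GoodRk V E f) hF dG
    set F1 := ZFSet.sep (fun f => GoodRk V E f) F
    have hG := hV.union _ hF1
    set G := ZFSet.sUnion F1
    have hA := hV.union _ (hV.union _ hG)
    refine ⟨insert (opair x (ZFSet.sUnion (ZFSet.sUnion G))) G,
      ZFM.ins (ZFM.opair hxV hA) hG, ?_, _, hA, by simp⟩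
    intro u hu a ha hua y hy huy
    rw [ZFSet.mem_insert_iff] at hua
    rcases hua with h | h
    · obtain ⟨rfl, rfl⟩ := opair_inj.1 h
      obtain ⟨f, hf, hff⟩ := hFF y (mem_sU2_right huy)
      obtain ⟨h1, b, hb, h2⟩ := hff huy
      have : opair y b ∈ G := ZFSet.mem_sUnion.2 ⟨f, ZFSet.mem_sep.2 ⟨hf, h1⟩, h2⟩
      exact ⟨b, mem_sU2_right this, ZFSet.mem_insert_iff.2 (Or.inr this)⟩
    · obtain ⟨f, hf, hf2⟩ := ZFSet.mem_sUnion.1 h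
      obtain ⟨b, hb, h2⟩ := (ZFSet.mem_sep.1 hf).2 u hu a ha hf2 y hy huy
      exact ⟨b, hb, ZFSet.mem_insert_iff.2 (Or.inr (ZFSet.mem_sUnion.2 ⟨f, hf, h2⟩))⟩

/-- recursion on omega inside `V` -/
theorem omega_rec {F : Zs → Zs → Zs} [hF : DT V (fun v => F (v 0) (v 1))] {a : ℕ → Zs}
    (h0 : a 0 ∈ V) (hs : ∀ n, a (n+1) = F (natZ n) (a n)) :
    ∃ S ∈ V, ∀ q, q ∈ S ↔ ∃ n, q = opair (natZ n) (a n) := by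
  have ha : ∀ n, a n ∈ V := by
    intro n
    induction n with
    | zero => exact h0
    | succ n ih =>
      rw [hs]
      exact hF.mem (fun k => match k with | 0 => natZ n | _ => a n) (by
        intro k; match k with
        | 0 => exact ZFM.natZ n
        | k+1 => exact ih)
  have i0 := InV_of h0
  let Ap : Zs → Prop := fun h => ∀ m, m ∈ (ZFSet.omega : Zs) → ∀ z, z ∈ V → (opair m z ∈ h →
    ((m = ∅ ∧ z = a 0) ∨ ∃ m', m' ∈ (ZFSet.omega : Zs) ∧ ∃ z', z' ∈ V ∧ (m = insert m' m' ∧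
      z = F m' z' ∧ opair m' z' ∈ h)))
  have dF : DT V (fun v => F (v 1) (v 0)) := hF.reindex (fun n => match n with | 0 => 1 | _ => 0)
  have dF2 : DP V (fun v => v 2 = F (v 1) (v 0)) := DP.eq (f := fun v => v 2) (g := fun v => F (v 1) (v 0))
  have dAp : DP V (fun v => Ap (v 0)) := by
    simp only [Ap]; infer_instance
  have dAp2 : DP V (fun v => Ap (v 1)) := dAp.reindex (fun n => n + 1)
  have dAp0 : DP V (fun v => ∃ h, h ∈ V ∧ (opair (v 0) (v 1) ∈ h ∧ Ap h)) := inferInstance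
  have key : ∀ n y, (∃ h, h ∈ V ∧ (opair (natZ n) y ∈ h ∧ Ap h)) ↔ y = a n := by
    intro n y
    constructor
    · rintro ⟨h, hh, h1, h2⟩
      revert y
      induction n with
      | zero =>
        intro y h1
        have h1V := ZFM.tr hh h1
        rcases h2 _ (mem_omega.2 ⟨0, rfl⟩) y (opair_mem_right h1V) h1 with h3 | ⟨m, hm, z, hz, h3, _⟩
        · exact h3.2
        · exfalso
          have : m ∈ (∅ : Zs) := by
            have e : (∅ : Zs) = insert m m := h3
            rw [e]; simp
          simp at this
      | succ n ih =>
        intro y h1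
        have h1V := ZFM.tr hh h1
        rcases h2 _ (mem_omega.2 ⟨n+1, rfl⟩) y (opair_mem_right h1V) h1 with h3 | ⟨m, hm, z, hz, h3, h4, h5⟩
        · exfalso
          have : natZ n ∈ natZ (n+1) := by simp [natZ]
          rw [h3.1] at this; simp at this
        · obtain ⟨k, rfl⟩ := mem_omega.1 hm
          have : n = k := by
            have h6 : natZ (n+1) = natZ (k+1) := h3
            have := natZ_inj h6; omega
          subst this
          rw [h4, hs, ih z h5]
    · rintro rfl
      obtain ⟨h, hh, h1⟩ := ZFM.finite_mem (V := V)
        (s := (fun k => opair (natZ k) (a k)) '' Set.Iic n) ((Set.finite_Iic n).image _) (by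
          rintro _ ⟨k, _, rfl⟩; exact ZFM.opair (ZFM.natZ k) (ha k))
      refine ⟨h, hh, (h1 _).2 ⟨n, by simp, rfl⟩, ?_⟩
      intro m hm z hz hmz
      obtain ⟨k, hk, he⟩ := (h1 _).1 hmz
      obtain ⟨rfl, rfl⟩ := opair_inj.1 he
      match k, hk with
      | 0, _ => exact Or.inl ⟨rfl, rfl⟩
      | k+1, hk =>
        refine Or.inr ⟨natZ k, mem_omega.2 ⟨k, rfl⟩, a k, ha k, rfl, hs k, (h1 _).2 ⟨k, ?_, rfl⟩⟩
        simp at hk ⊢; omega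
  obtain ⟨b, hb, hbb⟩ := hV.coll _ (fun n y => ∃ h, h ∈ V ∧ (opair n y ∈ h ∧ Ap h)) hV.omega dAp0 (by
    intro n hn
    obtain ⟨n, rfl⟩ := mem_omega.1 hn
    exact ⟨a n, ha n, (key n _).2 rfl⟩)
  have dS : DP V (fun v => ∃ h, h ∈ V ∧ (v 0 ∈ h ∧ Ap h)) := inferInstance
  refine ⟨_, hV.sep _ (fun q => ∃ h, h ∈ V ∧ (q ∈ h ∧ Ap h)) (ZFM.prod hV.omega hb) dS, ?_⟩
  intro q
  rw [ZFSet.mem_sep, ZFSet.mem_prod]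
  constructor
  · rintro ⟨⟨n, hn, y, hy, rfl⟩, h⟩
    obtain ⟨n, rfl⟩ := mem_omega.1 hn
    exact ⟨n, by rw [← (key n y).1 h]; rfl⟩
  · rintro ⟨n, rfl⟩
    refine ⟨⟨natZ n, mem_omega.2 ⟨n, rfl⟩, a n, ?_, rfl⟩, (key n _).2 rfl⟩
    obtain ⟨y, hy, h⟩ := hbb (natZ n) (mem_omega.2 ⟨n, rfl⟩)
    rw [← (key n y).1 h]; exact hy

/-- union along an omega-recursion -/
theorem omega_rec_union {F : Zs → Zs → Zs} [hF : DT V (fun v => F (v 0) (v 1))] {a : ℕ → Zs}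
    (h0 : a 0 ∈ V) (hs : ∀ n, a (n+1) = F (natZ n) (a n)) :
    ∃ S ∈ V, ∀ q, q ∈ S ↔ ∃ n, q ∈ a n := by
  obtain ⟨S, hS, h⟩ := omega_rec h0 hs
  have iS := InV_of hS
  have dd : DP V (fun v => ∃ n, n ∈ V ∧ ∃ z, z ∈ V ∧ (opair n z ∈ S ∧ v 0 ∈ z)) := inferInstance
  refine ⟨_, hV.sep _ (fun y => ∃ n, n ∈ V ∧ ∃ z, z ∈ V ∧ (opair n z ∈ S ∧ y ∈ z))
    (hV.union _ (hV.union _ (hV.union _ hS))) dd, ?_⟩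
  intro q
  rw [ZFSet.mem_sep]
  constructor
  · rintro ⟨_, n, hn, z, hz, h1, h2⟩
    obtain ⟨k, hk⟩ := (h _).1 h1
    obtain ⟨rfl, rfl⟩ := opair_inj.1 hk
    exact ⟨k, h2⟩
  · rintro ⟨n, hn⟩
    have h1 := (h _).2 ⟨n, rfl⟩
    have h1V := ZFM.tr hS h1
    exact ⟨ZFSet.mem_sUnion.2 ⟨_, mem_sU2_right h1, hn⟩, _, opair_mem_left h1V, _,
      opair_mem_right h1V, h1, hn⟩

theorem trcl_mem {x : Zs} (hx : x ∈ V) : ∃ T ∈ V, IsTrclOf x T := by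
  let a : ℕ → Zs := fun n => Nat.rec x (fun _ y => ZFSet.sUnion y) n
  obtain ⟨S, hS, h⟩ := omega_rec_union (V := V) (F := fun _ y => ZFSet.sUnion y) (a := a) hx
    (fun n => rfl)
  refine ⟨S, hS, fun y hy => (h y).2 ⟨0, hy⟩, ?_, ?_⟩
  · intro y hy z hz
    obtain ⟨n, hn⟩ := (h y).1 hy
    exact (h z).2 ⟨n+1, ZFSet.mem_sUnion.2 ⟨y, hn, hz⟩⟩
  · intro u hu hut y hy
    obtain ⟨n, hn⟩ := (h y).1 hy
    clear hy
    induction n generalizing y with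
    | zero => exact hu hn
    | succ n ih =>
      obtain ⟨z, hz, hyz⟩ := ZFSet.mem_sUnion.1 hn
      exact hut z (ih hz) hyz

theorem finite_iff_inV {a : Zs} (ha : a ∈ V) : a.toSet.Finite ↔
    ∃ n, n ∈ (ZFSet.omega : Zs) ∧ ∃ h, h ∈ V ∧ ∀ x, x ∈ a → ∃ m, m ∈ n ∧ (opair x m ∈ h ∧
      ∀ x', x' ∈ a → (opair x' m ∈ h → x' = x)) := by
  constructor
  · intro hf
    have hc : ∃ (n : ℕ) (e : Zs → ℕ), (∀ x ∈ a, e x < n) ∧ Set.InjOn e a.toSet := by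
      have := hf.to_subtype
      obtain ⟨n, ⟨e⟩⟩ := Finite.exists_equiv_fin a.toSet
      refine ⟨n, fun x => if h : x ∈ a.toSet then (e ⟨x, h⟩ : ℕ) else 0, ?_, ?_⟩
      · intro x hx
        have hx' : x ∈ a.toSet := hx
        simp [hx']
      · intro x hx y hy h
        simp only [hx, hy, dif_pos] at h
        have := e.injective (Fin.ext h)
        simpa using this
    obtain ⟨n, e, h1, h2⟩ := hc
    obtain ⟨h, hh, hh2⟩ := ZFM.finite_mem (V := V)
        (s := (fun x => opair x (natZ (e x))) '' a.toSet) (hf.image _) (by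
          rintro _ ⟨k, hk, rfl⟩; exact ZFM.opair (ZFM.tr ha hk) (ZFM.natZ _))
    refine ⟨natZ n, mem_omega.2 ⟨n, rfl⟩, h, hh, fun x hx => ⟨natZ (e x),
      mem_natZ.2 ⟨_, h1 x hx, rfl⟩, (hh2 _).2 ⟨x, hx, rfl⟩, fun x' hx' hm => ?_⟩⟩
    obtain ⟨y, hy, he⟩ := (hh2 _).1 hm
    obtain ⟨rfl, he2⟩ := opair_inj.1 he
    exact h2 hy hx (natZ_inj he2)
  · rintro ⟨n, hn, h, hh, H⟩
    obtain ⟨n, rfl⟩ := mem_omega.1 hn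
    choose! f hf1 hf2 hf3 using H
    have hfin : (natZ n).toSet.Finite := by
      have : (natZ n).toSet = natZ '' Set.Iio n := by
        ext x
        constructor
        · intro hx
          obtain ⟨m, hm, rfl⟩ := mem_natZ.1 hx
          exact ⟨m, hm, rfl⟩
        · rintro ⟨m, hm, rfl⟩
          exact mem_natZ.2 ⟨m, hm, rfl⟩
      rw [this]; exact (Set.finite_Iio n).image _
    refine Set.Finite.of_injOn (f := f) (t := (natZ n).toSet) (fun x hx => hf1 x hx) ?_ hfin
    intro x hx y hy he
    exact hf3 y hy x hx (he ▸ hf2 x hx)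

instance (priority := 1400) DP.finite {f : (ℕ → Zs) → Zs} [hf : DT V f] :
    DP V (fun v => (f v).toSet.Finite) := by
  refine DP.subst1 (Q := fun a => a.toSet.Finite) ?_ hf
  have : DP V (fun v => ∃ n, n ∈ (ZFSet.omega : Zs) ∧ ∃ h, h ∈ V ∧ ∀ x, x ∈ v 0 → ∃ m, m ∈ n ∧
    (opair x m ∈ h ∧ ∀ x', x' ∈ v 0 → (opair x' m ∈ h → x' = x))) := inferInstance
  exact this.congr fun v hv => finite_iff_inV (hv 0)

theorem finite_sub_mem {p a : Zs} (ha : a ∈ V) (hp : p ⊆ a) (hf : p.toSet.Finite) : p ∈ V := by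
  obtain ⟨b, hb, h⟩ := ZFM.finite_mem (V := V) hf (fun x hx => ZFM.tr ha (hp hx))
  have : p = b := by ext x; exact (h x).symm
  rw [this]; exact hb

theorem ColSet_mem {lam : Zs} (h : lam ∈ V) : ColSet lam ∈ V := by
  have hP := ZFM.prod hV.omega h
  have d : DP V (fun v => (∀ q, q ∈ v 0 → ∃ a, a ∈ V ∧ ∃ b, b ∈ V ∧ q = opair a b) ∧
    (∀ a, a ∈ V → ∀ b, b ∈ V → ∀ b', b' ∈ V → (opair a b ∈ v 0 → opair a b' ∈ v 0 → b = b')) ∧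
    (v 0).toSet.Finite) := inferInstance
  have := hV.sep _ (fun p => (∀ q, q ∈ p → ∃ a, a ∈ V ∧ ∃ b, b ∈ V ∧ q = opair a b) ∧
    (∀ a, a ∈ V → ∀ b, b ∈ V → ∀ b', b' ∈ V → (opair a b ∈ p → opair a b' ∈ p → b = b')) ∧
    p.toSet.Finite) (powV_mem hP) d
  convert this using 1
  ext f
  rw [ColSet, ZFSet.mem_sep, ZFSet.mem_sep, ZFSet.mem_powerset, mem_powV]
  constructor
  · rintro ⟨h1, h2, h3, h4⟩
    have hfV := finite_sub_mem hP h1 h4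
    refine ⟨⟨h1, hfV⟩, ?_, fun a _ b _ b' _ => h3 a b b', h4⟩
    intro q hq
    obtain ⟨a, b, rfl⟩ := h2 q hq
    have := ZFM.tr hfV hq
    exact ⟨a, opair_mem_left this, b, opair_mem_right this, rfl⟩
  · rintro ⟨⟨h1, h2⟩, h3, h4, h5⟩
    refine ⟨h1, ?_, ?_, h5⟩
    · intro q hq
      obtain ⟨a, _, b, _, rfl⟩ := h3 q hq
      exact ⟨a, b, rfl⟩
    · intro a b b' hb hb'
      have k1 := ZFM.tr h2 hb
      have k2 := ZFM.tr h2 hb'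
      exact h4 a (opair_mem_left k1) b (opair_mem_right k1) b' (opair_mem_right k2) hb hb'

theorem supsetOrder_mem {p : Zs} (h : p ∈ V) : supsetOrder p ∈ V := by
  have i := InV_of h
  have d : DP V (fun v => ∃ a, a ∈ p ∧ ∃ b, b ∈ p ∧ v 0 = opair a b ∧ b ⊆ a) := inferInstance
  exact hV.sep _ _ (ZFM.prod h h) d

theorem ColForcing_mem {lam : Zs} (h : lam ∈ V) : ColForcing lam ∈ V :=
  ZFM.opair (ColSet_mem h) (supsetOrder_mem (ColSet_mem h))

/-- internal function application -/
def app (c x : Zs) : Zs :=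
  ZFSet.sUnion (ZFSet.sep (fun y => opair x y ∈ c) (ZFSet.sUnion (ZFSet.sUnion c)))

theorem app_eq {c x y : Zs} (h : opair x y ∈ c) (hu : ∀ z, opair x z ∈ c → z = y) :
    app c x = y := by
  have : ZFSet.sep (fun y => opair x y ∈ c) (ZFSet.sUnion (ZFSet.sUnion c)) = {y} := by
    ext z
    rw [ZFSet.mem_sep, ZFSet.mem_singleton]
    exact ⟨fun hz => hu z hz.2, fun hz => hz ▸ ⟨mem_sU2_right h, h⟩⟩
  rw [app, this, ZFSet.sUnion_singleton]

instance (priority := 1400) DT.app {f g : (ℕ → Zs) → Zs} [hf : DT V f] [hg : DT V g] :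
    DT V (fun v => app (f v) (g v)) := by
  refine DT.subst2 (F := fun a b => SmallExt.app a b) ?_ hf hg
  unfold SmallExt.app
  infer_instance

end tools

theorem choice_fun {V : Zs} [hV : ZFCM V] {R a : Zs} (hR : R ∈ V) (ha : a ∈ V)
    (h : ∀ x ∈ a, ∃ y, opair x y ∈ R) :
    ∃ c ∈ V, ∀ x ∈ a, opair x (app c x) ∈ R := by
  have hm : ZFM V := inferInstance
  have iR := InV_of hR
  have dF : DT V (fun v => ZFSet.sep (fun q => zfst q = v 0) R) := inferInstance
  obtain ⟨fam, hfam, hf⟩ := ZFM.repl (V := V) ha (F := fun x => ZFSet.sep (fun q => zfst q = x ∧ q = opair x (zsnd q)) R)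
  obtain ⟨c, hc, hcc⟩ := hV.choice fam hfam (by
    intro x hx
    obtain ⟨u, hu, rfl⟩ := (hf x).1 hx
    obtain ⟨y, hy⟩ := h u hu
    exact ⟨opair u y, ZFSet.mem_sep.2 ⟨hy, zfst_opair _ _, by rw [zsnd_opair]⟩⟩) (by
    rintro x hx y hy ⟨z, hzx, hzy⟩
    obtain ⟨u, hu, rfl⟩ := (hf x).1 hx
    obtain ⟨w, hw, rfl⟩ := (hf y).1 hy
    have h1 := (ZFSet.mem_sep.1 hzx).2.1
    have h2 := (ZFSet.mem_sep.1 hzy).2.1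
    rw [← h1, ← h2])
  have ic := InV_of hc
  have hcR := hm.sep R (fun q => q ∈ c) hR inferInstance
  refine ⟨_, hcR, ?_⟩
  intro x hx
  obtain ⟨z, hz1, hz2, hz3⟩ := hcc _ ((hf _).2 ⟨x, hx, rfl⟩)
  obtain ⟨hzR, _, hz4⟩ := ZFSet.mem_sep.1 hz2
  have : app (ZFSet.sep (fun q => q ∈ c) R) x = zsnd z := by
    refine app_eq (ZFSet.mem_sep.2 ⟨hz4 ▸ hzR, hz4 ▸ hz1⟩) ?_
    intro y hy
    obtain ⟨h1, h2⟩ := ZFSet.mem_sep.1 hy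
    have := hz3 _ h2 (ZFSet.mem_sep.2 ⟨h1, zfst_opair _ _, by rw [zsnd_opair]⟩)
    rw [← this, zsnd_opair]
  rw [this, ← hz4]; exact hzR

end SmallExt

end

noncomputable section
namespace SmallExt
set_option linter.unusedVariables false
attribute [local instance] Classical.propDecidable

/-! ## Part 5: well-ordering theorem inside a model of ZFC -/

theorem zermelo {V : Zs} [hV : ZFCM V] {N : Zs} (hN : N ∈ V) : ∃ L ∈ V,
    (∀ x ∈ N, ∀ y ∈ N, x ≠ y → opair x y ∈ L ∨ opair y x ∈ L) ∧
    ∀ Z : Set Zs, (∀ z ∈ Z, z ∈ N) → Z.Nonempty → ∃ z ∈ Z, ∀ w ∈ Z, opair w z ∉ L := by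
  have hm : ZFM V := inferInstance
  have iN := InV_of hN
  have hPN := powV_mem hN
  have iP := InV_of hPN
  -- choice function
  have hR : ZFSet.sep (fun q => zsnd q ∈ zfst q) (ZFSet.prod (powV V N) N) ∈ V :=
    hm.sep _ _ (ZFM.prod hPN hN) inferInstance
  have ha : ZFSet.sep (fun Y => ∃ y, y ∈ Y ∧ True) (powV V N) ∈ V :=
    hm.sep _ _ hPN inferInstance
  obtain ⟨c, hc, hcc⟩ := choice_fun hR ha (by
    intro Y hY
    obtain ⟨hY, y, hy, _⟩ := ZFSet.mem_sep.1 hY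
    refine ⟨y, ZFSet.mem_sep.2 ⟨?_, by rw [zsnd_opair, zfst_opair]; exact hy⟩⟩
    exact ZFSet.pair_mem_prod.2 ⟨hY, (mem_powV.1 hY).1 hy⟩)
  have hγ : ∀ Y ∈ powV V N, ∀ y ∈ Y, app c Y ∈ Y := by
    intro Y hY y hy
    have := (ZFSet.mem_sep.1 (hcc Y (ZFSet.mem_sep.2 ⟨hY, y, hy, trivial⟩))).2
    rwa [zsnd_opair, zfst_opair] at this
  have ic := InV_of hc
  let F : Zs → Zs := fun Y => ZFSet.sep (fun z => ¬ z = app c Y) Y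
  have dF : DT V (fun v => F (v 0)) := by
    simp only [F]; infer_instance
  let I : Zs → Zs := fun Y => ZFSet.sep (fun z => ∀ u, u ∈ Y → z ∈ u) N
  have dI : DT V (fun v => I (v 0)) := by simp only [I]; infer_instance
  have mF : ∀ Y z, z ∈ F Y ↔ z ∈ Y ∧ z ≠ app c Y := fun Y z => ZFSet.mem_sep
  have mI : ∀ Y z, z ∈ I Y ↔ z ∈ N ∧ ∀ u, u ∈ Y → z ∈ u := fun Y z => ZFSet.mem_sep
  let Tow : Zs → Prop := fun T => (∀ Y, Y ∈ T → F Y ∈ T) ∧ ∀ Y, Y ∈ V → (Y ⊆ T → I Y ∈ T)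
  have dTow : DP V (fun v => Tow (v 0)) := by simp only [Tow, F, I]; infer_instance
  have dFF : DP V (fun v => ∀ T, T ∈ V → (Tow T → v 0 ∈ T)) := inferInstance
  have hFF := hm.sep _ (fun Y => ∀ T, T ∈ V → (Tow T → Y ∈ T)) hPN dFF
  set FF := ZFSet.sep (fun Y => ∀ T, T ∈ V → (Tow T → Y ∈ T)) (powV V N) with hFFdef
  have iFF := InV_of hFF
  have mFF : ∀ Y, Y ∈ FF ↔ Y ∈ powV V N ∧ ∀ T, T ∈ V → (Tow T → Y ∈ T) := fun Y => ZFSet.mem_sep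
  have dF' : ∀ Y ∈ V, F Y ∈ V := fun Y hY => dF.mem (fun _ => Y) (fun _ => hY)
  have dI' : ∀ Y ∈ V, I Y ∈ V := fun Y hY => dI.mem (fun _ => Y) (fun _ => hY)
  have FFF : ∀ Y ∈ FF, F Y ∈ FF := by
    intro Y hY
    obtain ⟨h1, h2⟩ := (mFF Y).1 hY
    obtain ⟨h3, h4⟩ := mem_powV.1 h1
    refine (mFF _).2 ⟨mem_powV.2 ⟨fun z hz => h3 ((mF _ _).1 hz).1, dF' Y h4⟩,
      fun T hT ht => ht.1 _ (h2 T hT ht)⟩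
  have FFI : ∀ Y ∈ V, Y ⊆ FF → I Y ∈ FF := by
    intro Y hY hs
    refine (mFF _).2 ⟨mem_powV.2 ⟨fun z hz => ((mI _ _).1 hz).1, dI' Y hY⟩, fun T hT ht =>
      ht.2 _ hY fun u hu => ((mFF u).1 (hs hu)).2 T hT ht⟩
  have ind : ∀ P : Zs → Prop, DP V (fun v => P (v 0)) → (∀ Y ∈ FF, P Y → P (F Y)) →
      (∀ Y ∈ V, Y ⊆ FF → (∀ u ∈ Y, P u) → P (I Y)) → ∀ Y ∈ FF, P Y := by
    intro P dP h1 h2 Y hY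
    have hT := hm.sep FF P hFF dP
    have := ((mFF Y).1 hY).2 _ hT ⟨fun Z hZ => ?_, fun Z hZ hs => ?_⟩
    · exact (ZFSet.mem_sep.1 this).2
    · obtain ⟨k1, k2⟩ := ZFSet.mem_sep.1 hZ
      exact ZFSet.mem_sep.2 ⟨FFF Z k1, h1 Z k1 k2⟩
    · have k1 : Z ⊆ FF := fun u hu => (ZFSet.mem_sep.1 (hs hu)).1
      exact ZFSet.mem_sep.2 ⟨FFI Z hZ k1, h2 Z hZ k1 fun u hu => (ZFSet.mem_sep.1 (hs hu)).2⟩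
  have cmp1 : ∀ C ∈ FF, (∀ Y, Y ∈ FF → Y ⊆ C ∨ C ⊆ Y) → ∀ Y ∈ FF, Y ⊆ F C ∨ C ⊆ Y := by
    intro C hC hcomp
    have iC := InV_of (ZFM.tr hFF hC)
    have iFC := InV_of (dF' _ (ZFM.tr hFF hC))
    refine ind (fun Y => Y ⊆ F C ∨ C ⊆ Y) inferInstance ?_ ?_
    · rintro Y hY (h | h)
      · exact Or.inl fun z hz => h ((mF _ _).1 hz).1
      · by_cases he : Y ⊆ C
        · have : Y = C := by ext z; exact ⟨fun hz => he hz, fun hz => h hz⟩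
          exact Or.inl (by rw [this])
        · refine (hcomp _ (FFF Y hY)).elim (fun h1 => Or.inr ?_) Or.inr
          intro z hz
          refine (mF _ _).2 ⟨h hz, fun e => he fun w hw => ?_⟩
          by_cases hwe : w = app c Y
          · rw [hwe, ← e]; exact hz
          · exact h1 ((mF _ _).2 ⟨hw, hwe⟩)
    · intro Y hY hs hP
      by_cases h : ∃ u ∈ Y, u ⊆ F C
      · obtain ⟨u, hu, h⟩ := h
        exact Or.inl fun z hz => h (((mI _ _).1 hz).2 u hu)
      · refine Or.inr fun z hz => (mI _ _).2 ⟨?_, fun u hu => ?_⟩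
        · exact (mem_powV.1 ((mFF C).1 hC).1).1 hz
        · rcases hP u hu with h1 | h1
          · exact absurd ⟨u, hu, h1⟩ h
          · exact h1 hz
  have comp : ∀ C ∈ FF, ∀ Y, Y ∈ FF → Y ⊆ C ∨ C ⊆ Y := by
    refine ind (fun C => ∀ Y, Y ∈ FF → Y ⊆ C ∨ C ⊆ Y) inferInstance ?_ ?_
    · intro C hC h Y hY
      rcases cmp1 C hC h Y hY with h1 | h1
      · exact Or.inl h1
      · exact Or.inr fun z hz => h1 ((mF _ _).1 hz).1
    · intro Y hY hs hP Z hZ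
      by_cases h : ∃ u ∈ Y, u ⊆ Z
      · obtain ⟨u, hu, h⟩ := h
        exact Or.inr fun z hz => h (((mI _ _).1 hz).2 u hu)
      · refine Or.inl fun z hz => (mI _ _).2 ⟨?_, fun u hu => ?_⟩
        · exact (mem_powV.1 ((mFF Z).1 hZ).1).1 hz
        · rcases hP u hu Z hZ with h1 | h1
          · exact h1 hz
          · exact absurd ⟨u, hu, h1⟩ h
  have cmp2 : ∀ C ∈ FF, ∀ Y ∈ FF, Y ⊆ F C ∨ C ⊆ Y := fun C hC => cmp1 C hC (comp C hC)
  -- least elements of internal subsets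
  have least : ∀ Z ∈ V, Z ⊆ N → (∃ z, z ∈ Z) → ∃ z ∈ Z, ∀ w ∈ Z, ∀ G ∈ FF, z ∈ G → w ∈ G := by
    intro Z hZ hZN ⟨z0, hz0⟩
    have iZ := InV_of hZ
    have hY := hm.sep FF (fun Y => Z ⊆ Y) hFF inferInstance
    have hG := FFI _ hY (fun u hu => (ZFSet.mem_sep.1 hu).1)
    set G := I (ZFSet.sep (fun Y => Z ⊆ Y) FF)
    have hZG : Z ⊆ G := fun z hz => (mI _ _).2 ⟨hZN hz, fun u hu => (ZFSet.mem_sep.1 hu).2 hz⟩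
    have hGl : ∀ G' ∈ FF, Z ⊆ G' → G ⊆ G' := fun G' h1 h2 z hz =>
      ((mI _ _).1 hz).2 G' (ZFSet.mem_sep.2 ⟨h1, h2⟩)
    have hγG := hγ G ((mFF G).1 hG).1 z0 (hZG hz0)
    refine ⟨app c G, ?_, ?_⟩
    · by_contra hn
      have : Z ⊆ F G := fun z hz => (mF _ _).2 ⟨hZG hz, fun e => hn (e ▸ hz)⟩
      exact ((mF _ _).1 (hGl _ (FFF G hG) this hγG)).2 rfl
    · intro w hw G' hG' hz
      rcases cmp2 G hG G' hG' with h | h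
      · exact absurd rfl ((mF _ _).1 (h hz)).2
      · exact h (hZG hw)
  have sepr : ∀ x ∈ N, ∀ y ∈ N, (∀ G ∈ FF, x ∈ G → y ∈ G) → (∀ G ∈ FF, y ∈ G → x ∈ G) → x = y := by
    intro x hx y hy h1 h2
    have hxV := ZFM.tr hN hx
    have ix := InV_of hxV
    have hY := hm.sep FF (fun Y => x ∈ Y) hFF inferInstance
    have hG := FFI _ hY (fun u hu => (ZFSet.mem_sep.1 hu).1)
    set G := I (ZFSet.sep (fun Y => x ∈ Y) FF)
    have hxG : x ∈ G := (mI _ _).2 ⟨hx, fun u hu => (ZFSet.mem_sep.1 hu).2⟩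
    have hGl : ∀ G' ∈ FF, x ∈ G' → G ⊆ G' := fun G' h1 h2 z hz =>
      ((mI _ _).1 hz).2 G' (ZFSet.mem_sep.2 ⟨h1, h2⟩)
    have hγG := hγ G ((mFF G).1 hG).1 x hxG
    have e1 : x = app c G := by
      by_contra hn
      have := hGl _ (FFF G hG) ((mF _ _).2 ⟨hxG, hn⟩) hγG
      exact ((mF _ _).1 this).2 rfl
    have e2 : y = app c G := by
      by_contra hn
      have := hGl _ (FFF G hG) (h2 _ (FFF G hG) ((mF _ _).2 ⟨h1 _ hG hxG, hn⟩)) hγG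
      exact ((mF _ _).1 this).2 rfl
    rw [e1, e2]
  -- the order
  have hL := hm.sep (ZFSet.prod N N) (fun q => ¬ zfst q = zsnd q ∧
    ∀ G, G ∈ FF → (zfst q ∈ G → zsnd q ∈ G)) (ZFM.prod hN hN) inferInstance
  refine ⟨_, hL, ?_, ?_⟩
  · intro x hx y hy hne
    simp only [ZFSet.mem_sep, zfst_opair, zsnd_opair]
    obtain ⟨z, hz, h⟩ := least {x, y} (hm.pair x (ZFM.tr hN hx) y (ZFM.tr hN hy))
      (fun z hz => by rcases ZFSet.mem_pair.1 hz with rfl | rfl <;> assumption) ⟨x, by simp⟩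
    rcases ZFSet.mem_pair.1 hz with rfl | rfl
    · exact Or.inl ⟨ZFSet.pair_mem_prod.2 ⟨hx, hy⟩, hne, h y (by simp)⟩
    · exact Or.inr ⟨ZFSet.pair_mem_prod.2 ⟨hy, hx⟩, fun e => hne e.symm, h x (by simp)⟩
  · intro Z hZ hne
    by_contra hcon
    push Not at hcon
    obtain ⟨z0, hz0⟩ := hne
    choose! nx h1 h2 using hcon
    let s : ℕ → Zs := fun n => nx^[n] z0
    have hsZ : ∀ n, s n ∈ Z := by
      intro n
      induction n with
      | zero => exact hz0
      | succ n ih => simp only [s, Function.iterate_succ_apply']; exact h1 _ ih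
    have hE := hm.sep (ZFSet.prod N N) (fun q => ¬ zsnd q = zfst q ∧
      ∀ G, G ∈ FF → (zsnd q ∈ G → zfst q ∈ G)) (ZFM.prod hN hN) inferInstance
    obtain ⟨B, hB, hB0, hBB⟩ := illf hE s (by
      intro n
      have := h2 _ (hsZ n)
      simp only [ZFSet.mem_sep, zfst_opair, zsnd_opair] at this ⊢
      simp only [s, Function.iterate_succ_apply'] at this ⊢
      exact ⟨ZFSet.pair_mem_prod.2 (ZFSet.pair_mem_prod.1 this.1).symm, this.2⟩)
    simp only [ZFSet.mem_sep, zfst_opair, zsnd_opair] at hBB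
    have hBN : B ⊆ N := fun x hx => by
      obtain ⟨y, _, h, _⟩ := hBB x hx
      exact (ZFSet.pair_mem_prod.1 h).1
    obtain ⟨z, hz, h⟩ := least B hB hBN ⟨_, hB0⟩
    obtain ⟨y, hy, _, hne, hyz⟩ := hBB z hz
    exact hne (sepr y (hBN hy) z (hBN hz) hyz (h y hy))

end SmallExt

end

noncomputable section
namespace SmallExt
set_option linter.unusedVariables false
attribute [local instance] Classical.propDecidable

/-! ## Part 6: names, valuation, forcing equality -/

/-- `g` is generic over `V` for the forcing `(P, ⊇)`. -/
structure Gen (V P g : Zs) : Prop where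
  PV : P ∈ V
  sub : ∀ p ∈ g, p ∈ P
  up : ∀ p ∈ g, ∀ q ∈ P, q ⊆ p → q ∈ g
  dir : ∀ p ∈ g, ∀ q ∈ g, ∃ r ∈ g, p ⊆ r ∧ q ⊆ r
  ne : ∃ p, p ∈ g
  gen : ∀ D : Zs → Prop, DP V (fun v => D (v 0)) → (∀ p ∈ P, ∃ q ∈ P, p ⊆ q ∧ D q) → ∃ q ∈ g, D q

theorem Gen.below {V P g : Zs} [hV : ZFM V] (G : Gen V P g) {p : Zs} (hp : p ∈ g)
    {D : Zs → Prop} (hD : DP V (fun v => D (v 0)))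
    (h : ∀ q ∈ P, p ⊆ q → ∃ r ∈ P, q ⊆ r ∧ D r) : ∃ r ∈ g, p ⊆ r ∧ D r := by
  have hpP := G.sub p hp
  have iP := InV_of G.PV
  have ip := InV_of (ZFM.tr G.PV hpP)
  obtain ⟨q, hq, h1⟩ := G.gen (fun q => (p ⊆ q ∧ D q) ∨ ∀ r, r ∈ P → (p ⊆ r → ¬ q ⊆ r))
    inferInstance (by
      intro q hq
      by_cases hc : ∃ r, r ∈ P ∧ p ⊆ r ∧ q ⊆ r
      · obtain ⟨r, hr, h1, h2⟩ := hc
        obtain ⟨r', hr', h3, h4⟩ := h r hr h1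
        exact ⟨r', hr', fun z hz => h3 (h2 hz), Or.inl ⟨fun z hz => h3 (h1 hz), h4⟩⟩
      · exact ⟨q, hq, fun z hz => hz, Or.inr fun r hr h1 h2 => hc ⟨r, hr, h1, h2⟩⟩)
  rcases h1 with h1 | h1
  · exact ⟨q, hq, h1⟩
  · obtain ⟨r, hr, h2, h3⟩ := G.dir p hp q hq
    exact absurd h3 (h1 r (G.sub r hr) h2)

theorem Gen.dec {V P g : Zs} [hV : ZFM V] (G : Gen V P g)
    {D : Zs → Prop} (hD : DP V (fun v => D (v 0))) :
    (∃ p ∈ g, D p) ∨ ∃ p ∈ g, ∀ q, q ∈ P → (p ⊆ q → ¬ D q) := by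
  have iP := InV_of G.PV
  have hD1 : DP V (fun v => D (v 1)) := hD.reindex (fun n => n + 1)
  obtain ⟨q, hq, h1⟩ := G.gen (fun q => D q ∨ ∀ r, r ∈ P → (q ⊆ r → ¬ D r)) inferInstance (by
    intro q hq
    by_cases hc : ∃ r, r ∈ P ∧ q ⊆ r ∧ D r
    · obtain ⟨r, hr, h1, h2⟩ := hc
      exact ⟨r, hr, h1, Or.inl h2⟩
    · exact ⟨q, hq, fun z hz => hz, Or.inr fun r hr h1 h2 => hc ⟨r, hr, h1, h2⟩⟩)
  rcases h1 with h1 | h1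
  · exact Or.inl ⟨q, hq, h1⟩
  · exact Or.inr ⟨q, hq, h1⟩

/-- `y` is in the name `x` with condition `s`. -/
def NE (P s y x : Zs) : Prop := s ∈ P ∧
  ((x = opair (natZ 0) (zsnd x) ∧ y = opair (natZ 0) (zsnd y) ∧ zsnd y ∈ zsnd x) ∨
   (x = opair (natZ 1) (zsnd x) ∧ opair y s ∈ zsnd x))

instance (priority := 1400) DP.NE {V P : Zs} [ZFM V] [InV V P] {f g h : (ℕ → Zs) → Zs}
    [DT V f] [DT V g] [DT V h] : DP V (fun v => NE P (f v) (g v) (h v)) := by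
  unfold SmallExt.NE; infer_instance

theorem NE_chk {P s y a : Zs} : NE P s y (opair (natZ 0) a) ↔ s ∈ P ∧ ∃ b ∈ a, y = opair (natZ 0) b := by
  unfold NE
  constructor
  · rintro ⟨h1, h2 | h2⟩
    · rw [zsnd_opair] at h2
      exact ⟨h1, _, h2.2.2, h2.2.1⟩
    · have := natZ_inj (opair_inj.1 h2.1).1
      omega
  · rintro ⟨h1, b, hb, rfl⟩
    refine ⟨h1, Or.inl ⟨by rw [zsnd_opair], by rw [zsnd_opair], by rw [zsnd_opair, zsnd_opair]; exact hb⟩⟩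

theorem NE_nm {P s y n : Zs} : NE P s y (opair (natZ 1) n) ↔ s ∈ P ∧ opair y s ∈ n := by
  unfold NE
  constructor
  · rintro ⟨h1, h2 | h2⟩
    · have := natZ_inj (opair_inj.1 h2.1).1
      omega
    · rw [zsnd_opair] at h2
      exact ⟨h1, h2.2⟩
  · rintro ⟨h1, h2⟩
    exact ⟨h1, Or.inr ⟨by rw [zsnd_opair], by rw [zsnd_opair]; exact h2⟩⟩

theorem NE_cases {P s y x : Zs} (h : NE P s y x) :
    (∃ a, x = opair (natZ 0) a) ∨ ∃ n, x = opair (natZ 1) n := by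
  rcases h.2 with h | h
  · exact Or.inl ⟨_, h.1⟩
  · exact Or.inr ⟨_, h.1⟩

theorem rank_opair_left {a b : Zs} : a.rank < (opair a b).rank := by
  have h1 : a ∈ ({a} : Zs) := by simp
  have h2 : ({a} : Zs) ∈ opair a b := by simp [mem_opair_def]
  exact (ZFSet.rank_lt_of_mem h1).trans (ZFSet.rank_lt_of_mem h2)

theorem rank_opair_right {a b : Zs} : b.rank < (opair a b).rank := by
  have h1 : b ∈ ({a, b} : Zs) := by simp
  have h2 : ({a, b} : Zs) ∈ opair a b := by simp [mem_opair_def]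
  exact (ZFSet.rank_lt_of_mem h1).trans (ZFSet.rank_lt_of_mem h2)

theorem NE_rank {P s y n : Zs} (h : NE P s y (opair (natZ 1) n)) :
    y.rank < (opair (natZ 1) n).rank :=
  rank_opair_left.trans ((ZFSet.rank_lt_of_mem (NE_nm.1 h).2).trans rank_opair_right)

def NR (P y x : Zs) : Prop := ∃ s, NE P s y x

theorem NR_wf (P : Zs) : WellFounded (NR P) := by
  have hchk : ∀ a, Acc (NR P) (opair (natZ 0) a) := by
    intro a
    induction a using ZFSet.inductionOn with
    | _ a ih =>
      constructor
      rintro y ⟨s, hs⟩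
      obtain ⟨_, b, hb, rfl⟩ := NE_chk.1 hs
      exact ih b hb
  refine ⟨fun x => ?_⟩
  induction hr : x.rank using WellFoundedLT.induction generalizing x with
  | _ o ih =>
    constructor
    rintro y ⟨s, hs⟩
    rcases NE_cases hs with ⟨a, rfl⟩ | ⟨n, rfl⟩
    · obtain ⟨_, b, hb, rfl⟩ := NE_chk.1 hs
      exact hchk b
    · exact ih _ (hr ▸ NE_rank hs) y rfl

theorem NE_mem {V P s y x : Zs} [hV : ZFM V] (hx : x ∈ V) (h : NE P s y x) : y ∈ V := by
  rcases NE_cases h with ⟨a, rfl⟩ | ⟨n, rfl⟩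
  · obtain ⟨_, b, hb, rfl⟩ := NE_chk.1 h
    exact ZFM.opair (ZFM.natZ 0) (ZFM.tr (opair_mem_right hx) hb)
  · exact opair_mem_left (ZFM.tr (opair_mem_right hx) (NE_nm.1 h).2)

theorem mem_zimage {f : Zs → Zs} {x y : Zs} : y ∈ zimage f x ↔ ∃ z ∈ x, f z = y := by
  unfold zimage
  exact @ZFSet.mem_image f (Classical.allZFSetDefinable _) x y

/-- the valuation of names by `g` -/
def val (V P g : Zs) : Zs → Zs :=
  WellFounded.fix (NR_wf P) fun x rec =>
    zimage (fun y => if h : NR P y x then rec y h else ∅)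
      (ZFSet.sep (fun y => ∃ s ∈ g, NE P s y x) V)

theorem mem_val' {V P g x z : Zs} : z ∈ val V P g x ↔
    ∃ y ∈ V, ∃ s ∈ g, NE P s y x ∧ z = val V P g y := by
  unfold val
  rw [WellFounded.fix_eq, mem_zimage]
  constructor
  · rintro ⟨y, hy, rfl⟩
    obtain ⟨h1, s, hs, h2⟩ := ZFSet.mem_sep.1 hy
    refine ⟨y, h1, s, hs, h2, ?_⟩
    rw [dif_pos ⟨s, h2⟩]
  · rintro ⟨y, hy, s, hs, h2, rfl⟩
    refine ⟨y, ZFSet.mem_sep.2 ⟨hy, s, hs, h2⟩, ?_⟩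
    rw [dif_pos ⟨s, h2⟩]

section val
variable {V P g : Zs} [hV : ZFM V]

theorem mem_val {x z : Zs} (hx : x ∈ V) : z ∈ val V P g x ↔
    ∃ y s, s ∈ g ∧ NE P s y x ∧ z = val V P g y := by
  rw [mem_val']
  constructor
  · rintro ⟨y, _, s, h⟩; exact ⟨y, s, h⟩
  · rintro ⟨y, s, h⟩; exact ⟨y, NE_mem hx h.2.1, s, h⟩

theorem val_chk (G : Gen V P g) {a : Zs} (ha : a ∈ V) : val V P g (opair (natZ 0) a) = a := by
  induction a using ZFSet.inductionOn with
  | _ a ih =>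
    ext z
    rw [mem_val (ZFM.opair (ZFM.natZ 0) ha)]
    constructor
    · rintro ⟨y, s, hs, h, rfl⟩
      obtain ⟨_, b, hb, rfl⟩ := NE_chk.1 h
      rw [ih b hb (ZFM.tr ha hb)]; exact hb
    · intro hz
      obtain ⟨p, hp⟩ := G.ne
      exact ⟨opair (natZ 0) z, p, hp, NE_chk.2 ⟨G.sub p hp, z, hz, rfl⟩,
        (ih z hz (ZFM.tr ha hz)).symm⟩

theorem mem_val_nm (G : Gen V P g) {n z : Zs} (hn : n ∈ V) : z ∈ val V P g (opair (natZ 1) n) ↔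
    ∃ y s, s ∈ g ∧ opair y s ∈ n ∧ z = val V P g y := by
  rw [mem_val (ZFM.opair (ZFM.natZ 1) hn)]
  constructor
  · rintro ⟨y, s, h1, h2, h3⟩; exact ⟨y, s, h1, (NE_nm.1 h2).2, h3⟩
  · rintro ⟨y, s, h1, h2, h3⟩; exact ⟨y, s, h1, NE_nm.2 ⟨G.sub s h1, h2⟩, h3⟩

/-- the set of potential elements of a name -/
def nd (P x : Zs) : Zs :=
  ZFSet.sep (fun y => ∃ s, s ∈ P ∧ NE P s y x)
    (ZFSet.prod {natZ 0} (ZFSet.sUnion (ZFSet.sUnion x)) ∪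
      ZFSet.sUnion (ZFSet.sUnion (ZFSet.sUnion (ZFSet.sUnion x))))

instance (priority := 1400) DT.nd [InV V P] {f : (ℕ → Zs) → Zs}
    [hf : DT V f] : DT V (fun v => nd P (f v)) := by
  refine DT.subst1 (F := fun a => SmallExt.nd P a) ?_ hf
  unfold SmallExt.nd; infer_instance

theorem mem_nd {y x : Zs} : y ∈ nd P x ↔ ∃ s, NE P s y x := by
  unfold nd
  rw [ZFSet.mem_sep]
  constructor
  · rintro ⟨_, s, _, h⟩; exact ⟨s, h⟩
  · rintro ⟨s, h⟩
    refine ⟨?_, s, h.1, h⟩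
    rw [ZFSet.mem_union]
    have hU : ∀ a b : Zs, b ∈ ZFSet.sUnion (opair a b) := fun a b =>
      ZFSet.mem_sUnion.2 ⟨{a, b}, by simp [mem_opair_def], by simp⟩
    rcases NE_cases h with ⟨a, rfl⟩ | ⟨n, rfl⟩
    · obtain ⟨_, b, hb, rfl⟩ := NE_chk.1 h
      refine Or.inl (ZFSet.pair_mem_prod.2 ⟨by simp, ZFSet.mem_sUnion.2 ⟨a, hU _ _, hb⟩⟩)
    · exact Or.inr (mem_sU2_left (ZFSet.mem_sUnion.2 ⟨n, hU _ _, (NE_nm.1 h).2⟩))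

theorem nd_mem (hP : P ∈ V) {x : Zs} (hx : x ∈ V) : nd P x ∈ V := by
  have := InV_of hP
  exact (inferInstance : DT V (fun v => nd P (v 0))).mem (fun _ => x) (fun _ => hx)

/-! ### forcing equality -/

/-- one half of the bisimulation condition -/
def BSc (V P R p x y : Zs) : Prop :=
  ∀ x', x' ∈ V → ∀ s, s ∈ P → (NE P s x' x → ∀ q, q ∈ P → (p ⊆ q → s ⊆ q →
    ∃ r, r ∈ P ∧ (q ⊆ r ∧ ∃ y', y' ∈ V ∧ ∃ s', s' ∈ P ∧ (NE P s' y' y ∧ s' ⊆ r ∧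
      opair r (opair x' y') ∈ R))))

def BS (V P R : Zs) : Prop :=
  ∀ p, p ∈ V → ∀ x, x ∈ V → ∀ y, y ∈ V → (opair p (opair x y) ∈ R →
    (opair p (opair y x) ∈ R ∧ BSc V P R p x y))

def FE (V P p x y : Zs) : Prop :=
  p ∈ P ∧ ∃ R, R ∈ V ∧ (BS V P R ∧ opair p (opair x y) ∈ R)

instance (priority := 1400) DP.BS [InV V P] {f : (ℕ → Zs) → Zs} [hf : DT V f] :
    DP V (fun v => BS V P (f v)) := by
  refine DP.subst1 (Q := fun R => SmallExt.BS V P R) ?_ hf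
  unfold SmallExt.BS SmallExt.BSc; infer_instance

instance (priority := 1400) DP.FE [InV V P] {f g h : (ℕ → Zs) → Zs} [hf : DT V f]
    [hg : DT V g] [hh : DT V h] :
    DP V (fun v => FE V P (f v) (g v) (h v)) := by
  refine DP.subst3 (Q := fun p x y => SmallExt.FE V P p x y) ?_ hf hg hh
  unfold SmallExt.FE; infer_instance

theorem sub_tr {a b c : Zs} (h1 : a ⊆ b) (h2 : b ⊆ c) : a ⊆ c := fun z hz => h2 (h1 hz)

theorem FE_symm {p x y : Zs} (hP : P ∈ V) (hx : x ∈ V) (hy : y ∈ V) (h : FE V P p x y) :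
    FE V P p y x := by
  obtain ⟨hp, R, hR, h1, h2⟩ := h
  exact ⟨hp, R, hR, h1, (h1 p (ZFM.tr hP hp) x hx y hy h2).1⟩

theorem BSc_mono {R R' p q x y : Zs} (hR : R ⊆ R') (hpq : p ⊆ q) (h : BSc V P R p x y) :
    BSc V P R' q x y := by
  intro x' hx' s hs hn q' hq' h1 h2
  obtain ⟨r, hr, h3, y', hy', s', hs', h4, h5, h6⟩ := h x' hx' s hs hn q' hq' (sub_tr hpq h1) h2
  exact ⟨r, hr, h3, y', hy', s', hs', h4, h5, hR h6⟩

theorem BS_insert {R p x y : Zs} (h : BS V P R) (h1 : BSc V P R p x y) (h2 : BSc V P R p y x) :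
    BS V P (insert (opair p (opair x y)) (insert (opair p (opair y x)) R)) := by
  have hR : R ⊆ insert (opair p (opair x y)) (insert (opair p (opair y x)) R) := by
    intro z hz; simp [hz]
  intro p' hp' x' hx' y' hy' hm
  rw [ZFSet.mem_insert_iff, ZFSet.mem_insert_iff] at hm
  rcases hm with e | e | hm
  · obtain ⟨rfl, e2⟩ := opair_inj.1 e
    obtain ⟨rfl, rfl⟩ := opair_inj.1 e2
    exact ⟨by simp, BSc_mono hR (fun z hz => hz) h1⟩
  · obtain ⟨rfl, e2⟩ := opair_inj.1 e
    obtain ⟨rfl, rfl⟩ := opair_inj.1 e2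
    exact ⟨by simp, BSc_mono hR (fun z hz => hz) h2⟩
  · obtain ⟨h3, h4⟩ := h p' hp' x' hx' y' hy' hm
    exact ⟨hR h3, BSc_mono hR (fun z hz => hz) h4⟩

theorem FE_mono {p q x y : Zs} (hP : P ∈ V) (hx : x ∈ V) (hy : y ∈ V) (h : FE V P p x y)
    (hq : q ∈ P) (hpq : p ⊆ q) : FE V P q x y := by
  obtain ⟨hp, R, hR, h1, h2⟩ := h
  have hqV := ZFM.tr hP hq
  have a1 := h1 p (ZFM.tr hP hp) x hx y hy h2
  have a2 := h1 p (ZFM.tr hP hp) y hy x hx a1.1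
  refine ⟨hq, _, ZFM.ins (ZFM.opair hqV (ZFM.opair hx hy)) (ZFM.ins (ZFM.opair hqV (ZFM.opair hy hx)) hR),
    BS_insert h1 (BSc_mono (fun z hz => hz) hpq a1.2) (BSc_mono (fun z hz => hz) hpq a2.2), by simp⟩

/-- the half condition with `FE` in place of the relation -/
def FEc (V P p x y : Zs) : Prop :=
  ∀ x', x' ∈ V → ∀ s, s ∈ P → (NE P s x' x → ∀ q, q ∈ P → (p ⊆ q → s ⊆ q →
    ∃ r, r ∈ P ∧ (q ⊆ r ∧ ∃ y', y' ∈ V ∧ ∃ s', s' ∈ P ∧ (NE P s' y' y ∧ s' ⊆ r ∧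
      FE V P r x' y'))))

theorem FEc_R (hP : P ∈ V) {p x y : Zs} (hx : x ∈ V) (hy : y ∈ V) (h : FEc V P p x y) :
    ∃ R ∈ V, BS V P R ∧ BSc V P R p x y := by
  have iP := InV_of hP
  have hI := ZFM.prod (nd_mem hP hx) hP
  have iy := InV_of hy
  let C : Zs → Zs → Prop := fun i R => BS V P R ∧
    ∃ r, r ∈ P ∧ (zsnd i ⊆ r ∧ ∃ y', y' ∈ V ∧ ∃ s', s' ∈ P ∧ (NE P s' y' y ∧ s' ⊆ r ∧
      opair r (opair (zfst i) y') ∈ R))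
  have dC : DP V (fun v => C (v 0) (v 1)) := by simp only [C]; infer_instance
  obtain ⟨b, hb, hbb⟩ := hV.coll _ (fun i R => (∃ R', R' ∈ V ∧ C i R') → C i R) hI (by
      have d2 : DP V (fun v => C (v 1) (v 0)) := dC.reindex (fun n => match n with | 0 => 1 | _ => 0)
      infer_instance) (by
    intro i _
    by_cases hc : ∃ R', R' ∈ V ∧ C i R'
    · obtain ⟨R, hR, h⟩ := hc
      exact ⟨R, hR, fun _ => h⟩
    · exact ⟨∅, hV.emp, fun h => absurd h hc⟩)
  have hb1 := hV.sep b (fun R => BS V P R) hb inferInstance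
  refine ⟨ZFSet.sUnion (ZFSet.sep (fun R => BS V P R) b), hV.union _ hb1, ?_, ?_⟩
  · intro p' hp' x' hx' y' hy' hm
    obtain ⟨R, hR, hm⟩ := ZFSet.mem_sUnion.1 hm
    have hs : R ⊆ ZFSet.sUnion (ZFSet.sep (fun R => BS V P R) b) := fun z hz =>
      ZFSet.mem_sUnion.2 ⟨R, hR, hz⟩
    obtain ⟨h1, h2⟩ := (ZFSet.mem_sep.1 hR).2 p' hp' x' hx' y' hy' hm
    exact ⟨hs h1, BSc_mono hs (fun z hz => hz) h2⟩
  · intro x' hx' s hs hn q hq h1 h2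
    obtain ⟨R, hR, hRR⟩ := hbb (opair x' q) (ZFSet.pair_mem_prod.2 ⟨mem_nd.2 ⟨s, hn⟩, hq⟩)
    obtain ⟨r, hr, h3, y', hy', s', hs', h4, h5, hr', R', hR', h6, h7⟩ := h x' hx' s hs hn q hq h1 h2
    have hC : C (opair x' q) R := hRR ⟨R', hR', h6, r, hr, by rw [zsnd_opair]; exact h3, y', hy', s',
      hs', h4, h5, by rw [zfst_opair]; exact h7⟩
    simp only [C, zfst_opair, zsnd_opair] at hC
    obtain ⟨k0, r, hr, k1, y', hy', s', hs', k2, k3, k4⟩ := hC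
    exact ⟨r, hr, k1, y', hy', s', hs', k2, k3, ZFSet.mem_sUnion.2 ⟨R, ZFSet.mem_sep.2 ⟨hR, k0⟩, k4⟩⟩

theorem FE_of (hP : P ∈ V) {p x y : Zs} (hp : p ∈ P) (hx : x ∈ V) (hy : y ∈ V)
    (h1 : FEc V P p x y) (h2 : FEc V P p y x) : FE V P p x y := by
  obtain ⟨R, hR, a1, a2⟩ := FEc_R hP hx hy h1
  obtain ⟨R', hR', b1, b2⟩ := FEc_R hP hy hx h2
  have hpV := ZFM.tr hP hp
  have s1 : R ⊆ R ∪ R' := fun z hz => ZFSet.mem_union.2 (Or.inl hz)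
  have s2 : R' ⊆ R ∪ R' := fun z hz => ZFSet.mem_union.2 (Or.inr hz)
  have hB : BS V P (R ∪ R') := by
    intro p' hp' x' hx' y' hy' hm
    rcases ZFSet.mem_union.1 hm with hm | hm
    · obtain ⟨h1, h2⟩ := a1 p' hp' x' hx' y' hy' hm
      exact ⟨s1 h1, BSc_mono s1 (fun z hz => hz) h2⟩
    · obtain ⟨h1, h2⟩ := b1 p' hp' x' hx' y' hy' hm
      exact ⟨s2 h1, BSc_mono s2 (fun z hz => hz) h2⟩
  exact ⟨hp, _, ZFM.ins (ZFM.opair hpV (ZFM.opair hx hy)) (ZFM.ins (ZFM.opair hpV (ZFM.opair hy hx))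
    (ZFM.un hR hR')), BS_insert hB (BSc_mono s1 (fun z hz => hz) a2)
      (BSc_mono s2 (fun z hz => hz) b2), by simp⟩

theorem FE_val (G : Gen V P g) {x y p : Zs} (hx : x ∈ V) (hy : y ∈ V) (hp : p ∈ g)
    (h : FE V P p x y) : val V P g x = val V P g y := by
  obtain ⟨_, R, hR, hB, h⟩ := h
  have iP := InV_of G.PV
  have iR := InV_of hR
  induction x using (NR_wf P).induction generalizing y p with
  | _ x ih =>
    have one : ∀ z, z ∈ val V P g x → z ∈ val V P g y := by
      intro z hz
      obtain ⟨x', s, hs, hn, rfl⟩ := (mem_val hx).1 hz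
      have hx' := NE_mem hx hn
      obtain ⟨q0, hq0, h1, h2⟩ := G.dir p hp s hs
      have i1 := InV_of hx'
      have i2 := InV_of hy
      obtain ⟨r, hr, _, y', hy', s', hs', h4, h5, h6⟩ := G.below hq0 (D := fun r =>
        ∃ y', y' ∈ V ∧ ∃ s', s' ∈ P ∧ (NE P s' y' y ∧ s' ⊆ r ∧ opair r (opair x' y') ∈ R))
        inferInstance (by
          intro q hq hqq
          obtain ⟨_, hc⟩ := hB p (ZFM.tr G.PV (G.sub p hp)) x hx y hy h
          exact hc x' hx' s (G.sub s hs) hn q hq (sub_tr h1 hqq) (sub_tr h2 hqq))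
      rw [ih x' ⟨s, hn⟩ hx' hy' hr (G.sub r hr) h6]
      exact (mem_val hy).2 ⟨y', s', G.up r hr s' hs' h5, h4, rfl⟩
    have two : ∀ z, z ∈ val V P g y → z ∈ val V P g x := by
      intro z hz
      obtain ⟨y', s, hs, hn, rfl⟩ := (mem_val hy).1 hz
      have hy' := NE_mem hy hn
      obtain ⟨q0, hq0, h1, h2⟩ := G.dir p hp s hs
      have i1 := InV_of hy'
      have i2 := InV_of hx
      obtain ⟨r, hr, _, x', hx', s', hs', h4, h5, h6⟩ := G.below hq0 (D := fun r =>
        ∃ x', x' ∈ V ∧ ∃ s', s' ∈ P ∧ (NE P s' x' x ∧ s' ⊆ r ∧ opair r (opair y' x') ∈ R))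
        inferInstance (by
          intro q hq hqq
          obtain ⟨h', _⟩ := hB p (ZFM.tr G.PV (G.sub p hp)) x hx y hy h
          obtain ⟨_, hc⟩ := hB p (ZFM.tr G.PV (G.sub p hp)) y hy x hx h'
          exact hc y' hy' s (G.sub s hs) hn q hq (sub_tr h1 hqq) (sub_tr h2 hqq))
      have h7 := (hB r (ZFM.tr G.PV (G.sub r hr)) y' hy' x' hx' h6).1
      rw [← ih x' ⟨s', h4⟩ hx' hy' hr (G.sub r hr) h7]
      exact (mem_val hx).2 ⟨x', s', G.up r hr s' hs' h5, h4, rfl⟩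
    ext z; exact ⟨one z, two z⟩

theorem val_FE (G : Gen V P g) {x y : Zs} (hx : x ∈ V) (hy : y ∈ V)
    (h : val V P g x = val V P g y) : ∃ p ∈ g, FE V P p x y := by
  have iP := InV_of G.PV
  induction x using (NR_wf P).induction generalizing y with
  | _ x ih =>
    have i1 := InV_of hx
    have i2 := InV_of hy
    rcases G.dec (D := fun p => FE V P p x y) inferInstance with h1 | ⟨p, hp, h1⟩
    · exact h1
    · exfalso
      let D1 : Zs → Zs → Zs → Prop := fun x y q =>
        ∃ x', x' ∈ V ∧ ∃ s, s ∈ P ∧ (NE P s x' x ∧ s ⊆ q ∧ ∀ r, r ∈ P → (q ⊆ r →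
          ∀ y', y' ∈ V → ∀ s', s' ∈ P → (NE P s' y' y → s' ⊆ r → ¬ FE V P r x' y')))
      have neg : ∀ x y q, ¬ FEc V P q x y → ∃ q', q' ∈ P ∧ q ⊆ q' ∧ D1 x y q' := by
        intro x y q hn
        unfold FEc at hn
        push Not at hn
        obtain ⟨x', hx', s, hs, hn, q', hq', h1, h2, h3⟩ := hn
        refine ⟨q', hq', h1, x', hx', s, hs, hn, h2, fun r hr hqr y' hy' s' hs' h4 h5 => ?_⟩
        exact h3 r hr hqr y' hy' s' hs' h4 h5
      have key : ∀ x y, x ∈ V → y ∈ V → val V P g x = val V P g y → (∀ x' y' : Zs, x' ∈ V → y' ∈ V →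
          NR P x' x → NR P y' y → val V P g x' = val V P g y' → ∃ p ∈ g, FE V P p x' y') →
          ∀ q ∈ g, ¬ D1 x y q := by
        rintro x y hx hy hv hh q hq ⟨x', hx', s, hs, hn, h2, h3⟩
        have : val V P g x' ∈ val V P g y := by
          rw [← hv]; exact (mem_val hx).2 ⟨x', s, G.up q hq s hs h2, hn, rfl⟩
        obtain ⟨y', s', hs', hn', he⟩ := (mem_val hy).1 this
        have hy' := NE_mem hy hn'
        obtain ⟨p', hp', hF⟩ := hh x' y' hx' hy' ⟨s, hn⟩ ⟨s', hn'⟩ he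
        obtain ⟨r, hr, k1, k2⟩ := G.dir q hq s' hs'
        obtain ⟨r2, hr2, k3, k4⟩ := G.dir r hr p' hp'
        exact h3 r2 (G.sub _ hr2) (sub_tr k1 k3) y' hy' s' (G.sub _ hs') hn' (sub_tr k2 k3)
          (FE_mono G.PV hx' hy' hF (G.sub _ hr2) k4)
      obtain ⟨q, hq, _, hqD⟩ := G.below hp (D := fun q => D1 x y q ∨ D1 y x q) (by
          simp only [D1]; infer_instance) (by
        intro q hq hpq
        have hnf := h1 q hq hpq
        by_cases c1 : FEc V P q x y
        · by_cases c2 : FEc V P q y x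
          · exact absurd (FE_of G.PV hq hx hy c1 c2) hnf
          · obtain ⟨q', a, b, c⟩ := neg _ _ _ c2
            exact ⟨q', a, b, Or.inr c⟩
        · obtain ⟨q', a, b, c⟩ := neg _ _ _ c1
          exact ⟨q', a, b, Or.inl c⟩)
      rcases hqD with hqD | hqD
      · exact key x y hx hy h (fun x' y' hx' hy' hn _ he => ih x' hn hx' hy' he) q hq hqD
      · refine key y x hy hx h.symm (fun y' x' hy' hx' _ hn he => ?_) q hq hqD
        obtain ⟨p, hp, hF⟩ := ih x' hn hx' hy' he.symm
        exact ⟨p, hp, FE_symm G.PV hx' hy' hF⟩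

end val

end SmallExt

end

noncomputable section
namespace SmallExt
set_option linter.unusedVariables false
set_option linter.unusedSectionVars false
attribute [local instance] Classical.propDecidable

/-! ## Part 7: forcing theorem -/

section forc
variable {V P g : Zs} [hV : ZFM V]

/-- The generic extension. -/
def VG (V P g : Zs) : Zs := zimage (val V P g) V

theorem mem_VG {z : Zs} : z ∈ VG V P g ↔ ∃ x ∈ V, val V P g x = z := mem_zimage

def FM (V P p x y : Zs) : Prop :=
  p ∈ P ∧ ∃ y', y' ∈ V ∧ ∃ s, s ∈ P ∧ (NE P s y' y ∧ s ⊆ p ∧ FE V P p x y')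

instance (priority := 1400) DP.FM [InV V P] {f g h : (ℕ → Zs) → Zs} [hf : DT V f]
    [hg : DT V g] [hh : DT V h] :
    DP V (fun v => FM V P (f v) (g v) (h v)) := by
  refine DP.subst3 (Q := fun p x y => SmallExt.FM V P p x y) ?_ hf hg hh
  unfold SmallExt.FM; infer_instance

theorem FM_mono {p q x y : Zs} (hP : P ∈ V) (hx : x ∈ V) (h : FM V P p x y)
    (hq : q ∈ P) (hpq : p ⊆ q) : FM V P q x y := by
  obtain ⟨hp, y', hy', s, hs, h1, h2, h3⟩ := h
  exact ⟨hq, y', hy', s, hs, h1, sub_tr h2 hpq, FE_mono hP hx hy' h3 hq hpq⟩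

theorem FM_truth (G : Gen V P g) {x y : Zs} (hx : x ∈ V) (hy : y ∈ V) :
    val V P g x ∈ val V P g y ↔ ∃ p ∈ g, FM V P p x y := by
  constructor
  · intro h
    obtain ⟨y', s, hs, hn, he⟩ := (mem_val hy).1 h
    have hy' := NE_mem hy hn
    obtain ⟨p, hp, hF⟩ := val_FE G hx hy' he
    obtain ⟨r, hr, h1, h2⟩ := G.dir p hp s hs
    exact ⟨r, hr, G.sub r hr, y', hy', s, G.sub s hs, hn, h2, FE_mono G.PV hx hy' hF (G.sub r hr) h1⟩
  · rintro ⟨p, hp, _, y', hy', s, hs, h1, h2, h3⟩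
    rw [FE_val G hx hy' hp h3]
    exact (mem_val hy).2 ⟨y', s, G.up p hp s hs h2, h1, rfl⟩

theorem FE_truth (G : Gen V P g) {x y : Zs} (hx : x ∈ V) (hy : y ∈ V) :
    val V P g x = val V P g y ↔ ∃ p ∈ g, FE V P p x y :=
  ⟨fun h => val_FE G hx hy h, fun ⟨p, hp, h⟩ => FE_val G hx hy hp h⟩

def FP (V P g : Zs) (Q : (ℕ → Zs) → Prop) : Prop :=
  ∃ F : Zs → (ℕ → Zs) → Prop, DP V (fun v => F (v 0) (fun n => v (n+1))) ∧
    (∀ p q x, (∀ n, x n ∈ V) → F p x → q ∈ P → p ⊆ q → F q x) ∧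
    ∀ x : ℕ → Zs, (∀ n, x n ∈ V) → (Q (fun n => val V P g (x n)) ↔ ∃ p ∈ g, F p x)

theorem FP.congr {Q Q' : (ℕ → Zs) → Prop} (h : FP V P g Q)
    (e : ∀ v : ℕ → Zs, (∀ n, v n ∈ VG V P g) → (Q' v ↔ Q v)) : FP V P g Q' := by
  obtain ⟨F, h1, h2, h3⟩ := h
  exact ⟨F, h1, h2, fun x hx => (e _ fun n => mem_VG.2 ⟨_, hx n, rfl⟩).trans (h3 x hx)⟩

theorem FP.not {Q : (ℕ → Zs) → Prop} (G : Gen V P g) (h : FP V P g Q) :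
    FP V P g (fun v => ¬ Q v) := by
  obtain ⟨F, h1, h2, h3⟩ := h
  have iP := InV_of G.PV
  have h1' : DP V (fun v => F (v 0) (fun n => v (n+2))) :=
    h1.reindex (fun n => match n with | 0 => 0 | n+1 => n+2)
  refine ⟨fun p x => ∀ q, q ∈ P → (p ⊆ q → ¬ F q x), inferInstance, ?_, ?_⟩
  · intro p q x hx h hq hpq r hr hqr
    exact h r hr (sub_tr hpq hqr)
  · intro x hx
    beta_reduce; rw [h3 x hx]
    constructor
    · intro h
      rcases G.dec (D := fun p => F p x) (h1.fix x hx) with h4 | h4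
      · exact absurd h4 h
      · exact h4
    · rintro ⟨p, hp, h⟩ ⟨q, hq, h'⟩
      obtain ⟨r, hr, h4, h5⟩ := G.dir p hp q hq
      exact h r (G.sub r hr) h4 (h2 q r x hx h' (G.sub r hr) h5)

theorem FP.or {Q Q' : (ℕ → Zs) → Prop} (h : FP V P g Q) (h' : FP V P g Q') :
    FP V P g (fun v => Q v ∨ Q' v) := by
  obtain ⟨F, h1, h2, h3⟩ := h
  obtain ⟨F', h1', h2', h3'⟩ := h'
  refine ⟨fun p x => F p x ∨ F' p x, inferInstance, ?_, ?_⟩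
  · rintro p q x hx (h | h) hq hpq
    · exact Or.inl (h2 p q x hx h hq hpq)
    · exact Or.inr (h2' p q x hx h hq hpq)
  · intro x hx
    beta_reduce; rw [h3 x hx, h3' x hx]
    constructor
    · rintro (⟨p, hp, h⟩ | ⟨p, hp, h⟩)
      · exact ⟨p, hp, Or.inl h⟩
      · exact ⟨p, hp, Or.inr h⟩
    · rintro ⟨p, hp, h | h⟩
      · exact Or.inl ⟨p, hp, h⟩
      · exact Or.inr ⟨p, hp, h⟩

theorem FP.ex {Q : (ℕ → Zs) → Prop} (h : FP V P g Q) :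
    FP V P g (fun v => ∃ z, z ∈ VG V P g ∧ Q (vcons z v)) := by
  obtain ⟨F, h1, h2, h3⟩ := h
  have h1' : DP V (fun v => F (v 1) (vcons (v 0) (fun n => v (n+2)))) := by
    have := h1.reindex (fun n => match n with | 0 => 1 | 1 => 0 | n+2 => n+2)
    refine this.congr fun v hv => ?_
    have e : (vcons (v 0) (fun n => v (n+2))) = (fun n => v (match n+1 with | 0 => 1 | 1 => 0 | n+2 => n+2)) := by
      funext n; cases n <;> rfl
    rw [e]
  have ev : ∀ (z : Zs) (x : ℕ → Zs), (fun n => val V P g (vcons z x n)) =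
      vcons (val V P g z) (fun n => val V P g (x n)) := by
    intro z x; funext n; cases n <;> rfl
  refine ⟨fun p x => ∃ n, n ∈ V ∧ F p (vcons n x), inferInstance, ?_, ?_⟩
  · rintro p q x hx ⟨n, hn, h⟩ hq hpq
    exact ⟨n, hn, h2 p q _ (vcons_mem hn hx) h hq hpq⟩
  · intro x hx
    constructor
    · rintro ⟨z, hz, h⟩
      obtain ⟨n, hn, rfl⟩ := mem_VG.1 hz
      rw [← ev, h3 _ (vcons_mem hn hx)] at h
      obtain ⟨p, hp, h⟩ := h
      exact ⟨p, hp, n, hn, h⟩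
    · rintro ⟨p, hp, n, hn, h⟩
      refine ⟨_, mem_VG.2 ⟨n, hn, rfl⟩, ?_⟩
      rw [← ev, h3 _ (vcons_mem hn hx)]
      exact ⟨p, hp, h⟩

theorem FP.term {u : Tm} (hu : u.noFunc) (hp : u.paramSet ⊆ {a | a ∈ VG V P g}) :
    ∃ f : (ℕ → Zs) → Zs, DT V f ∧ ∀ x : ℕ → Zs, (∀ n, x n ∈ V) →
      val V P g (f x) = u.eval fI0 (fun n => val V P g (x n)) := by
  cases u with
  | var n => exact ⟨fun v => v n, inferInstance, fun x hx => rfl⟩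
  | param a =>
    obtain ⟨m, hm, e⟩ := mem_VG.1 (show a ∈ VG V P g from hp (by simp [Tm.paramSet]))
    have := InV_of hm
    exact ⟨fun v => m, inferInstance, fun x hx => e⟩
  | func s n a => exact absurd hu (by simp [Tm.noFunc])

theorem FP.sat (G : Gen V P g) : ∀ (φ : Fm), φ.memOnly → φ.paramSet ⊆ {a | a ∈ VG V P g} →
    FP V P g (fun v => SatV (VG V P g) φ v) := by
  have iP := InV_of G.PV
  intro φ
  induction φ with
  | rel s n a =>
    rintro ⟨rfl, rfl, h3⟩ hp
    have hp' : ∀ i, (a i).paramSet ⊆ {a | a ∈ VG V P g} := fun i b hb => hp ⟨i, hb⟩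
    obtain ⟨f, hf, ef⟩ := FP.term (h3 0) (hp' 0)
    obtain ⟨f', hf', ef'⟩ := FP.term (h3 1) (hp' 1)
    have r1 := hf.reindex (fun n => n+1)
    have r2 := hf'.reindex (fun n => n+1)
    refine ⟨fun p x => FM V P p (f x) (f' x), inferInstance, ?_, ?_⟩
    · intro p q x hx h hq hpq
      exact FM_mono G.PV (hf.mem x hx) h hq hpq
    · intro x hx
      rw [← FM_truth G (hf.mem x hx) (hf'.mem x hx), ef x hx, ef' x hx]
      exact memRel_two _ _
  | eq t u =>
    rintro ⟨h1, h2⟩ hp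
    obtain ⟨f, hf, ef⟩ := FP.term h1 (fun b hb => hp (Or.inl hb))
    obtain ⟨f', hf', ef'⟩ := FP.term h2 (fun b hb => hp (Or.inr hb))
    have r1 := hf.reindex (fun n => n+1)
    have r2 := hf'.reindex (fun n => n+1)
    refine ⟨fun p x => FE V P p (f x) (f' x), inferInstance, ?_, ?_⟩
    · intro p q x hx h hq hpq
      exact FE_mono G.PV (hf.mem x hx) (hf'.mem x hx) h hq hpq
    · intro x hx
      rw [← FE_truth G (hf.mem x hx) (hf'.mem x hx), ef x hx, ef' x hx]
      exact Iff.rfl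
  | not f ih => intro h hp; exact (ih h hp).not G
  | imp f f' ih ih' =>
    intro h hp
    refine FP.congr (((ih h.1 fun b hb => hp (Or.inl hb)).not G).or
      (ih' h.2 fun b hb => hp (Or.inr hb))) fun v hv => ?_
    rw [SatV_imp]; tauto
  | all f ih =>
    intro h hp
    refine FP.congr ((((ih h hp).not G).ex).not G) fun v hv => ?_
    rw [SatV_all]; push Not; rfl
  | ex f ih => intro h hp; exact (ih h hp).ex

theorem FP.of (G : Gen V P g) {Q : (ℕ → Zs) → Prop} (h : DP (VG V P g) Q) : FP V P g Q := by
  obtain ⟨φ, h1, h2, h3⟩ := h.out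
  exact (FP.sat G φ h1 h2).congr fun v hv => (h3 v hv).symm

theorem FP2 (G : Gen V P g) {Q : Zs → Zs → Prop} (h : DP (VG V P g) (fun v => Q (v 0) (v 1))) :
    ∃ F : Zs → Zs → Zs → Prop, DP V (fun v => F (v 0) (v 1) (v 2)) ∧
    (∀ p q x y, x ∈ V → y ∈ V → F p x y → q ∈ P → p ⊆ q → F q x y) ∧
    ∀ x y : Zs, x ∈ V → y ∈ V → (Q (val V P g x) (val V P g y) ↔ ∃ p ∈ g, F p x y) := by
  obtain ⟨F, h1, h2, h3⟩ := FP.of G h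
  refine ⟨fun p x y => F p (vcons x fun _ => y), ?_, ?_, ?_⟩
  · have := h1.reindex (fun n => match n with | 0 => 0 | 1 => 1 | n+2 => 2)
    refine this.congr fun v hv => ?_
    have e : (vcons (v 1) (fun n => v 2)) = (fun n => v (match n+1 with | 0 => 0 | 1 => 1 | n+2 => 2)) := by
      funext n; cases n <;> rfl
    beta_reduce; rw [e]
  · intro p q x y hx hy h hq hpq
    exact h2 p q _ (vcons_mem hx fun _ => hy) h hq hpq
  · intro x y hx hy
    rw [← h3 _ (vcons_mem hx fun _ => hy)]
    rfl

theorem FP1 (G : Gen V P g) {Q : Zs → Prop} (h : DP (VG V P g) (fun v => Q (v 0))) :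
    ∃ F : Zs → Zs → Prop, DP V (fun v => F (v 0) (v 1)) ∧
    (∀ p q x, x ∈ V → F p x → q ∈ P → p ⊆ q → F q x) ∧
    ∀ x : Zs, x ∈ V → (Q (val V P g x) ↔ ∃ p ∈ g, F p x) := by
  obtain ⟨F, h1, h2, h3⟩ := FP2 G (Q := fun a b => Q a) h
  exact ⟨fun p x => F p x x, h1.reindex (fun n => match n with | 0 => 0 | _ => 1),
    fun p q x hx => h2 p q x x hx hx, fun x hx => h3 x x hx hx⟩

end forc

end SmallExt

end

noncomputable section
namespace SmallExt
set_option linter.unusedVariables false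
set_option linter.unusedSectionVars false
attribute [local instance] Classical.propDecidable

/-! ## Part 8: well-founded recursion inside a model -/

section wfrec
variable {V : Zs} [hV : ZFM V]

def RGood (pr : Zs → Zs) (K : Zs → Zs → Zs) (f : Zs) : Prop :=
  ∀ q, q ∈ f → (q = opair (zfst q) (zsnd q) ∧ (∀ y, y ∈ pr (zfst q) → ∃ q', q' ∈ f ∧ zfst q' = y) ∧
    zsnd q = K (zfst q) (ZFSet.sep (fun q' => zfst q' ∈ pr (zfst q)) f))

theorem wf_rec {pr : Zs → Zs} {K : Zs → Zs → Zs} {H : Zs → Zs}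
    (hpr : DT V (fun v => pr (v 0))) (hK : DT V (fun v => K (v 0) (v 1)))
    (wf : WellFounded (fun y x => y ∈ pr x))
    (hH : ∀ x f, x ∈ V → (∀ q, q ∈ f ↔ ∃ y ∈ pr x, q = opair y (H y)) → H x = K x f) :
    ∀ x ∈ V, H x ∈ V := by
  have prV : ∀ x ∈ V, pr x ∈ V := fun x hx => hpr.mem (fun _ => x) (fun _ => hx)
  have KV : ∀ x ∈ V, ∀ f ∈ V, K x f ∈ V := fun x hx f hf =>
    hK.mem (fun n => match n with | 0 => x | _ => f) (fun n => by match n with | 0 => exact hx | n+1 => exact hf)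
  have hG : DP V (fun v => RGood pr K (v 0)) := by
    unfold RGood
    have a1 : DT V (fun v => pr (zfst (v 0))) := DT.subst1 (F := pr) hpr inferInstance
    have a1' : DT V (fun v => pr (zfst (v 1))) := DT.subst1 (F := pr) hpr inferInstance
    have a2 : DT V (fun v => ZFSet.sep (fun q' => zfst q' ∈ pr (zfst (v 0))) (v 1)) := inferInstance
    have a3 : DT V (fun v => K (zfst (v 0)) (ZFSet.sep (fun q' => zfst q' ∈ pr (zfst (v 0))) (v 1))) :=
      DT.subst2 (F := K) hK inferInstance a2
    infer_instance
  have good1 : ∀ f ∈ V, RGood pr K f → ∀ x h, opair x h ∈ f → h = H x := by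
    intro f hf hg x
    induction x using wf.induction with
    | _ x ih =>
      intro h hm
      obtain ⟨_, h2, h3⟩ := hg _ hm
      rw [zfst_opair] at h2 h3
      rw [zsnd_opair] at h3
      rw [h3]
      refine (hH x _ (opair_mem_left (ZFM.tr hf hm)) fun q => ?_).symm
      rw [ZFSet.mem_sep]
      constructor
      · rintro ⟨h4, h5⟩
        refine ⟨zfst q, h5, ?_⟩
        have e := (hg q h4).1
        rw [← ih (zfst q) h5 (zsnd q) (by rw [← e]; exact h4)]; exact e
      · rintro ⟨y, hy, rfl⟩
        obtain ⟨q', hq', rfl⟩ := h2 y hy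
        have e := (hg q' hq').1
        rw [← ih (zfst q') hy (zsnd q') (by rw [← e]; exact hq'), ← e]
        exact ⟨hq', hy⟩
  have good2 : ∀ f ∈ V, (∀ q ∈ f, ∃ x, q = opair x (H x) ∧ ∀ y ∈ pr x, opair y (H y) ∈ f) → RGood pr K f := by
    intro f hf h q hq
    obtain ⟨x, rfl, h1⟩ := h q hq
    rw [zfst_opair, zsnd_opair]
    refine ⟨rfl, fun y hy => ⟨_, h1 y hy, zfst_opair _ _⟩, ?_⟩
    refine hH x _ (opair_mem_left (ZFM.tr hf hq)) fun q => ?_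
    rw [ZFSet.mem_sep]
    constructor
    · rintro ⟨h4, h5⟩
      obtain ⟨x', rfl, h6⟩ := h q h4
      rw [zfst_opair] at h5
      exact ⟨x', h5, rfl⟩
    · rintro ⟨y, hy, rfl⟩
      rw [zfst_opair]; exact ⟨h1 y hy, hy⟩
  have main : ∀ x ∈ V, ∃ f ∈ V, RGood pr K f ∧ opair x (H x) ∈ f := by
    intro x
    induction x using wf.induction with
    | _ x ih =>
      intro hx
      obtain ⟨b, hb, h1⟩ := hV.coll (pr x) (fun y f => RGood pr K f ∧ ∃ h, h ∈ V ∧ opair y h ∈ f) (prV x hx)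
        (by
          have : DP V (fun v => RGood pr K (v 1)) := hG.reindex (fun n => n+1)
          infer_instance)
        (by
          intro y hy
          obtain ⟨f, hf, h1, h2⟩ := ih y hy (ZFM.tr (prV x hx) hy)
          exact ⟨f, hf, h1, H y, opair_mem_right (ZFM.tr hf h2), h2⟩)
      have hu := hV.union _ (hV.sep b _ hb hG)
      set u := ZFSet.sUnion (ZFSet.sep (RGood pr K) b) with hud
      have u1 : ∀ q ∈ u, ∃ x, q = opair x (H x) ∧ ∀ y ∈ pr x, opair y (H y) ∈ u := by
        intro q hq
        obtain ⟨f, hf, hqf⟩ := ZFSet.mem_sUnion.1 hq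
        obtain ⟨hfb, hfg⟩ := ZFSet.mem_sep.1 hf
        have hfV := ZFM.tr hb hfb
        obtain ⟨e, h2, h3⟩ := hfg q hqf
        refine ⟨zfst q, ?_, ?_⟩
        · rw [← good1 f hfV hfg (zfst q) (zsnd q) (by rw [← e]; exact hqf)]; exact e
        · intro y hy
          obtain ⟨q', hq', rfl⟩ := h2 y hy
          have e' := (hfg q' hq').1
          rw [← good1 f hfV hfg (zfst q') (zsnd q') (by rw [← e']; exact hq'), ← e']
          exact ZFSet.mem_sUnion.2 ⟨f, hf, hq'⟩
      have u2 : ∀ y ∈ pr x, opair y (H y) ∈ u := by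
        intro y hy
        obtain ⟨f, hf, h2, h, _, h3⟩ := h1 y hy
        rw [← good1 f (ZFM.tr hb hf) h2 y h h3]
        exact ZFSet.mem_sUnion.2 ⟨f, ZFSet.mem_sep.2 ⟨hf, h2⟩, h3⟩
      have ipr := InV_of (prV x hx)
      have hs : ZFSet.sep (fun q => zfst q ∈ pr x) u ∈ V := hV.sep u _ hu inferInstance
      have hHx : H x ∈ V := by
        rw [hH x (ZFSet.sep (fun q => zfst q ∈ pr x) u) hx]
        · exact KV x hx _ hs
        · intro q
          rw [ZFSet.mem_sep]
          constructor
          · rintro ⟨h2, h3⟩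
            obtain ⟨y, rfl, _⟩ := u1 q h2
            rw [zfst_opair] at h3
            exact ⟨y, h3, rfl⟩
          · rintro ⟨y, hy, rfl⟩
            rw [zfst_opair]; exact ⟨u2 y hy, hy⟩
      have hf := ZFM.ins (ZFM.opair hx hHx) hu
      refine ⟨_, hf, good2 _ hf ?_, by simp⟩
      intro q hq
      rcases ZFSet.mem_insert_iff.1 hq with rfl | hq
      · exact ⟨x, rfl, fun y hy => ZFSet.mem_insert_iff.2 (Or.inr (u2 y hy))⟩
      · obtain ⟨z, e, h2⟩ := u1 q hq
        exact ⟨z, e, fun y hy => ZFSet.mem_insert_iff.2 (Or.inr (h2 y hy))⟩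
  intro x hx
  obtain ⟨f, hf, _, h⟩ := main x hx
  exact opair_mem_right (ZFM.tr hf h)

/-- von Neumann rank as a set -/
def vrk : Zs → Zs :=
  WellFounded.fix ZFSet.mem_wf fun x rec =>
    ZFSet.sUnion (zimage (fun y => if h : y ∈ x then insert (rec y h) (rec y h) else ∅) x)

theorem mem_vrk {x z : Zs} : z ∈ vrk x ↔ ∃ y ∈ x, z ∈ vrk y ∨ z = vrk y := by
  unfold vrk
  rw [WellFounded.fix_eq, ZFSet.mem_sUnion]
  constructor
  · rintro ⟨w, hw, hz⟩
    obtain ⟨y, hy, rfl⟩ := mem_zimage.1 hw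
    rw [dif_pos hy, ZFSet.mem_insert_iff] at hz
    exact ⟨y, hy, hz.symm⟩
  · rintro ⟨y, hy, h⟩
    refine ⟨_, mem_zimage.2 ⟨y, hy, rfl⟩, ?_⟩
    rw [dif_pos hy, ZFSet.mem_insert_iff]
    exact h.symm

theorem vrk_ord (x : Zs) : IsOrd (vrk x) := by
  induction x using ZFSet.inductionOn with
  | _ x ih =>
    refine ⟨?_, ?_⟩
    · intro z hz w hw
      obtain ⟨y, hy, h⟩ := mem_vrk.1 hz
      refine mem_vrk.2 ⟨y, hy, Or.inl ?_⟩
      rcases h with h | rfl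
      · exact (ih y hy).1 z h hw
      · exact hw
    · intro z hz
      obtain ⟨y, hy, h | rfl⟩ := mem_vrk.1 hz
      · exact (ih y hy).2 z h
      · exact (ih y hy).1

theorem rank_vrk (x : Zs) : x.rank ≤ (vrk x).rank := by
  induction x using ZFSet.inductionOn with
  | _ x ih =>
    rw [ZFSet.rank_le_iff]
    intro y hy
    exact (ih y hy).trans_lt (ZFSet.rank_lt_of_mem (mem_vrk.2 ⟨y, hy, Or.inr rfl⟩))

theorem vrk_mem : ∀ x ∈ V, vrk x ∈ V := by
  refine wf_rec (pr := fun x => x) (K := fun x f => ZFSet.sep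
    (fun w => ∃ q, q ∈ f ∧ (w ∈ zsnd q ∨ w = zsnd q))
    (ZFSet.sUnion (ZFSet.sUnion (ZFSet.sUnion f)) ∪ ZFSet.sUnion (ZFSet.sUnion f))) inferInstance inferInstance ZFSet.mem_wf ?_
  intro x f hx hf
  ext w
  rw [ZFSet.mem_sep, mem_vrk]
  constructor
  · rintro ⟨y, hy, h⟩
    have hq := (hf (opair y (vrk y))).2 ⟨y, hy, rfl⟩
    refine ⟨?_, opair y (vrk y), hq, by rwa [zsnd_opair]⟩
    have h2 := mem_sU2_right hq
    rw [ZFSet.mem_union]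
    rcases h with h | rfl
    · exact Or.inl (ZFSet.mem_sUnion.2 ⟨_, h2, h⟩)
    · exact Or.inr h2
  · rintro ⟨_, q, hq, h⟩
    obtain ⟨y, hy, rfl⟩ := (hf q).1 hq
    rw [zsnd_opair] at h
    exact ⟨y, hy, h⟩

theorem isOrd_iff (x : Zs) : IsOrd x ↔ x.IsOrdinal := by
  rw [ZFSet.isOrdinal_iff_forall_mem_isTransitive]; rfl

theorem ord_mem_of_rank {o x : Zs} (ho : IsOrd o) (hx : x ∈ V) (h : o.rank ≤ x.rank) : o ∈ V := by
  have h1 := vrk_mem x hx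
  have h2 := (isOrd_iff _).1 ho
  have h3 := (isOrd_iff _).1 (vrk_ord x)
  rcases h2.mem_trichotomous h3 with h4 | h4 | h4
  · exact ZFM.tr h1 h4
  · rw [h4]; exact h1
  · have := ZFSet.rank_lt_of_mem h4
    exact absurd (h.trans (rank_vrk x)) (not_le.2 this)

end wfrec

section
variable {V P g : Zs} [hV : ZFM V]

theorem rank_val (G : Gen V P g) {x : Zs} (hx : x ∈ V) : (val V P g x).rank ≤ x.rank := by
  induction x using (NR_wf P).induction with
  | _ x ih =>
    rw [ZFSet.rank_le_iff]
    intro z hz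
    obtain ⟨y, s, hs, h, rfl⟩ := (mem_val hx).1 hz
    rcases NE_cases h with ⟨a, rfl⟩ | ⟨n, rfl⟩
    · obtain ⟨_, b, hb, rfl⟩ := NE_chk.1 h
      have ha := opair_mem_right hx
      rw [val_chk G (ZFM.tr ha hb)]
      exact (ZFSet.rank_lt_of_mem hb).trans rank_opair_right
    · exact (ih y ⟨s, h⟩ (NE_mem hx h)).trans_lt (NE_rank h)

theorem VG_ord (G : Gen V P g) {o : Zs} (h : o ∈ VG V P g) (ho : IsOrd o) : o ∈ V := by
  obtain ⟨x, hx, rfl⟩ := mem_VG.1 h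
  exact ord_mem_of_rank ho hx (rank_val G hx)

theorem VG_min {W : Zs} [hW : ZFM W] (hP : P ∈ V) (hVW : ∀ x ∈ V, x ∈ W) (hg : g ∈ W) :
    ∀ z ∈ VG V P g, z ∈ W := by
  have iP := InV_of (hVW P hP)
  have ig := InV_of hg
  -- relativised valuation, defined on all of W
  have key : ∀ x ∈ W, (if x ∈ V then val V P g x else val W P g x) ∈ W := by
    have e : ∀ x ∈ V, val V P g x = val W P g x := by
      intro x
      induction x using (NR_wf P).induction with
      | _ x ih =>
        intro hx
        ext z
        rw [mem_val hx, mem_val (hVW x hx)]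
        constructor
        · rintro ⟨y, s, hs, h, rfl⟩
          exact ⟨y, s, hs, h, ih y ⟨s, h⟩ (NE_mem hx h)⟩
        · rintro ⟨y, s, hs, h, rfl⟩
          exact ⟨y, s, hs, h, (ih y ⟨s, h⟩ (NE_mem hx h)).symm⟩
    have : ∀ x ∈ W, val W P g x ∈ W := by
      refine wf_rec (pr := fun x => nd P x) (K := fun x f => ZFSet.sep
        (fun w => ∃ q, q ∈ f ∧ (∃ s, s ∈ g ∧ NE P s (zfst q) x) ∧ w = zsnd q) (ZFSet.sUnion (ZFSet.sUnion f)))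
        inferInstance inferInstance ?_ ?_
      · have : (fun y x => y ∈ nd P x) = NR P := by
          funext y x; exact propext mem_nd
        rw [this]; exact NR_wf P
      · intro x f hx hf
        ext w
        rw [mem_val hx, ZFSet.mem_sep]
        constructor
        · rintro ⟨y, s, hs, h, rfl⟩
          have hq := (hf (opair y (val W P g y))).2 ⟨y, mem_nd.2 ⟨s, h⟩, rfl⟩
          exact ⟨mem_sU2_right hq, _, hq, ⟨s, hs, by rwa [zfst_opair]⟩, by rw [zsnd_opair]⟩
        · rintro ⟨_, q, hq, ⟨s, hs, h⟩, rfl⟩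
          obtain ⟨y, hy, rfl⟩ := (hf q).1 hq
          rw [zfst_opair] at h
          exact ⟨y, s, hs, h, by rw [zsnd_opair]⟩
    intro x hx
    split_ifs with h
    · rw [e x h]; exact this x hx
    · exact this x hx
  intro z hz
  obtain ⟨x, hx, rfl⟩ := mem_VG.1 hz
  have := key x (hVW x hx)
  rwa [if_pos hx] at this

end

end SmallExt

end

noncomputable section
namespace SmallExt
set_option linter.unusedVariables false
set_option linter.unusedSectionVars false
attribute [local instance] Classical.propDecidable

/-! ## Part 9: the generic extension is a model -/

section
variable {V P g : Zs} [hV : ZFM V]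

theorem VG_chk (G : Gen V P g) {a : Zs} (ha : a ∈ V) : a ∈ VG V P g :=
  mem_VG.2 ⟨_, ZFM.opair (ZFM.natZ 0) ha, val_chk G ha⟩

theorem VG_g (G : Gen V P g) : g ∈ VG V P g := by
  obtain ⟨n, hn, h⟩ := ZFM.repl G.PV (F := fun p => opair (opair (natZ 0) p) p)
  refine mem_VG.2 ⟨_, ZFM.opair (ZFM.natZ 1) hn, ?_⟩
  ext z
  rw [mem_val_nm G hn]
  constructor
  · rintro ⟨y, s, hs, h1, rfl⟩
    obtain ⟨p, hp, e⟩ := (h _).1 h1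
    obtain ⟨rfl, rfl⟩ := opair_inj.1 e
    rw [val_chk G (ZFM.tr G.PV hp)]; exact hs
  · intro hz
    have hzP := G.sub z hz
    exact ⟨opair (natZ 0) z, z, hz, (h _).2 ⟨z, hzP, rfl⟩, (val_chk G (ZFM.tr G.PV hzP)).symm⟩

theorem VG_val {x : Zs} (hx : x ∈ V) : val V P g x ∈ VG V P g := mem_VG.2 ⟨x, hx, rfl⟩

theorem VG_tr {x y : Zs} (hx : x ∈ VG V P g) (hy : y ∈ x) : y ∈ VG V P g := by
  obtain ⟨n, hn, rfl⟩ := mem_VG.1 hx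
  obtain ⟨m, s, _, h, rfl⟩ := (mem_val hn).1 hy
  exact VG_val (NE_mem hn h)

def cov (P N : Zs) : Zs := opair (natZ 1) (ZFSet.prod N P)

theorem cov_mem (hP : P ∈ V) {N : Zs} (hN : N ∈ V) : cov P N ∈ V :=
  ZFM.opair (ZFM.natZ 1) (ZFM.prod hN hP)

theorem mem_cov (G : Gen V P g) {N z : Zs} (hN : N ∈ V) :
    z ∈ val V P g (cov P N) ↔ ∃ y ∈ N, z = val V P g y := by
  unfold cov
  rw [mem_val_nm G (ZFM.prod hN G.PV)]
  constructor
  · rintro ⟨y, s, hs, h, rfl⟩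
    exact ⟨y, (ZFSet.pair_mem_prod.1 h).1, rfl⟩
  · rintro ⟨y, hy, rfl⟩
    obtain ⟨p, hp⟩ := G.ne
    exact ⟨y, p, hp, ZFSet.pair_mem_prod.2 ⟨hy, G.sub p hp⟩, rfl⟩

theorem VG_sep (G : Gen V P g) {a : Zs} (ha : a ∈ VG V P g) {Q : Zs → Prop}
    (hQ : DP (VG V P g) (fun v => Q (v 0))) : ZFSet.sep Q a ∈ VG V P g := by
  obtain ⟨x, hx, rfl⟩ := mem_VG.1 ha
  obtain ⟨F, h1, h2, h3⟩ := FP1 G hQ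
  have iP := InV_of G.PV
  have ix := InV_of hx
  have i1 : DP V (fun v => F (zsnd (v 0)) (zfst (v 0))) := DP.subst2 (Q := F) h1 inferInstance inferInstance
  have hm : ZFSet.sep (fun q => F (zsnd q) (zfst q) ∧ ∃ s, s ∈ P ∧ (s ⊆ zsnd q ∧ NE P s (zfst q) x))
    (ZFSet.prod (nd P x) P) ∈ V := hV.sep _ _ (ZFM.prod (nd_mem G.PV hx) G.PV) inferInstance
  refine mem_VG.2 ⟨_, ZFM.opair (ZFM.natZ 1) hm, ?_⟩
  ext z
  rw [mem_val_nm G hm, ZFSet.mem_sep]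
  constructor
  · rintro ⟨y, r, hr, h, rfl⟩
    obtain ⟨h4, h5, s, hs, h6, h7⟩ := ZFSet.mem_sep.1 h
    rw [zfst_opair] at h5 h7
    rw [zsnd_opair] at h5 h6
    have hy := NE_mem hx h7
    exact ⟨(mem_val hx).2 ⟨y, s, G.up r hr s hs h6, h7, rfl⟩, (h3 y hy).2 ⟨r, hr, h5⟩⟩
  · rintro ⟨h4, h5⟩
    obtain ⟨y, s, hs, hn, rfl⟩ := (mem_val hx).1 h4
    have hy := NE_mem hx hn
    obtain ⟨p, hp, hF⟩ := (h3 y hy).1 h5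
    obtain ⟨r, hr, h6, h7⟩ := G.dir p hp s hs
    refine ⟨y, r, hr, ZFSet.mem_sep.2 ⟨ZFSet.pair_mem_prod.2 ⟨mem_nd.2 ⟨s, hn⟩, G.sub r hr⟩, ?_⟩, rfl⟩
    rw [zfst_opair, zsnd_opair]
    exact ⟨h2 p r y hy hF (G.sub r hr) h6, s, G.sub s hs, h7, hn⟩

theorem nd2 (G : Gen V P g) {x : Zs} (hx : x ∈ V) : ∃ N ∈ V, ∀ y, y ∈ val V P g x →
    ∀ z, z ∈ y → ∃ n ∈ N, z = val V P g n := by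
  have iP := InV_of G.PV
  obtain ⟨b, hb, h⟩ := ZFM.repl (nd_mem G.PV hx) (F := fun y => nd P y)
  refine ⟨_, hV.union b hb, ?_⟩
  intro y hy z hz
  obtain ⟨m, s, hs, hn, rfl⟩ := (mem_val hx).1 hy
  obtain ⟨n, s', hs', hn', rfl⟩ := (mem_val (NE_mem hx hn)).1 hz
  exact ⟨n, ZFSet.mem_sUnion.2 ⟨nd P m, (h _).2 ⟨m, mem_nd.2 ⟨s, hn⟩, rfl⟩, mem_nd.2 ⟨s', hn'⟩⟩, rfl⟩

theorem VG_pair (G : Gen V P g) {x y : Zs} (hx : x ∈ V) (hy : y ∈ V) :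
    val V P g (cov P {x, y}) = {val V P g x, val V P g y} := by
  ext z
  rw [mem_cov G (hV.pair x hx y hy)]
  simp

theorem VG_ZFM (G : Gen V P g) : ZFM (VG V P g) where
  trans := fun x hx y hy => VG_tr hx hy
  emp := VG_chk G hV.emp
  pair := by
    intro a ha b hb
    obtain ⟨x, hx, rfl⟩ := mem_VG.1 ha
    obtain ⟨y, hy, rfl⟩ := mem_VG.1 hb
    exact mem_VG.2 ⟨_, cov_mem G.PV (hV.pair x hx y hy), VG_pair G hx hy⟩
  union := by
    intro a ha
    have ia := InV_of ha
    obtain ⟨x, hx, rfl⟩ := mem_VG.1 ha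
    obtain ⟨N, hN, h⟩ := nd2 G hx
    have hs := VG_sep G (VG_val (g := g) (cov_mem G.PV hN))
      (Q := fun z => ∃ y, y ∈ VG V P g ∧ (y ∈ val V P g x ∧ z ∈ y)) inferInstance
    convert hs using 1
    ext z
    rw [ZFSet.mem_sep, ZFSet.mem_sUnion]
    constructor
    · rintro ⟨y, hy, hz⟩
      exact ⟨(mem_cov G hN).2 (h y hy z hz), y, VG_tr ha hy, hy, hz⟩
    · rintro ⟨_, y, _, hy, hz⟩
      exact ⟨y, hy, hz⟩
  pow := by
    intro a ha
    have ia := InV_of ha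
    have iP := InV_of G.PV
    obtain ⟨x, hx, rfl⟩ := mem_VG.1 ha
    have hN := ZFM.prod (ZFM.sing (ZFM.natZ (V := V) 1)) (powV_mem (ZFM.prod (nd_mem G.PV hx) G.PV))
    have hs := VG_sep G (VG_val (g := g) (cov_mem G.PV hN))
      (Q := fun z => ∀ u, u ∈ VG V P g → (u ∈ z → u ∈ val V P g x)) inferInstance
    convert hs using 1
    ext z
    rw [ZFSet.mem_sep, ZFSet.mem_sep, ZFSet.mem_powerset]
    constructor
    · rintro ⟨h1, hz⟩
      refine ⟨?_, fun u _ hu => h1 hu⟩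
      obtain ⟨w, hw, rfl⟩ := mem_VG.1 hz
      have iw := InV_of hw
      have hm : ZFSet.sep (fun q => FM V P (zsnd q) (zfst q) w) (ZFSet.prod (nd P x) P) ∈ V :=
        hV.sep _ _ (ZFM.prod (nd_mem G.PV hx) G.PV) inferInstance
      refine (mem_cov G hN).2 ⟨opair (natZ 1) _, ZFSet.pair_mem_prod.2 ⟨by simp, mem_powV.2 ⟨?_, hm⟩⟩, ?_⟩
      · intro q hq; exact (ZFSet.mem_sep.1 hq).1
      · ext u
        rw [mem_val_nm G hm]
        constructor
        · intro hu
          obtain ⟨y, s, hs, hn, rfl⟩ := (mem_val hx).1 (h1 hu)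
          obtain ⟨p, hp, hF⟩ := (FM_truth G (NE_mem hx hn) hw).1 hu
          refine ⟨y, p, hp, ZFSet.mem_sep.2 ⟨ZFSet.pair_mem_prod.2 ⟨mem_nd.2 ⟨s, hn⟩, G.sub p hp⟩, ?_⟩, rfl⟩
          rw [zfst_opair, zsnd_opair]; exact hF
        · rintro ⟨y, p, hp, hq, rfl⟩
          obtain ⟨h2, h3⟩ := ZFSet.mem_sep.1 hq
          rw [zfst_opair, zsnd_opair] at h3
          obtain ⟨s, hn⟩ := mem_nd.1 (ZFSet.pair_mem_prod.1 h2).1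
          exact (FM_truth G (NE_mem hx hn) hw).2 ⟨p, hp, h3⟩
    · rintro ⟨h1, h2⟩
      have hz := VG_tr (VG_val (g := g) (cov_mem G.PV hN)) h1
      exact ⟨fun u hu => h2 u (VG_tr hz hu) hu, hz⟩
  omega := VG_chk G hV.omega
  sep := fun a Q ha hQ => VG_sep G ha hQ
  coll := by
    intro a R ha hR htot
    obtain ⟨x, hx, rfl⟩ := mem_VG.1 ha
    obtain ⟨F, h1, h2, h3⟩ := FP2 G hR
    have i1 : DP V (fun v => F (zsnd (v 0)) (zfst (v 0)) (v 1)) :=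
      DP.subst3 (Q := F) h1 inferInstance inferInstance inferInstance
    have i2 : DP V (fun v => F (zsnd (v 1)) (zfst (v 1)) (v 0)) :=
      DP.subst3 (Q := F) h1 inferInstance inferInstance inferInstance
    obtain ⟨b, hb, h⟩ := hV.coll (ZFSet.prod (nd P x) P)
      (fun q w => F (zsnd q) (zfst q) w ∨ ∀ u, u ∈ V → ¬ F (zsnd q) (zfst q) u)
      (ZFM.prod (nd_mem G.PV hx) G.PV) inferInstance (by
        intro q hq
        by_cases hc : ∃ u, u ∈ V ∧ F (zsnd q) (zfst q) u
        · obtain ⟨u, hu, hF⟩ := hc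
          exact ⟨u, hu, Or.inl hF⟩
        · exact ⟨∅, hV.emp, Or.inr fun u hu hF => hc ⟨u, hu, hF⟩⟩)
    refine ⟨_, VG_val (g := g) (cov_mem G.PV hb), ?_⟩
    intro u hu
    obtain ⟨y, s, hs, hn, rfl⟩ := (mem_val hx).1 hu
    have hy := NE_mem hx hn
    obtain ⟨w0, hw0, hRw⟩ := htot _ hu
    obtain ⟨w, hw, rfl⟩ := mem_VG.1 hw0
    obtain ⟨p, hp, hF⟩ := (h3 y w hy hw).1 hRw
    obtain ⟨w', hw', h4⟩ := h (opair y p) (ZFSet.pair_mem_prod.2 ⟨mem_nd.2 ⟨s, hn⟩, G.sub p hp⟩)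
    rw [zfst_opair, zsnd_opair] at h4
    rcases h4 with h4 | h4
    · exact ⟨_, (mem_cov G hb).2 ⟨w', hw', rfl⟩, (h3 y w' hy (ZFM.tr hb hw')).2 ⟨p, hp, h4⟩⟩
    · exact absurd hF (h4 w hw)

end

section
variable {V P g : Zs} [hV : ZFCM V]

theorem VG_graph (G : Gen V P g) {N : Zs} (hN : N ∈ V) : ∃ E ∈ VG V P g, ∀ q, q ∈ E ↔
    ∃ n ∈ N, q = opair n (val V P g n) := by
  have iP := InV_of G.PV
  have hm : ZFM V := inferInstance
  have hpn : DT V (fun v => cov P {cov P {opair (natZ 0) (v 0), opair (natZ 0) (v 0)},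
    cov P {opair (natZ 0) (v 0), v 0}}) := by unfold cov; infer_instance
  obtain ⟨b, hb, h⟩ := ZFM.repl hN (F := fun n => cov P {cov P {opair (natZ 0) n, opair (natZ 0) n},
    cov P {opair (natZ 0) n, n}})
  refine ⟨_, VG_val (g := g) (cov_mem G.PV hb), ?_⟩
  have key : ∀ n ∈ V, val V P g (cov P {cov P {opair (natZ 0) n, opair (natZ 0) n},
    cov P {opair (natZ 0) n, n}}) = opair n (val V P g n) := by
    intro n hn
    have hc := ZFM.opair (ZFM.natZ (V := V) 0) hn
    rw [VG_pair G (cov_mem G.PV (hm.pair _ hc _ hc)) (cov_mem G.PV (hm.pair _ hc _ hn)),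
      VG_pair G hc hc, VG_pair G hc hn, val_chk G hn, mem_opair_def]
    have : ({n, n} : Zs) = {n} := by ext; simp
    rw [this]
  intro q
  rw [mem_cov G hb]
  constructor
  · rintro ⟨y, hy, rfl⟩
    obtain ⟨n, hn, rfl⟩ := (h y).1 hy
    exact ⟨n, hn, key n (ZFM.tr hN hn)⟩
  · rintro ⟨n, hn, rfl⟩
    exact ⟨_, (h _).2 ⟨n, hn, rfl⟩, (key n (ZFM.tr hN hn)).symm⟩

theorem VG_ZFCM (G : Gen V P g) : ZFCM (VG V P g) := by
  have hm : ZFM V := inferInstance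
  have hW : ZFM (VG V P g) := VG_ZFM G
  refine { hW with choice := ?_ }
  intro a ha hne hdis
  have ia := InV_of ha
  obtain ⟨x, hx, rfl⟩ := mem_VG.1 ha
  obtain ⟨N, hN, hcov⟩ := nd2 G hx
  obtain ⟨L, hL, hL1, hL2⟩ := zermelo hN
  obtain ⟨E, hE, hE1⟩ := VG_graph G hN
  have iE := InV_of hE
  have iN := InV_of (VG_chk G hN)
  have iL := InV_of (VG_chk G hL)
  have hEd : ∀ n z, opair n z ∈ E ↔ n ∈ N ∧ z = val V P g n := by
    intro n z
    rw [hE1]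
    constructor
    · rintro ⟨m, hm, e⟩
      obtain ⟨rfl, rfl⟩ := opair_inj.1 e
      exact ⟨hm, rfl⟩
    · rintro ⟨h, rfl⟩; exact ⟨n, h, rfl⟩
  refine ⟨_, VG_sep G (hW.union _ ha) (Q := fun z => ∃ n, n ∈ N ∧ (opair n z ∈ E ∧
    ∃ u, u ∈ val V P g x ∧ (z ∈ u ∧ ∀ m, m ∈ N → (opair m n ∈ L → ∀ z', z' ∈ VG V P g →
      (opair m z' ∈ E → ¬ z' ∈ u))))) inferInstance, ?_⟩
  intro u hu
  obtain ⟨w, hw⟩ := hne u hu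
  obtain ⟨n0, hn0, hw0⟩ := hcov u hu w hw
  obtain ⟨n, ⟨hnN, hnu⟩, hmin⟩ := hL2 {n | n ∈ N ∧ val V P g n ∈ u} (fun z hz => hz.1) ⟨n0, hn0, hw0 ▸ hw⟩
  refine ⟨val V P g n, ?_, hnu, ?_⟩
  · refine ZFSet.mem_sep.2 ⟨ZFSet.mem_sUnion.2 ⟨u, hu, hnu⟩, n, hnN, (hEd _ _).2 ⟨hnN, rfl⟩, u, hu, hnu, ?_⟩
    intro m hm hmn z' hz' hE' hzu
    obtain ⟨_, rfl⟩ := (hEd _ _).1 hE'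
    exact hmin m ⟨hm, hzu⟩ hmn
  · intro w hwc hwu
    obtain ⟨_, n', hn', hE', u', hu', hwu', hmin'⟩ := ZFSet.mem_sep.1 hwc
    have e := hdis u hu u' hu' ⟨w, hwu, hwu'⟩
    subst e
    obtain ⟨_, rfl⟩ := (hEd _ _).1 hE'
    by_contra hne
    have hnn : n' ≠ n := fun e => hne (by rw [e])
    rcases hL1 n' hn' n hnN hnn with h | h
    · exact hmin n' ⟨hn', hwu⟩ h
    · exact hmin' n hnN h _ (VG_val (ZFM.tr hN hnN)) ((hEd _ _).2 ⟨hnN, rfl⟩) hnu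

theorem VG_CTM (G : Gen V P g) (hc : V.toSet.Countable) : IsCTM (VG V P g) := by
  have := VG_ZFCM G
  refine ZFCM.isCTM ?_
  have : (VG V P g).toSet = val V P g '' V.toSet := by
    ext z
    exact mem_VG
  rw [this]
  exact hc.image _

end

end SmallExt

end

noncomputable section
namespace SmallExt
set_option linter.unusedVariables false
set_option linter.unusedSectionVars false
attribute [local instance] Classical.propDecidable

section
variable {V : Zs} [hV : ZFM V]

theorem ple_col {lam a b : Zs} : ple (ColForcing lam) a b ↔ a ∈ ColSet lam ∧ b ∈ ColSet lam ∧ b ⊆ a := by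
  unfold ple ColForcing supsetOrder
  rw [zsnd_opair, ZFSet.mem_sep]
  constructor
  · rintro ⟨_, a', ha, b', hb, e, h⟩
    obtain ⟨rfl, rfl⟩ := opair_inj.1 e
    exact ⟨ha, hb, h⟩
  · rintro ⟨ha, hb, h⟩
    exact ⟨ZFSet.pair_mem_prod.2 ⟨ha, hb⟩, a, ha, b, hb, rfl, h⟩

theorem zfst_col {lam : Zs} : zfst (ColForcing lam) = ColSet lam := zfst_opair _ _

theorem Gen_of_generic {lam g : Zs} (hlam : lam ∈ V) (h : GenericFilterOver V (ColForcing lam) g) :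
    Gen V (ColSet lam) g := by
  have hP : ColSet lam ∈ V := ColSet_mem hlam
  obtain ⟨⟨h1, h2, h3⟩, h4⟩ := h
  rw [zfst_col] at h1 h2
  have hgen : ∀ D : Zs → Prop, DP V (fun v => D (v 0)) →
      (∀ p ∈ ColSet lam, ∃ q ∈ ColSet lam, p ⊆ q ∧ D q) → ∃ q ∈ g, D q := by
    intro D hD hd
    obtain ⟨q, hq, hq'⟩ := h4 (ZFSet.sep D (ColSet lam)) (hV.sep _ _ hP hD) (by
      refine ⟨fun q hq => by rw [zfst_col]; exact (ZFSet.mem_sep.1 hq).1, ?_⟩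
      rw [zfst_col]
      intro p hp
      obtain ⟨q, hq, hpq, hDq⟩ := hd p hp
      exact ⟨q, ZFSet.mem_sep.2 ⟨hq, hDq⟩, ple_col.2 ⟨hq, hp, hpq⟩⟩)
    exact ⟨q, hq, (ZFSet.mem_sep.1 hq').2⟩
  refine ⟨hP, h1, fun p hp q hq hqp => h2 p hp q hq (ple_col.2 ⟨h1 hp, hq, hqp⟩), ?_, ?_, hgen⟩
  · intro p hp q hq
    obtain ⟨r, hr, ha, hb⟩ := h3 p hp q hq
    exact ⟨r, hr, (ple_col.1 ha).2.2, (ple_col.1 hb).2.2⟩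
  · obtain ⟨q, hq, _⟩ := hgen (fun _ => True) inferInstance (fun p hp => ⟨p, hp, fun _ h => h, trivial⟩)
    exact ⟨q, hq⟩

theorem exists_generic {lam : Zs} (hc : V.toSet.Countable) :
    ∃ g, GenericFilterOver V (ColForcing lam) g := by
  have hne : V.toSet.Nonempty := ⟨∅, hV.emp⟩
  obtain ⟨e, he⟩ := hc.exists_eq_range hne
  have hemp : (∅ : Zs) ∈ ColSet lam := by
    unfold ColSet
    refine ZFSet.mem_sep.2 ⟨ZFSet.mem_powerset.2 (fun x hx => absurd hx (ZFSet.notMem_empty _)), ?_, ?_, ?_⟩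
    · intro q hq; exact absurd hq (ZFSet.notMem_empty _)
    · intro a b b' hq; exact absurd hq (ZFSet.notMem_empty _)
    · have : (∅ : Zs).toSet = ∅ := by
        ext x; exact ⟨fun h => absurd h (ZFSet.notMem_empty _), fun h => h.elim⟩
      rw [this]; exact Set.finite_empty
  have step : ∀ (n : ℕ) (p : {p // p ∈ ColSet lam}), ∃ q : {p // p ∈ ColSet lam}, p.1 ⊆ q.1 ∧
      (IsDenseIn (ColForcing lam) (e n) → q.1 ∈ e n) := by
    intro n p
    by_cases hd : IsDenseIn (ColForcing lam) (e n)
    · obtain ⟨q, hq, hqp⟩ := hd.2 p.1 (by rw [zfst_col]; exact p.2)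
      obtain ⟨a, b, c⟩ := ple_col.1 hqp
      exact ⟨⟨q, a⟩, c, fun _ => hq⟩
    · exact ⟨p, fun _ h => h, fun h => absurd h hd⟩
  choose f hf1 hf2 using step
  let s : ℕ → {p // p ∈ ColSet lam} := fun n => Nat.rec ⟨∅, hemp⟩ (fun n p => f n p) n
  have hs : ∀ n, s (n+1) = f n (s n) := fun n => rfl
  have hmono : ∀ n m, n ≤ m → (s n).1 ⊆ (s m).1 := by
    intro n m h
    induction m, h using Nat.le_induction with
    | base => exact fun _ h => h
    | succ m hm ih => intro x hx; rw [hs]; exact hf1 m _ (ih hx)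
  refine ⟨ZFSet.sep (fun q => ∃ n, q ⊆ (s n).1) (ColSet lam), ⟨?_, ?_, ?_⟩, ?_⟩
  · intro q hq; rw [zfst_col]; exact (ZFSet.mem_sep.1 hq).1
  · intro p hp q hq hpq
    obtain ⟨hp, n, hn⟩ := ZFSet.mem_sep.1 hp
    obtain ⟨a, b, c⟩ := ple_col.1 hpq
    exact ZFSet.mem_sep.2 ⟨b, n, fun x hx => hn (c hx)⟩
  · intro p hp q hq
    obtain ⟨hp, n, hn⟩ := ZFSet.mem_sep.1 hp
    obtain ⟨hq, m, hm⟩ := ZFSet.mem_sep.1 hq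
    refine ⟨(s (max n m)).1, ZFSet.mem_sep.2 ⟨(s _).2, _, fun _ h => h⟩, ple_col.2 ⟨(s _).2, hp, ?_⟩, ple_col.2 ⟨(s _).2, hq, ?_⟩⟩
    · exact fun x hx => hmono _ _ (le_max_left n m) (hn hx)
    · exact fun x hx => hmono _ _ (le_max_right n m) (hm hx)
  · intro D hD hd
    have : D ∈ V.toSet := hD
    rw [he] at this
    obtain ⟨n, rfl⟩ := this
    refine ⟨(s (n+1)).1, ZFSet.mem_sep.2 ⟨(s (n+1)).2, n+1, fun _ h => h⟩, ?_⟩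
    rw [hs]; exact hf2 n _ hd

end

theorem backward {V t lam : Zs} (hV : IsCTM V) (hlam : lam ∈ V)
    (h : ∀ g : Zs, GenericFilterOver V (ColForcing lam) g →
          ∀ W, Generates V g W → ∃ M ∈ W, ModelsTCI M t) : ConsistentTCI V t := by
  have hZ := CTM_ZFCM hV
  have hZ' : ZFM V := inferInstance
  obtain ⟨g, hg⟩ := exists_generic (V := V) (lam := lam) hV.2
  have G := Gen_of_generic hlam hg
  have ho : OuterModel V (VG V (ColSet lam) g) :=
    ⟨hV, VG_CTM G hV.2, fun x hx => VG_chk G hx, fun y hy ho => VG_ord G hy ho⟩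
  obtain ⟨M, hM, hm⟩ := h g hg (VG V (ColSet lam) g) ⟨ho, VG_g G, fun W' hW' hVW hgW => by
    have := CTM_ZFM hW'
    intro z hz
    exact VG_min G.PV (fun x hx => hVW hx) hgW z hz⟩
  exact ⟨_, M, ho, hM, hm⟩

end SmallExt

end

noncomputable section
namespace SmallExt
set_option linter.unusedVariables false
set_option linter.unusedSectionVars false
attribute [local instance] Classical.propDecidable

/-- monotone and finitary conditions on positive and negative information -/
class Cont (φ : (Zs → Prop) → (Zs → Prop) → Prop) : Prop where
  mono : ∀ P N P' N' : Zs → Prop, (∀ d, P d → P' d) → (∀ d, N d → N' d) → φ P N → φ P' N'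
  fin : ∀ P N : Zs → Prop, φ P N → ∃ p n : Set Zs, p.Finite ∧ n.Finite ∧ (∀ d ∈ p, P d) ∧ (∀ d ∈ n, N d) ∧
    φ (fun d => d ∈ p) (fun d => d ∈ n)

section
variable {φ ψ : (Zs → Prop) → (Zs → Prop) → Prop}

instance (priority := 900) Cont.const (c : Prop) : Cont (fun _ _ => c) where
  mono := fun _ _ _ _ _ _ h => h
  fin := fun _ _ h => ⟨∅, ∅, Set.finite_empty, Set.finite_empty, fun _ h => h.elim, fun _ h => h.elim, h⟩

instance Cont.pos (d : Zs) : Cont (fun P _ => P d) where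
  mono := fun _ _ _ _ hP _ h => hP d h
  fin := fun P _ h => ⟨{d}, ∅, Set.finite_singleton d, Set.finite_empty,
    fun x hx => by rw [Set.mem_singleton_iff.1 hx]; exact h, fun _ h => h.elim, rfl⟩

instance Cont.neg (d : Zs) : Cont (fun _ N => N d) where
  mono := fun _ _ _ _ _ hN h => hN d h
  fin := fun _ N h => ⟨∅, {d}, Set.finite_empty, Set.finite_singleton d, fun _ h => h.elim,
    fun x hx => by rw [Set.mem_singleton_iff.1 hx]; exact h, rfl⟩

instance Cont.and [h1 : Cont φ] [h2 : Cont ψ] : Cont (fun P N => φ P N ∧ ψ P N) where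
  mono := fun P N P' N' hP hN h => ⟨h1.mono P N P' N' hP hN h.1, h2.mono P N P' N' hP hN h.2⟩
  fin := by
    intro P N h
    obtain ⟨p, n, a1, a2, a3, a4, a5⟩ := h1.fin P N h.1
    obtain ⟨p', n', b1, b2, b3, b4, b5⟩ := h2.fin P N h.2
    refine ⟨p ∪ p', n ∪ n', a1.union b1, a2.union b2, ?_, ?_, ?_, ?_⟩
    · rintro d (hd | hd)
      · exact a3 d hd
      · exact b3 d hd
    · rintro d (hd | hd)
      · exact a4 d hd
      · exact b4 d hd
    · exact h1.mono _ _ _ _ (fun d hd => Or.inl hd) (fun d hd => Or.inl hd) a5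
    · exact h2.mono _ _ _ _ (fun d hd => Or.inr hd) (fun d hd => Or.inr hd) b5

instance Cont.or [h1 : Cont φ] [h2 : Cont ψ] : Cont (fun P N => φ P N ∨ ψ P N) where
  mono := fun P N P' N' hP hN h => h.imp (h1.mono P N P' N' hP hN) (h2.mono P N P' N' hP hN)
  fin := by
    rintro P N (h | h)
    · obtain ⟨p, n, a1, a2, a3, a4, a5⟩ := h1.fin P N h
      exact ⟨p, n, a1, a2, a3, a4, Or.inl a5⟩
    · obtain ⟨p, n, a1, a2, a3, a4, a5⟩ := h2.fin P N h
      exact ⟨p, n, a1, a2, a3, a4, Or.inr a5⟩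

instance Cont.imp {c : Prop} [h1 : Cont φ] : Cont (fun P N => c → φ P N) where
  mono := fun P N P' N' hP hN h hc => h1.mono P N P' N' hP hN (h hc)
  fin := by
    intro P N h
    by_cases hc : c
    · obtain ⟨p, n, a1, a2, a3, a4, a5⟩ := h1.fin P N (h hc)
      exact ⟨p, n, a1, a2, a3, a4, fun _ => a5⟩
    · exact ⟨∅, ∅, Set.finite_empty, Set.finite_empty, fun _ h => h.elim, fun _ h => h.elim, fun h => absurd h hc⟩

instance Cont.ex {φ : Zs → (Zs → Prop) → (Zs → Prop) → Prop} [h1 : ∀ y, Cont (φ y)] :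
    Cont (fun P N => ∃ y, φ y P N) where
  mono := fun P N P' N' hP hN ⟨y, h⟩ => ⟨y, (h1 y).mono P N P' N' hP hN h⟩
  fin := by
    rintro P N ⟨y, h⟩
    obtain ⟨p, n, a1, a2, a3, a4, a5⟩ := (h1 y).fin P N h
    exact ⟨p, n, a1, a2, a3, a4, y, a5⟩

end

example (d : Zs) (K : Zs) : Cont (fun P N => (K = d → ∃ y, y ∈ K ∧ (P (opair y d) ∧ N y)) ∨ P d) := inferInstance

section
variable {W : Zs} [hW : ZFCM W]

theorem absol {K KS : Zs} (hK : K ∈ W) (hKS : KS ∈ W) (Kn : ℕ → Zs)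
    (hKS1 : ∀ q, q ∈ KS ↔ ∃ n, q = opair (natZ n) (Kn n))
    (hfin : ∀ n, (Kn n).toSet.Finite)
    (hsub : ∀ n, Kn n ⊆ K) (hcov : ∀ x ∈ K, ∃ n, x ∈ Kn n) (hmono : ∀ n, Kn n ⊆ Kn (n+1))
    (hop : ∀ x ∈ K, ∀ y ∈ K, opair x y ∈ K) (hnat : ∀ n, natZ n ∈ K)
    (cl : Zs → Zs → Zs → Zs → (Zs → Prop) → (Zs → Prop) → Prop)
    (hcont : ∀ a b c e, Cont (cl a b c e))
    (hDP : DP W (fun v => cl (v 0) (v 1) (v 2) (v 3) (fun d => opair (natZ 1) d ∈ v 4)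
      (fun d => opair (natZ 0) d ∈ v 4)))
    (S : Zs → Prop) (hS : ∀ a ∈ K, ∀ b ∈ K, ∀ c ∈ K, ∀ e ∈ K,
      cl a b c e (fun d => d ∈ K ∧ S d) (fun d => d ∈ K ∧ ¬ S d)) :
    ∃ S' ∈ W, ∀ a ∈ K, ∀ b ∈ K, ∀ c ∈ K, ∀ e ∈ K,
      cl a b c e (fun d => d ∈ S') (fun d => d ∉ S') := by
  have hm : ZFM W := inferInstance
  have iK := InV_of hK
  have iKS := InV_of hKS
  have happ : ∀ n, app KS (natZ n) = Kn n := by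
    intro n
    refine app_eq ((hKS1 _).2 ⟨n, rfl⟩) ?_
    intro z hz
    obtain ⟨m, hm⟩ := (hKS1 _).1 hz
    obtain ⟨e1, e2⟩ := opair_inj.1 hm
    rw [e2, natZ_inj e1]
  let C : Zs → Zs → Prop := fun x p => ∀ a, a ∈ K → ∀ b, b ∈ K → ∀ c, c ∈ K → ∀ e, e ∈ K →
    (x = opair a (opair b (opair c e)) →
    cl a b c e (fun d => opair (natZ 1) d ∈ p) (fun d => opair (natZ 0) d ∈ p))
  have hC : DP W (fun v => C (v 0) (v 1)) := by
    have h := hDP.reindex (fun n => match n with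
      | 0 => 3
      | 1 => 2
      | 2 => 1
      | 3 => 0
      | _ => 5)
    simp only [C]
    infer_instance
  -- the tree
  let Nd := ZFSet.prod ZFSet.omega (powV W K)
  have hNd : Nd ∈ W := ZFM.prod hm.omega (powV_mem hK)
  let Q : Zs → Prop := fun q => (zfst (zsnd q) = insert (zfst (zfst q)) (zfst (zfst q)) ∧
    zsnd (zfst q) ⊆ zsnd (zsnd q)) ∧ ((∀ d, d ∈ W → ¬ (opair (natZ 1) d ∈ zsnd (zsnd q) ∧
      opair (natZ 0) d ∈ zsnd (zsnd q))) ∧ ∀ x, x ∈ app KS (zfst (zfst q)) → C x (zsnd (zsnd q)))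
  have hQ : DP W (fun v => Q (v 0)) := by
    have h1 : DP W (fun v => C (v 0) (zsnd (zsnd (v 1)))) := DP.subst2 (Q := C) hC inferInstance inferInstance
    simp only [Q]
    infer_instance
  let E := ZFSet.sep Q (ZFSet.prod Nd Nd)
  have hE : E ∈ W := hm.sep _ _ (ZFM.prod hNd hNd) hQ
  have memE : ∀ n m p q, opair (opair n p) (opair m q) ∈ E ↔ (opair n p ∈ Nd ∧ opair m q ∈ Nd) ∧
      (m = insert n n ∧ p ⊆ q) ∧ (∀ d, d ∈ W → ¬ (opair (natZ 1) d ∈ q ∧ opair (natZ 0) d ∈ q)) ∧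
      ∀ x, x ∈ app KS n → C x q := by
    intro n m p q
    show _ ∈ ZFSet.sep _ _ ↔ _
    have : opair (opair n p) (opair m q) ∈ ZFSet.prod Nd Nd ↔ opair n p ∈ Nd ∧ opair m q ∈ Nd :=
      ZFSet.pair_mem_prod
    rw [ZFSet.mem_sep, this]
    simp only [Q, zfst_opair, zsnd_opair]
  -- the real branch
  have hreal : ∀ x, ∃ p : Set Zs, p.Finite ∧ (x ∈ K → (∀ d ∈ p, d ∈ K) ∧
      (∀ d, (opair (natZ 1) d ∈ p → S d) ∧ (opair (natZ 0) d ∈ p → ¬ S d)) ∧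
      ∀ q : Zs, (∀ d ∈ p, d ∈ q) → C x q) := by
    intro x
    by_cases hx : ∃ a ∈ K, ∃ b ∈ K, ∃ c ∈ K, ∃ e ∈ K, x = opair a (opair b (opair c e))
    · obtain ⟨a, ha, b, hb, c, hc, e, he, rfl⟩ := hx
      obtain ⟨p, n, h1, h2, h3, h4, h5⟩ := (hcont a b c e).fin _ _ (hS a ha b hb c hc e he)
      refine ⟨(opair (natZ 1)) '' p ∪ (opair (natZ 0)) '' n, (h1.image _).union (h2.image _), fun _ => ⟨?_, ?_, ?_⟩⟩
      · rintro _ (⟨d, hd, rfl⟩ | ⟨d, hd, rfl⟩)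
        · exact hop _ (hnat 1) _ (h3 d hd).1
        · exact hop _ (hnat 0) _ (h4 d hd).1
      · intro d
        constructor
        · rintro (⟨d', hd, e⟩ | ⟨d', hd, e⟩)
          · obtain ⟨_, rfl⟩ := opair_inj.1 e
            exact (h3 _ hd).2
          · exact absurd (natZ_inj (opair_inj.1 e).1) (by decide)
        · rintro (⟨d', hd, e⟩ | ⟨d', hd, e⟩)
          · exact absurd (natZ_inj (opair_inj.1 e).1) (by decide)
          · obtain ⟨_, rfl⟩ := opair_inj.1 e
            exact (h4 _ hd).2
      · intro q hq a' _ b' _ c' _ e' _ hx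
        obtain ⟨u1, hx1⟩ := opair_inj.1 hx
        obtain ⟨u2, hx2⟩ := opair_inj.1 hx1
        obtain ⟨u3, u4⟩ := opair_inj.1 hx2
        rw [← u1, ← u2, ← u3, ← u4]
        exact (hcont _ _ _ _).mono _ _ _ _ (fun d hd => hq _ (Or.inl ⟨d, hd, rfl⟩))
          (fun d hd => hq _ (Or.inr ⟨d, hd, rfl⟩)) h5
    · refine ⟨∅, Set.finite_empty, fun _ => ⟨fun _ h => h.elim, fun _ => ⟨fun h => h.elim, fun h => h.elim⟩, ?_⟩⟩
      intro q _ a ha b hb c hc e he h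
      exact absurd ⟨a, ha, b, hb, c, hc, e, he, h⟩ hx
  choose pr hpr1 hpr2 using hreal
  let qn : ℕ → Zs := fun n => ZFSet.sep (fun d => ∃ i < n, ∃ x ∈ Kn i, d ∈ pr x) K
  have mem_qn : ∀ n d, d ∈ qn n ↔ ∃ i < n, ∃ x ∈ Kn i, d ∈ pr x := by
    intro n d
    show d ∈ ZFSet.sep _ _ ↔ _
    rw [ZFSet.mem_sep]
    refine ⟨fun h => h.2, fun h => ⟨?_, h⟩⟩
    obtain ⟨i, _, x, hx, hd⟩ := h
    exact (hpr2 x (hsub i hx)).1 d hd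
  have hqK : ∀ n, qn n ⊆ K := fun n d hd => (ZFSet.mem_sep.1 hd).1
  have hqW : ∀ n, qn n ∈ W := by
    intro n
    refine finite_sub_mem hK (hqK n) ?_
    have : (qn n).toSet = ⋃ i ∈ Set.Iio n, ⋃ x ∈ (Kn i).toSet, pr x := by
      ext d
      simp only [Set.mem_iUnion, Set.mem_Iio, exists_prop]
      exact mem_qn n d
    rw [this]
    exact (Set.finite_Iio n).biUnion fun i _ => (hfin i).biUnion fun x _ => hpr1 x
  have hNdmem : ∀ n, opair (natZ n) (qn n) ∈ Nd := fun n =>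
    ZFSet.pair_mem_prod.2 ⟨mem_omega.2 ⟨n, rfl⟩, mem_powV.2 ⟨hqK n, hqW n⟩⟩
  obtain ⟨B, hB, hB0, hB1⟩ := illf (V := W) hE (fun n => opair (natZ n) (qn n)) (by
    intro n
    refine (memE _ _ _ _).2 ⟨⟨hNdmem n, hNdmem (n+1)⟩, ⟨rfl, ?_⟩, ?_, ?_⟩
    · intro d hd
      obtain ⟨i, hi, h⟩ := (mem_qn n d).1 hd
      exact (mem_qn _ _).2 ⟨i, by omega, h⟩
    · rintro d _ ⟨h1, h2⟩
      obtain ⟨i, _, x, hx, h⟩ := (mem_qn _ _).1 h1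
      obtain ⟨i', _, x', hx', h'⟩ := (mem_qn _ _).1 h2
      exact ((hpr2 x' (hsub i' hx')).2.1 d).2 h' (((hpr2 x (hsub i hx)).2.1 d).1 h)
    · intro x hx
      rw [happ] at hx
      exact (hpr2 x (hsub n hx)).2.2 _ fun d hd => (mem_qn _ _).2 ⟨n, by omega, x, hx, hd⟩)
  have iE := InV_of hE
  have iB := InV_of hB
  have hR : ZFSet.sep (fun q => zsnd q ∈ B) E ∈ W := hm.sep _ _ hE inferInstance
  obtain ⟨c, hc, hc1⟩ := choice_fun hR hB (by
    intro x hx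
    obtain ⟨y, hy, h⟩ := hB1 x hx
    exact ⟨y, ZFSet.mem_sep.2 ⟨h, by rw [zsnd_opair]; exact hy⟩⟩)
  have ic := InV_of hc
  let s : ℕ → Zs := fun n => Nat.rec (opair (natZ 0) (qn 0)) (fun _ y => app c y) n
  have hsB : ∀ n, s n ∈ B := by
    intro n
    induction n with
    | zero => exact hB0
    | succ n ih =>
      have := (ZFSet.mem_sep.1 (hc1 _ ih)).2
      rw [zsnd_opair] at this
      exact this
  have hsE : ∀ n, opair (s n) (s (n+1)) ∈ E := fun n => (ZFSet.mem_sep.1 (hc1 _ (hsB n))).1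
  obtain ⟨Sq, hSq, hSq1⟩ := omega_rec (V := W) (F := fun _ y => app c y) (a := s) (ZFM.tr hB hB0) (fun n => rfl)
  have iSq := InV_of hSq
  have hsN : ∀ n, ∃ q, s n = opair (natZ n) q ∧ q ⊆ K := by
    intro n
    induction n with
    | zero => exact ⟨_, rfl, hqK 0⟩
    | succ n ih =>
      obtain ⟨q, hq, _⟩ := ih
      have h := hsE n
      have h2 := (ZFSet.pair_mem_prod.1 (ZFSet.mem_sep.1 h).1).2
      obtain ⟨a, _, b, hb, e⟩ := ZFSet.mem_prod.1 h2
      rw [hq, e] at h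
      have h3 := ((memE _ _ _ _).1 h).2.1.1
      exact ⟨b, by rw [e, h3]; rfl, (mem_powV.1 hb).1⟩
  choose r hr hrK using hsN
  have hrE : ∀ n, (r n ⊆ r (n+1)) ∧ (∀ d, d ∈ W → ¬ (opair (natZ 1) d ∈ r (n+1) ∧ opair (natZ 0) d ∈ r (n+1))) ∧
      ∀ x, x ∈ Kn n → C x (r (n+1)) := by
    intro n
    have h := hsE n
    rw [hr n, hr (n+1)] at h
    obtain ⟨_, ⟨_, h1⟩, h2, h3⟩ := (memE _ _ _ _).1 h
    rw [happ] at h3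
    exact ⟨h1, h2, h3⟩
  have hrm : ∀ n m, n ≤ m → r n ⊆ r m := by
    intro n m h
    induction m, h using Nat.le_induction with
    | base => exact fun _ h => h
    | succ m hm ih => exact fun x hx => (hrE m).1 (ih hx)
  refine ⟨ZFSet.sep (fun d => ∃ q, q ∈ Sq ∧ opair (natZ 1) d ∈ zsnd (zsnd q)) (ZFSet.sUnion (ZFSet.sUnion K)), hm.sep _ _ (hm.union _ (hm.union _ hK)) inferInstance, ?_⟩
  have hS' : ∀ d, d ∈ ZFSet.sep (fun d => ∃ q, q ∈ Sq ∧ opair (natZ 1) d ∈ zsnd (zsnd q)) (ZFSet.sUnion (ZFSet.sUnion K)) ↔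
      ∃ n, opair (natZ 1) d ∈ r n := by
    intro d
    rw [ZFSet.mem_sep]
    constructor
    · rintro ⟨h0, q, hq, h⟩
      obtain ⟨n, rfl⟩ := (hSq1 q).1 hq
      rw [zsnd_opair, hr, zsnd_opair] at h
      exact ⟨n, h⟩
    · rintro ⟨n, h⟩
      exact ⟨mem_sU2_right (hrK n h), _, (hSq1 _).2 ⟨n, rfl⟩, by rw [zsnd_opair, hr, zsnd_opair]; exact h⟩
  intro a ha b hb c hc e he
  obtain ⟨n, hn⟩ := hcov _ (hop _ ha _ (hop _ hb _ (hop _ hc _ he)))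
  have h := (hrE n).2.2 _ hn a ha b hb c hc e he rfl
  refine (hcont _ _ _ _).mono _ _ _ _ (fun d hd => (hS' d).2 ⟨_, hd⟩) ?_ h
  intro d hd hd'
  obtain ⟨m, hm⟩ := (hS' d).1 hd'
  have hdW : d ∈ W := opair_mem_right (ZFM.tr hK (hrK _ hd))
  have e1 := hrm m (max m n + 1) (by omega) hm
  have e0 := hrm (n+1) (max m n + 1) (by omega) hd
  exact (hrE (max m n)).2.1 d hdW ⟨e1, e0⟩

end

end SmallExt

end

noncomputable section
namespace SmallExt
set_option linter.unusedVariables false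
set_option linter.unusedSectionVars false
attribute [local instance] Classical.propDecidable

theorem mem_ColSet {lam p : Zs} : p ∈ ColSet lam ↔ (∀ q ∈ p, ∃ n : ℕ, ∃ b ∈ lam, q = opair (natZ n) b) ∧
    (∀ a b b' : Zs, opair a b ∈ p → opair a b' ∈ p → b = b') ∧ p.toSet.Finite := by
  unfold ColSet
  rw [ZFSet.mem_sep, ZFSet.mem_powerset]
  constructor
  · rintro ⟨h1, h2, h3, h4⟩
    refine ⟨fun q hq => ?_, h3, h4⟩
    obtain ⟨a, ha, b, hb, e⟩ := ZFSet.mem_prod.1 (h1 hq)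
    obtain ⟨n, rfl⟩ := mem_omega.1 ha
    exact ⟨n, b, hb, e⟩
  · rintro ⟨h1, h3, h4⟩
    refine ⟨fun q hq => ?_, fun q hq => ?_, h3, h4⟩
    · obtain ⟨n, b, hb, rfl⟩ := h1 q hq
      exact ZFSet.pair_mem_prod.2 ⟨mem_omega.2 ⟨n, rfl⟩, hb⟩
    · obtain ⟨n, b, hb, rfl⟩ := h1 q hq
      exact ⟨_, _, rfl⟩

theorem col_hit {V lam g b : Zs} [hV : ZFM V] (G : Gen V (ColSet lam) g) (hlam : lam ∈ V) (hb : b ∈ lam) :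
    ∃ n : ℕ, ∃ p ∈ g, opair (natZ n) b ∈ p := by
  have ib := InV_of (ZFM.tr hlam hb)
  have io := InV_of hV.omega
  obtain ⟨p, hp, n, hn, h⟩ := G.gen (fun p => ∃ n, n ∈ ZFSet.omega ∧ opair n b ∈ p) inferInstance (by
    intro p hp
    obtain ⟨h1, h2, h3⟩ := mem_ColSet.1 hp
    have hinf : (Set.range natZ).Infinite := Set.infinite_range_of_injective (fun m n h => natZ_inj h)
    obtain ⟨_, ⟨n, rfl⟩, hn⟩ := hinf.exists_notMem_finite (h3.image zfst)
    have hn' : ∀ y, opair (natZ n) y ∉ p := fun y hy => hn ⟨_, hy, zfst_opair _ _⟩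
    refine ⟨insert (opair (natZ n) b) p, mem_ColSet.2 ⟨?_, ?_, ?_⟩, fun x hx => ZFSet.mem_insert_iff.2 (Or.inr hx),
      natZ n, mem_omega.2 ⟨n, rfl⟩, ZFSet.mem_insert_iff.2 (Or.inl rfl)⟩
    · intro q hq
      rcases ZFSet.mem_insert_iff.1 hq with rfl | hq
      · exact ⟨n, b, hb, rfl⟩
      · exact h1 q hq
    · intro x y y' hy hy'
      rcases ZFSet.mem_insert_iff.1 hy with e | hy1
      · obtain ⟨e1, e2⟩ := opair_inj.1 e
        rcases ZFSet.mem_insert_iff.1 hy' with e' | hy2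
        · rw [e2, (opair_inj.1 e').2]
        · rw [e1] at hy2; exact absurd hy2 (hn' _)
      · rcases ZFSet.mem_insert_iff.1 hy' with e' | hy2
        · rw [(opair_inj.1 e').1] at hy1
          exact absurd hy1 (hn' _)
        · exact h2 x y y' hy1 hy2
    · have : (insert (opair (natZ n) b) p).toSet = insert (opair (natZ n) b) p.toSet := by
        ext x; exact ZFSet.mem_insert_iff
      rw [this]; exact h3.insert _)
  obtain ⟨n, rfl⟩ := mem_omega.1 hn
  exact ⟨n, p, hp, h⟩

theorem exists_K {V W lam g A j J : Zs} [hV : ZFM V] [hW : ZFCM W] (hVW : ∀ x ∈ V, x ∈ W)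
    (G : Gen V (ColSet lam) g) (hg : g ∈ W) (hlam : lam ∈ V) (hA : A ∈ V) (hj : j ∈ V) (hJ : J ∈ W)
    (hj1 : ∀ a ∈ A, ∃ b ∈ lam, opair a b ∈ j)
    (hj2 : ∀ a ∈ A, ∀ a' ∈ A, ∀ b, opair a b ∈ j → opair a' b ∈ j → a = a') :
    ∃ (K KS : Zs) (Kn : ℕ → Zs), K ∈ W ∧ KS ∈ W ∧
      (∀ q, q ∈ KS ↔ ∃ n, q = opair (natZ n) (Kn n)) ∧ (∀ n, (Kn n).toSet.Finite) ∧
      (∀ n, Kn n ⊆ K) ∧ (∀ x ∈ K, ∃ n, x ∈ Kn n) ∧ (∀ n, Kn n ⊆ Kn (n+1)) ∧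
      (∀ x ∈ K, ∀ y ∈ K, ({x, y} : Zs) ∈ K) ∧ (∀ n, natZ n ∈ K) ∧ (∀ a ∈ A, a ∈ K) ∧ J ∈ K := by
  have hm : ZFM W := inferInstance
  have ig := InV_of hg
  have ij := InV_of (hVW _ hj)
  have il := InV_of (hVW _ hlam)
  have iA := InV_of (hVW _ hA)
  let F : Zs → Zs → Zs := fun m k => (k ∪ (ZFSet.sep (fun x => ∃ u, u ∈ k ∧ ∃ w, w ∈ k ∧ x = {u, w}) (powV W k))) ∪
    (ZFSet.sep (fun a => ∃ p, p ∈ g ∧ ∃ b, b ∈ lam ∧ (opair a b ∈ j ∧ opair m b ∈ p)) A ∪ {m})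
  have hF : DT W (fun v => F (v 0) (v 1)) := by simp only [F]; infer_instance
  have memF : ∀ n k, k ∈ W → ∀ x, x ∈ F n k ↔ (x ∈ k ∨ ∃ u ∈ k, ∃ w ∈ k, x = {u, w}) ∨
      ((x ∈ A ∧ ∃ p, p ∈ g ∧ ∃ b, b ∈ lam ∧ (opair x b ∈ j ∧ opair n b ∈ p)) ∨ x = n) := by
    intro n k hk x
    simp only [F, ZFSet.mem_union, ZFSet.mem_sep, ZFSet.mem_singleton, mem_powV]
    refine or_congr (or_congr Iff.rfl ⟨fun h => h.2, fun h => ⟨?_, h⟩⟩) Iff.rfl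
    obtain ⟨u, hu, w, hw, rfl⟩ := h
    refine ⟨fun y hy => ?_, hm.pair _ (ZFM.tr hk hu) _ (ZFM.tr hk hw)⟩
    rcases ZFSet.mem_pair.1 hy with rfl | rfl <;> assumption
  let Kn : ℕ → Zs := fun n => Nat.rec {J} (fun n k => F (natZ n) k) n
  have h0 : Kn 0 ∈ W := ZFM.sing hJ
  have hs : ∀ n, Kn (n+1) = F (natZ n) (Kn n) := fun n => rfl
  have hKW : ∀ n, Kn n ∈ W := by
    intro n
    induction n with
    | zero => exact h0
    | succ n ih =>
      rw [hs]
      exact hF.mem (fun i => if i = 0 then natZ n else Kn n) (fun i => by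
        by_cases hi : i = 0
        · simp only [hi, if_true]; exact ZFM.natZ n
        · simp only [hi, if_false]; exact ih)
  obtain ⟨KS, hKS, hKS1⟩ := omega_rec (V := W) h0 hs
  obtain ⟨K, hK, hK1⟩ := omega_rec_union (V := W) h0 hs
  have hmono : ∀ n, Kn n ⊆ Kn (n+1) := fun n x hx => by
    rw [hs]; exact (memF _ _ (hKW n) x).2 (Or.inl (Or.inl hx))
  have hmono' : ∀ n m, n ≤ m → Kn n ⊆ Kn m := by
    intro n m h
    induction m, h using Nat.le_induction with
    | base => exact fun _ h => h
    | succ m hm ih => exact fun x hx => hmono m (ih hx)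
  refine ⟨K, KS, Kn, hK, hKS, hKS1, ?_, fun n x hx => (hK1 x).2 ⟨n, hx⟩, fun x hx => (hK1 x).1 hx, hmono,
    ?_, ?_, ?_, ?_⟩
  · intro n
    induction n with
    | zero =>
      have : (Kn 0).toSet = {J} := by ext x; exact ZFSet.mem_singleton
      rw [this]; exact Set.finite_singleton _
    | succ n ih =>
      have : (Kn (n+1)).toSet = ((Kn n).toSet ∪ (fun q : Zs × Zs => ({q.1, q.2} : Zs)) '' ((Kn n).toSet ×ˢ (Kn n).toSet)) ∪
        ({x | x ∈ A ∧ ∃ p, p ∈ g ∧ ∃ b, b ∈ lam ∧ (opair x b ∈ j ∧ opair (natZ n) b ∈ p)} ∪ {natZ n}) := by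
        ext x
        refine (memF (natZ n) _ (hKW n) x).trans (or_congr (or_congr Iff.rfl ?_) (or_congr Iff.rfl Iff.rfl))
        constructor
        · rintro ⟨u, hu, w, hw, rfl⟩
          exact ⟨(u, w), ⟨hu, hw⟩, rfl⟩
        · rintro ⟨⟨u, w⟩, ⟨hu, hw⟩, rfl⟩
          exact ⟨u, hu, w, hw, rfl⟩
      rw [this]
      refine (ih.union ((ih.prod ih).image _)).union (Set.Finite.union ?_ (Set.finite_singleton _))
      refine Set.Subsingleton.finite ?_
      rintro a ⟨ha, p, hp, b, hb, hab, hpb⟩ a' ⟨ha', p', hp', b', hb', hab', hpb'⟩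
      obtain ⟨r, hr, h1, h2⟩ := G.dir p hp p' hp'
      have := (mem_ColSet.1 (G.sub r hr)).2.1 _ _ _ (h1 hpb) (h2 hpb')
      subst this
      exact hj2 a ha a' ha' b hab hab'
  · intro x hx y hy
    obtain ⟨n, hn⟩ := (hK1 x).1 hx
    obtain ⟨m, hm⟩ := (hK1 y).1 hy
    refine (hK1 _).2 ⟨max n m + 1, ?_⟩
    rw [hs]
    exact (memF _ _ (hKW _) _).2 (Or.inl (Or.inr ⟨x, hmono' _ _ (le_max_left _ _) hn, y, hmono' _ _ (le_max_right _ _) hm, rfl⟩))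
  · intro n
    refine (hK1 _).2 ⟨n+1, ?_⟩
    rw [hs]
    exact (memF _ _ (hKW _) _).2 (Or.inr (Or.inr rfl))
  · intro a ha
    obtain ⟨b, hb, hab⟩ := hj1 a ha
    obtain ⟨n, p, hp, h⟩ := col_hit G hlam hb
    refine (hK1 _).2 ⟨n+1, ?_⟩
    rw [hs]
    exact (memF _ _ (hKW _) _).2 (Or.inr (Or.inl ⟨ha, p, hp, b, hb, hab, h⟩))
  · exact (hK1 _).2 ⟨0, ZFSet.mem_singleton.2 rfl⟩

end SmallExt

end

noncomputable section
namespace SmallExt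
set_option linter.unusedVariables false
set_option linter.unusedSectionVars false
attribute [local instance] Classical.propDecidable

/-- all entries of a list lie in the set `K` -/
def LK (K : Zs) (l : List Zs) : Prop := ∀ x ∈ l, x ∈ K

theorem LK_nil {K : Zs} : LK K [] := by intro x hx; cases hx

theorem LK_cons {K a : Zs} {l : List Zs} : LK K (a :: l) ↔ a ∈ K ∧ LK K l := by
  simp [LK]

theorem zlist_mem {K : Zs} (hop : ∀ x ∈ K, ∀ y ∈ K, opair x y ∈ K) (h0 : ∅ ∈ K) :
    ∀ l : List Zs, LK K l → zlist l ∈ K := by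
  intro l
  induction l with
  | nil => intro _; exact h0
  | cons a l ih =>
    intro h
    rw [LK_cons] at h
    exact hop _ h.1 _ (ih h.2)

theorem ztuple_mem {K : Zs} (hop : ∀ x ∈ K, ∀ y ∈ K, opair x y ∈ K) (h0 : ∅ ∈ K) :
    ∀ l : List Zs, LK K l → ztuple l ∈ K
  | [], _ => h0
  | [a], h => h a (List.mem_singleton.2 rfl)
  | a :: b :: l, h => hop _ (LK_cons.1 h).1 _ (ztuple_mem hop h0 (b :: l) (LK_cons.1 h).2)

theorem opair_ne_empty {a b : Zs} : opair a b ≠ ∅ := by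
  intro h
  have : ({a} : Zs) ∈ opair a b := by rw [mem_opair_def]; exact ZFSet.mem_insert_iff.2 (Or.inl rfl)
  rw [h] at this
  exact ZFSet.notMem_empty _ this

theorem zlist_eq_empty {l : List Zs} : zlist l = ∅ ↔ l = [] := by
  cases l with
  | nil => simp [zlist]
  | cons a l => simp [zlist, opair_ne_empty]

theorem zlist_inj : ∀ {l l' : List Zs}, zlist l = zlist l' → l = l'
  | [], [], _ => rfl
  | [], a :: l, h => absurd h.symm opair_ne_empty
  | a :: l, [], h => absurd h opair_ne_empty
  | a :: l, a' :: l', h => by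
    obtain ⟨h1, h2⟩ := opair_inj.1 h
    rw [h1, zlist_inj h2]

theorem ztuple_cons {a : Zs} {l : List Zs} (h : l ≠ []) : ztuple (a :: l) = opair a (ztuple l) := by
  cases l with
  | nil => exact absurd rfl h
  | cons b l => rfl

theorem ind_table {W K : Zs} [hW : ZFM W] (hK : K ∈ W) (C : Zs → Zs → Prop)
    (hC : DP W (fun v => C (v 0) (v 1))) :
    ∃ R ∈ W, ∃ Rn : ℕ → Zs, Rn 0 = ∅ ∧ (∀ n q, q ∈ Rn (n+1) ↔ q ∈ K ∧ C q (Rn n)) ∧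
      ∀ q, q ∈ R ↔ ∃ n, q ∈ Rn n := by
  have iK := InV_of hK
  let F : Zs → Zs → Zs := fun _ k => ZFSet.sep (fun q => C q k) K
  have hF : DT W (fun v => F (v 0) (v 1)) := by
    have : DP W (fun v => C (v 0) (v 2)) := DP.subst2 (Q := C) hC inferInstance inferInstance
    simp only [F]
    infer_instance
  let a : ℕ → Zs := fun n => Nat.rec ∅ (fun _ y => F ∅ y) n
  obtain ⟨R, hR, h⟩ := omega_rec_union (V := W) (F := F) (a := a) hW.emp (fun n => rfl)
  exact ⟨R, hR, a, rfl, fun n q => ZFSet.mem_sep, h⟩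

section
variable {W K : Zs} [hW : ZFM W] (hK : K ∈ W) (hop : ∀ x ∈ K, ∀ y ∈ K, opair x y ∈ K) (h0 : ∀ n, natZ n ∈ K)
include hK hop h0

theorem table_L : ∃ R ∈ W, ∀ q, q ∈ R ↔ ∃ l, LK K l ∧ q = opair (natZ l.length) (zlist l) := by
  have iK := InV_of hK
  obtain ⟨R, hR, Rn, e0, e1, e2⟩ := ind_table (W := W) hK (fun q k => q = opair ∅ ∅ ∨
    ∃ n, n ∈ K ∧ ∃ a, a ∈ K ∧ ∃ m, m ∈ K ∧ (opair n m ∈ k ∧ q = opair (insert n n) (opair a m))) inferInstance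
  refine ⟨R, hR, fun q => (e2 q).trans ⟨?_, ?_⟩⟩
  · rintro ⟨n, hn⟩
    induction n generalizing q with
    | zero => rw [e0] at hn; exact absurd hn (ZFSet.notMem_empty _)
    | succ n ih =>
      rcases ((e1 _ _).1 hn).2 with h | ⟨n', hn', a, ha, m, hm, h1, h2⟩
      · exact ⟨[], LK_nil, h⟩
      · obtain ⟨l, hl, e⟩ := ih _ h1
        obtain ⟨ea, eb⟩ := opair_inj.1 e
        refine ⟨a :: l, LK_cons.2 ⟨ha, hl⟩, ?_⟩
        rw [h2, ea, eb]; rfl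
  · rintro ⟨l, hl, rfl⟩
    induction l with
    | nil => exact ⟨1, (e1 _ _).2 ⟨hop _ (h0 0) _ (h0 0), Or.inl rfl⟩⟩
    | cons a l ih =>
      rw [LK_cons] at hl
      obtain ⟨n, hn⟩ := ih hl.2
      have hz := zlist_mem hop (h0 0) l hl.2
      refine ⟨n+1, (e1 _ _).2 ⟨hop _ (h0 _) _ (hop _ hl.1 _ hz), Or.inr ⟨_, h0 _, a, hl.1, _, hz, hn, rfl⟩⟩⟩

theorem table_T : ∃ R ∈ W, ∀ q, q ∈ R ↔ ∃ l, LK K l ∧ q = opair (zlist l) (ztuple l) := by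
  have iK := InV_of hK
  obtain ⟨R, hR, Rn, e0, e1, e2⟩ := ind_table (W := W) hK (fun q k => q = opair ∅ ∅ ∨ ((∃ a, a ∈ K ∧ q = opair (opair a ∅) a) ∨
    ∃ a, a ∈ K ∧ ∃ m, m ∈ K ∧ ∃ w, w ∈ K ∧ (opair m w ∈ k ∧ (¬ m = ∅ ∧ q = opair (opair a m) (opair a w))))) inferInstance
  refine ⟨R, hR, fun q => (e2 q).trans ⟨?_, ?_⟩⟩
  · rintro ⟨n, hn⟩
    induction n generalizing q with
    | zero => rw [e0] at hn; exact absurd hn (ZFSet.notMem_empty _)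
    | succ n ih =>
      rcases ((e1 _ _).1 hn).2 with h | ⟨a, ha, h⟩ | ⟨a, ha, m, hm, w, hw, h1, h2, h3⟩
      · exact ⟨[], LK_nil, h⟩
      · exact ⟨[a], LK_cons.2 ⟨ha, LK_nil⟩, h⟩
      · obtain ⟨l, hl, e⟩ := ih _ h1
        obtain ⟨ea, eb⟩ := opair_inj.1 e
        refine ⟨a :: l, LK_cons.2 ⟨ha, hl⟩, ?_⟩
        rw [ztuple_cons (fun hh => h2 (by rw [ea, hh]; rfl)), h3, ea, eb]; rfl
  · rintro ⟨l, hl, rfl⟩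
    induction l with
    | nil => exact ⟨1, (e1 _ _).2 ⟨hop _ (h0 0) _ (h0 0), Or.inl rfl⟩⟩
    | cons a l ih =>
      have hl0 := hl
      rw [LK_cons] at hl
      obtain ⟨n, hn⟩ := ih hl.2
      have hz := zlist_mem hop (h0 0) l hl.2
      have hz' := ztuple_mem hop (h0 0) l hl.2
      refine ⟨n+1, (e1 _ _).2 ⟨hop _ (zlist_mem hop (h0 0) _ hl0) _ (ztuple_mem hop (h0 0) _ hl0), Or.inr ?_⟩⟩
      by_cases hh : l = []
      · subst hh; exact Or.inl ⟨a, hl.1, rfl⟩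
      · exact Or.inr ⟨a, hl.1, _, hz, _, hz', hn, fun h => hh (zlist_eq_empty.1 h), by rw [ztuple_cons hh]; rfl⟩

theorem table_A : ∃ R ∈ W, ∀ q, q ∈ R ↔ ∃ l b, LK K l ∧ b ∈ K ∧ q = opair (zlist l) (opair b (ztuple (l ++ [b]))) := by
  have iK := InV_of hK
  obtain ⟨R, hR, Rn, e0, e1, e2⟩ := ind_table (W := W) hK (fun q k => (∃ b, b ∈ K ∧ q = opair ∅ (opair b b)) ∨
    ∃ a, a ∈ K ∧ ∃ m, m ∈ K ∧ ∃ b, b ∈ K ∧ ∃ w, w ∈ K ∧ (opair m (opair b w) ∈ k ∧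
      q = opair (opair a m) (opair b (opair a w)))) inferInstance
  refine ⟨R, hR, fun q => (e2 q).trans ⟨?_, ?_⟩⟩
  · rintro ⟨n, hn⟩
    induction n generalizing q with
    | zero => rw [e0] at hn; exact absurd hn (ZFSet.notMem_empty _)
    | succ n ih =>
      rcases ((e1 _ _).1 hn).2 with ⟨b, hb, h⟩ | ⟨a, ha, m, hm, b, hb, w, hw, h1, h3⟩
      · exact ⟨[], b, LK_nil, hb, h⟩
      · obtain ⟨l, b', hl, hb', e⟩ := ih _ h1
        obtain ⟨ea, eb⟩ := opair_inj.1 e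
        obtain ⟨ec, ed⟩ := opair_inj.1 eb
        refine ⟨a :: l, b', LK_cons.2 ⟨ha, hl⟩, hb', ?_⟩
        rw [List.cons_append, ztuple_cons (by simp), h3, ea, ec, ed]; rfl
  · rintro ⟨l, b, hl, hb, rfl⟩
    induction l with
    | nil => exact ⟨1, (e1 _ _).2 ⟨hop _ (h0 0) _ (hop _ hb _ hb), Or.inl ⟨b, hb, rfl⟩⟩⟩
    | cons a l ih =>
      have hl0 := hl
      rw [LK_cons] at hl
      obtain ⟨n, hn⟩ := ih hl.2
      have hz := zlist_mem hop (h0 0) l hl.2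
      have hlb : ∀ l, LK K l → LK K (l ++ [b]) := by
        intro l hl x hx
        rcases List.mem_append.1 hx with h | h
        · exact hl x h
        · rw [List.mem_singleton.1 h]; exact hb
      have hz' := ztuple_mem hop (h0 0) (l ++ [b]) (hlb _ hl.2)
      refine ⟨n+1, (e1 _ _).2 ⟨hop _ (zlist_mem hop (h0 0) _ hl0) _ (hop _ hb _ (ztuple_mem hop (h0 0) _ (hlb _ hl0))), Or.inr ?_⟩⟩
      exact ⟨a, hl.1, _, hz, _, hb, _, hz', hn, by rw [List.cons_append, ztuple_cons (by simp)]; rfl⟩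

theorem table_N : ∃ R ∈ W, ∀ q, q ∈ R ↔ ∃ l n b, LK K l ∧ l[n]? = some b ∧ q = opair (natZ n) (opair (zlist l) b) := by
  have iK := InV_of hK
  obtain ⟨L, hL, hL'⟩ := table_L (W := W) hK hop h0
  have iL := InV_of hL
  obtain ⟨R, hR, Rn, e0, e1, e2⟩ := ind_table (W := W) hK (fun q k => (∃ b, b ∈ K ∧ ∃ m, m ∈ K ∧ ((∃ n, n ∈ K ∧ opair n m ∈ L) ∧ q = opair ∅ (opair (opair b m) b))) ∨
    ∃ a, a ∈ K ∧ ∃ m, m ∈ K ∧ ∃ b, b ∈ K ∧ ∃ n, n ∈ K ∧ (opair n (opair m b) ∈ k ∧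
      q = opair (insert n n) (opair (opair a m) b))) inferInstance
  refine ⟨R, hR, fun q => (e2 q).trans ⟨?_, ?_⟩⟩
  · rintro ⟨n, hn⟩
    induction n generalizing q with
    | zero => rw [e0] at hn; exact absurd hn (ZFSet.notMem_empty _)
    | succ n ih =>
      rcases ((e1 _ _).1 hn).2 with ⟨b, hb, m, hm, ⟨n, _, hn⟩, h⟩ | ⟨a, ha, m, hm, b, hb, w, hw, h1, h3⟩
      · obtain ⟨l, hl, e⟩ := (hL' _).1 hn
        refine ⟨b :: l, 0, b, LK_cons.2 ⟨hb, hl⟩, rfl, ?_⟩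
        rw [h, (opair_inj.1 e).2]; rfl
      · obtain ⟨l, n, b', hl, hb', e⟩ := ih _ h1
        obtain ⟨ea, eb⟩ := opair_inj.1 e
        obtain ⟨ec, ed⟩ := opair_inj.1 eb
        refine ⟨a :: l, n+1, b', LK_cons.2 ⟨ha, hl⟩, hb', ?_⟩
        rw [h3, ea, ec, ed]; rfl
  · rintro ⟨l, n, b, hl, hb, rfl⟩
    induction l generalizing n with
    | nil => simp at hb
    | cons a l ih =>
      have hl0 := hl
      rw [LK_cons] at hl
      have hz := zlist_mem hop (h0 0) l hl.2
      have hbK : b ∈ K := hl0 b (List.mem_of_getElem? hb)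
      have hq : ∀ n, opair (natZ n) (opair (zlist (a :: l)) b) ∈ K :=
        fun n => hop _ (h0 _) _ (hop _ (zlist_mem hop (h0 0) _ hl0) _ hbK)
      cases n with
      | zero =>
        have : a = b := by simpa using hb
        subst this
        exact ⟨1, (e1 _ _).2 ⟨hq _, Or.inl ⟨a, hbK, _, hz, ⟨_, h0 _, (hL' _).2 ⟨l, hl.2, rfl⟩⟩, rfl⟩⟩⟩
      | succ n =>
        obtain ⟨k, hk⟩ := ih n hl.2 (by simpa using hb)
        exact ⟨k+1, (e1 _ _).2 ⟨hq _, Or.inr ⟨a, hl.1, _, hz, b, hbK, _, h0 _, hk, rfl⟩⟩⟩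
end
end SmallExt

end

noncomputable section
namespace SmallExt
set_option linter.unusedVariables false
set_option linter.unusedSectionVars false
attribute [local instance] Classical.propDecidable

set_option synthInstance.maxSize 100000
set_option synthInstance.maxHeartbeats 400000
set_option maxHeartbeats 1000000
abbrev fact (k : ℕ) (x y z : Zs) : Zs := opair (natZ k) (opair x (opair y z))
abbrev fU (b : Zs) : Zs := fact 0 b ∅ ∅
abbrev fUL (m : Zs) : Zs := fact 1 m ∅ ∅
abbrev fI (s w : Zs) : Zs := fact 2 s w ∅
abbrev fV (t a b : Zs) : Zs := fact 3 t a b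
abbrev fVL (l a m : Zs) : Zs := fact 4 l a m
abbrev fSP (c a : Zs) : Zs := fact 5 c a ∅
abbrev fSN (c a : Zs) : Zs := fact 6 c a ∅

/-- parameters of the clauses -/
structure Par where
  (K z Z1 T S0 S1 S2 E Y TT AT NT LT J : Zs)

class ParIn (W : Zs) (p : Par) : Prop where
  K : p.K ∈ W
  z : p.z ∈ W
  Z1 : p.Z1 ∈ W
  T : p.T ∈ W
  S0 : p.S0 ∈ W
  S1 : p.S1 ∈ W
  S2 : p.S2 ∈ W
  E : p.E ∈ W
  Y : p.Y ∈ W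
  TT : p.TT ∈ W
  AT : p.AT ∈ W
  NT : p.NT ∈ W
  LT : p.LT ∈ W
  J : p.J ∈ W

section
variable {W : Zs} {p : Par} [h : ParIn W p]
instance : InV W p.K := ⟨h.K⟩
instance : InV W p.z := ⟨h.z⟩
instance : InV W p.Z1 := ⟨h.Z1⟩
instance : InV W p.T := ⟨h.T⟩
instance : InV W p.S0 := ⟨h.S0⟩
instance : InV W p.S1 := ⟨h.S1⟩
instance : InV W p.S2 := ⟨h.S2⟩
instance : InV W p.E := ⟨h.E⟩
instance : InV W p.Y := ⟨h.Y⟩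
instance : InV W p.TT := ⟨h.TT⟩
instance : InV W p.AT := ⟨h.AT⟩
instance : InV W p.NT := ⟨h.NT⟩
instance : InV W p.LT := ⟨h.LT⟩
instance : InV W p.J := ⟨h.J⟩
end

def lenOK (p : Par) (s m : Zs) : Prop := opair (zfst (zsnd s)) m ∈ p.LT

section
variable (p : Par) (a b c e : Zs) (P N : Zs → Prop)

def c1 : Prop := (N (fU a) ∨ a ∈ p.z) ∧ (P (fU a) ∨ ¬ a ∈ p.Z1)

def c2 : Prop := (N (fUL a) ∨ (a = ∅ ∨ ∃ x, x ∈ p.K ∧ ∃ m, m ∈ p.K ∧ (a = opair x m ∧ (P (fU x) ∧ P (fUL m))))) ∧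
  (P (fUL a) ∨ ¬ a = ∅)

def c3 : Prop := P (fUL (opair a b)) ∨ (N (fU a) ∨ N (fUL b))

def c4 : Prop := N (fI a b) ∨ (opair a b ∈ p.Y ∧ ((a ∈ p.S2 ∧ P (fU b)) ∨
  ((a ∈ p.S0 ∧ ∃ m, m ∈ p.K ∧ (opair (zfst (zsnd a)) m ∈ p.LT ∧ (P (fUL m) ∧ opair m b ∈ p.TT))) ∨
   (a ∈ p.S1 ∧ ∃ m, m ∈ p.K ∧ ∃ x, x ∈ p.K ∧ (opair (zfst (zsnd a)) m ∈ p.LT ∧ (P (fUL m) ∧ (P (fU x) ∧ opair m (opair x b) ∈ p.AT)))))))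

def c5 : Prop := ¬ (a ∈ p.S0 ∧ (a ∈ p.E ∧ (opair a c ∈ p.Y ∧ (opair (zfst (zsnd a)) b ∈ p.LT ∧ opair b c ∈ p.TT)))) ∨
  (P (fI a c) ∨ N (fUL b))

def c6 : Prop := ¬ (a ∈ p.S1 ∧ (a ∈ p.E ∧ (opair a c ∈ p.Y ∧ (opair (zfst (zsnd a)) b ∈ p.LT ∧ opair b (opair e c) ∈ p.AT)))) ∨
  (P (fI a c) ∨ (N (fUL b) ∨ N (fU e)))

def c7 : Prop := ¬ (a ∈ p.S1 ∧ opair (zfst (zsnd a)) b ∈ p.LT) ∨ (N (fUL b) ∨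
  ∃ x, x ∈ p.K ∧ ∃ w, w ∈ p.K ∧ (P (fU x) ∧ (opair b (opair x w) ∈ p.AT ∧ P (fI a w))))

def c8 : Prop := ¬ (a ∈ p.S1 ∧ opair (zfst (zsnd a)) b ∈ p.LT) ∨ (N (fUL b) ∨ (N (fU c) ∨ (N (fU e) ∨ (c = e ∨
  ∃ w, w ∈ p.K ∧ ∃ w', w' ∈ p.K ∧ (opair b (opair c w) ∈ p.AT ∧ (opair b (opair e w') ∈ p.AT ∧
    (N (fI a w) ∨ N (fI a w'))))))))

def c9 : Prop := ¬ a ∈ p.S2 ∨ ∃ x, x ∈ p.K ∧ P (fI a x)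

def c10 : Prop := ¬ a ∈ p.S2 ∨ (b = c ∨ (N (fI a b) ∨ N (fI a c)))

def c11 : Prop := N (fV a b c) ∨ ((∃ n, n ∈ p.K ∧ (a = opair (natZ 0) n ∧ opair n (opair b c) ∈ p.NT)) ∨
  ∃ s, s ∈ p.K ∧ ∃ l, l ∈ p.K ∧ ∃ m, m ∈ p.K ∧ (a = opair (natZ 2) (opair s l) ∧ (P (fVL l b m) ∧
    ((s ∈ p.S2 ∧ (m = ∅ ∧ P (fI s c))) ∨ ((s ∈ p.S1 ∧ (m = ∅ ∧ ∃ x, x ∈ p.K ∧ (P (fI s x) ∧ c = {x}))) ∨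
      (s ∈ p.S1 ∧ (¬ m = ∅ ∧ ((c = p.J ∧ N (fUL m)) ∨
        ∃ w, w ∈ p.K ∧ (opair m (opair c w) ∈ p.AT ∧ P (fI s w))))))))))

def c12 : Prop := N (fVL a b c) ∨ ((a = ∅ ∧ c = ∅) ∨ ∃ t, t ∈ p.K ∧ ∃ l, l ∈ p.K ∧ ∃ x, x ∈ p.K ∧ ∃ m, m ∈ p.K ∧
  (a = opair t l ∧ (c = opair x m ∧ (P (fV t b x) ∧ P (fVL l b m)))))

def c13 : Prop := N (fSP a b) ∨
  ((∃ s, s ∈ p.K ∧ ∃ l, l ∈ p.K ∧ ∃ m, m ∈ p.K ∧ ∃ w, w ∈ p.K ∧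
     (a = opair (natZ 0) (opair s l) ∧ (P (fVL l b m) ∧ (opair m w ∈ p.TT ∧ P (fI s w))))) ∨
  ((∃ t, t ∈ p.K ∧ ∃ u, u ∈ p.K ∧ ∃ x, x ∈ p.K ∧
     (a = opair (natZ 1) (opair t u) ∧ (P (fV t b x) ∧ P (fV u b x)))) ∨
  ((∃ f, f ∈ p.K ∧ (a = opair (natZ 2) f ∧ P (fSN f b))) ∨
  ((∃ f, f ∈ p.K ∧ ∃ g, g ∈ p.K ∧ (a = opair (natZ 3) (opair f g) ∧ (P (fSN f b) ∨ P (fSP g b)))) ∨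
  ((∃ f, f ∈ p.K ∧ a = opair (natZ 4) f) ∨
  (∃ f, f ∈ p.K ∧ ∃ x, x ∈ p.K ∧ (a = opair (natZ 5) f ∧ (P (fU x) ∧ P (fSP f (opair x b))))))))))

def c14 : Prop := N (fSN a b) ∨
  ((∃ s, s ∈ p.K ∧ ∃ l, l ∈ p.K ∧ ∃ m, m ∈ p.K ∧ ∃ w, w ∈ p.K ∧
     (a = opair (natZ 0) (opair s l) ∧ (P (fVL l b m) ∧ (opair m w ∈ p.TT ∧ N (fI s w))))) ∨
  ((∃ t, t ∈ p.K ∧ ∃ u, u ∈ p.K ∧ ∃ x, x ∈ p.K ∧ ∃ y, y ∈ p.K ∧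
     (a = opair (natZ 1) (opair t u) ∧ (P (fV t b x) ∧ (P (fV u b y) ∧ ¬ x = y)))) ∨
  ((∃ f, f ∈ p.K ∧ (a = opair (natZ 2) f ∧ P (fSP f b))) ∨
  ((∃ f, f ∈ p.K ∧ ∃ g, g ∈ p.K ∧ (a = opair (natZ 3) (opair f g) ∧ (P (fSP f b) ∧ P (fSN g b)))) ∨
  ((∃ f, f ∈ p.K ∧ a = opair (natZ 5) f) ∨
  (∃ f, f ∈ p.K ∧ ∃ x, x ∈ p.K ∧ (a = opair (natZ 4) f ∧ (P (fU x) ∧ P (fSN f (opair x b))))))))))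

def c15 : Prop := N (fSP (opair (natZ 4) a) b) ∨ (N (fU c) ∨ P (fSP a (opair c b)))
def c16 : Prop := N (fSN (opair (natZ 5) a) b) ∨ (N (fU c) ∨ P (fSN a (opair c b)))
def c17 : Prop := ¬ a ∈ p.T ∨ P (fSP a ∅)

structure Clauses : Prop where
  h1 : c1 p a P N
  h2 : c2 p a P N
  h3 : c3 a b P N
  h4 : c4 p a b P N
  h5 : c5 p a b c P N
  h6 : c6 p a b c e P N
  h7 : c7 p a b P N
  h8 : c8 p a b c e N
  h9 : c9 p a P
  h10 : c10 p a b c N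
  h11 : c11 p a b c P N
  h12 : c12 p a b c P N
  h13 : c13 p a b P N
  h14 : c14 p a b P N
  h15 : c15 a b c P N
  h16 : c16 a b c P N
  h17 : c17 p a P
end

section
variable (p : Par) (a b c e : Zs)
instance : Cont (c1 p a) := by unfold c1; infer_instance
instance : Cont (c2 p a) := by unfold c2; infer_instance
instance : Cont (c3 a b) := by unfold c3; infer_instance
instance : Cont (c4 p a b) := by unfold c4; infer_instance
instance : Cont (c5 p a b c) := by unfold c5; infer_instance
instance : Cont (c6 p a b c e) := by unfold c6; infer_instance
instance : Cont (c7 p a b) := by unfold c7; infer_instance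
instance : Cont (fun P N => c8 p a b c e N) := by unfold c8; infer_instance
instance : Cont (fun P N => c9 p a P) := by unfold c9; infer_instance
instance : Cont (fun P N => c10 p a b c N) := by unfold c10; infer_instance
instance : Cont (c11 p a b c) := by unfold c11; infer_instance
instance : Cont (c12 p a b c) := by unfold c12; infer_instance
instance : Cont (c13 p a b) := by unfold c13; infer_instance
instance : Cont (c14 p a b) := by unfold c14; infer_instance
instance : Cont (c15 a b c) := by unfold c15; infer_instance
instance : Cont (c16 a b c) := by unfold c16; infer_instance
instance : Cont (fun P N => c17 p a P) := by unfold c17; infer_instance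

theorem Clauses_iff {P N : Zs → Prop} : Clauses p a b c e P N ↔
    c1 p a P N ∧ c2 p a P N ∧ c3 a b P N ∧ c4 p a b P N ∧ c5 p a b c P N ∧ c6 p a b c e P N ∧ c7 p a b P N ∧
    c8 p a b c e N ∧ c9 p a P ∧ c10 p a b c N ∧ c11 p a b c P N ∧ c12 p a b c P N ∧ c13 p a b P N ∧
    c14 p a b P N ∧ c15 a b c P N ∧ c16 a b c P N ∧ c17 p a P :=
  ⟨fun ⟨h1, h2, h3, h4, h5, h6, h7, h8, h9, h10, h11, h12, h13, h14, h15, h16, h17⟩ =>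
    ⟨h1, h2, h3, h4, h5, h6, h7, h8, h9, h10, h11, h12, h13, h14, h15, h16, h17⟩,
   fun ⟨h1, h2, h3, h4, h5, h6, h7, h8, h9, h10, h11, h12, h13, h14, h15, h16, h17⟩ =>
    ⟨h1, h2, h3, h4, h5, h6, h7, h8, h9, h10, h11, h12, h13, h14, h15, h16, h17⟩⟩

theorem Clauses_Cont : Cont (Clauses p a b c e) := by
  have : Clauses p a b c e = _ := funext fun P => funext fun N => propext (Clauses_iff p a b c e)
  rw [this]
  infer_instance
end

section
variable {W : Zs} (p : Par) [hW : ZFM W] [ParIn W p]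
local notation "pos" => fun (v : ℕ → Zs) d => opair (natZ 1) d ∈ v 4
local notation "neg" => fun (v : ℕ → Zs) d => opair (natZ 0) d ∈ v 4
set_option synthInstance.maxHeartbeats 400000
set_option maxHeartbeats 1000000

theorem d1 : DP W (fun v => c1 p (v 0) (pos v) (neg v)) := by unfold c1; beta_reduce; infer_instance
theorem d2 : DP W (fun v => c2 p (v 0) (pos v) (neg v)) := by unfold c2; beta_reduce; infer_instance
theorem d3 : DP W (fun v => c3 (v 0) (v 1) (pos v) (neg v)) := by unfold c3; beta_reduce; infer_instance
theorem d4 : DP W (fun v => c4 p (v 0) (v 1) (pos v) (neg v)) := by unfold c4; beta_reduce; infer_instance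
theorem d5 : DP W (fun v => c5 p (v 0) (v 1) (v 2) (pos v) (neg v)) := by unfold c5; beta_reduce; infer_instance
theorem d6 : DP W (fun v => c6 p (v 0) (v 1) (v 2) (v 3) (pos v) (neg v)) := by unfold c6; beta_reduce; infer_instance
theorem d7 : DP W (fun v => c7 p (v 0) (v 1) (pos v) (neg v)) := by unfold c7; beta_reduce; infer_instance
theorem d8 : DP W (fun v => c8 p (v 0) (v 1) (v 2) (v 3) (neg v)) := by unfold c8; beta_reduce; infer_instance
theorem d9 : DP W (fun v => c9 p (v 0) (pos v)) := by unfold c9; beta_reduce; infer_instance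
theorem d10 : DP W (fun v => c10 p (v 0) (v 1) (v 2) (neg v)) := by unfold c10; beta_reduce; infer_instance
theorem d11 : DP W (fun v => c11 p (v 0) (v 1) (v 2) (pos v) (neg v)) := by unfold c11; beta_reduce; infer_instance
theorem d12 : DP W (fun v => c12 p (v 0) (v 1) (v 2) (pos v) (neg v)) := by unfold c12; beta_reduce; infer_instance
theorem d13 : DP W (fun v => c13 p (v 0) (v 1) (pos v) (neg v)) := by unfold c13; beta_reduce; infer_instance
theorem d14 : DP W (fun v => c14 p (v 0) (v 1) (pos v) (neg v)) := by unfold c14; beta_reduce; infer_instance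
theorem d15 : DP W (fun v => c15 (v 0) (v 1) (v 2) (pos v) (neg v)) := by unfold c15; beta_reduce; infer_instance
theorem d16 : DP W (fun v => c16 (v 0) (v 1) (v 2) (pos v) (neg v)) := by unfold c16; beta_reduce; infer_instance
theorem d17 : DP W (fun v => c17 p (v 0) (pos v)) := by unfold c17; beta_reduce; infer_instance

theorem Clauses_DP : DP W (fun v => Clauses p (v 0) (v 1) (v 2) (v 3) (pos v) (neg v)) := by
  simp only [Clauses_iff]
  exact @DP.and _ _ _ (d1 p) <| @DP.and _ _ _ (d2 p) <| @DP.and _ _ _ d3 <| @DP.and _ _ _ (d4 p) <| @DP.and _ _ _ (d5 p) <|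
    @DP.and _ _ _ (d6 p) <| @DP.and _ _ _ (d7 p) <| @DP.and _ _ _ (d8 p) <| @DP.and _ _ _ (d9 p) <| @DP.and _ _ _ (d10 p) <|
    @DP.and _ _ _ (d11 p) <| @DP.and _ _ _ (d12 p) <| @DP.and _ _ _ (d13 p) <| @DP.and _ _ _ (d14 p) <| @DP.and _ _ _ d15 <|
    @DP.and _ _ _ d16 (d17 p)
end
end SmallExt

end

noncomputable section
namespace SmallExt
set_option linter.unusedVariables false
set_option linter.unusedSectionVars false
attribute [local instance] Classical.propDecidable

theorem ztuple_mem_ZPow {X : Zs} : ∀ l : List Zs, ztuple l ∈ ZPow X l.length ↔ LK X l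
  | [] => by simp [ztuple, ZPow, LK]
  | [a] => by simp [ztuple, ZPow, LK]
  | a :: b :: l => by
    rw [LK_cons, ← ztuple_mem_ZPow (b :: l)]
    exact ZFSet.pair_mem_prod

theorem mem_ZPow {X : Zs} : ∀ (n : ℕ) {w : Zs}, w ∈ ZPow X n → ∃ l, l.length = n ∧ LK X l ∧ w = ztuple l
  | 0, w, h => ⟨[], rfl, LK_nil, ZFSet.mem_singleton.1 h⟩
  | 1, w, h => ⟨[w], rfl, LK_cons.2 ⟨h, LK_nil⟩, rfl⟩
  | n+2, w, h => by
    obtain ⟨a, ha, b, hb, e⟩ := ZFSet.mem_prod.1 h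
    obtain ⟨l, h1, h2, h3⟩ := mem_ZPow (n+1) hb
    refine ⟨a :: l, by simp [h1], LK_cons.2 ⟨ha, h2⟩, ?_⟩
    rw [ztuple_cons (by intro hh; rw [hh] at h1; simp at h1), e, h3]
    rfl

theorem ztuple_inj : ∀ {l l' : List Zs}, l.length = l'.length → ztuple l = ztuple l' → l = l'
  | [], [], _, _ => rfl
  | [a], [b], _, h => by rw [show a = b from h]
  | a :: b :: l, a' :: b' :: l', hl, h => by
    obtain ⟨h1, h2⟩ := opair_inj.1 h
    rw [h1, ztuple_inj (l := b :: l) (l' := b' :: l') (by simpa using hl) h2]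
  | [], _ :: _, hl, _ => by simp at hl
  | _ :: _, [], hl, _ => by simp at hl
  | [_], _ :: _ :: _, hl, _ => by simp at hl
  | _ :: _ :: _, [_], hl, _ => by simp at hl

theorem LK_append {K b : Zs} {l : List Zs} : LK K (l ++ [b]) ↔ LK K l ∧ b ∈ K := by
  simp only [LK, List.mem_append, List.mem_singleton]
  exact ⟨fun h => ⟨fun x hx => h x (Or.inl hx), h b (Or.inr rfl)⟩,
    fun h x hx => hx.elim (h.1 x) (fun e => e ▸ h.2)⟩

/-- the value chosen by epsilon for an unsatisfiable predicate -/
def junk0 : Zs := Classical.epsilon (fun _ : Zs => False)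

/-- interpretation of function symbols -/
def fIv (I : Zs → Zs) (s : Zs) (args : List Zs) : Zs :=
  if args = [] then I s else Classical.epsilon fun b => ztuple (args ++ [b]) ∈ I s

def rIv (I : Zs → Zs) (s : Zs) (args : List Zs) : Prop := ztuple args ∈ I s

theorem SatStr_eq (M : Zs) (f : Fm) : SatStr M f ↔ Sat (· ∈ zfst M) (rIv (iapp (zsnd M))) (fIv (iapp (zsnd M))) f (fun _ => ∅) :=
  Iff.rfl

abbrev tz (t : Zs) : Zs := zfst (iapp (tciTheta t) (tciUdot t))
abbrev ty (t s : Zs) : Zs := zfst (iapp (tciTheta t) s)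
abbrev ti (t s : Zs) : Zs := zsnd (iapp (tciTheta t) s)

/-- semantic requirements on a structure -/
structure StrOK (t X : Zs) (I : Zs → Zs) : Prop where
  Xz : X ⊆ tz t
  X1 : ti t (tciUdot t) = natZ 1 → tz t ⊆ X
  k0 : ∀ s ∈ tciSig t, symKind s = natZ 0 → ∀ w ∈ I s, w ∈ ty t s ∧ w ∈ ZPow X (arityOf s)
  k0e : ∀ s ∈ tciSig t, symKind s = natZ 0 → ti t s = natZ 1 → ∀ w ∈ ty t s, w ∈ ZPow X (arityOf s) → w ∈ I s
  k1 : ∀ s ∈ tciSig t, symKind s = natZ 1 → ∀ w ∈ I s, w ∈ ty t s ∧ w ∈ ZPow X (arityOf s + 1)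
  k1e : ∀ s ∈ tciSig t, symKind s = natZ 1 → ti t s = natZ 1 → ∀ w ∈ ty t s, w ∈ ZPow X (arityOf s + 1) → w ∈ I s
  k1u : ∀ s ∈ tciSig t, symKind s = natZ 1 → ∀ args : List Zs, args.length = arityOf s → LK X args →
    ∃! b, b ∈ X ∧ ztuple (args ++ [b]) ∈ I s
  k2 : ∀ s ∈ tciSig t, symKind s = natZ 2 → I s ∈ ty t s ∧ I s ∈ X

theorem tci_pair {t : Zs} (h : IsTCI t) {s : Zs} (hs : s ∈ insert (tciUdot t) (tciSig t)) :
    iapp (tciTheta t) s = opair (ty t s) (ti t s) ∧ (ti t s = natZ 0 ∨ ti t s = natZ 1) := by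
  obtain ⟨y, i, e, hi, _⟩ := h.2.2.2.2.2.2.2.1 s hs
  simp only [ty, ti, e, zfst_opair, zsnd_opair]
  exact ⟨trivial, hi⟩

theorem StrOK_of_models {M t : Zs} (h : ModelsTCI M t) : StrOK t (zfst M) (iapp (zsnd M)) := by
  obtain ⟨h1, h2, h3, h4, h5, h6⟩ := h
  have hU := tci_pair h1 (ZFSet.mem_insert_iff.2 (Or.inl rfl))
  have hs := fun s (hs : s ∈ tciSig t) => tci_pair h1 (ZFSet.mem_insert_iff.2 (Or.inr hs))
  have hu := h4 _ _ hU.1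
  have hh := fun s hss => h5 s hss _ _ (hs s hss).1
  constructor
  · rcases hU.2 with h | h
    · exact hu.1 h
    · rw [hu.2 h]
  · intro h; rw [hu.2 h]
  · intro s hs' hk w hw
    rcases (hs s hs').2 with h | h
    · exact ZFSet.mem_inter.1 (((hh s hs').1 hk).1 h hw)
    · rw [((hh s hs').1 hk).2 h] at hw
      exact ZFSet.mem_inter.1 hw
  · intro s hs' hk hi w hw hw'
    rw [((hh s hs').1 hk).2 hi]
    exact ZFSet.mem_inter.2 ⟨hw, hw'⟩
  · intro s hs' hk w hw
    rcases (hs s hs').2 with h | h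
    · exact ZFSet.mem_inter.1 (((hh s hs').2.1 hk).2.1 h hw)
    · rw [((hh s hs').2.1 hk).2.2 h] at hw
      exact ZFSet.mem_inter.1 hw
  · intro s hs' hk hi w hw hw'
    rw [((hh s hs').2.1 hk).2.2 hi]
    exact ZFSet.mem_inter.2 ⟨hw, hw'⟩
  · intro s hs' hk
    exact ((hh s hs').2.1 hk).1
  · intro s hs' hk
    exact (hh s hs').2.2 hk

theorem models_of_StrOK {M t : Zs} (h1 : IsTCI t) (h2 : M = opair (zfst M) (zsnd M)) (h3 : IsZFunc (zsnd M) (tciSig t))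
    (h : StrOK t (zfst M) (iapp (zsnd M))) (h6 : ∀ c ∈ tciT t, ∀ f : Fm, FmCode f = c → SatStr M f) : ModelsTCI M t := by
  refine ⟨h1, h2, h3, ?_, ?_, h6⟩
  · intro y i e
    have e1 : tz t = y := by simp only [tz, e, zfst_opair]
    have e2 : ti t (tciUdot t) = i := by simp only [ti, e, zsnd_opair]
    refine ⟨fun _ => e1 ▸ h.Xz, fun hi => ?_⟩
    ext x
    exact ⟨fun hx => e1 ▸ h.Xz hx, fun hx => h.X1 (e2.trans hi) (e1 ▸ hx)⟩
  · intro s hs y i e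
    have e1 : ty t s = y := by simp only [ty, e, zfst_opair]
    have e2 : ti t s = i := by simp only [ti, e, zsnd_opair]
    subst e1; subst e2
    refine ⟨fun hk => ⟨fun hi w hw => ZFSet.mem_inter.2 (h.k0 s hs hk w hw), fun hi => ?_⟩,
      fun hk => ⟨h.k1u s hs hk, fun hi w hw => ZFSet.mem_inter.2 (h.k1 s hs hk w hw), fun hi => ?_⟩, h.k2 s hs⟩
    · ext w
      rw [ZFSet.mem_inter]
      exact ⟨h.k0 s hs hk w, fun hw => h.k0e s hs hk hi w hw.1 hw.2⟩
    · ext w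
      rw [ZFSet.mem_inter]
      exact ⟨h.k1 s hs hk w, fun hw => h.k1e s hs hk hi w hw.1 hw.2⟩

theorem arityOf_eq {s : Zs} {n : ℕ} (h : symArity s = natZ n) : arityOf s = n := by
  unfold arityOf zToNat
  have hx : ∃ m, natZ m = symArity s := ⟨n, h.symm⟩
  rw [dif_pos hx]
  exact natZ_inj (hx.choose_spec.trans h)

theorem sym_ar {t s : Zs} (h : IsTCI t) (hs : s ∈ tciSig t) : symArity s = natZ (arityOf s) := by
  obtain ⟨k, a, nm, e, _, n, hn⟩ := h.2.1 s hs
  have : symArity s = natZ n := by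
    unfold symArity
    rw [e, zsnd_opair, zfst_opair, hn]
  rw [arityOf_eq this, this]

theorem sym_kind {t s : Zs} (h : IsTCI t) (hs : s ∈ tciSig t) : symKind s = natZ 0 ∨ symKind s = natZ 1 ∨ symKind s = natZ 2 := by
  obtain ⟨k, a, nm, e, hk, _⟩ := h.2.1 s hs
  have : symKind s = k := by unfold symKind; rw [e, zfst_opair]
  rw [this]; exact hk

section
variable {t X : Zs} {I : Zs → Zs} (h : StrOK t X I)
include h

theorem fIv_pos {s : Zs} (hs : s ∈ tciSig t) (hk : symKind s = natZ 1) {args : List Zs} (hl : args.length = arityOf s)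
    (h0 : args ≠ []) (hX : LK X args) : fIv I s args ∈ X ∧ ztuple (args ++ [fIv I s args]) ∈ I s := by
  obtain ⟨b, ⟨hb, hb'⟩, _⟩ := h.k1u s hs hk args hl hX
  have : ztuple (args ++ [fIv I s args]) ∈ I s := by
    unfold fIv
    rw [if_neg h0]
    exact Classical.epsilon_spec (p := fun b => ztuple (args ++ [b]) ∈ I s) ⟨b, hb'⟩
  refine ⟨?_, this⟩
  have h2 := (h.k1 s hs hk _ this).2
  have : (args ++ [fIv I s args]).length = arityOf s + 1 := by simp [hl]
  rw [← this, ztuple_mem_ZPow, LK_append] at h2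
  exact h2.2

theorem k1_mem {s : Zs} (hs : s ∈ tciSig t) (hk : symKind s = natZ 1) {args : List Zs} (hl : args.length = arityOf s)
    {b : Zs} (hb : ztuple (args ++ [b]) ∈ I s) : LK X args ∧ b ∈ X := by
  have h2 := (h.k1 s hs hk _ hb).2
  have : (args ++ [b]).length = arityOf s + 1 := by simp [hl]
  rw [← this, ztuple_mem_ZPow, LK_append] at h2
  exact h2

theorem fIv_eq {s : Zs} (hs : s ∈ tciSig t) (hk : symKind s = natZ 1) {args : List Zs} (hl : args.length = arityOf s)
    (h0 : args ≠ []) {b : Zs} (hb : ztuple (args ++ [b]) ∈ I s) : fIv I s args = b := by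
  obtain ⟨hX, hbX⟩ := k1_mem h hs hk hl hb
  exact (h.k1u s hs hk args hl hX).unique (fIv_pos h hs hk hl h0 hX) ⟨hbX, hb⟩

theorem fIv_neg {s : Zs} (hs : s ∈ tciSig t) (hk : symKind s = natZ 1) {args : List Zs} (hl : args.length = arityOf s)
    (h0 : args ≠ []) (hX : ¬ LK X args) : fIv I s args = junk0 := by
  unfold fIv junk0
  rw [if_neg h0]
  congr 1
  funext b
  exact propext ⟨fun hb => hX (k1_mem h hs hk hl hb).1, False.elim⟩

theorem fIv_nil1 {s : Zs} (hs : s ∈ tciSig t) (hk : symKind s = natZ 1) (hl : arityOf s = 0) :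
    ∃ b ∈ X, b ∈ I s ∧ fIv I s [] = {b} := by
  obtain ⟨b, ⟨hb, hb'⟩, hu⟩ := h.k1u s hs hk [] hl.symm LK_nil
  refine ⟨b, hb, hb', ?_⟩
  unfold fIv
  rw [if_pos rfl]
  ext x
  rw [ZFSet.mem_singleton]
  constructor
  · intro hx
    exact hu x ⟨(k1_mem h hs hk (args := []) hl.symm (b := x) hx).2, hx⟩
  · rintro rfl; exact hb'

/-- possible values of terms -/
def VOK (z x : Zs) : Prop := x ∈ z ∨ (∃ b ∈ z, x = {b}) ∨ x = junk0

theorem eval_VOK (τ : Tm) (v : ℕ → Zs) (hu : τ.usesSig (tciSig t)) (hv : ∀ n ∈ τ.free, v n ∈ tz t) :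
    VOK (tz t) (Tm.eval (fIv I) v τ) := by
  cases τ with
  | var n => exact Or.inl (hv n rfl)
  | param a => exact hu.elim
  | func s n a =>
    obtain ⟨hs, hk, ha⟩ := hu
    simp only [Tm.eval]
    rcases hk with ⟨hk, hn⟩ | ⟨hk, hn⟩
    · have hl : (List.ofFn fun i => Tm.eval (fIv I) v (a i)).length = arityOf s := by
        rw [List.length_ofFn, arityOf_eq hn]
      by_cases h0 : (List.ofFn fun i => Tm.eval (fIv I) v (a i)) = []
      · rw [h0] at hl ⊢
        obtain ⟨b, hb, _, e⟩ := fIv_nil1 h hs hk hl.symm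
        exact Or.inr (Or.inl ⟨b, h.Xz hb, e⟩)
      · by_cases hX : LK X (List.ofFn fun i => Tm.eval (fIv I) v (a i))
        · exact Or.inl (h.Xz (fIv_pos h hs hk hl h0 hX).1)
        · exact Or.inr (Or.inr (fIv_neg h hs hk hl h0 hX))
    · subst hn
      have : (List.ofFn fun i => Tm.eval (fIv I) v (a i)) = [] := by simp
      rw [this]
      unfold fIv
      rw [if_pos rfl]
      exact Or.inl (h.Xz (h.k2 s hs hk).2)
end

/-- valuation attached to a list -/
def vl (l : List Zs) : ℕ → Zs := fun n => l.getD n ∅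

theorem vl_nil : vl [] = fun _ => ∅ := by funext n; simp [vl]

theorem vl_cons (b : Zs) (l : List Zs) : vcons b (vl l) = vl (b :: l) := by
  funext n
  cases n <;> simp [vl, vcons]

theorem vl_get {l : List Zs} {n : ℕ} {b : Zs} (h : l[n]? = some b) : vl l n = b := by
  simp [vl, List.getD, h]

/-- codes are injective -/
theorem TmCode_inj : ∀ {τ τ' : Tm}, TmCode τ = TmCode τ' → τ = τ' := by
  intro τ
  induction τ with
  | var n =>
    intro τ' h
    cases τ' with
    | var m => rw [natZ_inj (opair_inj.1 h).2]
    | param a => exact absurd (natZ_inj (opair_inj.1 h).1) (by decide)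
    | func s n a => exact absurd (natZ_inj (opair_inj.1 h).1) (by decide)
  | param a =>
    intro τ' h
    cases τ' with
    | var m => exact absurd (natZ_inj (opair_inj.1 h).1) (by decide)
    | param a' => rw [(opair_inj.1 h).2]
    | func s n a => exact absurd (natZ_inj (opair_inj.1 h).1) (by decide)
  | func s n a ih =>
    intro τ' h
    cases τ' with
    | var m => exact absurd (natZ_inj (opair_inj.1 h).1) (by decide)
    | param a' => exact absurd (natZ_inj (opair_inj.1 h).1) (by decide)
    | func s' n' a' =>
      obtain ⟨e1, e2⟩ := opair_inj.1 (opair_inj.1 h).2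
      have e3 := zlist_inj e2
      have e4 : n = n' := by simpa using congrArg List.length e3
      subst e4; subst e1
      have := List.ofFn_injective e3
      congr 1
      funext i
      exact ih i (congrFun this i)

theorem codes_inj {n n' : ℕ} {a : Fin n → Tm} {a' : Fin n' → Tm}
    (h : zlist (List.ofFn fun i => TmCode (a i)) = zlist (List.ofFn fun i => TmCode (a' i))) :
    ∃ e : n = n', a = fun i => a' (Fin.cast e i) := by
  have e3 := zlist_inj h
  have e4 : n = n' := by simpa using congrArg List.length e3
  subst e4
  refine ⟨rfl, funext fun i => TmCode_inj (congrFun (List.ofFn_injective e3) i)⟩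

theorem FmCode_inj : ∀ {f g : Fm}, FmCode f = FmCode g → f = g := by
  intro f
  induction f with
  | rel s n a =>
    intro g h
    cases g with
    | rel s' n' a' =>
      obtain ⟨e1, e2⟩ := opair_inj.1 (opair_inj.1 h).2
      obtain ⟨e, e3⟩ := codes_inj e2
      subst e; subst e1; subst e3; rfl
    | _ => exact absurd (natZ_inj (opair_inj.1 h).1) (by decide)
  | eq t u =>
    intro g h
    cases g with
    | eq t' u' =>
      obtain ⟨e1, e2⟩ := opair_inj.1 (opair_inj.1 h).2
      rw [TmCode_inj e1, TmCode_inj e2]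
    | _ => exact absurd (natZ_inj (opair_inj.1 h).1) (by decide)
  | not f ih =>
    intro g h
    cases g with
    | not g => rw [ih (opair_inj.1 h).2]
    | _ => exact absurd (natZ_inj (opair_inj.1 h).1) (by decide)
  | imp f g ih1 ih2 =>
    intro g h
    cases g with
    | imp f' g' =>
      obtain ⟨e1, e2⟩ := opair_inj.1 (opair_inj.1 h).2
      rw [ih1 e1, ih2 e2]
    | _ => exact absurd (natZ_inj (opair_inj.1 h).1) (by decide)
  | all f ih =>
    intro g h
    cases g with
    | all g => rw [ih (opair_inj.1 h).2]
    | _ => exact absurd (natZ_inj (opair_inj.1 h).1) (by decide)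
  | ex f ih =>
    intro g h
    cases g with
    | ex g => rw [ih (opair_inj.1 h).2]
    | _ => exact absurd (natZ_inj (opair_inj.1 h).1) (by decide)

end SmallExt

end

noncomputable section
namespace SmallExt
set_option linter.unusedVariables false
set_option linter.unusedSectionVars false
attribute [local instance] Classical.propDecidable

/-- correctness of the parameters -/
structure Good (t A : Zs) (p : Par) : Prop where
  tci : IsTCI t
  Atr : A.IsTransitive
  hT : ∀ c ∈ tciT t, c ∈ A
  hσ : ∀ s ∈ tciSig t, s ∈ A
  hz : ∀ b ∈ tz t, b ∈ A
  hY : ∀ s ∈ tciSig t, ∀ w ∈ ty t s, w ∈ A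
  AK : ∀ a ∈ A, a ∈ p.K
  hop : ∀ x ∈ p.K, ∀ y ∈ p.K, opair x y ∈ p.K
  hsing : ∀ x ∈ p.K, ({x} : Zs) ∈ p.K
  hnat : ∀ n, natZ n ∈ p.K
  JK : p.J ∈ p.K
  hJ : p.J = junk0 ∨ (p.J = {tz t} ∧ junk0 ∉ p.K)
  pz : p.z = tz t
  Z1 : ∀ x, x ∈ p.Z1 ↔ x ∈ tz t ∧ ti t (tciUdot t) = natZ 1
  pT : p.T = tciT t
  S0 : ∀ s, s ∈ p.S0 ↔ s ∈ tciSig t ∧ symKind s = natZ 0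
  S1 : ∀ s, s ∈ p.S1 ↔ s ∈ tciSig t ∧ symKind s = natZ 1
  S2 : ∀ s, s ∈ p.S2 ↔ s ∈ tciSig t ∧ symKind s = natZ 2
  E : ∀ s, s ∈ p.E ↔ s ∈ tciSig t ∧ ti t s = natZ 1
  Y : ∀ s w, opair s w ∈ p.Y ↔ s ∈ tciSig t ∧ w ∈ ty t s
  LT : ∀ q, q ∈ p.LT ↔ ∃ l, LK p.K l ∧ q = opair (natZ l.length) (zlist l)
  TT : ∀ q, q ∈ p.TT ↔ ∃ l, LK p.K l ∧ q = opair (zlist l) (ztuple l)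
  AT : ∀ q, q ∈ p.AT ↔ ∃ l b, LK p.K l ∧ b ∈ p.K ∧ q = opair (zlist l) (opair b (ztuple (l ++ [b])))
  NT : ∀ q, q ∈ p.NT ↔ ∃ l n b, LK p.K l ∧ l[n]? = some b ∧ q = opair (natZ n) (opair (zlist l) b)

def rho (J x : Zs) : Zs := if x = junk0 then J else x

theorem opair_tr {A a b : Zs} (h : A.IsTransitive) (hab : opair a b ∈ A) : a ∈ A ∧ b ∈ A := by
  rw [mem_opair_def] at hab
  have : ({a, b} : Zs) ∈ A := h _ hab (ZFSet.mem_pair.2 (Or.inr rfl))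
  exact ⟨h _ this (ZFSet.mem_pair.2 (Or.inl rfl)), h _ this (ZFSet.mem_pair.2 (Or.inr rfl))⟩

theorem ofFn_map {α : Type*} {n : ℕ} (a : Fin n → Tm) (g : Tm → α) :
    (List.ofFn fun i => g (a i)) = (List.ofFn a).map g := by
  rw [List.map_ofFn]; rfl

theorem fact_inj {k k' : ℕ} {x y z x' y' z' : Zs} (h : fact k x y z = fact k' x' y' z') :
    k = k' ∧ x = x' ∧ y = y' ∧ z = z' := by
  obtain ⟨h1, h2⟩ := opair_inj.1 h
  obtain ⟨h3, h4⟩ := opair_inj.1 h2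
  obtain ⟨h5, h6⟩ := opair_inj.1 h4
  exact ⟨natZ_inj h1, h3, h5, h6⟩

theorem vl_mem {X : Zs} {l : List Zs} (hl : LK X l) {n : ℕ} (hn : n < l.length) : l[n]? = some (vl l n) ∧ vl l n ∈ X := by
  have e : l[n]? = some l[n] := List.getElem?_eq_getElem hn
  rw [vl_get e]
  exact ⟨e, hl _ (List.getElem_mem hn)⟩

section
variable {t A : Zs} {p : Par} (G : Good t A p)
include G

theorem Good.zK {x : Zs} (h : x ∈ tz t) : x ∈ p.K := G.AK _ (G.hz _ h)
theorem Good.σK {x : Zs} (h : x ∈ tciSig t) : x ∈ p.K := G.AK _ (G.hσ _ h)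
theorem Good.fact {k : ℕ} {x y z : Zs} (hx : x ∈ p.K) (hy : y ∈ p.K) (hz : z ∈ p.K) : fact k x y z ∈ p.K :=
  G.hop _ (G.hnat _) _ (G.hop _ hx _ (G.hop _ hy _ hz))
theorem Good.emp : ∅ ∈ p.K := G.hnat 0
theorem Good.zl {l : List Zs} (h : LK p.K l) : zlist l ∈ p.K := zlist_mem G.hop G.emp l h
theorem Good.zt {l : List Zs} (h : LK p.K l) : ztuple l ∈ p.K := ztuple_mem G.hop G.emp l h

theorem Good.rho_z {x : Zs} (h : x ∈ tz t) : rho p.J x = x := by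
  unfold rho
  split
  · next e =>
    rcases G.hJ with h' | ⟨_, h'⟩
    · rw [h', e]
    · exact absurd (e ▸ G.zK h) h'
  · rfl

theorem Good.rho_z' {x : Zs} (h : rho p.J x ∈ tz t) : x ∈ tz t := by
  unfold rho at h
  split at h
  · next e =>
    rcases G.hJ with h' | ⟨h', _⟩
    · rw [e, ← h']; exact h
    · rw [h'] at h
      exact absurd (ZFSet.mem_singleton.2 rfl) (ZFSet.mem_asymm h)
  · exact h

theorem Good.rho_sing {b : Zs} (h : b ∈ tz t) : rho p.J {b} = {b} := by
  unfold rho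
  split
  · next e =>
    rcases G.hJ with h' | ⟨_, h'⟩
    · rw [h', e]
    · exact absurd (e ▸ G.hsing _ (G.zK h)) h'
  · rfl

theorem Good.rho_junk : rho p.J junk0 = p.J := if_pos rfl

theorem Good.rho_K {x : Zs} (h : VOK (tz t) x) : rho p.J x ∈ p.K := by
  rcases h with h | ⟨b, h, rfl⟩ | rfl
  · rw [G.rho_z h]; exact G.zK h
  · rw [G.rho_sing h]; exact G.hsing _ (G.zK h)
  · rw [G.rho_junk]; exact G.JK

theorem Good.rho_ne {x : Zs} (h : VOK (tz t) x) (hx : x ≠ junk0) (h' : p.J ≠ junk0) : rho p.J x ≠ p.J := by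
  have hJ := (G.hJ.resolve_left h').1
  have e : rho p.J x = x := if_neg hx
  rw [e, hJ]
  rcases h with h | ⟨b, h, rfl⟩ | rfl
  · rintro rfl; exact absurd (ZFSet.mem_singleton.2 rfl) (ZFSet.mem_asymm h)
  · intro e
    rw [ZFSet.singleton_inj.1 e] at h
    exact ZFSet.mem_irrefl _ h
  · exact absurd rfl hx

theorem Good.rho_inj {x y : Zs} (hx : VOK (tz t) x) (hy : VOK (tz t) y) (h : rho p.J x = rho p.J y) : x = y := by
  by_cases hJ : p.J = junk0
  · have : ∀ x, rho p.J x = x := by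
      intro x; unfold rho; split
      · next e => rw [hJ, e]
      · rfl
    rwa [this, this] at h
  · by_cases h1 : x = junk0 <;> by_cases h2 : y = junk0
    · rw [h1, h2]
    · rw [h1, G.rho_junk] at h; exact absurd h.symm (G.rho_ne hy h2 hJ)
    · rw [h2, G.rho_junk] at h; exact absurd h (G.rho_ne hx h1 hJ)
    · rwa [rho, if_neg h1, rho, if_neg h2] at h

variable {X : Zs} {I : Zs → Zs} (h : StrOK t X I)
include h

theorem Good.XK {x : Zs} (hx : x ∈ X) : x ∈ p.K := G.zK (h.Xz hx)
theorem Good.LXK {l : List Zs} (hx : LK X l) : LK p.K l := fun x hx' => G.XK h (hx x hx')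

theorem Good.rho_map {l : List Zs} (hl : LK X l) : l.map (rho p.J) = l := by
  conv_rhs => rw [← List.map_id l]
  exact List.map_congr_left fun x hx => G.rho_z (h.Xz (hl x hx))

theorem Good.rho_map' {l : List Zs} (hl : LK X (l.map (rho p.J))) : l.map (rho p.J) = l := by
  conv_rhs => rw [← List.map_id l]
  exact List.map_congr_left fun x hx => G.rho_z (G.rho_z' (h.Xz (hl _ (List.mem_map_of_mem hx))))

theorem Good.rho_rel {s : Zs} (hs : s ∈ tciSig t) (hk : symKind s = natZ 0) {l : List Zs} (hl : l.length = arityOf s) :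
    ztuple (l.map (rho p.J)) ∈ I s ↔ ztuple l ∈ I s := by
  constructor
  · intro hh
    have := (h.k0 s hs hk _ hh).2
    rw [← hl, ← List.length_map (f := rho p.J), ztuple_mem_ZPow] at this
    rwa [G.rho_map' h this] at hh
  · intro hh
    have := (h.k0 s hs hk _ hh).2
    rw [← hl, ztuple_mem_ZPow] at this
    rwa [G.rho_map h this]
end

/-- the intended facts in a real structure -/
def RV (t A J X : Zs) (I : Zs → Zs) (c a b : Zs) : Prop :=
  ∃ τ l, c = TmCode τ ∧ c ∈ A ∧ τ.usesSig (tciSig t) ∧ a = zlist l ∧ LK X l ∧ (∀ n ∈ τ.free, n < l.length) ∧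
    b = rho J (τ.eval (fIv I) (vl l))

def RVL (t A J X : Zs) (I : Zs → Zs) (c a b : Zs) : Prop :=
  ∃ (τs : List Tm) (l : List Zs), c = zlist (τs.map TmCode) ∧ c ∈ A ∧ (∀ τ ∈ τs, τ.usesSig (tciSig t) ∧ ∀ n ∈ τ.free, n < l.length) ∧
    a = zlist l ∧ LK X l ∧ b = zlist (τs.map fun τ => rho J (τ.eval (fIv I) (vl l)))

def RS (Q : Prop → Prop) (t A J X : Zs) (I : Zs → Zs) (c a : Zs) : Prop :=
  ∃ f l, c = FmCode f ∧ c ∈ A ∧ f.usesSig (tciSig t) ∧ a = zlist l ∧ LK X l ∧ (∀ n ∈ f.free, n < l.length) ∧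
    Q (Sat (· ∈ X) (rIv I) (fIv I) f (vl l))

def RR (t A J X : Zs) (I : Zs → Zs) : ℕ → Zs → Zs → Zs → Prop
  | 0, x, _, _ => x ∈ X
  | 1, x, _, _ => ∃ l, x = zlist l ∧ LK X l
  | 2, x, y, _ => x ∈ tciSig t ∧ ((symKind x = natZ 2 ∧ y = I x) ∨ (symKind x ≠ natZ 2 ∧ y ∈ I x))
  | 3, x, y, z => RV t A J X I x y z
  | 4, x, y, z => RVL t A J X I x y z
  | 5, x, y, _ => RS (fun q => q) t A J X I x y
  | 6, x, y, _ => RS (fun q => ¬ q) t A J X I x y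
  | _, _, _, _ => False

end SmallExt

end

noncomputable section
namespace SmallExt
set_option linter.unusedVariables false
set_option linter.unusedSectionVars false
attribute [local instance] Classical.propDecidable

def SS (t A : Zs) (p : Par) (X : Zs) (I : Zs → Zs) (d : Zs) : Prop :=
  ∃ k x y z, d = fact k x y z ∧ RR t A p.J X I k x y z

theorem SS_iff {t A : Zs} {p : Par} {X : Zs} {I : Zs → Zs} {k : ℕ} {x y z : Zs} :
    SS t A p X I (fact k x y z) ↔ RR t A p.J X I k x y z := by
  constructor
  · rintro ⟨k', x', y', z', e, h⟩
    obtain ⟨rfl, rfl, rfl, rfl⟩ := fact_inj e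
    exact h
  · intro h; exact ⟨k, x, y, z, rfl, h⟩

def PP (t A : Zs) (p : Par) (X : Zs) (I : Zs → Zs) (d : Zs) : Prop := d ∈ p.K ∧ SS t A p X I d
def NN (t A : Zs) (p : Par) (X : Zs) (I : Zs → Zs) (d : Zs) : Prop := d ∈ p.K ∧ ¬ SS t A p X I d

section
variable {t A : Zs} {p : Par} (G : Good t A p) {X : Zs} {I : Zs → Zs} (h : StrOK t X I)
include G

theorem mkP (k : ℕ) {x y z : Zs} (hx : x ∈ p.K) (hy : y ∈ p.K) (hz : z ∈ p.K) (hr : RR t A p.J X I k x y z) :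
    PP t A p X I (fact k x y z) := ⟨G.fact hx hy hz, SS_iff.2 hr⟩

theorem mkN (k : ℕ) {x y z : Zs} (hx : x ∈ p.K) (hy : y ∈ p.K) (hz : z ∈ p.K) (hr : ¬ RR t A p.J X I k x y z) :
    NN t A p X I (fact k x y z) := ⟨G.fact hx hy hz, fun e => hr (SS_iff.1 e)⟩

theorem Good.ltIff {s m : Zs} (hs : s ∈ tciSig t) : opair (zfst (zsnd s)) m ∈ p.LT ↔
    ∃ l, LK p.K l ∧ l.length = arityOf s ∧ m = zlist l := by
  have e : zfst (zsnd s) = natZ (arityOf s) := sym_ar G.tci hs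
  rw [e, G.LT]
  constructor
  · rintro ⟨l, h1, h2⟩
    obtain ⟨h3, h4⟩ := opair_inj.1 h2
    exact ⟨l, h1, (natZ_inj h3).symm, h4⟩
  · rintro ⟨l, h1, h2, h3⟩
    exact ⟨l, h1, by rw [h2, h3]⟩

theorem Good.ttIff {l : List Zs} {w : Zs} : opair (zlist l) w ∈ p.TT ↔ LK p.K l ∧ w = ztuple l := by
  rw [G.TT]
  constructor
  · rintro ⟨l', h1, h2⟩
    obtain ⟨h3, h4⟩ := opair_inj.1 h2
    rw [zlist_inj h3]; exact ⟨h1, h4⟩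
  · rintro ⟨h1, h2⟩; exact ⟨l, h1, by rw [h2]⟩

theorem Good.atIff {l : List Zs} {x w : Zs} : opair (zlist l) (opair x w) ∈ p.AT ↔
    LK p.K l ∧ x ∈ p.K ∧ w = ztuple (l ++ [x]) := by
  rw [G.AT]
  constructor
  · rintro ⟨l', b, h1, hb, h2⟩
    obtain ⟨h3, h4⟩ := opair_inj.1 h2
    obtain ⟨h5, h6⟩ := opair_inj.1 h4
    rw [zlist_inj h3, h5]; exact ⟨h1, hb, h6⟩
  · rintro ⟨h1, hb, h2⟩; exact ⟨l, x, h1, hb, by rw [h2]⟩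

theorem Good.ntIff {l : List Zs} {n : ℕ} {b : Zs} : opair (natZ n) (opair (zlist l) b) ∈ p.NT ↔
    LK p.K l ∧ l[n]? = some b := by
  rw [G.NT]
  constructor
  · rintro ⟨l', n', b', h1, hb, h2⟩
    obtain ⟨h3, h4⟩ := opair_inj.1 h2
    obtain ⟨h5, h6⟩ := opair_inj.1 h4
    rw [natZ_inj h3, zlist_inj h5, h6]; exact ⟨h1, hb⟩
  · rintro ⟨h1, hb⟩; exact ⟨l, n, b, h1, hb, rfl⟩

theorem LK_of_UL {l : List Zs} (hh : ∃ l', zlist l = zlist l' ∧ LK X l') : LK X l := by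
  obtain ⟨l', e, h⟩ := hh
  rw [zlist_inj e]; exact h

include h
local notation "PX" => PP t A p X I
local notation "NX" => NN t A p X I

theorem pU {x : Zs} (hx : x ∈ X) : PX (fU x) := mkP G 0 (G.XK h hx) G.emp G.emp hx
theorem pUL {l : List Zs} (hx : LK X l) : PX (fUL (zlist l)) := mkP G 1 (G.zl (G.LXK h hx)) G.emp G.emp ⟨l, rfl, hx⟩
theorem nUL {l : List Zs} (hl : LK p.K l) (hx : ¬ LK X l) : NX (fUL (zlist l)) :=
  mkN G 1 (G.zl hl) G.emp G.emp (fun hh => hx (LK_of_UL G hh))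

theorem r1 {a : Zs} (ha : a ∈ p.K) : c1 p a PX NX := by
  constructor
  · by_cases hx : a ∈ X
    · right; rw [G.pz]; exact h.Xz hx
    · left; exact mkN G 0 ha G.emp G.emp hx
  · by_cases hx : a ∈ p.Z1
    · left
      obtain ⟨h1, h2⟩ := (G.Z1 a).1 hx
      exact pU G h (h.X1 h2 h1)
    · right; exact hx

theorem r2 {a : Zs} (ha : a ∈ p.K) : c2 p a PX NX := by
  constructor
  · by_cases hx : RR t A p.J X I 1 a ∅ ∅
    · right
      obtain ⟨l, rfl, hl⟩ := hx
      cases l with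
      | nil => left; rfl
      | cons x l =>
        right
        obtain ⟨hx, hl⟩ := LK_cons.1 hl
        exact ⟨x, G.XK h hx, zlist l, G.zl (G.LXK h hl), rfl, pU G h hx, pUL G h hl⟩
    · left; exact mkN G 1 ha G.emp G.emp hx
  · by_cases ha : a = ∅
    · left; subst ha; exact pUL G h (l := []) LK_nil
    · right; exact ha

theorem r3 {a b : Zs} (ha : a ∈ p.K) (hb : b ∈ p.K) : c3 a b PX NX := by
  by_cases hx : a ∈ X
  · by_cases hy : RR t A p.J X I 1 b ∅ ∅
    · left
      obtain ⟨l, rfl, hl⟩ := hy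
      exact pUL G h (l := a :: l) (LK_cons.2 ⟨hx, hl⟩)
    · right; right; exact mkN G 1 hb G.emp G.emp hy
  · right; left; exact mkN G 0 ha G.emp G.emp hx

theorem k01 : natZ 0 ≠ natZ 1 := fun e => absurd (natZ_inj e) (by decide)
theorem k02 : natZ 0 ≠ natZ 2 := fun e => absurd (natZ_inj e) (by decide)
theorem k12 : natZ 1 ≠ natZ 2 := fun e => absurd (natZ_inj e) (by decide)

theorem pI {s w : Zs} (hs : s ∈ tciSig t) (hk : symKind s ≠ natZ 2) (hwK : w ∈ p.K) (hw : w ∈ I s) : PX (fI s w) :=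
  mkP G 2 (G.σK hs) hwK G.emp ⟨hs, Or.inr ⟨hk, hw⟩⟩
theorem nI {s w : Zs} (hs : s ∈ tciSig t) (hk : symKind s ≠ natZ 2) (hwK : w ∈ p.K) (hw : w ∉ I s) : NX (fI s w) :=
  mkN G 2 (G.σK hs) hwK G.emp (by
    rintro ⟨_, ⟨h1, _⟩ | ⟨_, h1⟩⟩
    · exact hk h1
    · exact hw h1)
theorem pI2 {s : Zs} (hs : s ∈ tciSig t) (hk : symKind s = natZ 2) : PX (fI s (I s)) :=
  mkP G 2 (G.σK hs) (G.XK h (h.k2 s hs hk).2) G.emp ⟨hs, Or.inl ⟨hk, rfl⟩⟩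

theorem r4 {a b : Zs} (ha : a ∈ p.K) (hb : b ∈ p.K) : c4 p a b PX NX := by
  by_cases hx : RR t A p.J X I 2 a b ∅
  · right
    obtain ⟨hs, hh⟩ := hx
    rcases sym_kind G.tci hs with hk | hk | hk
    · have hw : b ∈ I a := by
        rcases hh with ⟨h1, _⟩ | ⟨_, h1⟩
        · exact absurd (hk.symm.trans h1) (k02 G h)
        · exact h1
      obtain ⟨h1, h2⟩ := h.k0 a hs hk b hw
      obtain ⟨l, hl, hl', rfl⟩ := mem_ZPow _ h2
      exact ⟨(G.Y _ _).2 ⟨hs, h1⟩, Or.inr (Or.inl ⟨(G.S0 _).2 ⟨hs, hk⟩, zlist l, G.zl (G.LXK h hl'),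
        (G.ltIff hs).2 ⟨l, G.LXK h hl', hl, rfl⟩, pUL G h hl', G.ttIff.2 ⟨G.LXK h hl', rfl⟩⟩)⟩
    · have hw : b ∈ I a := by
        rcases hh with ⟨h1, _⟩ | ⟨_, h1⟩
        · exact absurd (hk.symm.trans h1) (k12 G h)
        · exact h1
      obtain ⟨h1, h2⟩ := h.k1 a hs hk b hw
      obtain ⟨l, hl, hl', rfl⟩ := mem_ZPow _ h2
      obtain ⟨l, x, rfl⟩ : ∃ l' x, l = l' ++ [x] := by
        have : l ≠ [] := by rintro rfl; simp at hl
        exact ⟨l.dropLast, l.getLast this, (List.dropLast_append_getLast this).symm⟩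
      obtain ⟨hl', hx⟩ := LK_append.1 hl'
      exact ⟨(G.Y _ _).2 ⟨hs, h1⟩, Or.inr (Or.inr ⟨(G.S1 _).2 ⟨hs, hk⟩, zlist l, G.zl (G.LXK h hl'), x, G.XK h hx,
        (G.ltIff hs).2 ⟨l, G.LXK h hl', by simpa using hl, rfl⟩, pUL G h hl', pU G h hx,
        G.atIff.2 ⟨G.LXK h hl', G.XK h hx, rfl⟩⟩)⟩
    · have hw : b = I a := by
        rcases hh with ⟨_, h1⟩ | ⟨h1, _⟩
        · exact h1
        · exact absurd hk h1
      obtain ⟨h1, h2⟩ := h.k2 a hs hk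
      rw [hw]
      exact ⟨(G.Y _ _).2 ⟨hs, h1⟩, Or.inl ⟨(G.S2 _).2 ⟨hs, hk⟩, pU G h h2⟩⟩
  · left; exact mkN G 2 ha hb G.emp hx

theorem r5 {a b c : Zs} (hc : c ∈ p.K) : c5 p a b c PX NX := by
  refine or_iff_not_imp_left.2 fun hh => ?_
  obtain ⟨h1, h2, h3, h4, h5⟩ := not_not.1 hh
  obtain ⟨hs, hk⟩ := (G.S0 _).1 h1
  obtain ⟨l, hl, hl', rfl⟩ := (G.ltIff hs).1 h4
  obtain ⟨_, rfl⟩ := G.ttIff.1 h5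
  by_cases hX : LK X l
  · left
    refine pI G h hs (hk ▸ k02 G h) hc (h.k0e a hs hk ((G.E _).1 h2).2 _ ((G.Y _ _).1 h3).2 ?_)
    rw [← hl']; exact (ztuple_mem_ZPow l).2 hX
  · right; exact nUL G h hl hX

theorem r6 {a b c e : Zs} (hc : c ∈ p.K) (he : e ∈ p.K) : c6 p a b c e PX NX := by
  refine or_iff_not_imp_left.2 fun hh => ?_
  obtain ⟨h1, h2, h3, h4, h5⟩ := not_not.1 hh
  obtain ⟨hs, hk⟩ := (G.S1 _).1 h1
  obtain ⟨l, hl, hl', rfl⟩ := (G.ltIff hs).1 h4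
  obtain ⟨_, _, rfl⟩ := G.atIff.1 h5
  by_cases hX : LK X l
  · by_cases hy : e ∈ X
    · left
      refine pI G h hs (hk ▸ k12 G h) hc (h.k1e a hs hk ((G.E _).1 h2).2 _ ((G.Y _ _).1 h3).2 ?_)
      have : arityOf a + 1 = (l ++ [e]).length := by simp [hl']
      rw [this]; exact (ztuple_mem_ZPow _).2 (LK_append.2 ⟨hX, hy⟩)
    · right; right; exact mkN G 0 he G.emp G.emp hy
  · right; left; exact nUL G h hl hX

theorem LKapp {l : List Zs} (hl : LK p.K l) {x : Zs} (hx : x ∈ p.K) : ztuple (l ++ [x]) ∈ p.K :=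
  G.zt (LK_append.2 ⟨hl, hx⟩)

theorem r7 {a b : Zs} : c7 p a b PX NX := by
  refine or_iff_not_imp_left.2 fun hh => ?_
  obtain ⟨h1, h4⟩ := not_not.1 hh
  obtain ⟨hs, hk⟩ := (G.S1 _).1 h1
  obtain ⟨l, hl, hl', rfl⟩ := (G.ltIff hs).1 h4
  by_cases hX : LK X l
  · right
    obtain ⟨x, ⟨hx, hx'⟩, _⟩ := h.k1u a hs hk l hl' hX
    have := LKapp G h hl (G.XK h hx)
    exact ⟨x, G.XK h hx, _, this, pU G h hx, G.atIff.2 ⟨hl, G.XK h hx, rfl⟩, pI G h hs (hk ▸ k12 G h) this hx'⟩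
  · left; exact nUL G h hl hX

theorem r8 {a b c e : Zs} (hc : c ∈ p.K) (he : e ∈ p.K) : c8 p a b c e NX := by
  refine or_iff_not_imp_left.2 fun hh => ?_
  obtain ⟨h1, h4⟩ := not_not.1 hh
  obtain ⟨hs, hk⟩ := (G.S1 _).1 h1
  obtain ⟨l, hl, hl', rfl⟩ := (G.ltIff hs).1 h4
  by_cases hX : LK X l
  swap
  · left; exact nUL G h hl hX
  right
  by_cases hcX : c ∈ X
  swap
  · left; exact mkN G 0 hc G.emp G.emp hcX
  right
  by_cases heX : e ∈ X
  swap
  · left; exact mkN G 0 he G.emp G.emp heX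
  right
  by_cases hce : c = e
  · exact Or.inl hce
  right
  have hu := h.k1u a hs hk l hl' hX
  have w1 := LKapp G h hl hc
  have w2 := LKapp G h hl he
  refine ⟨_, w1, _, w2, G.atIff.2 ⟨hl, hc, rfl⟩, G.atIff.2 ⟨hl, he, rfl⟩, ?_⟩
  by_cases hi : ztuple (l ++ [c]) ∈ I a
  · right
    exact nI G h hs (hk ▸ k12 G h) w2 (fun hi' => hce (hu.unique ⟨hcX, hi⟩ ⟨heX, hi'⟩))
  · left; exact nI G h hs (hk ▸ k12 G h) w1 hi

theorem r9 {a : Zs} : c9 p a PX := by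
  refine or_iff_not_imp_left.2 fun hh => ?_
  obtain ⟨hs, hk⟩ := (G.S2 _).1 (not_not.1 hh)
  exact ⟨I a, G.XK h (h.k2 a hs hk).2, pI2 G h hs hk⟩

theorem r10 {a b c : Zs} (hb : b ∈ p.K) (hc : c ∈ p.K) : c10 p a b c NX := by
  refine or_iff_not_imp_left.2 fun hh => ?_
  obtain ⟨hs, hk⟩ := (G.S2 _).1 (not_not.1 hh)
  by_cases e1 : b = I a
  · by_cases e2 : c = I a
    · left; rw [e1, e2]
    · right; right
      exact mkN G 2 (G.σK hs) hc G.emp (by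
        rintro ⟨_, ⟨_, h1⟩ | ⟨h1, _⟩⟩
        · exact e2 h1
        · exact h1 hk)
  · right; left
    exact mkN G 2 (G.σK hs) hb G.emp (by
        rintro ⟨_, ⟨_, h1⟩ | ⟨h1, _⟩⟩
        · exact e1 h1
        · exact h1 hk)

theorem valK {τ : Tm} {l : List Zs} (hu : τ.usesSig (tciSig t)) (hl : LK X l) (hf : ∀ n ∈ τ.free, n < l.length) :
    VOK (tz t) (τ.eval (fIv I) (vl l)) :=
  eval_VOK h τ (vl l) hu fun n hn => h.Xz (vl_mem hl (hf n hn)).2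

/-- evaluation of argument lists -/
theorem argsP {n : ℕ} {a : Fin n → Tm} {l : List Zs} (ha : ∀ i, (a i).usesSig (tciSig t)) (hl : LK X l)
    (hf : ∀ i, ∀ m ∈ (a i).free, m < l.length) (hA : zlist (List.ofFn fun i => TmCode (a i)) ∈ A) :
    LK p.K ((List.ofFn fun i => (a i).eval (fIv I) (vl l)).map (rho p.J)) ∧
    PX (fVL (zlist (List.ofFn fun i => TmCode (a i))) (zlist l)
      (zlist ((List.ofFn fun i => (a i).eval (fIv I) (vl l)).map (rho p.J)))) := by
  have h1 : LK p.K ((List.ofFn fun i => (a i).eval (fIv I) (vl l)).map (rho p.J)) := by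
    intro x hx
    obtain ⟨y, hy, rfl⟩ := List.mem_map.1 hx
    obtain ⟨i, rfl⟩ := (List.mem_ofFn' _ _).1 hy
    exact G.rho_K (valK G h (ha i) hl (hf i))
  refine ⟨h1, mkP G 4 (G.AK _ hA) (G.zl (G.LXK h hl)) (G.zl h1) ⟨List.ofFn a, l, ?_, hA, ?_, rfl, hl, ?_⟩⟩
  · rw [ofFn_map]
  · intro τ hτ
    obtain ⟨i, rfl⟩ := (List.mem_ofFn' _ _).1 hτ
    exact ⟨ha i, hf i⟩
  · rw [ofFn_map a (fun τ => τ.eval (fIv I) (vl l)), List.map_map]; rfl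

theorem pV {τ : Tm} {l : List Zs} (hu : τ.usesSig (tciSig t)) (hl : LK X l) (hf : ∀ n ∈ τ.free, n < l.length)
    (hA : TmCode τ ∈ A) : PX (fV (TmCode τ) (zlist l) (rho p.J (τ.eval (fIv I) (vl l)))) :=
  mkP G 3 (G.AK _ hA) (G.zl (G.LXK h hl)) (G.rho_K (valK G h hu hl hf)) ⟨τ, l, rfl, hA, hu, rfl, hl, hf, rfl⟩

theorem r11 {a b c : Zs} (ha : a ∈ p.K) (hb : b ∈ p.K) (hc : c ∈ p.K) : c11 p a b c PX NX := by
  by_cases hx : RR t A p.J X I 3 a b c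
  swap
  · left; exact mkN G 3 ha hb hc hx
  right
  obtain ⟨τ, l, rfl, hA, hu, rfl, hl, hf, rfl⟩ := hx
  cases τ with
  | var n =>
    left
    have := vl_mem hl (hf n rfl)
    refine ⟨natZ n, G.hnat n, rfl, ?_⟩
    simp only [Tm.eval]
    rw [G.rho_z (h.Xz this.2)]
    exact G.ntIff.2 ⟨G.LXK h hl, this.1⟩
  | param x => exact hu.elim
  | func s n f =>
    right
    obtain ⟨hs, hk, hua⟩ := hu
    have hA' := (opair_tr G.Atr (opair_tr G.Atr hA).2)
    obtain ⟨hm, hP⟩ := argsP G h hua hl (fun i m hm => hf m ⟨i, hm⟩) hA'.2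
    refine ⟨s, G.σK hs, _, G.AK _ hA'.2, _, G.zl hm, rfl, hP, ?_⟩
    simp only [Tm.eval] at hc ⊢
    rcases hk with ⟨hk, hn⟩ | ⟨hk, hn⟩
    · have hlen : (List.ofFn fun i => Tm.eval (fIv I) (vl l) (f i)).length = arityOf s := by
        rw [List.length_ofFn, arityOf_eq hn]
      generalize (List.ofFn fun i => Tm.eval (fIv I) (vl l) (f i)) = m at *
      have hs1 := (G.S1 _).2 ⟨hs, hk⟩
      have hk2 : symKind s ≠ natZ 2 := hk ▸ k12 G h
      by_cases h0 : m = []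
      · right; left
        subst h0
        obtain ⟨x, hxX, hxI, e⟩ := fIv_nil1 h hs hk hlen.symm
        refine ⟨hs1, rfl, x, G.XK h hxX, pI G h hs hk2 (G.XK h hxX) hxI, ?_⟩
        rw [e, G.rho_sing (h.Xz hxX)]
      · right; right
        have h0' : zlist (m.map (rho p.J)) ≠ ∅ := fun e => h0 (List.map_eq_nil_iff.1 (zlist_eq_empty.1 e))
        refine ⟨hs1, h0', ?_⟩
        by_cases hX : LK X m
        · right
          obtain ⟨h1, h2⟩ := fIv_pos h hs hk hlen h0 hX
          rw [G.rho_z (h.Xz h1), G.rho_map h hX]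
          have := LKapp G h (G.LXK h hX) (G.XK h h1)
          exact ⟨_, this, G.atIff.2 ⟨G.LXK h hX, G.XK h h1, rfl⟩, pI G h hs hk2 this h2⟩
        · left
          refine ⟨by rw [fIv_neg h hs hk hlen h0 hX, G.rho_junk], nUL G h hm fun hh => hX ?_⟩
          rwa [G.rho_map' h hh] at hh
    · left
      subst hn
      have e : (List.ofFn fun i => Tm.eval (fIv I) (vl l) (f i)) = [] := by simp
      rw [e] at hc ⊢
      refine ⟨(G.S2 _).2 ⟨hs, hk⟩, rfl, ?_⟩
      have : fIv I s [] = I s := if_pos rfl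
      rw [this, G.rho_z (h.Xz (h.k2 s hs hk).2)]
      exact pI2 G h hs hk

theorem r12 {a b c : Zs} (ha : a ∈ p.K) (hb : b ∈ p.K) (hc : c ∈ p.K) : c12 p a b c PX NX := by
  by_cases hx : RR t A p.J X I 4 a b c
  swap
  · left; exact mkN G 4 ha hb hc hx
  right
  obtain ⟨τs, l, rfl, hA, hu, rfl, hl, rfl⟩ := hx
  cases τs with
  | nil => left; exact ⟨rfl, rfl⟩
  | cons τ τs =>
    right
    obtain ⟨hA1, hA2⟩ := opair_tr G.Atr hA
    have h1 := hu τ (List.mem_cons_self ..)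
    have hm : LK p.K (τs.map fun τ => rho p.J (τ.eval (fIv I) (vl l))) := by
      intro x hx
      obtain ⟨y, hy, rfl⟩ := List.mem_map.1 hx
      have := hu y (List.mem_cons_of_mem _ hy)
      exact G.rho_K (valK G h this.1 hl this.2)
    exact ⟨_, G.AK _ hA1, _, G.AK _ hA2, _, G.rho_K (valK G h h1.1 hl h1.2), _, G.zl hm, rfl, rfl, pV G h h1.1 hl h1.2 hA1,
      mkP G 4 (G.AK _ hA2) hb (G.zl hm) ⟨τs, l, rfl, hA2, fun τ hτ => hu τ (List.mem_cons_of_mem _ hτ), rfl, hl, rfl⟩⟩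

theorem pS {f : Fm} {l : List Zs} (hu : f.usesSig (tciSig t)) (hl : LK X l) (hf : ∀ n ∈ f.free, n < l.length)
    (hA : FmCode f ∈ A) (hs : Sat (· ∈ X) (rIv I) (fIv I) f (vl l)) : PX (fSP (FmCode f) (zlist l)) :=
  mkP G 5 (G.AK _ hA) (G.zl (G.LXK h hl)) G.emp ⟨f, l, rfl, hA, hu, rfl, hl, hf, hs⟩

theorem pSN {f : Fm} {l : List Zs} (hu : f.usesSig (tciSig t)) (hl : LK X l) (hf : ∀ n ∈ f.free, n < l.length)
    (hA : FmCode f ∈ A) (hs : ¬ Sat (· ∈ X) (rIv I) (fIv I) f (vl l)) : PX (fSN (FmCode f) (zlist l)) :=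
  mkP G 6 (G.AK _ hA) (G.zl (G.LXK h hl)) G.emp ⟨f, l, rfl, hA, hu, rfl, hl, hf, hs⟩

theorem freeq {f : Fm} {l : List Zs} {x : Zs} (hf : ∀ m, m + 1 ∈ f.free → m < l.length) : ∀ n ∈ f.free, n < (x :: l).length := by
  intro n hn
  cases n with
  | zero => simp
  | succ n => have := hf n hn; simp only [List.length_cons]; omega

theorem r13 {a b : Zs} (ha : a ∈ p.K) (hb : b ∈ p.K) : c13 p a b PX NX := by
  by_cases hx : RR t A p.J X I 5 a b ∅
  swap
  · left; exact mkN G 5 ha hb G.emp hx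
  right
  obtain ⟨f, l, rfl, hA, hu, rfl, hl, hf, hsat⟩ := hx
  cases f with
  | rel s n f =>
    left
    obtain ⟨hs, hk, hn, hua⟩ := hu
    have hA' := (opair_tr G.Atr (opair_tr G.Atr hA).2)
    obtain ⟨hm, hP⟩ := argsP G h hua hl (fun i m hm => hf m ⟨i, hm⟩) hA'.2
    refine ⟨s, G.σK hs, _, G.AK _ hA'.2, _, G.zl hm, _, G.zt hm, rfl, hP, G.ttIff.2 ⟨hm, rfl⟩, ?_⟩
    refine pI G h hs (hk ▸ k02 G h) (G.zt hm) ((G.rho_rel h hs hk ?_).2 hsat)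
    rw [List.length_ofFn, arityOf_eq hn]
  | eq u v =>
    right; left
    have hA' := (opair_tr G.Atr (opair_tr G.Atr hA).2)
    have hfu : ∀ n ∈ u.free, n < l.length := fun n hn => hf n (Or.inl hn)
    have hfv : ∀ n ∈ v.free, n < l.length := fun n hn => hf n (Or.inr hn)
    refine ⟨_, G.AK _ hA'.1, _, G.AK _ hA'.2, _, G.rho_K (valK G h hu.1 hl hfu), rfl, pV G h hu.1 hl hfu hA'.1, ?_⟩
    have e : u.eval (fIv I) (vl l) = v.eval (fIv I) (vl l) := hsat
    rw [e]
    exact pV G h hu.2 hl hfv hA'.2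
  | not f =>
    right; right; left
    have hA' := (opair_tr G.Atr hA)
    exact ⟨_, G.AK _ hA'.2, rfl, pSN G h hu hl hf hA'.2 hsat⟩
  | imp f g =>
    right; right; right; left
    have hA' := (opair_tr G.Atr (opair_tr G.Atr hA).2)
    refine ⟨_, G.AK _ hA'.1, _, G.AK _ hA'.2, rfl, ?_⟩
    by_cases h1 : Sat (· ∈ X) (rIv I) (fIv I) f (vl l)
    · right; exact pS G h hu.2 hl (fun n hn => hf n (Or.inr hn)) hA'.2 (hsat h1)
    · left; exact pSN G h hu.1 hl (fun n hn => hf n (Or.inl hn)) hA'.1 h1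
  | all f =>
    right; right; right; right; left
    exact ⟨_, G.AK _ (opair_tr G.Atr hA).2, rfl⟩
  | ex f =>
    right; right; right; right; right
    obtain ⟨x, hx, hsat⟩ := hsat
    rw [vl_cons] at hsat
    exact ⟨_, G.AK _ (opair_tr G.Atr hA).2, x, G.XK h hx, rfl, pU G h hx,
      pS G h (l := x :: l) hu (LK_cons.2 ⟨hx, hl⟩) (freeq G h hf) (opair_tr G.Atr hA).2 hsat⟩

theorem r14 {a b : Zs} (ha : a ∈ p.K) (hb : b ∈ p.K) : c14 p a b PX NX := by
  by_cases hx : RR t A p.J X I 6 a b ∅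
  swap
  · left; exact mkN G 6 ha hb G.emp hx
  right
  obtain ⟨f, l, rfl, hA, hu, rfl, hl, hf, hsat⟩ := hx
  cases f with
  | rel s n f =>
    left
    obtain ⟨hs, hk, hn, hua⟩ := hu
    have hA' := (opair_tr G.Atr (opair_tr G.Atr hA).2)
    obtain ⟨hm, hP⟩ := argsP G h hua hl (fun i m hm => hf m ⟨i, hm⟩) hA'.2
    refine ⟨s, G.σK hs, _, G.AK _ hA'.2, _, G.zl hm, _, G.zt hm, rfl, hP, G.ttIff.2 ⟨hm, rfl⟩, ?_⟩
    refine nI G h hs (hk ▸ k02 G h) (G.zt hm) (fun hh => hsat ((G.rho_rel h hs hk ?_).1 hh))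
    rw [List.length_ofFn, arityOf_eq hn]
  | eq u v =>
    right; left
    have hA' := (opair_tr G.Atr (opair_tr G.Atr hA).2)
    have hfu : ∀ n ∈ u.free, n < l.length := fun n hn => hf n (Or.inl hn)
    have hfv : ∀ n ∈ v.free, n < l.length := fun n hn => hf n (Or.inr hn)
    refine ⟨_, G.AK _ hA'.1, _, G.AK _ hA'.2, _, G.rho_K (valK G h hu.1 hl hfu), _, G.rho_K (valK G h hu.2 hl hfv), rfl,
      pV G h hu.1 hl hfu hA'.1, pV G h hu.2 hl hfv hA'.2, fun e => hsat ?_⟩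
    exact G.rho_inj (valK G h hu.1 hl hfu) (valK G h hu.2 hl hfv) e
  | not f =>
    right; right; left
    have hA' := (opair_tr G.Atr hA)
    exact ⟨_, G.AK _ hA'.2, rfl, pS G h hu hl hf hA'.2 (not_not.1 hsat)⟩
  | imp f g =>
    right; right; right; left
    have hA' := (opair_tr G.Atr (opair_tr G.Atr hA).2)
    refine ⟨_, G.AK _ hA'.1, _, G.AK _ hA'.2, rfl, ?_⟩
    have := _root_.not_imp.1 hsat
    exact ⟨pS G h hu.1 hl (fun n hn => hf n (Or.inl hn)) hA'.1 this.1,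
      pSN G h hu.2 hl (fun n hn => hf n (Or.inr hn)) hA'.2 this.2⟩
  | ex f =>
    right; right; right; right; left
    exact ⟨_, G.AK _ (opair_tr G.Atr hA).2, rfl⟩
  | all f =>
    right; right; right; right; right
    have : ∃ x, x ∈ X ∧ ¬ Sat (· ∈ X) (rIv I) (fIv I) f (vcons x (vl l)) := by
      by_contra hcon
      exact hsat fun x hx => by_contra fun hh => hcon ⟨x, hx, hh⟩
    obtain ⟨x, hx, hsat⟩ := this
    rw [vl_cons] at hsat
    exact ⟨_, G.AK _ (opair_tr G.Atr hA).2, x, G.XK h hx, rfl, pU G h hx,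
      pSN G h (l := x :: l) hu (LK_cons.2 ⟨hx, hl⟩) (freeq G h hf) (opair_tr G.Atr hA).2 hsat⟩

theorem r15 {a b c : Zs} (ha : a ∈ p.K) (hb : b ∈ p.K) (hc : c ∈ p.K) : c15 a b c PX NX := by
  by_cases hx : RR t A p.J X I 5 (opair (natZ 4) a) b ∅
  swap
  · left; exact mkN G 5 (G.hop _ (G.hnat 4) _ ha) hb G.emp hx
  right
  by_cases hcX : c ∈ X
  swap
  · left; exact mkN G 0 hc G.emp G.emp hcX
  right
  obtain ⟨f, l, e, hA, hu, rfl, hl, hf, hsat⟩ := hx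
  cases f with
  | all f =>
    obtain ⟨_, rfl⟩ := opair_inj.1 e
    have := hsat c hcX
    rw [vl_cons] at this
    exact pS G h (l := c :: l) hu (LK_cons.2 ⟨hcX, hl⟩) (freeq G h hf) (opair_tr G.Atr hA).2 this
  | _ => exact absurd (natZ_inj (opair_inj.1 e).1) (by decide)

theorem r16 {a b c : Zs} (ha : a ∈ p.K) (hb : b ∈ p.K) (hc : c ∈ p.K) : c16 a b c PX NX := by
  by_cases hx : RR t A p.J X I 6 (opair (natZ 5) a) b ∅
  swap
  · left; exact mkN G 6 (G.hop _ (G.hnat 5) _ ha) hb G.emp hx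
  right
  by_cases hcX : c ∈ X
  swap
  · left; exact mkN G 0 hc G.emp G.emp hcX
  right
  obtain ⟨f, l, e, hA, hu, rfl, hl, hf, hsat⟩ := hx
  cases f with
  | ex f =>
    obtain ⟨_, rfl⟩ := opair_inj.1 e
    have : ¬ Sat (· ∈ X) (rIv I) (fIv I) f (vcons c (vl l)) := fun hh => hsat ⟨c, hcX, hh⟩
    rw [vl_cons] at this
    exact pSN G h (l := c :: l) hu (LK_cons.2 ⟨hcX, hl⟩) (freeq G h hf) (opair_tr G.Atr hA).2 this
  | _ => exact absurd (natZ_inj (opair_inj.1 e).1) (by decide)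

theorem r17 (hsat : ∀ c ∈ tciT t, ∀ f, FmCode f = c → Sat (· ∈ X) (rIv I) (fIv I) f (fun _ => ∅)) {a : Zs} : c17 p a PX := by
  refine or_iff_not_imp_left.2 fun hh => ?_
  have ha := not_not.1 hh
  rw [G.pT] at ha
  obtain ⟨f, rfl, hf, hu⟩ := G.tci.2.2.2.2.2.2.2.2.2.2 a ha
  have := hsat _ ha f rfl
  rw [← vl_nil] at this
  exact pS G h (l := []) hu LK_nil (by rw [hf]; intro n hn; exact hn.elim) (G.hT _ ha) this

theorem real_clauses (hsat : ∀ c ∈ tciT t, ∀ f, FmCode f = c → Sat (· ∈ X) (rIv I) (fIv I) f (fun _ => ∅)) :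
    ∀ a ∈ p.K, ∀ b ∈ p.K, ∀ c ∈ p.K, ∀ e ∈ p.K, Clauses p a b c e PX NX := fun a ha b hb c hc e he =>
  ⟨r1 G h ha, r2 G h ha, r3 G h ha hb, r4 G h ha hb, r5 G h hc, r6 G h hc he, r7 G h, r8 G h hc he, r9 G h, r10 G h hb hc,
   r11 G h ha hb hc, r12 G h ha hb hc, r13 G h ha hb, r14 G h ha hb, r15 G h ha hb hc, r16 G h ha hb hc, r17 G h hsat⟩

end
end SmallExt

end

noncomputable section
namespace SmallExt
set_option linter.unusedVariables false
set_option linter.unusedSectionVars false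
attribute [local instance] Classical.propDecidable

def HC (p : Par) (S : Zs) : Prop := ∀ a ∈ p.K, ∀ b ∈ p.K, ∀ c ∈ p.K, ∀ e ∈ p.K,
      Clauses p a b c e (fun d => d ∈ S) (fun d => d ∉ S)

def Xs (p : Par) (S : Zs) : Zs := ZFSet.sep (fun b => fU b ∈ S) p.z
def Vs (p : Par) (S s : Zs) : Zs := ZFSet.sep (fun w => (¬ s ∈ p.S2 ∧ (w ∈ p.K ∧ fI s w ∈ S)) ∨
  (s ∈ p.S2 ∧ ∃ b, b ∈ p.K ∧ (fI s b ∈ S ∧ w ∈ b))) (p.K ∪ ZFSet.sUnion p.K)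

section
variable {t A : Zs} {p : Par} (G : Good t A p) {S : Zs} (H : HC p S)
include G H

theorem H1 {a : Zs} (ha : a ∈ p.K) : Clauses p a ∅ ∅ ∅ (fun d => d ∈ S) (fun d => d ∉ S) := H a ha ∅ G.emp ∅ G.emp ∅ G.emp
theorem H2 {a b : Zs} (ha : a ∈ p.K) (hb : b ∈ p.K) : Clauses p a b ∅ ∅ (fun d => d ∈ S) (fun d => d ∉ S) := H a ha b hb ∅ G.emp ∅ G.emp
theorem H3 {a b c : Zs} (ha : a ∈ p.K) (hb : b ∈ p.K) (hc : c ∈ p.K) : Clauses p a b c ∅ (fun d => d ∈ S) (fun d => d ∉ S) := H a ha b hb c hc ∅ G.emp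

theorem mem_Xs {x : Zs} (hx : x ∈ p.K) : x ∈ Xs p S ↔ fU x ∈ S := by
  rw [Xs, ZFSet.mem_sep]
  exact ⟨fun h => h.2, fun h => ⟨(H1 G H hx).h1.1.resolve_left (not_not.2 h), h⟩⟩

theorem Xs_z : Xs p S ⊆ tz t := fun x hx => G.pz ▸ (ZFSet.mem_sep.1 hx).1
theorem Xs_K {x : Zs} (hx : x ∈ Xs p S) : x ∈ p.K := G.zK (Xs_z G H hx)
theorem LXs_K {l : List Zs} (hx : LK (Xs p S) l) : LK p.K l := fun x h => Xs_K G H (hx x h)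
theorem Xs_U {x : Zs} (hx : x ∈ Xs p S) : fU x ∈ S := (ZFSet.mem_sep.1 hx).2

theorem UL_iff : ∀ l, LK p.K l → (fUL (zlist l) ∈ S ↔ LK (Xs p S) l) := by
  intro l
  induction l with
  | nil =>
    intro _
    exact ⟨fun _ => LK_nil, fun _ => (H1 G H G.emp).h2.2.resolve_right (fun h => h rfl)⟩
  | cons x l ih =>
    intro hl
    obtain ⟨hx, hl'⟩ := LK_cons.1 hl
    rw [LK_cons, mem_Xs G H hx, ← ih hl']
    constructor
    · intro h
      rcases (H1 G H (G.zl hl)).h2.1.resolve_left (not_not.2 h) with h | ⟨x', _, m, _, e, h1, h2⟩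
      · exact absurd h opair_ne_empty
      · obtain ⟨rfl, rfl⟩ := opair_inj.1 e
        exact ⟨h1, h2⟩
    · rintro ⟨h1, h2⟩
      rcases (H2 G H hx (G.zl hl')).h3 with h | h | h
      · exact h
      · exact absurd h1 h
      · exact absurd h2 h

theorem Vs_ne {s : Zs} (hs : s ∈ tciSig t) (hk : symKind s ≠ natZ 2) {w : Zs} : w ∈ Vs p S s ↔ w ∈ p.K ∧ fI s w ∈ S := by
  rw [Vs, ZFSet.mem_sep]
  constructor
  · rintro ⟨_, ⟨_, h⟩ | ⟨h, _⟩⟩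
    · exact h
    · exact absurd ((G.S2 _).1 h).2 hk
  · intro h
    exact ⟨ZFSet.mem_union.2 (Or.inl h.1), Or.inl ⟨fun h => hk ((G.S2 _).1 h).2, h⟩⟩

theorem Vs_2 {s : Zs} (hs : s ∈ tciSig t) (hk : symKind s = natZ 2) {b : Zs} (hb : b ∈ p.K) (hbS : fI s b ∈ S) :
    Vs p S s = b := by
  have h2 := (G.S2 _).2 ⟨hs, hk⟩
  ext w
  rw [Vs, ZFSet.mem_sep]
  constructor
  · rintro ⟨_, ⟨h, _⟩ | ⟨_, b', hb', h1, h3⟩⟩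
    · exact absurd h2 h
    · rcases (H3 G H (G.σK hs) hb hb').h10 with h | h | h | h
      · exact absurd h2 h
      · rw [h]; exact h3
      · exact absurd hbS h
      · exact absurd h1 h
  · intro h
    exact ⟨ZFSet.mem_union.2 (Or.inr (ZFSet.mem_sUnion.2 ⟨b, hb, h⟩)), Or.inr ⟨h2, b, hb, hbS, h⟩⟩

theorem Vs_2S {s : Zs} (hs : s ∈ tciSig t) (hk : symKind s = natZ 2) : Vs p S s ∈ p.K ∧ fI s (Vs p S s) ∈ S := by
  obtain ⟨b, hb, h⟩ := (H1 G H (G.σK hs)).h9.resolve_left (not_not.2 ((G.S2 _).2 ⟨hs, hk⟩))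
  rw [Vs_2 G H hs hk hb h]; exact ⟨hb, h⟩

theorem e_StrOK {I : Zs → Zs} (hI : ∀ s ∈ tciSig t, I s = Vs p S s) : StrOK t (Xs p S) I := by
  have n02 : natZ 0 ≠ natZ 2 := fun e => absurd (natZ_inj e) (by decide)
  have n12 : natZ 1 ≠ natZ 2 := fun e => absurd (natZ_inj e) (by decide)
  have n01 : natZ 0 ≠ natZ 1 := fun e => absurd (natZ_inj e) (by decide)
  constructor
  · exact Xs_z G H
  · intro h x hx
    exact (mem_Xs G H (G.zK hx)).2 ((H1 G H (G.zK hx)).h1.2.resolve_right (not_not.2 ((G.Z1 x).2 ⟨hx, h⟩)))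
  · intro s hs hk w hw
    rw [hI s hs, Vs_ne G H hs (hk ▸ n02)] at hw
    obtain ⟨hY, h | h | h⟩ := (H2 G H (G.σK hs) hw.1).h4.resolve_left (not_not.2 hw.2)
    · exact absurd (hk.symm.trans ((G.S2 _).1 h.1).2) n02
    · obtain ⟨_, m, _, h1, h2, h3⟩ := h
      obtain ⟨l, hl, hl', rfl⟩ := (G.ltIff hs).1 h1
      obtain ⟨_, rfl⟩ := G.ttIff.1 h3
      refine ⟨((G.Y _ _).1 hY).2, ?_⟩
      rw [← hl']; exact (ztuple_mem_ZPow l).2 ((UL_iff G H l hl).1 h2)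
    · exact absurd (hk.symm.trans ((G.S1 _).1 h.1).2) n01
  · intro s hs hk hi w hw hw'
    obtain ⟨l, hl, hlX, rfl⟩ := mem_ZPow _ hw'
    have hlK := LXs_K G H hlX
    rw [hI s hs, Vs_ne G H hs (hk ▸ n02)]
    refine ⟨G.zt hlK, ?_⟩
    have := (H3 G H (G.σK hs) (G.zl hlK) (G.zt hlK)).h5.resolve_left (not_not.2 ⟨(G.S0 _).2 ⟨hs, hk⟩, (G.E _).2 ⟨hs, hi⟩,
      (G.Y _ _).2 ⟨hs, hw⟩, (G.ltIff hs).2 ⟨l, hlK, hl, rfl⟩, G.ttIff.2 ⟨hlK, rfl⟩⟩)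
    exact this.resolve_right (not_not.2 ((UL_iff G H l hlK).2 hlX))
  · intro s hs hk w hw
    rw [hI s hs, Vs_ne G H hs (hk ▸ n12)] at hw
    obtain ⟨hY, h | h | h⟩ := (H2 G H (G.σK hs) hw.1).h4.resolve_left (not_not.2 hw.2)
    · exact absurd (hk.symm.trans ((G.S2 _).1 h.1).2) n12
    · exact absurd (((G.S0 _).1 h.1).2.symm.trans hk) n01
    · obtain ⟨_, m, _, x, hx, h1, h2, h2', h3⟩ := h
      obtain ⟨l, hl, hl', rfl⟩ := (G.ltIff hs).1 h1
      obtain ⟨_, _, rfl⟩ := G.atIff.1 h3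
      refine ⟨((G.Y _ _).1 hY).2, ?_⟩
      have : arityOf s + 1 = (l ++ [x]).length := by simp [hl']
      rw [this]
      exact (ztuple_mem_ZPow _).2 (LK_append.2 ⟨(UL_iff G H l hl).1 h2, (mem_Xs G H hx).2 h2'⟩)
  · intro s hs hk hi w hw hw'
    obtain ⟨l, hl, hlX, rfl⟩ := mem_ZPow _ hw'
    obtain ⟨l, x, rfl⟩ : ∃ l' x, l = l' ++ [x] := by
        have : l ≠ [] := by rintro rfl; simp at hl
        exact ⟨l.dropLast, l.getLast this, (List.dropLast_append_getLast this).symm⟩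
    obtain ⟨hlX, hxX⟩ := LK_append.1 hlX
    have hlK := LXs_K G H hlX
    have hxK := Xs_K G H hxX
    have hwK := G.zt (LK_append.2 ⟨hlK, hxK⟩)
    rw [hI s hs, Vs_ne G H hs (hk ▸ n12)]
    refine ⟨hwK, ?_⟩
    have := (H _ (G.σK hs) _ (G.zl hlK) _ hwK _ hxK).h6.resolve_left (not_not.2 ⟨(G.S1 _).2 ⟨hs, hk⟩, (G.E _).2 ⟨hs, hi⟩,
      (G.Y _ _).2 ⟨hs, hw⟩, (G.ltIff hs).2 ⟨l, hlK, by simpa using hl, rfl⟩, G.atIff.2 ⟨hlK, hxK, rfl⟩⟩)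
    rcases this with h | h | h
    · exact h
    · exact absurd ((UL_iff G H l hlK).2 hlX) h
    · exact absurd (Xs_U G H hxX) h
  · intro s hs hk l hl hlX
    have hlK := LXs_K G H hlX
    have hL := (UL_iff G H l hlK).2 hlX
    have hs1 : s ∈ p.S1 ∧ opair (zfst (zsnd s)) (zlist l) ∈ p.LT := ⟨(G.S1 _).2 ⟨hs, hk⟩, (G.ltIff hs).2 ⟨l, hlK, hl, rfl⟩⟩
    rw [hI s hs]
    have hex := ((H2 G H (G.σK hs) (G.zl hlK)).h7.resolve_left (not_not.2 hs1)).resolve_left (not_not.2 hL)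
    obtain ⟨x, hx, w, hw, hxS, hxw, hwS⟩ := hex
    obtain ⟨_, _, rfl⟩ := G.atIff.1 hxw
    refine ⟨x, ⟨(mem_Xs G H hx).2 hxS, (Vs_ne G H hs (hk ▸ n12)).2 ⟨hw, hwS⟩⟩, ?_⟩
    rintro y ⟨hy, hyS⟩
    have hyK := Xs_K G H hy
    have hyS := (Vs_ne G H hs (hk ▸ n12)).1 hyS
    rcases (H _ (G.σK hs) _ (G.zl hlK) _ hx _ hyK).h8 with h | h | h | h | h | h
    · exact absurd hs1 h
    · exact absurd hL h
    · exact absurd hxS h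
    · exact absurd (Xs_U G H hy) h
    · exact h.symm
    · obtain ⟨w, _, w', _, e1, e2, h⟩ := h
      obtain ⟨_, _, rfl⟩ := G.atIff.1 e1
      obtain ⟨_, _, rfl⟩ := G.atIff.1 e2
      rcases h with h | h
      · exact absurd hwS h
      · exact absurd hyS.2 h
  · intro s hs hk
    rw [hI s hs]
    obtain ⟨h1, h2⟩ := Vs_2S G H hs hk
    obtain ⟨hY, h | h | h⟩ := (H2 G H (G.σK hs) h1).h4.resolve_left (not_not.2 h2)
    · exact ⟨((G.Y _ _).1 hY).2, (mem_Xs G H h1).2 h.2⟩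
    · exact absurd (((G.S0 _).1 h.1).2.symm.trans hk) n02
    · exact absurd (((G.S1 _).1 h.1).2.symm.trans hk) n12

theorem e_args {l : List Zs} (hl : zlist l ∈ p.K) {Q : Tm → Zs} : ∀ τs : List Tm,
    (∀ τ ∈ τs, TmCode τ ∈ p.K → ∀ b ∈ p.K, fV (TmCode τ) (zlist l) b ∈ S → b = Q τ) → (zlist (τs.map TmCode) ∈ p.K) →
    ∀ m ∈ p.K, fVL (zlist (τs.map TmCode)) (zlist l) m ∈ S → m = zlist (τs.map Q) := by
  intro τs
  induction τs with
  | nil =>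
    intro _ hK m hm h
    rcases (H3 G H hK hl hm).h12.resolve_left (not_not.2 h) with ⟨_, h⟩ | ⟨_, _, _, _, _, _, _, _, e, _⟩
    · exact h
    · exact absurd e.symm opair_ne_empty
  | cons τ τs ih =>
    intro hτ hK m hm h
    rcases (H3 G H hK hl hm).h12.resolve_left (not_not.2 h) with ⟨h, _⟩ | ⟨u, hu, l', hl', x, hx, m', hm', e, e', h1, h2⟩
    · exact absurd h opair_ne_empty
    · obtain ⟨rfl, rfl⟩ := opair_inj.1 e
      rw [e', hτ τ (List.mem_cons_self ..) hu x hx h1,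
        ih (fun τ' hh => hτ τ' (List.mem_cons_of_mem _ hh)) hl' m' hm' h2]
      rfl

variable {I : Zs → Zs} (hI : ∀ s ∈ tciSig t, I s = Vs p S s)
include hI

theorem e_I {s w : Zs} (hs : s ∈ tciSig t) (hk : symKind s ≠ natZ 2) : w ∈ I s ↔ w ∈ p.K ∧ fI s w ∈ S := by
  rw [hI s hs]; exact Vs_ne G H hs hk

theorem e_tm {l : List Zs} (hl : LK (Xs p S) l) : ∀ τ : Tm, τ.usesSig (tciSig t) → TmCode τ ∈ p.K → ∀ b ∈ p.K,
    fV (TmCode τ) (zlist l) b ∈ S → b = rho p.J (τ.eval (fIv I) (vl l)) := by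
  have h := e_StrOK G H hI
  have hlK := LXs_K G H hl
  have n12 : natZ 1 ≠ natZ 2 := fun e => absurd (natZ_inj e) (by decide)
  intro τ
  induction τ with
  | var n =>
    intro _ hK b hb hS
    rcases (H3 G H hK (G.zl hlK) hb).h11.resolve_left (not_not.2 hS) with ⟨n', _, e, h1⟩ | ⟨s, _, _, _, _, _, e, _⟩
    · obtain ⟨_, rfl⟩ := opair_inj.1 e
      obtain ⟨_, h2⟩ := G.ntIff.1 h1
      have e : vl l n = b := vl_get h2
      simp only [Tm.eval]
      rw [e, G.rho_z (h.Xz (hl b (List.mem_of_getElem? h2)))]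
    · exact absurd (natZ_inj (opair_inj.1 e).1) (by decide)
  | param a => intro h; exact h.elim
  | func s n a ih =>
    intro hu hK b hb hS
    obtain ⟨hs, hk, hua⟩ := hu
    rcases (H3 G H hK (G.zl hlK) hb).h11.resolve_left (not_not.2 hS) with ⟨n', _, e, h1⟩ | ⟨s', hs', c, hc, m, hm, e, hVL, hh⟩
    · exact absurd (natZ_inj (opair_inj.1 e).1) (by decide)
    · obtain ⟨_, e⟩ := opair_inj.1 e
      obtain ⟨e, e'⟩ := opair_inj.1 e
      subst e; subst e'
      have em := e_args G H (G.zl hlK) (Q := fun τ => rho p.J (τ.eval (fIv I) (vl l))) (List.ofFn a) (by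
        intro τ hτ hτK b' hb' hh'
        obtain ⟨i, rfl⟩ := (List.mem_ofFn' _ _).1 hτ
        exact ih i (hua i) hτK b' hb' hh') (by rw [← ofFn_map]; exact hc) m hm (by rw [← ofFn_map]; exact hVL)
      have em' : m = zlist ((List.ofFn fun i => (a i).eval (fIv I) (vl l)).map (rho p.J)) := by
        rw [em, ofFn_map a (fun τ => τ.eval (fIv I) (vl l)), List.map_map]; rfl
      subst em'
      simp only [Tm.eval]
      have hlen : (List.ofFn fun i => Tm.eval (fIv I) (vl l) (a i)).length = n := List.length_ofFn
      generalize (List.ofFn fun i => Tm.eval (fIv I) (vl l) (a i)) = m at *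
      have h0' : zlist (m.map (rho p.J)) = ∅ ↔ m = [] := by rw [zlist_eq_empty, List.map_eq_nil_iff]
      rcases hh with ⟨h2, hm0, hS'⟩ | ⟨h1, hm0, x, hx, hxS, e⟩ | ⟨h1, hm0, hh⟩
      · have hk2 := ((G.S2 _).1 h2).2
        rw [h0'] at hm0
        subst hm0
        have e1 : fIv I s [] = I s := if_pos rfl
        rw [e1, G.rho_z (h.Xz (h.k2 s hs hk2).2), hI s hs, Vs_2 G H hs hk2 hb hS']
      · have hk1 := ((G.S1 _).1 h1).2
        rw [h0'] at hm0
        subst hm0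
        have har : arityOf s = 0 := by
          rcases hk with ⟨_, hn⟩ | ⟨hk, _⟩
          · rw [arityOf_eq hn]; exact hlen.symm
          · exact absurd (hk1.symm.trans hk) n12
        obtain ⟨y, hy, hyI, e1⟩ := fIv_nil1 h hs hk1 har
        have hxI : x ∈ I s := (e_I G H hI hs (hk1 ▸ n12)).2 ⟨hx, hxS⟩
        have e2 : fIv I s [] = I s := if_pos rfl
        have e3 : x = y := by
          rw [← e2, e1] at hxI
          exact ZFSet.mem_singleton.1 hxI
        rw [e1, e, e3, G.rho_sing (h.Xz hy)]
      · have hk1 := ((G.S1 _).1 h1).2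
        have h0 : m ≠ [] := fun e => hm0 (h0'.2 e)
        have har : m.length = arityOf s := by
          rcases hk with ⟨_, hn⟩ | ⟨hk, _⟩
          · rw [arityOf_eq hn]; exact hlen
          · exact absurd (hk1.symm.trans hk) n12
        rcases hh with ⟨e, hN⟩ | ⟨w, hw, hAT, hwS⟩
        · have : ¬ LK (Xs p S) m := by
            intro hX
            rw [G.rho_map h hX] at hN
            exact hN ((UL_iff G H m (LXs_K G H hX)).2 hX)
          rw [fIv_neg h hs hk1 har h0 this, G.rho_junk, e]
        · obtain ⟨hmK, _, rfl⟩ := G.atIff.1 hAT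
          have hwI := (e_I G H hI hs (hk1 ▸ n12)).2 ⟨hw, hwS⟩
          have := k1_mem h hs hk1 (by rw [List.length_map]; exact har) hwI
          rw [G.rho_map' h this.1] at hwI
          rw [fIv_eq h hs hk1 har h0 hwI, G.rho_z (h.Xz this.2)]

theorem e_fm : ∀ f : Fm, f.usesSig (tciSig t) → FmCode f ∈ p.K → ∀ l, LK (Xs p S) l → (∀ n ∈ f.free, n < l.length) →
    (fSP (FmCode f) (zlist l) ∈ S → Sat (· ∈ Xs p S) (rIv I) (fIv I) f (vl l)) ∧
    (fSN (FmCode f) (zlist l) ∈ S → ¬ Sat (· ∈ Xs p S) (rIv I) (fIv I) f (vl l)) := by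
  have h := e_StrOK G H hI
  have n02 : natZ 0 ≠ natZ 2 := fun e => absurd (natZ_inj e) (by decide)
  have h13 : ∀ {a b : Zs} (ha : a ∈ p.K) (hb : b ∈ p.K), fSP a b ∈ S → _ :=
    fun ha hb hS => (H2 G H ha hb).h13.resolve_left (not_not.2 hS)
  have h14 : ∀ {a b : Zs} (ha : a ∈ p.K) (hb : b ∈ p.K), fSN a b ∈ S → _ :=
    fun ha hb hS => (H2 G H ha hb).h14.resolve_left (not_not.2 hS)
  have args : ∀ {n} {a : Fin n → Tm} {l}, (∀ i, (a i).usesSig (tciSig t)) → LK (Xs p S) l →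
      zlist (List.ofFn fun i => TmCode (a i)) ∈ p.K → ∀ m ∈ p.K, fVL (zlist (List.ofFn fun i => TmCode (a i))) (zlist l) m ∈ S →
      m = zlist ((List.ofFn fun i => (a i).eval (fIv I) (vl l)).map (rho p.J)) := by
    intro n a l hua hl hc m hm hVL
    have em := e_args G H (G.zl (LXs_K G H hl)) (Q := fun τ => rho p.J (τ.eval (fIv I) (vl l))) (List.ofFn a) (by
        intro τ hτ hτK b' hb' hh'
        obtain ⟨i, rfl⟩ := (List.mem_ofFn' _ _).1 hτ
        exact e_tm G H hI hl (a i) (hua i) hτK b' hb' hh') (by rw [← ofFn_map]; exact hc) m hm (by rw [← ofFn_map]; exact hVL)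
    rw [em, ofFn_map a (fun τ => τ.eval (fIv I) (vl l)), List.map_map]; rfl
  have bad : ∀ {i j : ℕ} {x y : Zs} {q : Prop}, i ≠ j → opair (natZ i) x = opair (natZ j) y → q :=
    fun hij e => absurd (natZ_inj (opair_inj.1 e).1) hij
  intro f
  induction f with
  | rel s n a =>
    intro hu hK l hl hf
    have hlK := G.zl (LXs_K G H hl)
    obtain ⟨hs, hk, hn, hua⟩ := hu
    have hlen : (List.ofFn fun i => (a i).eval (fIv I) (vl l)).length = arityOf s := by
      rw [List.length_ofFn, arityOf_eq hn]
    constructor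
    · intro hS
      rcases h13 hK hlK hS with ⟨s', _, c, hc, m, hm, w, hw, e, hVL, hT, hwS⟩ | ⟨_, _, _, _, _, _, e, _⟩ | ⟨_, _, e, _⟩ |
        ⟨_, _, _, _, e, _⟩ | ⟨_, _, e⟩ | ⟨_, _, _, _, e, _⟩
      · obtain ⟨_, e⟩ := opair_inj.1 e
        obtain ⟨e, e'⟩ := opair_inj.1 e
        subst e; subst e'
        have := args hua hl hc m hm hVL
        subst this
        obtain ⟨_, rfl⟩ := G.ttIff.1 hT
        exact (G.rho_rel h hs hk hlen).1 ((e_I G H hI hs (hk ▸ n02)).2 ⟨hw, hwS⟩)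
      all_goals exact bad (by decide) e
    · intro hS
      rcases h14 hK hlK hS with ⟨s', _, c, hc, m, hm, w, hw, e, hVL, hT, hwS⟩ | ⟨_, _, _, _, _, _, _, _, e, _⟩ | ⟨_, _, e, _⟩ |
        ⟨_, _, _, _, e, _⟩ | ⟨_, _, e⟩ | ⟨_, _, _, _, e, _⟩
      · obtain ⟨_, e⟩ := opair_inj.1 e
        obtain ⟨e, e'⟩ := opair_inj.1 e
        subst e; subst e'
        have := args hua hl hc m hm hVL
        subst this
        obtain ⟨_, rfl⟩ := G.ttIff.1 hT
        exact fun hh => hwS ((e_I G H hI hs (hk ▸ n02)).1 ((G.rho_rel h hs hk hlen).2 hh)).2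
      all_goals exact bad (by decide) e
  | eq u v =>
    intro hu hK l hl hf
    have hlK := G.zl (LXs_K G H hl)
    constructor
    · intro hS
      rcases h13 hK hlK hS with ⟨s', _, c, hc, m, hm, w, hw, e, hVL, hT, hwS⟩ | ⟨u', hu', v', hv', x, hx, e, h1, h2⟩ | ⟨_, _, e, _⟩ |
        ⟨_, _, _, _, e, _⟩ | ⟨_, _, e⟩ | ⟨_, _, _, _, e, _⟩
      · exact bad (by decide) e
      · obtain ⟨_, e⟩ := opair_inj.1 e
        obtain ⟨e, e'⟩ := opair_inj.1 e
        subst e; subst e'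
        have e1 := e_tm G H hI hl u hu.1 hu' x hx h1
        have e2 := e_tm G H hI hl v hu.2 hv' x hx h2
        exact G.rho_inj (valK G h hu.1 hl fun n hn => hf n (Or.inl hn)) (valK G h hu.2 hl fun n hn => hf n (Or.inr hn))
          (e1.symm.trans e2)
      all_goals exact bad (by decide) e
    · intro hS
      rcases h14 hK hlK hS with ⟨s', _, c, hc, m, hm, w, hw, e, hVL, hT, hwS⟩ | ⟨u', hu', v', hv', x, hx, y, hy, e, h1, h2, hne⟩ | ⟨_, _, e, _⟩ |
        ⟨_, _, _, _, e, _⟩ | ⟨_, _, e⟩ | ⟨_, _, _, _, e, _⟩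
      · exact bad (by decide) e
      · obtain ⟨_, e⟩ := opair_inj.1 e
        obtain ⟨e, e'⟩ := opair_inj.1 e
        subst e; subst e'
        have e1 := e_tm G H hI hl u hu.1 hu' x hx h1
        have e2 := e_tm G H hI hl v hu.2 hv' y hy h2
        intro hh
        have hh : u.eval (fIv I) (vl l) = v.eval (fIv I) (vl l) := hh
        exact hne (by rw [e1, e2, hh])
      all_goals exact bad (by decide) e
  | not f ih =>
    intro hu hK l hl hf
    have hlK := G.zl (LXs_K G H hl)
    constructor
    · intro hS
      rcases h13 hK hlK hS with ⟨s', _, c, hc, m, hm, w, hw, e, hVL, hT, hwS⟩ | ⟨_, _, _, _, _, _, e, _⟩ | ⟨f', hf', e, h1⟩ |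
        ⟨_, _, _, _, e, _⟩ | ⟨_, _, e⟩ | ⟨_, _, _, _, e, _⟩
      · exact bad (by decide) e
      · exact bad (by decide) e
      · obtain ⟨_, e⟩ := opair_inj.1 e
        subst e
        exact (ih hu hf' l hl hf).2 h1
      all_goals exact bad (by decide) e
    · intro hS
      rcases h14 hK hlK hS with ⟨s', _, c, hc, m, hm, w, hw, e, hVL, hT, hwS⟩ | ⟨_, _, _, _, _, _, _, _, e, _⟩ | ⟨f', hf', e, h1⟩ |
        ⟨_, _, _, _, e, _⟩ | ⟨_, _, e⟩ | ⟨_, _, _, _, e, _⟩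
      · exact bad (by decide) e
      · exact bad (by decide) e
      · obtain ⟨_, e⟩ := opair_inj.1 e
        subst e
        exact not_not.2 ((ih hu hf' l hl hf).1 h1)
      all_goals exact bad (by decide) e
  | imp f g ihf ihg =>
    intro hu hK l hl hf
    have hlK := G.zl (LXs_K G H hl)
    have hf1 : ∀ n ∈ f.free, n < l.length := fun n hn => hf n (Or.inl hn)
    have hf2 : ∀ n ∈ g.free, n < l.length := fun n hn => hf n (Or.inr hn)
    constructor
    · intro hS
      rcases h13 hK hlK hS with ⟨s', _, c, hc, m, hm, w, hw, e, hVL, hT, hwS⟩ | ⟨_, _, _, _, _, _, e, _⟩ | ⟨_, _, e, _⟩ |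
        ⟨f', hf', g', hg', e, h1⟩ | ⟨_, _, e⟩ | ⟨_, _, _, _, e, _⟩
      · exact bad (by decide) e
      · exact bad (by decide) e
      · exact bad (by decide) e
      · obtain ⟨_, e⟩ := opair_inj.1 e
        obtain ⟨e, e'⟩ := opair_inj.1 e
        subst e; subst e'
        rcases h1 with h1 | h1
        · exact fun hh => absurd hh ((ihf hu.1 hf' l hl hf1).2 h1)
        · exact fun _ => (ihg hu.2 hg' l hl hf2).1 h1
      all_goals exact bad (by decide) e
    · intro hS
      rcases h14 hK hlK hS with ⟨s', _, c, hc, m, hm, w, hw, e, hVL, hT, hwS⟩ | ⟨_, _, _, _, _, _, _, _, e, _⟩ | ⟨_, _, e, _⟩ |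
        ⟨f', hf', g', hg', e, h1⟩ | ⟨_, _, e⟩ | ⟨_, _, _, _, e, _⟩
      · exact bad (by decide) e
      · exact bad (by decide) e
      · exact bad (by decide) e
      · obtain ⟨_, e⟩ := opair_inj.1 e
        obtain ⟨e, e'⟩ := opair_inj.1 e
        subst e; subst e'
        exact fun hh => (ihg hu.2 hg' l hl hf2).2 h1.2 (hh ((ihf hu.1 hf' l hl hf1).1 h1.1))
      all_goals exact bad (by decide) e
  | all f ih =>
    intro hu hK l hl hf
    have hlK := G.zl (LXs_K G H hl)
    constructor
    · intro hS
      rcases h13 hK hlK hS with ⟨s', _, c, hc, m, hm, w, hw, e, hVL, hT, hwS⟩ | ⟨_, _, _, _, _, _, e, _⟩ | ⟨_, _, e, _⟩ |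
        ⟨_, _, _, _, e, _⟩ | ⟨f', hf', e⟩ | ⟨_, _, _, _, e, _⟩
      · exact bad (by decide) e
      · exact bad (by decide) e
      · exact bad (by decide) e
      · exact bad (by decide) e
      · obtain ⟨_, e⟩ := opair_inj.1 e
        subst e
        intro x hx
        rw [vl_cons]
        refine (ih hu hf' (x :: l) (LK_cons.2 ⟨hx, hl⟩) (freeq G h hf)).1 ?_
        exact ((H3 G H hf' hlK (Xs_K G H hx)).h15.resolve_left (not_not.2 hS)).resolve_left (not_not.2 (Xs_U G H hx))
      all_goals exact bad (by decide) e
    · intro hS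
      rcases h14 hK hlK hS with ⟨s', _, c, hc, m, hm, w, hw, e, hVL, hT, hwS⟩ | ⟨_, _, _, _, _, _, _, _, e, _⟩ | ⟨_, _, e, _⟩ |
        ⟨_, _, _, _, e, _⟩ | ⟨_, _, e⟩ | ⟨f', hf', x, hx, e, h1, h2⟩
      · exact bad (by decide) e
      · exact bad (by decide) e
      · exact bad (by decide) e
      · exact bad (by decide) e
      · exact bad (by decide) e
      · obtain ⟨_, e⟩ := opair_inj.1 e
        subst e
        intro hh
        have hx' := (mem_Xs G H hx).2 h1
        have hh := hh x hx'
        rw [vl_cons] at hh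
        exact (ih hu hf' (x :: l) (LK_cons.2 ⟨hx', hl⟩) (freeq G h hf)).2 h2 hh
  | ex f ih =>
    intro hu hK l hl hf
    have hlK := G.zl (LXs_K G H hl)
    constructor
    · intro hS
      rcases h13 hK hlK hS with ⟨s', _, c, hc, m, hm, w, hw, e, hVL, hT, hwS⟩ | ⟨_, _, _, _, _, _, e, _⟩ | ⟨_, _, e, _⟩ |
        ⟨_, _, _, _, e, _⟩ | ⟨_, _, e⟩ | ⟨f', hf', x, hx, e, h1, h2⟩
      · exact bad (by decide) e
      · exact bad (by decide) e
      · exact bad (by decide) e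
      · exact bad (by decide) e
      · exact bad (by decide) e
      · obtain ⟨_, e⟩ := opair_inj.1 e
        subst e
        have hx' := (mem_Xs G H hx).2 h1
        refine ⟨x, hx', ?_⟩
        rw [vl_cons]
        exact (ih hu hf' (x :: l) (LK_cons.2 ⟨hx', hl⟩) (freeq G h hf)).1 h2
    · intro hS
      rcases h14 hK hlK hS with ⟨s', _, c, hc, m, hm, w, hw, e, hVL, hT, hwS⟩ | ⟨_, _, _, _, _, _, _, _, e, _⟩ | ⟨_, _, e, _⟩ |
        ⟨_, _, _, _, e, _⟩ | ⟨f', hf', e⟩ | ⟨_, _, _, _, e, _⟩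
      · exact bad (by decide) e
      · exact bad (by decide) e
      · exact bad (by decide) e
      · exact bad (by decide) e
      · obtain ⟨_, e⟩ := opair_inj.1 e
        subst e
        rintro ⟨x, hx, hh⟩
        rw [vl_cons] at hh
        refine (ih hu hf' (x :: l) (LK_cons.2 ⟨hx, hl⟩) (freeq G h hf)).2 ?_ hh
        exact ((H3 G H hf' hlK (Xs_K G H hx)).h16.resolve_left (not_not.2 hS)).resolve_left (not_not.2 (Xs_U G H hx))
      all_goals exact bad (by decide) e
end

/-- a solution of the clauses in W gives a model in W -/
theorem extract {t A W : Zs} {p : Par} [hW : ZFCM W] [ParIn W p] (G : Good t A p) (hσ : tciSig t ∈ W)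
    {S : Zs} (hS : S ∈ W) (H : HC p S) : ∃ M ∈ W, ModelsTCI M t := by
  have hm : ZFM W := inferInstance
  have iS := InV_of hS
  have hz : p.z ∈ W := ParIn.z
  have hX : Xs p S ∈ W := hm.sep _ (fun b => fU b ∈ S) hz inferInstance
  have dV : DT W (fun v => opair (v 0) (Vs p S (v 0))) := by
    unfold Vs
    infer_instance
  obtain ⟨Ig, hIg, hIg'⟩ := ZFM.repl (V := W) hσ (F := fun s => opair s (Vs p S s)) (hF := dV)
  have hmem : ∀ s v, opair s v ∈ Ig ↔ s ∈ tciSig t ∧ v = Vs p S s := by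
    intro s v
    rw [hIg']
    constructor
    · rintro ⟨x, hx, e⟩
      obtain ⟨rfl, rfl⟩ := opair_inj.1 e
      exact ⟨hx, rfl⟩
    · rintro ⟨h1, rfl⟩; exact ⟨s, h1, rfl⟩
  have hI : ∀ s ∈ tciSig t, iapp Ig s = Vs p S s := by
    intro s hs
    have : opair s (iapp Ig s) ∈ Ig := Classical.epsilon_spec (p := fun v => opair s v ∈ Ig) ⟨_, (hmem _ _).2 ⟨hs, rfl⟩⟩
    exact ((hmem _ _).1 this).2
  refine ⟨opair (Xs p S) Ig, ZFM.opair hX hIg, models_of_StrOK G.tci ?_ ?_ ?_ ?_⟩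
  · rw [zfst_opair, zsnd_opair]
  · rw [zsnd_opair]
    refine ⟨?_, ?_⟩
    · intro q hq
      obtain ⟨x, hx, e⟩ := (hIg' q).1 hq
      exact ⟨x, _, e, hx⟩
    · intro s hs
      exact ⟨_, (hmem _ _).2 ⟨hs, rfl⟩, fun y hy => ((hmem _ _).1 hy).2⟩
  · rw [zfst_opair, zsnd_opair]; exact e_StrOK G H hI
  · intro c hc f hf
    rw [SatStr_eq, zfst_opair, zsnd_opair, ← vl_nil]
    obtain ⟨f', hf', hfree, hu⟩ := G.tci.2.2.2.2.2.2.2.2.2.2 c hc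
    obtain rfl := FmCode_inj (hf'.trans hf.symm)
    have hcK := G.AK _ (G.hT _ hc)
    subst hf'
    refine (e_fm G H hI f' hu hcK [] LK_nil (by rw [hfree]; intro n hn; exact hn.elim)).1 ?_
    exact (H1 G H hcK).h17.resolve_left (not_not.2 (by rw [G.pT]; exact hc))
end SmallExt

end

noncomputable section
namespace SmallExt
set_option linter.unusedVariables false
set_option linter.unusedSectionVars false
attribute [local instance] Classical.propDecidable

theorem iapp_spec {f d s : Zs} (h : IsZFunc f d) (hs : s ∈ d) :
    opair s (iapp f s) ∈ f ∧ ∀ z, opair s z ∈ f → z = iapp f s := by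
  obtain ⟨v, hv, hu⟩ := h.2 s hs
  have h1 : opair s (iapp f s) ∈ f := Classical.epsilon_spec (p := fun v => opair s v ∈ f) ⟨v, hv⟩
  exact ⟨h1, fun z hz => (hu z hz).trans (hu _ h1).symm⟩

theorem iapp_app {f d s : Zs} (h : IsZFunc f d) (hs : s ∈ d) : app f s = iapp f s :=
  app_eq (iapp_spec h hs).1 (iapp_spec h hs).2

theorem trcl_unique {x T T' : Zs} (h : IsTrclOf x T) (h' : IsTrclOf x T') : T = T' :=
  ZFSet.ext fun z => ⟨fun hz => h.2.2 _ h'.1 h'.2.1 hz, fun hz => h'.2.2 _ h.1 h.2.1 hz⟩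

theorem trcl_sub_H {V t H A : Zs} [ZFM V] (hH : IsHIn V t H) (hA : A ∈ V) (hA1 : IsTrclOf t A) :
    ∀ y ∈ A, y ∈ H := by
  have hm : ZFM V := inferInstance
  intro y hy
  have hyV : y ∈ V := hm.trans _ hA _ hy
  refine (hH.2 y).2 ⟨hyV, ?_⟩
  intro ty tt h1 h2
  have e := trcl_unique h2 hA1
  subst e
  have hyy : ({y} : Zs) ∈ V := ZFM.sing hyV
  obtain ⟨T', hT', h3⟩ := trcl_mem (V := V) hyy
  have e := trcl_unique h1 h3
  subst e
  have hsub : ty ⊆ tt := h1.2.2 _ (fun z hz => by rw [ZFSet.mem_singleton.1 hz]; exact hy) hA1.2.1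
  obtain ⟨j, hj, hj1⟩ := ZFM.repl (V := V) hT' (F := fun x => opair x x)
  have hf : IsZFunc j ty := by
    constructor
    · intro q hq
      obtain ⟨x, hx, e⟩ := (hj1 q).1 hq
      exact ⟨x, x, e, hx⟩
    · intro s hs
      refine ⟨s, (hj1 _).2 ⟨s, hs, rfl⟩, fun z hz => ?_⟩
      obtain ⟨x, hx, e⟩ := (hj1 _).1 hz
      obtain ⟨e1, e2⟩ := opair_inj.1 e
      rw [e1, e2]
  have hv : ∀ s ∈ ty, iapp j s = s := fun s hs =>
    ((iapp_spec hf hs).2 _ ((hj1 _).2 ⟨s, hs, rfl⟩)).symm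
  refine ⟨j, hj, hf, fun s hs => by rw [hv s hs]; exact hsub hs, fun s hs s' hs' e => ?_⟩
  rwa [hv s hs, hv s' hs'] at e

theorem forward {V t lam H : Zs} (hV : IsCTM V) (htV : t ∈ V) (hlam : lam ∈ V) (hH : IsHIn V t H)
    (hj : ∃ j ∈ V, ZInjFun j H lam) (hc : ConsistentTCI V t) {g W : Zs}
    (hg : GenericFilterOver V (ColForcing lam) g) (hW : Generates V g W) : ∃ M ∈ W, ModelsTCI M t := by
  obtain ⟨W0, M, -, -, hM⟩ := hc
  have tci := hM.1
  have iV : ZFM V := CTM_ZFM hV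
  have iW : ZFCM W := CTM_ZFCM hW.1.2.1
  have hm : ZFM W := inferInstance
  have hVW : ∀ x ∈ V, x ∈ W := fun x hx => hW.1.2.2.1 hx
  obtain ⟨A, hA, hA1⟩ := trcl_mem (V := V) htV
  have Atr := hA1.2.1
  obtain ⟨j, hjV, hj1, hj2, hj3⟩ := hj
  have AH := trcl_sub_H hH hA hA1
  -- components
  have e := tci.1
  have tA : ∀ x ∈ t, x ∈ A := fun x hx => hA1.1 hx
  have h1 : ({tciT t, opair (tciSig t) (opair (tciUdot t) (tciTheta t))} : Zs) ∈ A := by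
    apply tA
    rw [mem_opair_def (tciT t)] at e
    rw [e]
    exact ZFSet.mem_pair.2 (Or.inr (by rw [← e]))
  have hTA : tciT t ∈ A := Atr _ h1 (ZFSet.mem_pair.2 (Or.inl rfl))
  have h2 := Atr _ h1 (ZFSet.mem_pair.2 (Or.inr rfl))
  obtain ⟨hσA, h3⟩ := opair_tr Atr h2
  obtain ⟨hUA, hΘA⟩ := opair_tr Atr h3
  have hZF := tci.2.2.2.2.2.2.1
  have hval : ∀ s ∈ insert (tciUdot t) (tciSig t), ty t s ∈ A ∧ ti t s ∈ A := by
    intro s hs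
    have k1 := (opair_tr Atr (Atr _ hΘA (iapp_spec hZF hs).1)).2
    rw [(tci_pair tci hs).1] at k1
    exact opair_tr Atr k1
  have mU : tciUdot t ∈ insert (tciUdot t) (tciSig t) := ZFSet.mem_insert_iff.2 (Or.inl rfl)
  have mS : ∀ s ∈ tciSig t, s ∈ insert (tciUdot t) (tciSig t) := fun s hs => ZFSet.mem_insert_iff.2 (Or.inr hs)
  have AW : ∀ x ∈ A, x ∈ W := fun x hx => hVW _ (iV.trans _ hA _ hx)
  have hzA : tz t ∈ A := (hval _ mU).1
  obtain ⟨J, hJ, hJ1⟩ : ∃ J ∈ W, J = junk0 ∨ (J = {tz t} ∧ junk0 ∉ W) := by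
    by_cases hjk : junk0 ∈ W
    · exact ⟨junk0, hjk, Or.inl rfl⟩
    · exact ⟨{tz t}, ZFM.sing (AW _ hzA), Or.inr ⟨rfl, hjk⟩⟩
  obtain ⟨K, KS, Kn, hK, hKS, hKS1, hfin, hsub, hcov, hmono, hpair, hnat, hAK, hJK⟩ :=
    exists_K (V := V) (W := W) hVW (Gen_of_generic hlam hg) hW.2.1 hlam hA hjV hJ
      (fun a ha => ⟨iapp j a, hj2 a (AH a ha), (iapp_spec hj1 (AH a ha)).1⟩)
      (fun a ha a' ha' b hb hb' => hj3 a (AH a ha) a' (AH a' ha')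
        (((iapp_spec hj1 (AH a ha)).2 b hb).symm.trans ((iapp_spec hj1 (AH a' ha')).2 b hb')))
  have hsing : ∀ x ∈ K, ({x} : Zs) ∈ K := fun x hx => by
    have := hpair x hx x hx
    rwa [show ({x, x} : Zs) = {x} from by ext z; simp] at this
  have hop : ∀ x ∈ K, ∀ y ∈ K, opair x y ∈ K := fun x hx y hy => by
    rw [mem_opair_def]
    exact hpair _ (hsing x hx) _ (hpair x hx y hy)
  obtain ⟨LT, hLT, hLT1⟩ := table_L (W := W) hK hop hnat
  obtain ⟨TT, hTT, hTT1⟩ := table_T (W := W) hK hop hnat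
  obtain ⟨AT, hAT, hAT1⟩ := table_A (W := W) hK hop hnat
  obtain ⟨NT, hNT, hNT1⟩ := table_N (W := W) hK hop hnat
  have hσW := AW _ hσA
  have hΘW := AW _ hΘA
  have hzW := AW _ hzA
  have iσ := InV_of hσW
  have iΘ := InV_of hΘW
  have iA := InV_of (hVW _ hA)
  have dS : ∀ i : ℕ, ZFSet.sep (fun s => zfst s = natZ i) (tciSig t) ∈ W := fun i => by
    have := InV_of (ZFM.natZ (V := W) i)
    exact hm.sep _ (fun s => zfst s = natZ i) hσW inferInstance
  have dE : ZFSet.sep (fun s => zsnd (app (tciTheta t) s) = natZ 1) (tciSig t) ∈ W := by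
    have := InV_of (ZFM.natZ (V := W) 1)
    exact hm.sep _ (fun s => zsnd (app (tciTheta t) s) = natZ 1) hσW inferInstance
  have dY : ZFSet.sep (fun q => zsnd q ∈ zfst (app (tciTheta t) (zfst q))) (ZFSet.prod (tciSig t) A) ∈ W :=
    hm.sep _ (fun q => zsnd q ∈ zfst (app (tciTheta t) (zfst q))) (ZFM.prod hσW (hVW _ hA)) inferInstance
  obtain ⟨Z1, hZ1, hZ11⟩ : ∃ Z1 ∈ W, ∀ x, x ∈ Z1 ↔ x ∈ tz t ∧ ti t (tciUdot t) = natZ 1 := by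
    by_cases h : ti t (tciUdot t) = natZ 1
    · exact ⟨tz t, hzW, fun x => by simp only [h, and_true]⟩
    · exact ⟨∅, hm.emp, fun x => by simp only [h, and_false, iff_false]; exact ZFSet.notMem_empty x⟩
  let p : Par := ⟨K, tz t, Z1, tciT t, ZFSet.sep (fun s => zfst s = natZ 0) (tciSig t),
    ZFSet.sep (fun s => zfst s = natZ 1) (tciSig t), ZFSet.sep (fun s => zfst s = natZ 2) (tciSig t),
    ZFSet.sep (fun s => zsnd (app (tciTheta t) s) = natZ 1) (tciSig t),
    ZFSet.sep (fun q => zsnd q ∈ zfst (app (tciTheta t) (zfst q))) (ZFSet.prod (tciSig t) A),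
    TT, AT, NT, LT, J⟩
  have iP : ParIn W p := ⟨hK, hzW, hZ1, AW _ hTA, dS 0, dS 1, dS 2, dE, dY, hTT, hAT, hNT, hLT, hJ⟩
  have G : Good t A p :=
    { tci := tci
      Atr := Atr
      hT := fun c hc => Atr _ hTA hc
      hσ := fun s hs => Atr _ hσA hs
      hz := fun b hb => Atr _ hzA hb
      hY := fun s hs w hw => Atr _ (hval s (mS s hs)).1 hw
      AK := hAK
      hop := hop
      hsing := hsing
      hnat := hnat
      JK := hJK
      hJ := hJ1.imp id (fun h => ⟨h.1, fun hk => h.2 (hm.trans _ hK _ hk)⟩)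
      pz := rfl
      Z1 := hZ11
      pT := rfl
      S0 := fun s => by
        show s ∈ ZFSet.sep (fun s => zfst s = natZ 0) (tciSig t) ↔ _
        exact ZFSet.mem_sep
      S1 := fun s => by
        show s ∈ ZFSet.sep (fun s => zfst s = natZ 1) (tciSig t) ↔ _
        exact ZFSet.mem_sep
      S2 := fun s => by
        show s ∈ ZFSet.sep (fun s => zfst s = natZ 2) (tciSig t) ↔ _
        exact ZFSet.mem_sep
      E := fun s => by
        show s ∈ ZFSet.sep (fun s => zsnd (app (tciTheta t) s) = natZ 1) (tciSig t) ↔ _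
        refine ZFSet.mem_sep.trans (and_congr_right fun hs => ?_)
        rw [iapp_app hZF (mS s hs)]
      Y := fun s w => by
        show opair s w ∈ ZFSet.sep (fun q => zsnd q ∈ zfst (app (tciTheta t) (zfst q))) (ZFSet.prod (tciSig t) A) ↔ _
        refine ZFSet.mem_sep.trans ?_
        rw [zfst_opair, zsnd_opair]
        constructor
        · rintro ⟨hp, hw⟩
          obtain ⟨a, ha, b, hb, e⟩ := ZFSet.mem_prod.1 hp
          obtain ⟨rfl, rfl⟩ := opair_inj.1 e
          rw [iapp_app hZF (mS s ha)] at hw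
          exact ⟨ha, hw⟩
        · rintro ⟨hs, hw⟩
          rw [iapp_app hZF (mS s hs)]
          exact ⟨ZFSet.mem_prod.2 ⟨s, hs, w, Atr _ (hval s (mS s hs)).1 hw, rfl⟩, hw⟩
      LT := hLT1
      TT := hTT1
      AT := hAT1
      NT := hNT1 }
  have hreal := real_clauses G (StrOK_of_models hM) (by
    intro c hc f hf
    have := hM.2.2.2.2.2
    exact (SatStr_eq M f).1 (this c hc f hf))
  obtain ⟨S', hS', HS⟩ := absol (W := W) hK hKS Kn hKS1 hfin hsub hcov hmono hop hnat (Clauses p)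
    (Clauses_Cont p) (Clauses_DP p) (SS t A p (zfst M) (iapp (zsnd M))) hreal
  exact extract (W := W) G hσW hS' HS

end SmallExt

end

open SmallExt in
/-- A TCI `𝔗 ∈ V` is consistent iff (semantically, via the
forcing theorem) every condition of `Col(ω, λ)` forces over `V` that `𝔗` has
a model, where `λ` is any cardinal of `V` with `λ ≥ |H(|trcl 𝔗|⁺)|`
(computed in `V`). -/
theorem consistency_iff_collapse_forces_model (V t : ZFSet) (hV : IsCTM V)
    (htV : t ∈ V) (hTCI : IsTCI t) :
    ∀ lam H : ZFSet, IsCardinalIn V lam → IsHIn V t H →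
      (∃ j ∈ V, ZInjFun j H lam) →
      (ConsistentTCI V t ↔
        ∀ g : ZFSet, GenericFilterOver V (ColForcing lam) g →
          ∀ W, Generates V g W → ∃ M ∈ W, ModelsTCI M t) := by
  intro lam H hlam hH hj
  exact ⟨fun hc g hg W hW => forward hV htV hlam.1 hH hj hc hg hW, fun h => backward hV hlam.1 h⟩
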